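/- For every natural number n there exists a set Γ_n ⊆ ℝ² with the following properties. (1) Γ_n is the image of an injective, proper, real-analytic map γ_n : ℝ → ℝ² whose derivative never vanishes (a proper analytic embedding of the real line). (2) For every (a,λ) ∈ Γ_n there exists an eigenfunction w of the PT-cubic problem at a with eigenvalue λ that has exactly 2n zeros in ℂ \ ℝ, has infinitely many real zeros, and there exists x₀ ∈ ℝ such that every real zero of w is less than x₀. (3) The sets Γ_n (n = 0, 1, 2, …) are pairwise disjoint and their union equals the real spectral locus Σ. (4) For every n, the restriction of the projection (a,λ) ↦ a to Γ_n ∩ ([0,∞)×ℝ) is a covering map onto [0,∞), and for every a ≥ 0 the fiber {λ ∈ ℝ : (a,λ) ∈ Γ_n} has exactly two elements. (5) For every a ≥ 0 and every n, if (a,λ) ∈ Γ_n and (a,λ') ∈ Γ_{n+1} then λ < λ'. -/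

import Mathlib

open Complex Filter

/-- `w` is an eigenfunction of the PT-cubic problem at `a` with eigenvalue `lam`:
a nonzero entire solution of `w'' = (z³ − a z + λ) w` with `w(it) → 0` as `t → ±∞`. -/
def PTCubicEigenfunction (a lam : ℝ) (w : ℂ → ℂ) : Prop :=
  w ≠ 0 ∧ Differentiable ℂ w ∧
    (∀ z : ℂ, deriv (deriv w) z = (z ^ 3 - (a : ℂ) * z + (lam : ℂ)) * w z) ∧
    Tendsto (fun t : ℝ => w ((t : ℂ) * Complex.I)) atTop (nhds 0) ∧
    Tendsto (fun t : ℝ => w ((t : ℂ) * Complex.I)) atBot (nhds 0)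

/-- The real spectral locus of the PT-symmetric cubic. -/
def PTCubicLocus : Set (ℝ × ℝ) :=
  {p : ℝ × ℝ | ∃ w : ℂ → ℂ, PTCubicEigenfunction p.1 p.2 w}

namespace PTCubic
open scoped Topology ComplexConjugate

lemma exists_bound_of_recurrence (L D₀ : ℝ) (hL : 0 ≤ L) (hD₀ : 0 ≤ D₀) :
    ∃ D : ℝ, 0 ≤ D ∧ ∀ d : ℕ → ℝ, (∀ k < 5, d k ≤ D₀) →
      (∀ k m, 0 ≤ m → (∀ j < k + 5, d j ≤ m) → d (k + 5) ≤ L / ((k + 1) * (k + 2)) * m) →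
      ∀ k, d k ≤ D := by
  obtain ⟨N, hN⟩ := exists_nat_ge L
  refine ⟨D₀ * (1 + L) ^ (N + 5), by positivity, fun d h0 hrec => ?_⟩
  have h1 : ∀ k, d k ≤ D₀ * (1 + L) ^ k := by
    intro k
    induction k using Nat.strong_induction_on with
    | _ k ih =>
      by_cases hk : k < 5
      · exact (h0 k hk).trans (le_mul_of_one_le_right hD₀ (one_le_pow₀ (by linarith)))
      · obtain ⟨j, rfl⟩ : ∃ j, k = j + 5 := ⟨k - 5, by omega⟩
        refine (hrec j (D₀ * (1 + L) ^ (j + 4)) (by positivity) fun i hi =>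
          (ih i hi).trans ?_).trans ?_
        · gcongr
          · linarith
          · omega
        · have : L / ((j + 1 : ℝ) * (j + 2)) ≤ 1 + L := by
            rw [div_le_iff₀ (by positivity)]
            nlinarith [mul_nonneg hL (Nat.cast_nonneg (α := ℝ) j),
              Nat.cast_nonneg (α := ℝ) j, mul_nonneg (mul_nonneg hL (Nat.cast_nonneg (α := ℝ) j)) (Nat.cast_nonneg (α := ℝ) j)]
          calc _ ≤ (1 + L) * (D₀ * (1 + L) ^ (j + 4)) := by gcongr
            _ = _ := by ring
  intro k
  induction k using Nat.strong_induction_on with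
  | _ k ih =>
    by_cases hk : k < N + 5
    · refine (h1 k).trans ?_
      gcongr
      linarith
    · obtain ⟨j, rfl⟩ : ∃ j, k = j + 5 := ⟨k - 5, by omega⟩
      refine (hrec j _ (by positivity) ih).trans ?_
      refine mul_le_of_le_one_left (by positivity) ?_
      have : (N : ℝ) ≤ j := by exact_mod_cast (by omega : N ≤ j)
      rw [div_le_one (by positivity)]
      nlinarith [Nat.cast_nonneg (α := ℝ) j]

/-- Taylor coefficients (shifted by three) of the solution of
`w'' = (q₀ + q₁ z + q₂ z² + q₃ z³) w` with `w(0) = A`, `w'(0) = B`. -/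
noncomputable def coeff (q : Fin 4 → ℂ) (A B : ℂ) : ℕ → ℂ
  | 0 => 0
  | 1 => 0
  | 2 => 0
  | 3 => A
  | 4 => B
  | (k + 5) => (q 0 * coeff q A B (k + 3) + q 1 * coeff q A B (k + 2) +
      q 2 * coeff q A B (k + 1) + q 3 * coeff q A B k) / ((k + 1) * (k + 2))

lemma exists_coeff_bound (M R : ℝ) (hM : 0 ≤ M) (hR : 1 ≤ R) :
    ∃ D : ℝ, 0 ≤ D ∧ ∀ q : Fin 4 → ℂ, ‖q‖ ≤ M → ∀ A B : ℂ, ‖A‖ ≤ M → ‖B‖ ≤ M →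
      ∀ k, ‖coeff q A B k‖ * R ^ k ≤ D := by
  obtain ⟨D, hD, h⟩ := exists_bound_of_recurrence (4 * M * R ^ 5) (M * R ^ 4) (by positivity)
    (by positivity)
  refine ⟨D, hD, fun q hq A B hA hB => h _ ?_ ?_⟩
  · intro k hk
    have : R ^ 3 ≤ R ^ 4 := pow_le_pow_right₀ hR (by norm_num)
    interval_cases k <;> simp only [coeff, norm_zero, zero_mul] <;> first | positivity | skip
    · gcongr
    · gcongr
  · intro k m hm hj
    have hq' : ∀ i, ‖q i‖ ≤ M := fun i => (norm_le_pi_norm q i).trans hq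
    have key : ∀ i j, j ≤ k + 3 → k ≤ j → ‖q i * coeff q A B j‖ * R ^ (k + 5) ≤ M * R ^ 5 * m := by
      intro i j hj1 hj2
      rw [norm_mul]
      calc _ = ‖q i‖ * (R ^ (k + 5 - j)) * (‖coeff q A B j‖ * R ^ j) := by
            rw [show k + 5 = (k + 5 - j) + j by omega, pow_add]
            simp only [Nat.add_sub_cancel]; ring
        _ ≤ _ := by
            gcongr
            · exact hq' i
            · omega
            · exact hj j (by omega)
    have hp : (0 : ℝ) < (k + 1) * (k + 2) := by positivity
    have hn : ‖((k + 1) * (k + 2) : ℂ)‖ = (k + 1) * (k + 2) := by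
      have : ((k + 1) * (k + 2) : ℂ) = (((k + 1) * (k + 2) : ℝ) : ℂ) := by push_cast; ring
      rw [this, Complex.norm_of_nonneg hp.le]
    rw [coeff, norm_div, hn]
    rw [div_mul_eq_mul_div, div_le_iff₀ hp]
    have := key 0 (k+3) (by omega) (by omega)
    have := key 1 (k+2) (by omega) (by omega)
    have := key 2 (k+1) (by omega) (by omega)
    have := key 3 k (by omega) (by omega)
    have h4 : ∀ x y z w : ℂ, ‖x + y + z + w‖ ≤ ‖x‖ + ‖y‖ + ‖z‖ + ‖w‖ := fun x y z w =>
      (norm_add_le _ _).trans (by gcongr; exact (norm_add_le _ _).trans (by gcongr; exact norm_add_le _ _))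
    calc _ ≤ (‖q 0 * coeff q A B (k + 3)‖ + ‖q 1 * coeff q A B (k + 2)‖ +
      ‖q 2 * coeff q A B (k + 1)‖ + ‖q 3 * coeff q A B k‖) * R ^ (k + 5) := by
            gcongr; exact h4 _ _ _ _
      _ ≤ 4 * (M * R ^ 5 * m) := by linarith
      _ = _ := by field_simp


lemma summable_of_pow_bound {c : ℕ → ℂ} {R D : ℝ} (_ : 0 < R) (h : ∀ k, ‖c k‖ * (2 * R) ^ k ≤ D)
    {z : ℂ} (hz : ‖z‖ ≤ R) (k : ℕ) : ‖c k * z ^ k‖ ≤ D * (1 / 2) ^ k := by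
  have : ‖c k * z ^ k‖ ≤ ‖c k‖ * R ^ k := by
    rw [norm_mul, norm_pow]; gcongr
  refine this.trans ?_
  have h' := h k
  rw [mul_pow] at h'
  rw [one_div, inv_pow, ← div_eq_mul_inv, le_div_iff₀ (by positivity)]
  linarith

lemma shift_pow_bound {c : ℕ → ℂ} {R D : ℝ} (hR : 1 ≤ R) (h : ∀ k, ‖c k‖ * (2 * R) ^ k ≤ D)
    (k : ℕ) : ‖(k + 1) * c (k + 1)‖ * R ^ k ≤ D := by
  refine le_trans ?_ (h (k + 1))
  have h1 : ‖((k : ℂ) + 1)‖ = k + 1 := by exact_mod_cast Complex.norm_natCast (k + 1)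
  have h2 : ((k : ℝ) + 1) ≤ 2 ^ (k + 1) := by
    exact_mod_cast (Nat.lt_two_pow_self (n := k + 1)).le
  rw [norm_mul, h1, mul_pow]
  have h3 : R ^ k ≤ R ^ (k + 1) := pow_le_pow_right₀ hR (by omega)
  calc _ = ‖c (k + 1)‖ * ((k + 1) * R ^ k) := by ring
    _ ≤ _ := by gcongr

lemma hasDerivAt_powerSeries {c : ℕ → ℂ} (h : ∀ R : ℝ, 1 ≤ R → ∃ D, ∀ k, ‖c k‖ * R ^ k ≤ D) (z : ℂ) :
    HasDerivAt (fun z => ∑' k, c k * z ^ k) (∑' k, (k + 1) * c (k + 1) * z ^ k) z := by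
  set R := ‖z‖ + 1 with hRdef
  have hR1 : 1 ≤ R := by simp [hRdef]
  obtain ⟨D, hD⟩ := h (2 * R) (by linarith)
  have hU : IsOpen (Metric.ball (0 : ℂ) R) := Metric.isOpen_ball
  have hz : z ∈ Metric.ball (0 : ℂ) R := by simp [hRdef]
  have hu : Summable fun k : ℕ => D * (1 / 2 : ℝ) ^ k :=
    (summable_geometric_of_lt_one (by norm_num) (by norm_num)).mul_left _
  have hF : ∀ (k : ℕ) (w : ℂ), w ∈ Metric.ball (0 : ℂ) R → ‖c k * w ^ k‖ ≤ D * (1 / 2) ^ k :=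
    fun k w hw => summable_of_pow_bound (by linarith) hD (by simpa using (mem_ball_zero_iff.1 hw).le) k
  have hd : ∀ k : ℕ, DifferentiableOn ℂ (fun w : ℂ => c k * w ^ k) (Metric.ball (0 : ℂ) R) :=
    fun k => by fun_prop
  have h1 := (differentiableOn_tsum_of_summable_norm hu hd hU hF).differentiableAt (hU.mem_nhds hz)
  have h2 := hasSum_deriv_of_summable_norm hu hd hU hF hz
  have h3 := h1.hasDerivAt
  refine h3.congr_deriv ?_
  rw [← h2.tsum_eq, h2.summable.tsum_eq_zero_add]
  simp only [pow_zero, mul_one, deriv_const', zero_add]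
  refine tsum_congr fun k => ?_
  have := ((hasDerivAt_pow (k + 1) z).const_mul (c (k + 1))).deriv
  rw [this]
  push_cast
  ring

/-- The solution of `w'' = (q₀ + q₁ z + q₂ z² + q₃ z³) w` with `w(0) = A`, `w'(0) = B`. -/
noncomputable def sol (q : Fin 4 → ℂ) (A B z : ℂ) : ℂ := ∑' k : ℕ, coeff q A B (k + 3) * z ^ k

/-- The derivative of `sol`. -/
noncomputable def dsol (q : Fin 4 → ℂ) (A B z : ℂ) : ℂ :=
  ∑' k : ℕ, ((k + 1) * coeff q A B (k + 4)) * z ^ k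

/-- The cubic potential. -/
def cubic (q : Fin 4 → ℂ) (z : ℂ) : ℂ := q 0 + q 1 * z + q 2 * z ^ 2 + q 3 * z ^ 3

lemma coeff_bound' (M R : ℝ) (hM : 0 ≤ M) (hR : 1 ≤ R) :
    ∃ D : ℝ, ∀ q : Fin 4 → ℂ, ‖q‖ ≤ M → ∀ A B : ℂ, ‖A‖ ≤ M → ‖B‖ ≤ M →
      ∀ k, ‖coeff q A B (k + 3)‖ * R ^ k ≤ D := by
  obtain ⟨D, hD, h⟩ := exists_coeff_bound M R hM hR
  refine ⟨D, fun q hq A B hA hB k => le_trans ?_ (h q hq A B hA hB (k + 3))⟩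
  gcongr
  omega

lemma exists_norm_bound (q : Fin 4 → ℂ) (A B : ℂ) : ∃ M : ℝ, 0 ≤ M ∧ ‖q‖ ≤ M ∧ ‖A‖ ≤ M ∧ ‖B‖ ≤ M :=
  ⟨‖q‖ + ‖A‖ + ‖B‖, by positivity, by linarith [norm_nonneg A, norm_nonneg B],
    by linarith [norm_nonneg q, norm_nonneg B], by linarith [norm_nonneg A, norm_nonneg q]⟩

lemma coeff_bound'' (q : Fin 4 → ℂ) (A B : ℂ) (R : ℝ) (hR : 1 ≤ R) :
    ∃ D, ∀ k, ‖coeff q A B (k + 3)‖ * R ^ k ≤ D := by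
  obtain ⟨M, h0, h1, h2, h3⟩ := exists_norm_bound q A B
  obtain ⟨D, h⟩ := coeff_bound' M R h0 hR
  exact ⟨D, h q h1 A B h2 h3⟩

lemma hasDerivAt_sol (q : Fin 4 → ℂ) (A B z : ℂ) :
    HasDerivAt (sol q A B) (dsol q A B z) z :=
  hasDerivAt_powerSeries (coeff_bound'' q A B) z

lemma summable_sol (q : Fin 4 → ℂ) (A B z : ℂ) : Summable fun k : ℕ => coeff q A B (k + 3) * z ^ k := by
  obtain ⟨D, hD⟩ := coeff_bound'' q A B (2 * (‖z‖ + 1)) (by linarith [norm_nonneg z])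
  exact Summable.of_norm_bounded ((summable_geometric_of_lt_one (by norm_num) (by norm_num)).mul_left _)
    (summable_of_pow_bound (by positivity) hD (by linarith))

lemma hasDerivAt_dsol (q : Fin 4 → ℂ) (A B z : ℂ) :
    HasDerivAt (dsol q A B) (cubic q z * sol q A B z) z := by
  have h := hasDerivAt_powerSeries (c := fun k => (k + 1) * coeff q A B (k + 4)) (fun R hR => by
    obtain ⟨D, hD⟩ := coeff_bound'' q A B (2 * R) (by linarith)
    exact ⟨D, shift_pow_bound hR hD⟩) z
  refine HasDerivAt.congr_deriv (f := dsol q A B) h ?_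
  have hs := summable_sol q A B z
  have e1 : ∀ (f : ℕ → ℂ), f 0 = 0 → Summable (fun k => f (k + 1) * z ^ k) →
      Summable (fun k => f k * z ^ k) ∧ ∑' k, f k * z ^ k = z * ∑' k, f (k + 1) * z ^ k := by
    intro f hf hs
    have h1 : Summable (fun k => f k * z ^ k) := by
      rw [← summable_nat_add_iff 1]
      simpa only [pow_succ, mul_assoc] using hs.mul_right z
    refine ⟨h1, ?_⟩
    rw [h1.tsum_eq_zero_add, ← tsum_mul_left, hf]
    simp only [pow_succ, zero_mul, zero_add]
    exact tsum_congr fun k => by ring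
  have s2 := e1 (fun k => coeff q A B (k + 2)) rfl hs
  have s1 := e1 (fun k => coeff q A B (k + 1)) rfl s2.1
  have s0 := e1 (fun k => coeff q A B k) rfl s1.1
  have hk : ∀ k : ℕ, ((k : ℂ) + 1) * ((((k + 1 : ℕ) : ℂ) + 1) * coeff q A B (k + 1 + 4)) * z ^ k =
      q 0 * (coeff q A B (k + 3) * z ^ k) + q 1 * (coeff q A B (k + 2) * z ^ k) +
      q 2 * (coeff q A B (k + 1) * z ^ k) + q 3 * (coeff q A B k * z ^ k) := by
    intro k
    rw [show k + 1 + 4 = k + 5 by ring, coeff]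
    have h1 : (k : ℂ) + 1 ≠ 0 := by exact_mod_cast Nat.succ_ne_zero k
    have h2 : (k : ℂ) + 2 ≠ 0 := by exact_mod_cast Nat.succ_ne_zero (k + 1)
    push_cast
    rw [show (k : ℂ) + 1 + 1 = k + 2 by ring]
    field_simp
  rw [tsum_congr hk]
  rw [(((hs.mul_left (q 0)).add (s2.1.mul_left (q 1))).add (s1.1.mul_left (q 2))).tsum_add
    (s0.1.mul_left (q 3)), ((hs.mul_left (q 0)).add (s2.1.mul_left (q 1))).tsum_add
    (s1.1.mul_left (q 2)), (hs.mul_left (q 0)).tsum_add (s2.1.mul_left (q 1)), tsum_mul_left,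
    tsum_mul_left, tsum_mul_left, tsum_mul_left, s0.2, s1.2, s2.2]
  simp only [cubic, sol]
  ring

lemma sol_zero (q : Fin 4 → ℂ) (A B : ℂ) : sol q A B 0 = A := by
  rw [sol, tsum_eq_single 0 (by intro k hk; simp [hk])]
  simp [coeff]

lemma dsol_zero (q : Fin 4 → ℂ) (A B : ℂ) : dsol q A B 0 = B := by
  rw [dsol, tsum_eq_single 0 (by intro k hk; simp [hk])]
  simp [coeff]

/-- A family version of the bound, for `sol` and `dsol` simultaneously. -/
lemma exists_uniform_bound (M : ℝ) (hM : 0 ≤ M) : ∃ D : ℝ, ∀ q : Fin 4 → ℂ, ‖q‖ ≤ M →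
    ∀ A B z : ℂ, ‖A‖ ≤ M → ‖B‖ ≤ M → ‖z‖ ≤ M → ∀ k : ℕ,
      ‖coeff q A B (k + 3) * z ^ k‖ ≤ D * (1 / 2) ^ k ∧
      ‖((k + 1) * coeff q A B (k + 4)) * z ^ k‖ ≤ D * (1 / 2) ^ k := by
  obtain ⟨D, hD⟩ := coeff_bound' M (2 * (2 * (M + 1))) hM (by linarith)
  refine ⟨D, fun q hq A B z hA hB hz k => ⟨?_, ?_⟩⟩
  · exact summable_of_pow_bound (by positivity) (hD q hq A B hA hB) (by linarith) k
  · exact summable_of_pow_bound (c := fun k => (k + 1) * coeff q A B (k + 4)) (R := M + 1)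
      (by positivity) (shift_pow_bound (by linarith) (hD q hq A B hA hB)) (by linarith) k

lemma summable_half (D : ℝ) : Summable fun k : ℕ => D * (1 / 2 : ℝ) ^ k :=
  (summable_geometric_of_lt_one (by norm_num) (by norm_num)).mul_left _

section families
variable {X : Type*} [TopologicalSpace X] {q : X → Fin 4 → ℂ} {A B z : X → ℂ}

lemma continuous_coeff (hq : Continuous q) (hA : Continuous A) (hB : Continuous B) (k : ℕ) :
    Continuous fun x => coeff (q x) (A x) (B x) k := by
  have hq' : ∀ i, Continuous fun x => q x i := fun i => (continuous_apply i).comp hq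
  have h0 := hq' 0
  have h1 := hq' 1
  have h2 := hq' 2
  have h3 := hq' 3
  induction k using Nat.strong_induction_on with
  | _ k ih =>
    match k with
    | 0 | 1 | 2 => simp only [coeff]; exact continuous_const
    | 3 => simpa only [coeff]
    | 4 => simpa only [coeff]
    | k + 5 =>
      simp only [coeff]
      have i0 := ih k (by omega)
      have i1 := ih (k + 1) (by omega)
      have i2 := ih (k + 2) (by omega)
      have i3 := ih (k + 3) (by omega)
      fun_prop

lemma continuous_sol_aux (hq : Continuous q) (hA : Continuous A) (hB : Continuous B)
    (hz : Continuous z) : Continuous (fun x => sol (q x) (A x) (B x) (z x)) ∧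
      Continuous (fun x => dsol (q x) (A x) (B x) (z x)) := by
  have key : ∀ x₀, ContinuousAt (fun x => sol (q x) (A x) (B x) (z x)) x₀ ∧
      ContinuousAt (fun x => dsol (q x) (A x) (B x) (z x)) x₀ := by
    intro x₀
    set M := ‖q x₀‖ + ‖A x₀‖ + ‖B x₀‖ + ‖z x₀‖ + 1 with hM
    have hM0 : 0 ≤ M := by positivity
    obtain ⟨D, hD⟩ := exists_uniform_bound M hM0
    set s : Set X := {x | ‖q x‖ + ‖A x‖ + ‖B x‖ + ‖z x‖ < M}
    have hs : s ∈ nhds x₀ :=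
      (isOpen_lt (by fun_prop) continuous_const).mem_nhds (by simp [hM])
    have hb : ∀ x ∈ s, ‖q x‖ ≤ M ∧ ‖A x‖ ≤ M ∧ ‖B x‖ ≤ M ∧ ‖z x‖ ≤ M := by
      intro x hx
      have hx : ‖q x‖ + ‖A x‖ + ‖B x‖ + ‖z x‖ < M := hx
      have := norm_nonneg (q x); have := norm_nonneg (A x)
      have := norm_nonneg (B x); have := norm_nonneg (z x)
      refine ⟨?_, ?_, ?_, ?_⟩ <;> linarith
    have hc := continuous_coeff hq hA hB
    constructor
    · refine ContinuousOn.continuousAt (s := s) ?_ hs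
      refine continuousOn_tsum (u := fun k => D * (1 / 2) ^ k) (fun k => ?_) (summable_half D) ?_
      · exact ((hc (k + 3)).mul (hz.pow k)).continuousOn
      · intro k x hx
        obtain ⟨h1, h2, h3, h4⟩ := hb x hx
        exact (hD _ h1 _ _ _ h2 h3 h4 k).1
    · refine ContinuousOn.continuousAt (s := s) ?_ hs
      refine continuousOn_tsum (u := fun k => D * (1 / 2) ^ k) (fun k => ?_) (summable_half D) ?_
      · exact (((continuous_const).mul (hc (k + 4))).mul (hz.pow k)).continuousOn
      · intro k x hx
        obtain ⟨h1, h2, h3, h4⟩ := hb x hx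
        exact (hD _ h1 _ _ _ h2 h3 h4 k).2
  exact ⟨continuous_iff_continuousAt.2 fun x => (key x).1,
    continuous_iff_continuousAt.2 fun x => (key x).2⟩

end families

section holomorphic
variable {q : ℂ → Fin 4 → ℂ} {A B z : ℂ → ℂ}

lemma differentiable_coeff (hq : Differentiable ℂ q) (hA : Differentiable ℂ A)
    (hB : Differentiable ℂ B) (k : ℕ) :
    Differentiable ℂ fun x => coeff (q x) (A x) (B x) k := by
  have hq' : ∀ i, Differentiable ℂ fun x => q x i := fun i => differentiable_pi.1 hq i
  have h0 := hq' 0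
  have h1 := hq' 1
  have h2 := hq' 2
  have h3 := hq' 3
  induction k using Nat.strong_induction_on with
  | _ k ih =>
    match k with
    | 0 | 1 | 2 => simp only [coeff]; fun_prop
    | 3 => simpa only [coeff]
    | 4 => simpa only [coeff]
    | k + 5 =>
      simp only [coeff]
      have i0 := ih k (by omega)
      have i1 := ih (k + 1) (by omega)
      have i2 := ih (k + 2) (by omega)
      have i3 := ih (k + 3) (by omega)
      fun_prop

lemma differentiable_sol_aux (hq : Differentiable ℂ q) (hA : Differentiable ℂ A)
    (hB : Differentiable ℂ B) (hz : Differentiable ℂ z) :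
    Differentiable ℂ (fun x => sol (q x) (A x) (B x) (z x)) ∧
      Differentiable ℂ (fun x => dsol (q x) (A x) (B x) (z x)) := by
  have key : ∀ x₀, DifferentiableAt ℂ (fun x => sol (q x) (A x) (B x) (z x)) x₀ ∧
      DifferentiableAt ℂ (fun x => dsol (q x) (A x) (B x) (z x)) x₀ := by
    intro x₀
    set M := ‖q x₀‖ + ‖A x₀‖ + ‖B x₀‖ + ‖z x₀‖ + 1 with hM
    have hM0 : 0 ≤ M := by positivity
    obtain ⟨D, hD⟩ := exists_uniform_bound M hM0
    set s : Set ℂ := {x | ‖q x‖ + ‖A x‖ + ‖B x‖ + ‖z x‖ < M}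
    have hqc := hq.continuous
    have hAc := hA.continuous
    have hBc := hB.continuous
    have hzc := hz.continuous
    have hso : IsOpen s := isOpen_lt (by fun_prop) continuous_const
    have hs : s ∈ nhds x₀ := hso.mem_nhds (by simp [s, hM])
    have hb : ∀ x ∈ s, ‖q x‖ ≤ M ∧ ‖A x‖ ≤ M ∧ ‖B x‖ ≤ M ∧ ‖z x‖ ≤ M := by
      intro x hx
      have hx : ‖q x‖ + ‖A x‖ + ‖B x‖ + ‖z x‖ < M := hx
      have := norm_nonneg (q x); have := norm_nonneg (A x)
      have := norm_nonneg (B x); have := norm_nonneg (z x)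
      refine ⟨?_, ?_, ?_, ?_⟩ <;> linarith
    have hc := differentiable_coeff hq hA hB
    constructor
    · refine DifferentiableOn.differentiableAt (s := s) ?_ hs
      refine differentiableOn_tsum_of_summable_norm (u := fun k => D * (1 / 2) ^ k)
        (summable_half D) (fun k => ?_) hso ?_
      · exact ((hc (k + 3)).mul (hz.pow k)).differentiableOn
      · intro k x hx
        obtain ⟨h1, h2, h3, h4⟩ := hb x hx
        exact (hD _ h1 _ _ _ h2 h3 h4 k).1
    · refine DifferentiableOn.differentiableAt (s := s) ?_ hs
      refine differentiableOn_tsum_of_summable_norm (u := fun k => D * (1 / 2) ^ k)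
        (summable_half D) (fun k => ?_) hso ?_
      · exact (((differentiable_const _).mul (hc (k + 4))).mul (hz.pow k)).differentiableOn
      · intro k x hx
        obtain ⟨h1, h2, h3, h4⟩ := hb x hx
        exact (hD _ h1 _ _ _ h2 h3 h4 k).2
  exact ⟨fun x => (key x).1, fun x => (key x).2⟩

end holomorphic

lemma continuous_deriv_param {X : Type*} [TopologicalSpace X] {f : ℂ → X → ℂ}
    (hf : Continuous fun p : ℂ × X => f p.1 p.2) (hd : ∀ x, Differentiable ℂ fun z => f z x) :
    Continuous fun p : ℂ × X => deriv (fun z => f z p.2) p.1 := by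
  rw [continuous_iff_continuousAt]
  rintro ⟨z₀, x₀⟩
  rw [ContinuousAt, Metric.tendsto_nhds]
  intro ε hε
  have h1 : ∀ᶠ x in 𝓝 x₀, ∀ z ∈ Metric.closedBall z₀ 2, ‖f z x - f z x₀‖ < ε / 2 := by
    refine (isCompact_closedBall z₀ 2).eventually_forall_of_forall_eventually fun z hz => ?_
    have hc : Continuous fun p : X × ℂ => ‖f p.2 p.1 - f p.2 x₀‖ := by
      have h2 : Continuous fun p : X × ℂ => f p.2 p.1 := hf.comp continuous_swap
      have h3 : Continuous fun p : X × ℂ => f p.2 x₀ :=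
        hf.comp (continuous_snd.prodMk continuous_const)
      exact (h2.sub h3).norm
    have := hc.tendsto (x₀, z)
    exact (tendsto_order.1 this).2 _ (by simpa using hε)
  have h2 : ∀ᶠ z in 𝓝 z₀, ‖deriv (fun z => f z x₀) z - deriv (fun z => f z x₀) z₀‖ < ε / 2 := by
    have := ((hd x₀).contDiff (n := 1)).continuous_deriv le_rfl
    have := (this.sub (continuous_const (y := deriv (fun z => f z x₀) z₀))).norm.tendsto z₀
    exact (tendsto_order.1 this).2 _ (by simpa using hε)
  have h3 := (h2.and (Metric.ball_mem_nhds z₀ one_pos)).prod_nhds h1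
  filter_upwards [h3] with ⟨z, x⟩ ⟨⟨hz, hz1⟩, hx⟩
  simp only at hz hx hz1
  rw [dist_eq_norm]
  have h4 : ‖deriv (fun z => f z x - f z x₀) z‖ ≤ ε / 2 / 1 := by
    refine norm_deriv_le_of_forall_mem_sphere_norm_le one_pos
      ((hd x).sub (hd x₀)).diffContOnCl fun w hw => (hx w ?_).le
    rw [Metric.mem_closedBall]
    rw [Metric.mem_sphere] at hw
    have := dist_triangle w z z₀
    linarith
  rw [deriv_fun_sub (hd x z) (hd x₀ z)] at h4
  calc _ = ‖(deriv (fun z => f z x) z - deriv (fun z => f z x₀) z) +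
        (deriv (fun z => f z x₀) z - deriv (fun z => f z x₀) z₀)‖ := by congr 1; ring
    _ ≤ _ := norm_add_le _ _
    _ < ε := by linarith

/-- Continuous, separately entire functions of two variables. -/
structure SepHol (f : ℂ → ℂ → ℂ) : Prop where
  cont : Continuous fun p : ℂ × ℂ => f p.1 p.2
  d1 : ∀ y, Differentiable ℂ fun x => f x y
  d2 : ∀ x, Differentiable ℂ fun y => f x y

namespace SepHol
variable {f : ℂ → ℂ → ℂ}

lemma swap (h : SepHol f) : SepHol fun x y => f y x :=
  ⟨h.cont.comp continuous_swap, h.d2, h.d1⟩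

lemma tendsto_quot (h : SepHol f) (x : ℂ) :
    TendstoLocallyUniformlyOn (fun (n : ℕ) y => (n + 1 : ℂ) * (f (x + 1 / (n + 1)) y - f x y))
      (fun y => deriv (fun x => f x y) x) atTop Set.univ := by
  rw [Metric.tendstoLocallyUniformlyOn_iff]
  intro ε hε y₀ _
  have hc := continuous_deriv_param h.cont h.d1
  obtain ⟨δ, hδ, hd⟩ := Metric.continuousAt_iff.1 (hc.continuousAt (x := (x, y₀))) (ε / 3) (by positivity)
  refine ⟨Metric.ball y₀ δ, mem_nhdsWithin_of_mem_nhds (Metric.ball_mem_nhds _ hδ), ?_⟩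
  obtain ⟨N, hN⟩ := exists_nat_gt (1 / δ)
  filter_upwards [eventually_ge_atTop N] with n hn y hy
  have hn0 : (0 : ℝ) < n + 1 := by positivity
  have hnn : ‖(n + 1 : ℂ)‖ = n + 1 := by exact_mod_cast Complex.norm_natCast (n + 1)
  have hne : (n + 1 : ℂ) ≠ 0 := by exact_mod_cast Nat.succ_ne_zero n
  have hn1 : 1 / ((n : ℝ) + 1) < δ := by
    rw [div_lt_iff₀ hn0]
    rw [div_lt_iff₀ hδ] at hN
    have : (N : ℝ) ≤ n := by exact_mod_cast hn
    nlinarith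
  have key : ‖(fun t => f t y - t * deriv (fun x => f x y) x) (x + 1 / (n + 1)) -
      (fun t => f t y - t * deriv (fun x => f x y) x) x‖ ≤ (2 * ε / 3) * ‖(x + 1 / (n + 1)) - x‖ := by
    refine (convex_ball x δ).norm_image_sub_le_of_norm_hasDerivWithin_le
      (f' := fun t => deriv (fun x => f x y) t - 1 * deriv (fun x => f x y) x)
      (fun t ht => (((h.d1 y t).hasDerivAt).sub ((hasDerivAt_id t).mul_const _)).hasDerivWithinAt)
      (fun t ht => ?_) (Metric.mem_ball_self hδ) ?_
    · have a1 := @hd (t, y) (by rw [Prod.dist_eq]; exact max_lt ht hy)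
      have a2 := @hd (x, y) (by rw [Prod.dist_eq]; exact max_lt (by simpa) hy)
      rw [one_mul, ← dist_eq_norm]
      have := dist_triangle_right (deriv (fun x => f x y) t) (deriv (fun x => f x y) x)
        (deriv (fun x => f x y₀) x)
      simp only at a1 a2
      linarith
    · rw [Metric.mem_ball, dist_eq_norm, add_sub_cancel_left, norm_div, hnn, norm_one]
      exact hn1
  rw [add_sub_cancel_left, norm_div, hnn, norm_one] at key
  rw [dist_comm, dist_eq_norm]
  have e : (n + 1 : ℂ) * (f (x + 1 / (n + 1)) y - f x y) - deriv (fun x => f x y) x =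
    (n + 1) * ((fun t => f t y - t * deriv (fun x => f x y) x) (x + 1 / (n + 1)) -
      (fun t => f t y - t * deriv (fun x => f x y) x) x) := by
    simp only
    field_simp
    ring
  rw [e, norm_mul, hnn]
  calc _ ≤ (n + 1 : ℝ) * (2 * ε / 3 * (1 / (n + 1))) := by gcongr
    _ = 2 * ε / 3 := by field_simp
    _ < ε := by linarith

lemma deriv1 (h : SepHol f) : SepHol fun x y => deriv (fun x => f x y) x where
  cont := continuous_deriv_param h.cont h.d1
  d1 y := ((h.d1 y).contDiff (n := 2)).differentiable_deriv_two
  d2 x := by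
    rw [← differentiableOn_univ]
    refine (h.tendsto_quot x).differentiableOn (Eventually.of_forall fun n => ?_) isOpen_univ
    have h1 := h.d2 (x + 1 / (n + 1))
    have h2 := h.d2 x
    exact ((h1.sub h2).const_mul _).differentiableOn

lemma deriv2 (h : SepHol f) : SepHol fun x y => deriv (fun y => f x y) y := h.swap.deriv1.swap

lemma deriv_comm (h : SepHol f) (x y : ℂ) :
    deriv (fun y => deriv (fun x => f x y) x) y = deriv (fun x => deriv (fun y => f x y) y) x := by
  have h1 := (h.tendsto_quot x).deriv (Eventually.of_forall fun n => by
    have h1 := h.d2 (x + 1 / (n + 1))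
    have h2 := h.d2 x
    exact ((h1.sub h2).const_mul _).differentiableOn) isOpen_univ
  have h2 := h1.tendsto_at (Set.mem_univ y)
  have h3 := (h.deriv2.tendsto_quot x).tendsto_at (Set.mem_univ y)
  refine tendsto_nhds_unique h2 (h3.congr fun n => ?_)
  have h1 := h.d2 (x + 1 / (n + 1))
  have h2 := h.d2 x
  simp only [Function.comp]
  exact (((h1 y).hasDerivAt.sub (h2 y).hasDerivAt).const_mul _).deriv.symm

lemma hasStrictFDerivAt (h : SepHol f) (u : ℂ × ℂ) :
    HasStrictFDerivAt (fun p : ℂ × ℂ => f p.1 p.2)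
      ((ContinuousLinearMap.toSpanSingleton ℂ (deriv (fun x => f x u.2) u.1)).coprod
        (ContinuousLinearMap.toSpanSingleton ℂ (deriv (fun y => f u.1 y) u.2))) u := by
  have hc : Continuous fun a : ℂ => ContinuousLinearMap.toSpanSingleton ℂ a :=
    (ContinuousLinearMap.toSpanSingletonCLE (𝕜 := ℂ) (E := ℂ)).continuous
  exact hasStrictFDerivAt_uncurry_coprod (u := u) (f := f)
    (f₁ := fun x y => ContinuousLinearMap.toSpanSingleton ℂ (deriv (fun x => f x y) x))
    (f₂ := fun x y => ContinuousLinearMap.toSpanSingleton ℂ (deriv (fun y => f x y) y))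
    (Eventually.of_forall fun v => ((h.d1 v.2 v.1).hasDerivAt).hasFDerivAt)
    (Eventually.of_forall fun v => ((h.d2 v.1 v.2).hasDerivAt).hasFDerivAt)
    (hc.comp h.deriv1.cont).continuousAt (hc.comp h.deriv2.cont).continuousAt

end SepHol

/-- `w` is an entire solution of `w'' = Q w` with derivative `w'`. -/
structure IsSol (Q : ℂ → ℂ) (w w' : ℂ → ℂ) : Prop where
  d1 : ∀ z, HasDerivAt w (w' z) z
  d2 : ∀ z, HasDerivAt w' (Q z * w z) z

/-- Wronskian, as a function. -/
def wr (f f' g g' : ℂ → ℂ) (z : ℂ) : ℂ := f z * g' z - f' z * g z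

namespace IsSol
variable {Q f f' g g' h h' : ℂ → ℂ}

lemma wr_const (hf : IsSol Q f f') (hg : IsSol Q g g') (z z₀ : ℂ) :
    wr f f' g g' z = wr f f' g g' z₀ := by
  have hd : ∀ z, HasDerivAt (wr f f' g g') 0 z := fun z => by
    have := ((hf.d1 z).mul (hg.d2 z)).sub ((hf.d2 z).mul (hg.d1 z))
    refine this.congr_deriv ?_
    ring
  exact is_const_of_deriv_eq_zero (fun z => (hd z).differentiableAt) (fun z => (hd z).deriv) z z₀

lemma lin (hf : IsSol Q f f') (hg : IsSol Q g g') (A B : ℂ) :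
    IsSol Q (fun z => A * f z + B * g z) (fun z => A * f' z + B * g' z) :=
  ⟨fun z => ((hf.d1 z).const_mul A).add ((hg.d1 z).const_mul B), fun z =>
    (((hf.d2 z).const_mul A).add ((hg.d2 z).const_mul B)).congr_deriv (by ring)⟩

lemma smul (hf : IsSol Q f f') (A : ℂ) : IsSol Q (fun z => A * f z) (fun z => A * f' z) :=
  ⟨fun z => (hf.d1 z).const_mul A, fun z => ((hf.d2 z).const_mul A).congr_deriv (by ring)⟩

lemma differentiable (hf : IsSol Q f f') : Differentiable ℂ f := fun z => (hf.d1 z).differentiableAt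

lemma differentiable' (hf : IsSol Q f f') : Differentiable ℂ f' :=
  fun z => (hf.d2 z).differentiableAt

lemma deriv_eq (hf : IsSol Q f f') : deriv f = f' := funext fun z => (hf.d1 z).deriv

end IsSol

lemma isSol_sol (q : Fin 4 → ℂ) (A B : ℂ) : IsSol (cubic q) (sol q A B) (dsol q A B) :=
  ⟨hasDerivAt_sol q A B, hasDerivAt_dsol q A B⟩

namespace IsSol
variable {q : Fin 4 → ℂ} {w w' : ℂ → ℂ}

lemma wr_fund (q : Fin 4 → ℂ) (z : ℂ) :
    sol q 1 0 z * dsol q 0 1 z - dsol q 1 0 z * sol q 0 1 z = 1 := by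
  have := (isSol_sol q 1 0).wr_const (isSol_sol q 0 1) z 0
  simpa [wr, sol_zero, dsol_zero] using this

/-- Expression of a solution through the fundamental system with data at `z₀`. -/
lemma eq_fund (hw : IsSol (cubic q) w w') (z₀ z : ℂ) :
    w z = (w z₀ * dsol q 0 1 z₀ - w' z₀ * sol q 0 1 z₀) * sol q 1 0 z +
      (sol q 1 0 z₀ * w' z₀ - dsol q 1 0 z₀ * w z₀) * sol q 0 1 z := by
  have h1 := hw.wr_const (isSol_sol q 0 1) z z₀
  have h2 := (isSol_sol q 1 0).wr_const hw z z₀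
  have h3 := wr_fund q z
  simp only [wr] at h1 h2
  rw [← h1, ← h2]
  linear_combination (- w z) * h3

lemma eq_fund' (hw : IsSol (cubic q) w w') (z₀ z : ℂ) :
    w' z = (w z₀ * dsol q 0 1 z₀ - w' z₀ * sol q 0 1 z₀) * dsol q 1 0 z +
      (sol q 1 0 z₀ * w' z₀ - dsol q 1 0 z₀ * w z₀) * dsol q 0 1 z := by
  have h1 := hw.wr_const (isSol_sol q 0 1) z z₀
  have h2 := (isSol_sol q 1 0).wr_const hw z z₀
  have h3 := wr_fund q z
  simp only [wr] at h1 h2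
  rw [← h1, ← h2]
  linear_combination (- w' z) * h3

lemma eq_zero (hw : IsSol (cubic q) w w') {z₀ : ℂ} (h0 : w z₀ = 0) (h1 : w' z₀ = 0) (z : ℂ) :
    w z = 0 := by
  rw [hw.eq_fund z₀ z, h0, h1]; ring

end IsSol

/-- Backward estimate for a linear system that grows in the forward direction. -/
lemma segment_estimate {t₀ T κ ρ M : ℝ} (ht : t₀ ≤ T) (hκ : 0 < κ)
    {G H q r : ℝ → ℂ}
    (hH : ∀ t ∈ Set.Icc t₀ T, HasDerivAt H (q t * H t + r t * G t) t)
    (hq : ∀ t ∈ Set.Icc t₀ T, κ ≤ (q t).re) (hr : ∀ t ∈ Set.Icc t₀ T, ‖r t * G t‖ ≤ ρ * M)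
    (hρM : 0 ≤ ρ * M) :
    ‖H t₀‖ ≤ ‖H T‖ + ρ * M / κ := by
  set B := (ρ * M / κ) ^ 2 with hB
  set φ : ℝ → ℝ := fun t => (Complex.normSq (H t) - B) * Real.exp (-κ * t) with hφ
  have hns : ∀ t ∈ Set.Icc t₀ T, HasDerivAt (fun t => Complex.normSq (H t))
      (2 * ((H t).re * (q t * H t + r t * G t).re + (H t).im * (q t * H t + r t * G t).im)) t := by
    intro t ht
    have h1 := Complex.reCLM.hasFDerivAt.comp_hasDerivAt t (hH t ht)
    have h2 := Complex.imCLM.hasFDerivAt.comp_hasDerivAt t (hH t ht)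
    have := (h1.mul h1).add (h2.mul h2)
    simp only [Complex.reCLM_apply, Complex.imCLM_apply, Function.comp_def] at this
    refine (this.congr_deriv ?_)
    ring
  have hd : ∀ t ∈ Set.Icc t₀ T, HasDerivAt φ
      ((2 * ((H t).re * (q t * H t + r t * G t).re + (H t).im * (q t * H t + r t * G t).im)) *
        Real.exp (-κ * t) + (Complex.normSq (H t) - B) * (Real.exp (-κ * t) * (-κ * 1))) t := by
    intro t ht
    exact ((hns t ht).sub_const B).mul (((hasDerivAt_id t).const_mul (-κ)).exp)
  have hmono : MonotoneOn φ (Set.Icc t₀ T) := by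
    refine monotoneOn_of_deriv_nonneg (convex_Icc _ _)
      (fun t ht => (hd t ht).continuousAt.continuousWithinAt)
      (fun t ht => (hd t (interior_subset ht)).differentiableAt.differentiableWithinAt) ?_
    intro t ht
    have ht := interior_subset ht
    rw [(hd t ht).deriv]
    have hk := hq t ht
    have hr' := hr t ht
    set u := r t * G t
    have h1 : (H t).re * u.re + (H t).im * u.im ≥ - (‖H t‖ * (ρ * M)) := by
      have e : (H t).re * u.re + (H t).im * u.im = ((starRingEnd ℂ) (H t) * u).re := by
        simp [Complex.mul_re]
      rw [e]
      have h2 := Complex.abs_re_le_norm ((starRingEnd ℂ) (H t) * u)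
      rw [norm_mul, Complex.norm_conj] at h2
      have h3 : ‖H t‖ * ‖u‖ ≤ ‖H t‖ * (ρ * M) := by gcongr
      linarith [neg_abs_le (((starRingEnd ℂ) (H t) * u).re)]
    have h4 : Complex.normSq (H t) = ‖H t‖ ^ 2 := Complex.normSq_eq_norm_sq _
    have h5 : (H t).re * (q t * H t + u).re + (H t).im * (q t * H t + u).im =
        (q t).re * Complex.normSq (H t) + ((H t).re * u.re + (H t).im * u.im) := by
      simp only [Complex.add_re, Complex.add_im, Complex.mul_re, Complex.mul_im, Complex.normSq_apply]
      ring
    rw [h5, h4]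
    have h6 : κ * ‖H t‖ ^ 2 ≤ (q t).re * ‖H t‖ ^ 2 := by gcongr
    have h7 : κ * B = (ρ * M) ^ 2 / κ := by rw [hB]; field_simp
    have h8 : 0 ≤ κ * ‖H t‖ ^ 2 - 2 * (‖H t‖ * (ρ * M)) + κ * B := by
      have : κ * ‖H t‖ ^ 2 - 2 * (‖H t‖ * (ρ * M)) + κ * B = κ * (‖H t‖ - ρ * M / κ) ^ 2 := by
        rw [hB]; field_simp; ring
      rw [this]; positivity
    have : 0 ≤ (2 * ((q t).re * ‖H t‖ ^ 2 + ((H t).re * u.re + (H t).im * u.im)) -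
      κ * (‖H t‖ ^ 2 - B)) * Real.exp (-κ * t) := mul_nonneg (by linarith) (Real.exp_pos _).le
    linarith
  have h1 := hmono (Set.left_mem_Icc.2 ht) (Set.right_mem_Icc.2 ht) ht
  simp only [hφ, Complex.normSq_eq_norm_sq] at h1
  have hρκ : 0 ≤ ρ * M / κ := by positivity
  refine abs_le_of_sq_le_sq' ?_ (by positivity) |>.2
  by_cases hc : ‖H t₀‖ ^ 2 ≤ B
  · refine hc.trans ?_
    rw [hB]
    exact pow_le_pow_left₀ hρκ (by linarith [norm_nonneg (H T)]) 2
  · push Not at hc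
    have e1 : Real.exp (-κ * T) ≤ Real.exp (-κ * t₀) := Real.exp_le_exp.2 (by nlinarith)
    have h2 : (‖H t₀‖ ^ 2 - B) * Real.exp (-κ * T) ≤ (‖H T‖ ^ 2 - B) * Real.exp (-κ * T) :=
      le_trans (mul_le_mul_of_nonneg_left e1 (by linarith)) h1
    have h3 := le_of_mul_le_mul_right h2 (Real.exp_pos _)
    nlinarith [norm_nonneg (H T)]

/-- Principal square root. -/
noncomputable def rt (z : ℂ) : ℂ := exp (log z / 2)

lemma rt_ne_zero (z : ℂ) : rt z ≠ 0 := exp_ne_zero _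

lemma rt_sq {z : ℂ} (hz : z ≠ 0) : rt z ^ 2 = z := by
  rw [rt, ← exp_nat_mul]
  push_cast
  rw [mul_div_cancel₀ _ (two_ne_zero), exp_log hz]

lemma norm_rt {z : ℂ} (hz : z ≠ 0) : ‖rt z‖ = √‖z‖ := by
  have := congrArg norm (rt_sq hz)
  rw [norm_pow] at this
  rw [← this, Real.sqrt_sq (norm_nonneg _)]

lemma hasDerivAt_rt {z : ℂ} (hz : z ∈ slitPlane) : HasDerivAt rt (1 / (2 * rt z)) z := by
  have hz0 := slitPlane_ne_zero hz
  have := ((hasDerivAt_log hz).div_const 2).cexp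
  refine this.congr_deriv ?_
  change rt z * (z⁻¹ / 2) = _
  have h := rt_ne_zero z
  have h2 := rt_sq hz0
  have h3 : z⁻¹ = (rt z ^ 2)⁻¹ := by rw [h2]
  rw [h3]
  field_simp

lemma rt_ofReal {x : ℝ} (hx : 0 < x) : rt x = (√x : ℝ) := by
  rw [rt, ← ofReal_log hx.le, show ((Real.log x : ℂ) / 2) = ((Real.log x / 2 : ℝ) : ℂ) by push_cast; rfl,
    ← ofReal_exp, ← Real.log_sqrt hx.le, Real.exp_log (Real.sqrt_pos.2 hx)]

lemma rt_eq_polar {z : ℂ} (hz : z ≠ 0) : rt z = (√‖z‖ : ℝ) * exp ((arg z / 2 : ℝ) * I) := by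
  have hn : 0 < ‖z‖ := norm_pos_iff.2 hz
  have h1 : ((√‖z‖ : ℝ) : ℂ) = exp ((Real.log ‖z‖ / 2 : ℝ)) := by
    rw [← ofReal_exp, ← Real.log_sqrt hn.le, Real.exp_log (Real.sqrt_pos.2 hn)]
  rw [h1, ← exp_add, rt, log]
  congr 1
  push_cast
  ring

/-- The WKB approximation of the subdominant solution. -/
noncomputable def wkb (a z : ℂ) : ℂ := exp (-(2 / 5) * rt z ^ 5 + a * rt z - 3 / 4 * log z)

/-- Logarithmic derivative of `wkb`. -/
noncomputable def wkbL (a z : ℂ) : ℂ := -rt z ^ 3 + a / (2 * rt z) - 3 / (4 * rt z ^ 2)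

/-- The cubic potential `z³ - a z + λ`. -/
def pot (p : ℂ × ℂ) (z : ℂ) : ℂ := z ^ 3 - p.1 * z + p.2

/-- The remainder in the equation for `w / wkb`. -/
noncomputable def wkbR (p : ℂ × ℂ) (z : ℂ) : ℂ :=
  p.2 - p.1 ^ 2 / (4 * rt z ^ 2) + p.1 / rt z ^ 3 - 21 / (16 * rt z ^ 4)

lemma wkb_ne_zero (a z : ℂ) : wkb a z ≠ 0 := exp_ne_zero _

lemma hasDerivAt_wkb (a : ℂ) {z : ℂ} (hz : z ∈ slitPlane) :
    HasDerivAt (wkb a) (wkbL a z * wkb a z) z := by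
  have hz0 := slitPlane_ne_zero hz
  have h := hasDerivAt_rt hz
  have := ((((h.pow 5).const_mul (-(2 / 5) : ℂ)).add (h.const_mul a)).sub
    ((hasDerivAt_log hz).const_mul (3 / 4))).cexp
  refine this.congr_deriv ?_
  change wkb a z * _ = _
  rw [mul_comm]
  congr 1
  have h := rt_ne_zero z
  have h2 := rt_sq hz0
  have h3 : z⁻¹ = (rt z ^ 2)⁻¹ := by rw [h2]
  rw [h3, wkbL]
  field_simp
  ring

lemma hasDerivAt_wkbL (a : ℂ) {z : ℂ} (hz : z ∈ slitPlane) :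
    HasDerivAt (wkbL a) (-(3 / 2) * rt z - a / (4 * rt z ^ 3) + 3 / (4 * rt z ^ 4)) z := by
  have h := hasDerivAt_rt hz
  have hn := rt_ne_zero z
  have h1 : HasDerivAt (fun z => a / (2 * rt z)) _ z := (hasDerivAt_const z a).div (h.const_mul 2) (by simpa)
  have h2 : HasDerivAt (fun z => 3 / (4 * rt z ^ 2)) _ z :=
    (hasDerivAt_const z 3).div ((h.pow 2).const_mul 4) (by simpa)
  refine (((h.pow 3).neg.add h1).sub h2).congr_deriv ?_
  field_simp
  ring

lemma hasDerivAt_div_wkb {p : ℂ × ℂ} {w w' : ℂ → ℂ} (hw : IsSol (pot p) w w') {z : ℂ}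
    (hz : z ∈ slitPlane) :
    HasDerivAt (fun z => w z / wkb p.1 z) ((w' z - wkbL p.1 z * w z) / wkb p.1 z) z := by
  refine ((hw.d1 z).div (hasDerivAt_wkb p.1 hz) (wkb_ne_zero _ _)).congr_deriv ?_
  have := wkb_ne_zero p.1 z
  field_simp

lemma hasDerivAt_div_wkb' {p : ℂ × ℂ} {w w' : ℂ → ℂ} (hw : IsSol (pot p) w w') {z : ℂ}
    (hz : z ∈ slitPlane) :
    HasDerivAt (fun z => (w' z - wkbL p.1 z * w z) / wkb p.1 z)
      (-2 * wkbL p.1 z * ((w' z - wkbL p.1 z * w z) / wkb p.1 z) +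
        wkbR p z * (w z / wkb p.1 z)) z := by
  refine (((hw.d2 z).sub ((hasDerivAt_wkbL p.1 hz).mul (hw.d1 z))).div (hasDerivAt_wkb p.1 hz)
    (wkb_ne_zero _ _)).congr_deriv ?_
  have h0 := wkb_ne_zero p.1 z
  have h1 := rt_ne_zero z
  have h2 := rt_sq (slitPlane_ne_zero hz)
  have h3 : pot p z = rt z ^ 6 - p.1 * rt z ^ 2 + p.2 := by
    rw [pot]; nth_rewrite 1 2 [← h2]; ring
  rw [h3]
  simp only [Pi.sub_apply, Pi.mul_apply]
  field_simp
  simp only [wkbL, wkbR]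
  field_simp
  ring

lemma norm_wkbR_le {p : ℂ × ℂ} {M : ℝ} (h1 : ‖p.1‖ ≤ M) (h2 : ‖p.2‖ ≤ M) {z : ℂ} (hz : 1 ≤ ‖z‖) :
    ‖wkbR p z‖ ≤ (M + 2) ^ 2 := by
  have hM : 0 ≤ M := (norm_nonneg _).trans h1
  have hz0 : z ≠ 0 := norm_pos_iff.1 (by linarith)
  have hr : 1 ≤ ‖rt z‖ := by rw [norm_rt hz0]; exact Real.one_le_sqrt.2 hz
  have hr2 := one_le_pow₀ hr (n := 2)
  have hr3 := one_le_pow₀ hr (n := 3)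
  have hr4 := one_le_pow₀ hr (n := 4)
  have e1 : ‖p.1 ^ 2 / (4 * rt z ^ 2)‖ ≤ M ^ 2 := by
    rw [norm_div, norm_mul, norm_pow, norm_pow]
    simp only [Complex.norm_ofNat]
    rw [div_le_iff₀ (by positivity)]
    have : ‖p.1‖ ^ 2 ≤ M ^ 2 := by gcongr
    nlinarith [sq_nonneg M]
  have e2 : ‖p.1 / rt z ^ 3‖ ≤ M := by
    rw [norm_div, norm_pow]
    exact (div_le_self (norm_nonneg _) hr3).trans h1
  have e3 : ‖21 / (16 * rt z ^ 4)‖ ≤ 2 := by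
    rw [norm_div, norm_mul, norm_pow]
    simp only [Complex.norm_ofNat]
    rw [div_le_iff₀ (by positivity)]
    nlinarith
  calc _ ≤ ‖p.2‖ + ‖p.1 ^ 2 / (4 * rt z ^ 2)‖ + ‖p.1 / rt z ^ 3‖ + ‖21 / (16 * rt z ^ 4)‖ := by
        refine (norm_sub_le _ _).trans ?_
        gcongr
        refine (norm_add_le _ _).trans ?_
        gcongr
        exact norm_sub_le _ _
    _ ≤ M + M ^ 2 + M + 2 := by gcongr
    _ ≤ _ := by nlinarith

/-- Lower bound for the growth rate along a direction `e`, when `e z^{3/2}` has large real part. -/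
lemma growth_rate {a e z : ℂ} {M : ℝ} (ha : ‖a‖ ≤ M) (hz : 1 ≤ ‖z‖) (he : ‖e‖ = 1)
    (h : √‖z‖ ^ 3 / 6 ≤ (e * rt z ^ 3).re) (hM : 6 * (M + 2) ≤ √‖z‖) :
    √‖z‖ ^ 3 / 6 ≤ (e * (-2 * wkbL a z)).re := by
  have hM0 : 0 ≤ M := (norm_nonneg _).trans ha
  have hz0 : z ≠ 0 := norm_pos_iff.1 (by linarith)
  have hr : 1 ≤ ‖rt z‖ := by rw [norm_rt hz0]; exact Real.one_le_sqrt.2 hz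
  have hr2 := one_le_pow₀ hr (n := 2)
  have e1 : ‖e * (a / rt z)‖ ≤ M := by
    rw [norm_mul, he, one_mul, norm_div]
    exact (div_le_self (norm_nonneg _) hr).trans ha
  have e2 : ‖e * (3 / (2 * rt z ^ 2))‖ ≤ 3 / 2 := by
    rw [norm_mul, he, one_mul, norm_div, norm_mul, norm_pow]
    simp only [Complex.norm_ofNat]
    rw [div_le_iff₀ (by positivity)]
    nlinarith
  have e3 : e * (-2 * wkbL a z) = 2 * (e * rt z ^ 3) - e * (a / rt z) + e * (3 / (2 * rt z ^ 2)) := by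
    rw [wkbL]
    have := rt_ne_zero z
    field_simp
    ring
  rw [e3]
  have f1 := (abs_le.1 ((abs_re_le_norm _).trans e1)).2
  have f2 := (abs_le.1 ((abs_re_le_norm _).trans e2)).1
  have f3 : (2 * (e * rt z ^ 3)).re = 2 * (e * rt z ^ 3).re := by simp
  rw [add_re, sub_re, f3]
  have hs : 1 ≤ √‖z‖ := by rwa [Real.one_le_sqrt]
  have : √‖z‖ ≤ √‖z‖ ^ 3 := le_self_pow₀ hs (by norm_num)
  linarith

lemma growth_rate_one {a : ℂ} {M x : ℝ} (ha : ‖a‖ ≤ M) (hx : 1 ≤ x) (hM : 6 * (M + 2) ≤ √x) :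
    √x ^ 3 / 6 ≤ (-2 * wkbL a x).re := by
  have hn : ‖(x : ℂ)‖ = x := by simpa using (by linarith : (0:ℝ) ≤ x)
  have := growth_rate (e := 1) ha (z := x) (by rwa [hn]) (by simp) (by
    rw [hn, one_mul, rt_ofReal (by linarith), ← ofReal_pow, ofReal_re]
    have : 0 ≤ √x ^ 3 := by positivity
    linarith) (by rwa [hn])
  rwa [hn, one_mul] at this

/-- The direction `exp(-iπ/3)`. -/
noncomputable def dir : ℂ := exp ((-(Real.pi / 3) : ℝ) * I)

lemma dir_rt {z : ℂ} (hz : 0 < ‖z‖) (h1 : 0 ≤ z.re) (h2 : 0 ≤ z.im) :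
    √‖z‖ ^ 3 / 6 ≤ (dir * rt z ^ 3).re := by
  have hz0 : z ≠ 0 := norm_pos_iff.1 hz
  have e : dir * rt z ^ 3 = (√‖z‖ ^ 3 : ℝ) * exp ((3 / 2 * arg z - Real.pi / 3 : ℝ) * I) := by
    rw [rt_eq_polar hz0, mul_pow, ← exp_nat_mul, dir, mul_left_comm, ← exp_add]
    push_cast
    congr 2
    ring
  rw [e, re_ofReal_mul, exp_ofReal_mul_I_re]
  have ha1 : 0 ≤ arg z := arg_nonneg_iff.2 h2
  have ha2 : arg z ≤ Real.pi / 2 := by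
    have := abs_arg_le_pi_div_two_iff.2 h1
    exact (abs_le.1 this).2
  have hpi := Real.pi_pos
  have hab : |3 / 2 * arg z - Real.pi / 3| ≤ 5 / 12 * Real.pi := by
    rw [abs_le]; constructor <;> linarith
  have hc : (1 : ℝ) / 6 ≤ Real.cos (3 / 2 * arg z - Real.pi / 3) := by
    rw [← Real.cos_abs]
    have := Real.one_sub_mul_le_cos (abs_nonneg (3 / 2 * arg z - Real.pi / 3)) (by linarith)
    refine le_trans ?_ this
    have : 2 / Real.pi * |3 / 2 * arg z - Real.pi / 3| ≤ 5 / 6 := by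
      rw [div_mul_eq_mul_div, div_le_iff₀ hpi]; linarith
    linarith
  have : 0 ≤ √‖z‖ ^ 3 := by positivity
  nlinarith

/-- The ratio of a function to the WKB approximation. -/
noncomputable def hq (p : ℂ × ℂ) (w : ℂ → ℂ) (z : ℂ) : ℂ := w z / wkb p.1 z

/-- The derivative of the ratio. -/
noncomputable def hqd (p : ℂ × ℂ) (w w' : ℂ → ℂ) (z : ℂ) : ℂ :=
  (w' z - wkbL p.1 z * w z) / wkb p.1 z

lemma mem_slitPlane_of_re {z : ℂ} (h : 0 ≤ z.re) (h0 : z ≠ 0) : z ∈ slitPlane := by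
  rw [mem_slitPlane_iff]
  rcases h.lt_or_eq with h | h
  · exact Or.inl h
  · exact Or.inr fun hi => h0 (Complex.ext h.symm hi)

/-- Bound for `h'` along a segment. -/
lemma hqd_segment {p : ℂ × ℂ} {w w' : ℂ → ℂ} (hw : IsSol (pot p) w w') {M : ℝ}
    (h1 : ‖p.1‖ ≤ M) (h2 : ‖p.2‖ ≤ M) {z e : ℂ} (he : ‖e‖ = 1) {t₀ T κ N : ℝ} (ht : t₀ ≤ T)
    (hκ : 0 < κ) (hN : 0 ≤ N)
    (hs : ∀ t ∈ Set.Icc t₀ T, z + t * e ∈ slitPlane)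
    (hs1 : ∀ t ∈ Set.Icc t₀ T, 1 ≤ ‖z + t * e‖)
    (hs2 : ∀ t ∈ Set.Icc t₀ T, κ ≤ (e * (-2 * wkbL p.1 (z + t * e))).re)
    (hs3 : ∀ t ∈ Set.Icc t₀ T, ‖hq p w (z + t * e)‖ ≤ N) :
    ‖hqd p w w' (z + t₀ * e)‖ ≤ ‖hqd p w w' (z + T * e)‖ + (M + 2) ^ 2 * N / κ := by
  have hpath : ∀ t : ℝ, HasDerivAt (fun t : ℝ => z + t * e) e t := fun t => by
    simpa using ((hasDerivAt_id t).ofReal_comp.mul_const e).const_add z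
  have := segment_estimate (ρ := (M + 2) ^ 2) (M := N) ht hκ (G := fun t => hq p w (z + t * e))
    (H := fun t => e * hqd p w w' (z + t * e)) (q := fun t => e * (-2 * wkbL p.1 (z + t * e)))
    (r := fun t => e ^ 2 * wkbR p (z + t * e)) (fun t ht => by
      have h := (hasDerivAt_div_wkb' hw (hs t ht)).comp t (hpath t)
      refine (h.const_mul e).congr_deriv ?_
      simp only [hq, hqd]
      ring) hs2 (fun t ht => by
      rw [norm_mul, norm_mul, norm_pow, he, one_pow, one_mul]
      have := norm_wkbR_le h1 h2 (hs1 t ht)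
      have := hs3 t ht
      gcongr) (by positivity)
  simpa [norm_mul, he] using this

lemma ray_estimate {p : ℂ × ℂ} {w w' : ℂ → ℂ} (hw : IsSol (pot p) w w') {M R T m m' : ℝ}
    (h1 : ‖p.1‖ ≤ M) (h2 : ‖p.2‖ ≤ M) (hR : 1 ≤ R) (hR' : 24 * (M + 2) ^ 2 ≤ √R) (hT : R ≤ T)
    (hm : ‖hq p w T‖ ≤ m) (hm' : ‖hqd p w w' T‖ ≤ m') {x : ℝ} (hx : x ∈ Set.Icc R T) :
    ‖hq p w x‖ ≤ 2 * (m + T * m') ∧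
      ‖hqd p w w' x‖ ≤ m' + 12 * (M + 2) ^ 2 * (m + T * m') / √x ^ 3 ∧
      ‖hq p w x - hq p w T‖ ≤ T * m' + 24 * (M + 2) ^ 2 * (m + T * m') / √x := by
  have hM : 0 ≤ M := (norm_nonneg _).trans h1
  have hm0 : 0 ≤ m := (norm_nonneg _).trans hm
  have hm'0 : 0 ≤ m' := (norm_nonneg _).trans hm'
  set ρ := (M + 2) ^ 2 with hρ
  have hρ0 : 0 ≤ ρ := by positivity
  have h6 : 6 * (M + 2) ≤ √R := by nlinarith
  have hslit : ∀ t : ℝ, R ≤ t → (t : ℂ) ∈ slitPlane := fun t ht =>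
    ofReal_mem_slitPlane.2 (by linarith)
  have hd : ∀ t : ℝ, R ≤ t → HasDerivAt (fun t : ℝ => hq p w t) (hqd p w w' t) t := fun t ht =>
    (hasDerivAt_div_wkb hw (hslit t ht)).comp_ofReal
  obtain ⟨x₁, hx₁, hmax⟩ := isCompact_Icc.exists_isMaxOn (Set.nonempty_Icc.2 hT)
    (f := fun t : ℝ => ‖hq p w t‖) fun t ht => (hd t ht.1).continuousAt.norm.continuousWithinAt
  set N := ‖hq p w x₁‖ with hN
  have hN0 : 0 ≤ N := norm_nonneg _
  have hle : ∀ t ∈ Set.Icc R T, ‖hq p w t‖ ≤ N := fun t ht => hmax ht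
  have A : ∀ x ∈ Set.Icc R T, ‖hqd p w w' x‖ ≤ m' + 6 * ρ * N / √x ^ 3 := by
    intro x hx
    have hx0 : 0 < √x := Real.sqrt_pos.2 (by linarith [hx.1])
    have := hqd_segment hw h1 h2 (z := 0) (e := 1) (by simp) (t₀ := x) (T := T) (κ := √x ^ 3 / 6)
      (N := N) hx.2 (by positivity) hN0
      (fun t ht => by simpa using hslit t (hx.1.trans ht.1))
      (fun t ht => by
        have : 1 ≤ t := by linarith [hx.1, ht.1]
        simpa using this.trans (le_abs_self t))
      (fun t ht => by
        have h3 : R ≤ t := hx.1.trans ht.1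
        have := growth_rate_one h1 (x := t) (by linarith) (h6.trans (Real.sqrt_le_sqrt h3))
        have h4 : √x ^ 3 / 6 ≤ √t ^ 3 / 6 := by
          have := Real.sqrt_le_sqrt ht.1
          gcongr
        simpa using h4.trans this)
      (fun t ht => by simpa using hle t ⟨hx.1.trans ht.1, ht.2⟩)
    simp only [zero_add, mul_one] at this
    refine this.trans ?_
    rw [show (M + 2) ^ 2 * N / (√x ^ 3 / 6) = 6 * ρ * N / √x ^ 3 by rw [hρ]; field_simp]
    gcongr
  have B : ∀ x ∈ Set.Icc R T, ‖hq p w x - hq p w T‖ ≤ T * m' + 12 * ρ * N / √x := by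
    intro x hx
    have hx0 : 0 < √x := Real.sqrt_pos.2 (by linarith [hx.1])
    have hbd : ∀ t : ℝ, R ≤ t → HasDerivAt (fun t : ℝ => m' * (t - x) + 12 * ρ * N * (1 / √x - 1 / √t))
        (m' + 6 * ρ * N / √t ^ 3) t := by
      intro t ht
      have ht0 : 0 < t := by linarith
      have hst : √t ≠ 0 := (Real.sqrt_pos.2 ht0).ne'
      have h3 : HasDerivAt (fun t : ℝ => 1 / √t) _ t :=
        (hasDerivAt_const t (1 : ℝ)).div (Real.hasDerivAt_sqrt ht0.ne') hst
      refine ((((hasDerivAt_id t).sub_const x).const_mul m').add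
        ((h3.const_sub (1 / √x)).const_mul (12 * ρ * N))).congr_deriv ?_
      field_simp
      ring
    have := image_norm_le_of_norm_deriv_right_le_deriv_boundary' (a := x) (b := T)
      (f := fun t : ℝ => hq p w t - hq p w x) (f' := fun t : ℝ => hqd p w w' t)
      (B := fun t : ℝ => m' * (t - x) + 12 * ρ * N * (1 / √x - 1 / √t))
      (B' := fun t => m' + 6 * ρ * N / √t ^ 3)
      (fun t ht => ((hd t (hx.1.trans ht.1)).sub_const _).continuousAt.continuousWithinAt)
      (fun t ht => ((hd t (hx.1.trans ht.1)).sub_const _).hasDerivWithinAt)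
      (by simp)
      (fun t ht => (hbd t (hx.1.trans ht.1)).continuousAt.continuousWithinAt)
      (fun t ht => (hbd t (hx.1.trans ht.1)).hasDerivWithinAt)
      (fun t ht => A t ⟨hx.1.trans ht.1, ht.2.le⟩) (Set.right_mem_Icc.2 hx.2)
    rw [norm_sub_rev]
    refine this.trans ?_
    have e1 : m' * (T - x) ≤ T * m' := by nlinarith [hx.1]
    have e2 : 12 * ρ * N * (1 / √x - 1 / √T) ≤ 12 * ρ * N / √x := by
      rw [mul_sub, mul_one_div]
      have : 0 ≤ 12 * ρ * N * (1 / √T) := by positivity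
      linarith
    linarith
  have hNle : N ≤ 2 * (m + T * m') := by
    have hb := B x₁ hx₁
    have h3 : N ≤ ‖hq p w x₁ - hq p w T‖ + ‖hq p w T‖ := by
      rw [hN]; simpa using norm_add_le (hq p w x₁ - hq p w T) (hq p w T)
    have h4 : 12 * ρ * N / √x₁ ≤ N / 2 := by
      have : √R ≤ √x₁ := Real.sqrt_le_sqrt hx₁.1
      have hp : 0 < √x₁ := Real.sqrt_pos.2 (by linarith [hx₁.1])
      rw [div_le_iff₀ hp]
      nlinarith [mul_le_mul_of_nonneg_left (hR'.trans this) hN0]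
    linarith
  have hx0 : 0 < √x := Real.sqrt_pos.2 (by linarith [hx.1])
  refine ⟨(hle x hx).trans hNle, (A x hx).trans ?_, (B x hx).trans ?_⟩
  · have : 6 * ρ * N / √x ^ 3 ≤ 6 * ρ * (2 * (m + T * m')) / √x ^ 3 := by gcongr
    linarith [show 6 * ρ * (2 * (m + T * m')) / √x ^ 3 = 12 * ρ * (m + T * m') / √x ^ 3 by ring]
  · have : 12 * ρ * N / √x ≤ 12 * ρ * (2 * (m + T * m')) / √x := by gcongr
    linarith [show 12 * ρ * (2 * (m + T * m')) / √x = 24 * ρ * (m + T * m') / √x by ring]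

lemma norm_dir : ‖dir‖ = 1 := by rw [dir, norm_exp_ofReal_mul_I]

lemma dir_eq : dir = (1 / 2 : ℝ) - (√3 / 2 : ℝ) * I := by
  rw [dir, exp_mul_I, ← ofReal_cos, ← ofReal_sin, Real.cos_neg, Real.sin_neg, Real.cos_pi_div_three,
    Real.sin_pi_div_three]
  push_cast
  ring

lemma slant_estimate {p : ℂ × ℂ} {w w' : ℂ → ℂ} (hw : IsSol (pot p) w w') {M m m' : ℝ}
    (h1 : ‖p.1‖ ≤ M) (h2 : ‖p.2‖ ≤ M) {z : ℂ} (hz1 : 0 ≤ z.re) (hz2 : 0 ≤ z.im) (hR : 2 ≤ ‖z‖)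
    (hR' : 48 * (M + 2) ^ 2 ≤ √(‖z‖ / 2))
    (hm : ‖hq p w (z.re + z.im / √3 : ℝ)‖ ≤ m) (hm' : ‖hqd p w w' (z.re + z.im / √3 : ℝ)‖ ≤ m') :
    ‖hqd p w w' z‖ ≤ m' + 12 * (M + 2) ^ 2 * (m + 2 * ‖z‖ * m') / √(‖z‖ / 2) ^ 3 ∧
      ‖hq p w z - hq p w (z.re + z.im / √3 : ℝ)‖ ≤
        2 * ‖z‖ * m' + 48 * (M + 2) ^ 2 * (m + 2 * ‖z‖ * m') / √(‖z‖ / 2) := by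
  have hM : 0 ≤ M := (norm_nonneg _).trans h1
  have hm0 : 0 ≤ m := (norm_nonneg _).trans hm
  have hm'0 : 0 ≤ m' := (norm_nonneg _).trans hm'
  set ρ := (M + 2) ^ 2 with hρ
  set r := ‖z‖ with hr
  set σ := √(r / 2) with hσ
  have hσ0 : 0 < σ := Real.sqrt_pos.2 (by linarith)
  have hσ2 : σ ^ 2 = r / 2 := Real.sq_sqrt (by linarith)
  have h6 : 6 * (M + 2) ≤ σ := by nlinarith
  have h3 : 0 < √3 := by positivity
  have h33 : √3 ^ 2 = 3 := Real.sq_sqrt (by norm_num)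
  set L := 2 * z.im / √3 with hL
  have hL0 : 0 ≤ L := by positivity
  have hLe : √3 * L = 2 * z.im := by rw [hL]; field_simp
  have hre : ∀ t : ℝ, (z + t * dir).re = z.re + t / 2 := fun t => by
    rw [dir_eq]; simp; ring
  have him : ∀ t : ℝ, (z + t * dir).im = z.im - √3 / 2 * t := fun t => by
    rw [dir_eq]; simp; ring
  have hend : z + L * dir = (z.re + z.im / √3 : ℝ) := by
    apply Complex.ext
    · rw [hre, ofReal_re, hL]; field_simp
    · rw [him, ofReal_im]; nlinarith
  have hzsq : r ^ 2 = z.re ^ 2 + z.im ^ 2 := by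
    rw [hr, ← Complex.normSq_eq_norm_sq, Complex.normSq_apply]; ring
  have hr0 : 0 < r := by linarith
  have hnorm : ∀ t ∈ Set.Icc 0 L, r / 2 ≤ ‖z + t * dir‖ := by
    intro t ht
    refine abs_le_of_sq_le_sq' ?_ (norm_nonneg _) |>.2
    rw [← Complex.normSq_eq_norm_sq, Complex.normSq_apply, hre, him]
    nlinarith [mul_nonneg ht.1 hz1, sq_nonneg (t - √3 / 2 * z.im), sq_nonneg z.re]
  have hslit : ∀ t ∈ Set.Icc 0 L, z + t * dir ∈ slitPlane := fun t ht =>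
    mem_slitPlane_of_re (by rw [hre]; linarith [ht.1]) (norm_pos_iff.1 (by linarith [hnorm t ht]))
  have hpath : ∀ t : ℝ, HasDerivAt (fun t : ℝ => z + t * dir) dir t := fun t => by
    simpa using ((hasDerivAt_id t).ofReal_comp.mul_const dir).const_add z
  have hd : ∀ t ∈ Set.Icc 0 L, HasDerivAt (fun t : ℝ => hq p w (z + t * dir))
      (hqd p w w' (z + t * dir) * dir) t := fun t ht => by
    have h := (hasDerivAt_div_wkb hw (hslit t ht)).comp t (hpath t)
    exact h
  obtain ⟨x₁, hx₁, hmax⟩ := isCompact_Icc.exists_isMaxOn (Set.nonempty_Icc.2 hL0)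
    (f := fun t : ℝ => ‖hq p w (z + t * dir)‖)
    fun t ht => (hd t ht).continuousAt.norm.continuousWithinAt
  set N := ‖hq p w (z + x₁ * dir)‖ with hN
  have hN0 : 0 ≤ N := norm_nonneg _
  have hle : ∀ t ∈ Set.Icc 0 L, ‖hq p w (z + t * dir)‖ ≤ N := fun t ht => hmax ht
  have A : ∀ x ∈ Set.Icc 0 L, ‖hqd p w w' (z + x * dir)‖ ≤ m' + 6 * ρ * N / σ ^ 3 := by
    intro x hx
    have hsub : ∀ t ∈ Set.Icc x L, t ∈ Set.Icc 0 L := fun t ht => ⟨hx.1.trans ht.1, ht.2⟩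
    have := hqd_segment hw h1 h2 (z := z) (e := dir) norm_dir (t₀ := x) (T := L) (κ := σ ^ 3 / 6)
      (N := N) hx.2 (by positivity) hN0
      (fun t ht => hslit t (hsub t ht))
      (fun t ht => by linarith [hnorm t (hsub t ht)])
      (fun t ht => by
        have hn := hnorm t (hsub t ht)
        have hs := Real.sqrt_le_sqrt hn
        have h4 : σ ^ 3 / 6 ≤ √‖z + t * dir‖ ^ 3 / 6 := by gcongr
        refine h4.trans (growth_rate h1 (by linarith) norm_dir (dir_rt (by linarith) ?_ ?_)
          (h6.trans hs))
        · rw [hre]; linarith [hx.1, ht.1]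
        · rw [him]; nlinarith [ht.2])
      (fun t ht => hle t (hsub t ht))
    refine this.trans ?_
    rw [hend, show (M + 2) ^ 2 * N / (σ ^ 3 / 6) = 6 * ρ * N / σ ^ 3 by rw [hρ]; field_simp]
    gcongr
  have hLr : L ≤ 2 * r := by
    have : z.im ≤ r := (le_abs_self _).trans (abs_im_le_norm z)
    have h1 : 1 ≤ √3 := Real.one_le_sqrt.2 (by norm_num)
    nlinarith
  have B : ∀ x ∈ Set.Icc 0 L, ‖hq p w (z + x * dir) - hq p w (z + L * dir)‖ ≤
      2 * r * m' + 24 * ρ * N / σ := by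
    intro x hx
    have := (convex_Icc (0 : ℝ) L).norm_image_sub_le_of_norm_hasDerivWithin_le
      (f := fun t : ℝ => hq p w (z + t * dir)) (f' := fun t => hqd p w w' (z + t * dir) * dir)
      (C := m' + 6 * ρ * N / σ ^ 3) (fun t ht => (hd t ht).hasDerivWithinAt)
      (fun t ht => by rw [norm_mul, norm_dir, mul_one]; exact A t ht)
      (Set.right_mem_Icc.2 hL0) hx
    refine this.trans ?_
    have hxl : ‖x - L‖ ≤ 2 * r := by
      rw [Real.norm_eq_abs, abs_le]; constructor <;> linarith [hx.1, hx.2]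
    calc _ ≤ (m' + 6 * ρ * N / σ ^ 3) * (2 * r) := by gcongr
      _ = 2 * r * m' + 12 * ρ * N * (2 * σ ^ 2) / σ ^ 3 := by rw [hσ2]; ring
      _ = _ := by field_simp; ring
  have hNle : N ≤ 2 * (m + 2 * r * m') := by
    have hb := B x₁ hx₁
    have h3 : N ≤ ‖hq p w (z + x₁ * dir) - hq p w (z + L * dir)‖ + ‖hq p w (z + L * dir)‖ := by
      rw [hN]; simpa using norm_add_le (hq p w (z + x₁ * dir) - hq p w (z + L * dir)) (hq p w (z + L * dir))
    have h4 : 24 * ρ * N / σ ≤ N / 2 := by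
      rw [div_le_iff₀ hσ0]
      nlinarith [mul_le_mul_of_nonneg_left hR' hN0]
    rw [hend] at h3 hb
    linarith
  have h00 : (0 : ℝ) ∈ Set.Icc 0 L := Set.left_mem_Icc.2 hL0
  have a0 := A 0 h00
  have b0 := B 0 h00
  rw [hend] at b0
  simp only [ofReal_zero, zero_mul, add_zero] at a0 b0
  refine ⟨a0.trans ?_, b0.trans ?_⟩
  · have : 6 * ρ * N / σ ^ 3 ≤ 6 * ρ * (2 * (m + 2 * r * m')) / σ ^ 3 := by gcongr
    linarith [show 6 * ρ * (2 * (m + 2 * r * m')) / σ ^ 3 = 12 * ρ * (m + 2 * r * m') / σ ^ 3 by ring]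
  · have : 24 * ρ * N / σ ≤ 24 * ρ * (2 * (m + 2 * r * m')) / σ := by gcongr
    linarith [show 24 * ρ * (2 * (m + 2 * r * m')) / σ = 48 * ρ * (m + 2 * r * m') / σ by ring]

/-- Coefficient vector of the potential `z³ - a z + λ`. -/
def qv (p : ℂ × ℂ) : Fin 4 → ℂ := ![p.2, -p.1, 0, 1]

lemma cubic_qv (p : ℂ × ℂ) : cubic (qv p) = pot p := by
  funext z
  simp [cubic, qv, pot]
  ring

lemma continuous_qv : Continuous qv := by
  refine continuous_pi fun i => ?_
  fin_cases i
  · exact continuous_snd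
  · exact continuous_fst.neg
  · exact continuous_const
  · exact continuous_const

lemma differentiable_qv : Differentiable ℂ qv := by
  refine differentiable_pi.2 fun i => ?_
  fin_cases i <;> simp [qv]

/-- Solution with given data at `0`. -/
noncomputable def fsol (p : ℂ × ℂ) (A B z : ℂ) : ℂ := A * sol (qv p) 1 0 z + B * sol (qv p) 0 1 z

/-- Derivative of `fsol`. -/
noncomputable def fsol' (p : ℂ × ℂ) (A B z : ℂ) : ℂ := A * dsol (qv p) 1 0 z + B * dsol (qv p) 0 1 z

lemma isSol_fsol (p : ℂ × ℂ) (A B : ℂ) : IsSol (pot p) (fsol p A B) (fsol' p A B) := by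
  have := (isSol_sol (qv p) 1 0).lin (isSol_sol (qv p) 0 1) A B
  rwa [cubic_qv] at this

lemma continuous_fsol_aux {X : Type*} [TopologicalSpace X] {p : X → ℂ × ℂ} {A B z : X → ℂ}
    (hp : Continuous p) (hA : Continuous A) (hB : Continuous B) (hz : Continuous z) :
    Continuous (fun x => fsol (p x) (A x) (B x) (z x)) ∧
      Continuous (fun x => fsol' (p x) (A x) (B x) (z x)) := by
  have h1 := continuous_sol_aux (continuous_qv.comp hp) (continuous_const (y := (1 : ℂ)))
    (continuous_const (y := (0 : ℂ))) hz
  have h2 := continuous_sol_aux (continuous_qv.comp hp) (continuous_const (y := (0 : ℂ)))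
    (continuous_const (y := (1 : ℂ))) hz
  exact ⟨(hA.mul h1.1).add (hB.mul h2.1), (hA.mul h1.2).add (hB.mul h2.2)⟩

lemma differentiable_fsol_aux {p : ℂ → ℂ × ℂ} {A B z : ℂ → ℂ}
    (hp : Differentiable ℂ p) (hA : Differentiable ℂ A) (hB : Differentiable ℂ B)
    (hz : Differentiable ℂ z) :
    Differentiable ℂ (fun x => fsol (p x) (A x) (B x) (z x)) ∧
      Differentiable ℂ (fun x => fsol' (p x) (A x) (B x) (z x)) := by
  have h1 := differentiable_sol_aux (differentiable_qv.comp hp) (differentiable_const (1 : ℂ))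
    (differentiable_const (0 : ℂ)) hz
  have h2 := differentiable_sol_aux (differentiable_qv.comp hp) (differentiable_const (0 : ℂ))
    (differentiable_const (1 : ℂ)) hz
  exact ⟨(hA.mul h1.1).add (hB.mul h2.1), (hA.mul h1.2).add (hB.mul h2.2)⟩

lemma fsol_zero (p : ℂ × ℂ) (A B : ℂ) : fsol p A B 0 = A := by simp [fsol, sol_zero]

lemma fsol'_zero (p : ℂ × ℂ) (A B : ℂ) : fsol' p A B 0 = B := by simp [fsol', dsol_zero]

lemma IsSol.eq_fsol {p : ℂ × ℂ} {w w' : ℂ → ℂ} (hw : IsSol (pot p) w w') :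
    w = fsol p (w 0) (w' 0) ∧ w' = fsol' p (w 0) (w' 0) := by
  rw [← cubic_qv] at hw
  constructor <;> funext z
  · rw [hw.eq_fund 0 z]; simp [fsol, sol_zero, dsol_zero]
  · rw [hw.eq_fund' 0 z]; simp [fsol', sol_zero, dsol_zero]

/-- Coefficient extraction at a point `x`: value at zero. -/
noncomputable def backA (p : ℂ × ℂ) (x u u' : ℂ) : ℂ :=
  u * dsol (qv p) 0 1 x - u' * sol (qv p) 0 1 x

/-- Coefficient extraction at a point `x`: derivative at zero. -/
noncomputable def backB (p : ℂ × ℂ) (x u u' : ℂ) : ℂ :=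
  sol (qv p) 1 0 x * u' - dsol (qv p) 1 0 x * u

lemma fsol_back (p : ℂ × ℂ) (x u u' : ℂ) : fsol p (backA p x u u') (backB p x u u') x = u ∧
    fsol' p (backA p x u u') (backB p x u u') x = u' := by
  have := IsSol.wr_fund (qv p) x
  constructor
  · simp only [fsol, backA, backB]; linear_combination u * this
  · simp only [fsol', backA, backB]; linear_combination u' * this

lemma back_fsol (p : ℂ × ℂ) (x A B : ℂ) : backA p x (fsol p A B x) (fsol' p A B x) = A ∧
    backB p x (fsol p A B x) (fsol' p A B x) = B := by
  have := IsSol.wr_fund (qv p) x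
  constructor
  · simp only [fsol, fsol', backA]; linear_combination A * this
  · simp only [fsol, fsol', backB]; linear_combination B * this

/-- Approximations of the subdominant solution: value at zero. -/
noncomputable def apA (n : ℕ) (p : ℂ × ℂ) : ℂ :=
  backA p (n + 1 : ℝ) (wkb p.1 (n + 1 : ℝ)) (wkbL p.1 (n + 1 : ℝ) * wkb p.1 (n + 1 : ℝ))

/-- Approximations of the subdominant solution: derivative at zero. -/
noncomputable def apB (n : ℕ) (p : ℂ × ℂ) : ℂ :=
  backB p (n + 1 : ℝ) (wkb p.1 (n + 1 : ℝ)) (wkbL p.1 (n + 1 : ℝ) * wkb p.1 (n + 1 : ℝ))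

lemma hq_ap (n : ℕ) (p : ℂ × ℂ) :
    hq p (fsol p (apA n p) (apB n p)) (n + 1 : ℝ) = 1 ∧
    hqd p (fsol p (apA n p) (apB n p)) (fsol' p (apA n p) (apB n p)) (n + 1 : ℝ) = 0 := by
  have := wkb_ne_zero p.1 (n + 1 : ℝ)
  obtain ⟨h1, h2⟩ := fsol_back p (n + 1 : ℝ) (wkb p.1 (n + 1 : ℝ))
    (wkbL p.1 (n + 1 : ℝ) * wkb p.1 (n + 1 : ℝ))
  simp only [hq, hqd, apA, apB] at *
  rw [h1, h2]
  exact ⟨div_self this, by simp⟩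

lemma hq_fsol_sub (p : ℂ × ℂ) (A B A' B' z : ℂ) :
    hq p (fsol p (A - A') (B - B')) z = hq p (fsol p A B) z - hq p (fsol p A' B') z ∧
    hqd p (fsol p (A - A') (B - B')) (fsol' p (A - A') (B - B')) z =
      hqd p (fsol p A B) (fsol' p A B) z - hqd p (fsol p A' B') (fsol' p A' B') z := by
  have := wkb_ne_zero p.1 z
  constructor
  · simp only [hq, fsol]; field_simp; ring
  · simp only [hqd, fsol, fsol']; field_simp; ring

/-- Estimates for the approximations on the real axis. -/
lemma ap_estimate {p : ℂ × ℂ} {M x : ℝ} (h1 : ‖p.1‖ ≤ M) (h2 : ‖p.2‖ ≤ M) {n : ℕ}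
    (hx1 : 1 ≤ x) (hx : 24 * (M + 2) ^ 2 ≤ √x) (hn : x ≤ n + 1) :
    ‖hq p (fsol p (apA n p) (apB n p)) x - 1‖ ≤ 24 * (M + 2) ^ 2 / √x ∧
    ‖hqd p (fsol p (apA n p) (apB n p)) (fsol' p (apA n p) (apB n p)) x‖ ≤
      12 * (M + 2) ^ 2 / √x ^ 3 := by
  obtain ⟨e1, e2⟩ := hq_ap n p
  have := ray_estimate (isSol_fsol p (apA n p) (apB n p)) (m := 1) (m' := 0) h1 h2 hx1 hx hn
    (by rw [e1]; simp) (by rw [e2]; simp) (x := x) ⟨le_rfl, hn⟩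
  rw [e1] at this
  simpa using this.2.symm

lemma ap_sub_estimate {p : ℂ × ℂ} {M R : ℝ} (h1 : ‖p.1‖ ≤ M) (h2 : ‖p.2‖ ≤ M) {n m : ℕ}
    (hR1 : 1 ≤ R) (hR : 24 * (M + 2) ^ 2 ≤ √R) (hn : R ≤ n + 1) (hnm : n ≤ m) :
    ‖hq p (fsol p (apA m p - apA n p) (apB m p - apB n p)) R‖ ≤ 72 * (M + 2) ^ 2 / √(n + 1) ∧
    ‖hqd p (fsol p (apA m p - apA n p) (apB m p - apB n p))
      (fsol' p (apA m p - apA n p) (apB m p - apB n p)) R‖ ≤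
      (12 * (M + 2) ^ 2 + 432 * (M + 2) ^ 4) / √(n + 1) := by
  have hM : 0 ≤ M := (norm_nonneg _).trans h1
  set τ : ℝ := n + 1 with hτ
  have hτ1 : 1 ≤ τ := hR1.trans hn
  have hs1 : 1 ≤ √τ := Real.one_le_sqrt.2 hτ1
  have hsq : √τ ^ 2 = τ := Real.sq_sqrt (by linarith)
  have hτm : τ ≤ m + 1 := by rw [hτ]; gcongr
  obtain ⟨a1, a2⟩ := ap_estimate h1 h2 hτ1 (hR.trans (Real.sqrt_le_sqrt hn)) hτm
  obtain ⟨e1, e2⟩ := hq_ap n p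
  obtain ⟨s1, s2⟩ := hq_fsol_sub p (apA m p) (apB m p) (apA n p) (apB n p) τ
  rw [hτ] at s1 s2
  rw [e1] at s1
  rw [e2, sub_zero] at s2
  rw [← hτ] at s1 s2
  have := ray_estimate (isSol_fsol p (apA m p - apA n p) (apB m p - apB n p)) h1 h2 hR1 hR hn
    (m := 24 * (M + 2) ^ 2 / √τ) (m' := 12 * (M + 2) ^ 2 / √τ ^ 3)
    (by rw [s1]; exact a1) (by rw [s2]; exact a2) (x := R) ⟨le_rfl, hn⟩
  set ρ := (M + 2) ^ 2 with hρ
  have hρ4 : (M + 2) ^ 4 = ρ ^ 2 := by rw [hρ]; ring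
  rw [hρ4]
  have hρ0 : 0 ≤ ρ := by positivity
  have k1 : 24 * ρ / √τ + τ * (12 * ρ / √τ ^ 3) = 36 * ρ / √τ := by
    nth_rewrite 2 [← hsq]; field_simp; ring
  rw [k1] at this
  refine ⟨this.1.trans (le_of_eq (by ring)), this.2.1.trans ?_⟩
  rw [add_div]
  have hR2 : 1 ≤ √R := Real.one_le_sqrt.2 hR1
  have := one_le_pow₀ hR2 (n := 3)
  refine add_le_add ?_ ((div_le_self (by positivity) this).trans (le_of_eq (by ring)))
  have := le_self_pow₀ hs1 (n := 3) (by norm_num)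
  gcongr

lemma continuous_back {X : Type*} [TopologicalSpace X] {p : X → ℂ × ℂ} {x u u' : X → ℂ}
    (hp : Continuous p) (hx : Continuous x) (hu : Continuous u) (hu' : Continuous u') :
    Continuous (fun y => backA (p y) (x y) (u y) (u' y)) ∧
      Continuous (fun y => backB (p y) (x y) (u y) (u' y)) := by
  have h1 := continuous_sol_aux (continuous_qv.comp hp) (continuous_const (y := (1 : ℂ)))
    (continuous_const (y := (0 : ℂ))) hx
  have h2 := continuous_sol_aux (continuous_qv.comp hp) (continuous_const (y := (0 : ℂ)))
    (continuous_const (y := (1 : ℂ))) hx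
  exact ⟨(hu.mul h2.2).sub (hu'.mul h2.1), (h1.1.mul hu').sub (h1.2.mul hu)⟩

lemma differentiable_back {p : ℂ → ℂ × ℂ} {x u u' : ℂ → ℂ}
    (hp : Differentiable ℂ p) (hx : Differentiable ℂ x) (hu : Differentiable ℂ u)
    (hu' : Differentiable ℂ u') :
    Differentiable ℂ (fun y => backA (p y) (x y) (u y) (u' y)) ∧
      Differentiable ℂ (fun y => backB (p y) (x y) (u y) (u' y)) := by
  have h1 := differentiable_sol_aux (differentiable_qv.comp hp) (differentiable_const (1 : ℂ))
    (differentiable_const (0 : ℂ)) hx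
  have h2 := differentiable_sol_aux (differentiable_qv.comp hp) (differentiable_const (0 : ℂ))
    (differentiable_const (1 : ℂ)) hx
  exact ⟨(hu.mul h2.2).sub (hu'.mul h2.1), (h1.1.mul hu').sub (h1.2.mul hu)⟩

lemma continuous_ap (n : ℕ) : Continuous (apA n) ∧ Continuous (apB n) := by
  have h : Continuous fun p : ℂ × ℂ => wkb p.1 (n + 1 : ℝ) := by unfold wkb; fun_prop
  have h' : Continuous fun p : ℂ × ℂ => wkbL p.1 (n + 1 : ℝ) := by
    unfold wkbL; simp only [div_eq_mul_inv]; fun_prop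
  exact continuous_back continuous_id continuous_const h (h'.mul h)

lemma differentiable_ap (n : ℕ) {p : ℂ → ℂ × ℂ} (hp : Differentiable ℂ p) :
    Differentiable ℂ (fun y => apA n (p y)) ∧ Differentiable ℂ (fun y => apB n (p y)) := by
  have h : Differentiable ℂ fun y => wkb (p y).1 (n + 1 : ℝ) := by unfold wkb; fun_prop
  have h' : Differentiable ℂ fun y => wkbL (p y).1 (n + 1 : ℝ) := by
    unfold wkbL; simp only [div_eq_mul_inv]; fun_prop
  exact differentiable_back hp (differentiable_const _) h (h'.mul h)

/-- Uniform Cauchy estimate on bounded parameter sets. -/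
lemma ap_cauchy (M : ℝ) : ∃ K N : ℝ, ∀ p : ℂ × ℂ, ‖p.1‖ ≤ M → ‖p.2‖ ≤ M → ∀ n m : ℕ, N ≤ n →
    n ≤ m → ‖apA m p - apA n p‖ ≤ K / √(n + 1) ∧ ‖apB m p - apB n p‖ ≤ K / √(n + 1) := by
  set ρ := (M + 2) ^ 2 with hρ
  set R := (24 * ρ) ^ 2 + 1 with hR
  have hρ0 : 0 ≤ ρ := by positivity
  have hR1 : 1 ≤ R := by rw [hR]; linarith [sq_nonneg (24 * ρ)]
  have hR2 : 24 * ρ ≤ √R := Real.le_sqrt_of_sq_le (by rw [hR]; linarith)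
  set F : ℂ × ℂ → ℝ := fun p => (‖wkb p.1 R‖ * (72 * ρ)) *
    (‖dsol (qv p) 0 1 R‖ + ‖dsol (qv p) 1 0 R‖) +
    (‖wkb p.1 R‖ * ((12 * ρ + 432 * (M + 2) ^ 4) + ‖wkbL p.1 R‖ * (72 * ρ))) *
      (‖sol (qv p) 0 1 R‖ + ‖sol (qv p) 1 0 R‖) with hF
  have hFc : Continuous F := by
    have h : Continuous fun p : ℂ × ℂ => wkb p.1 R := by unfold wkb; fun_prop
    have h' : Continuous fun p : ℂ × ℂ => wkbL p.1 R := by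
      unfold wkbL; simp only [div_eq_mul_inv]; fun_prop
    have h1 := continuous_sol_aux continuous_qv (continuous_const (y := (1 : ℂ)))
      (continuous_const (y := (0 : ℂ))) (continuous_const (y := (R : ℂ)))
    have h2 := continuous_sol_aux continuous_qv (continuous_const (y := (0 : ℂ)))
      (continuous_const (y := (1 : ℂ))) (continuous_const (y := (R : ℂ)))
    exact ((h.norm.mul continuous_const).mul (h2.2.norm.add h1.2.norm)).add
      ((h.norm.mul (continuous_const.add (h'.norm.mul continuous_const))).mul
        (h2.1.norm.add h1.1.norm))
  obtain ⟨K, hK⟩ := ((isCompact_closedBall (0 : ℂ) M).prod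
    (isCompact_closedBall (0 : ℂ) M)).bddAbove_image hFc.continuousOn
  refine ⟨K, R, fun p h1 h2 n m hn hnm => ?_⟩
  have hKp : F p ≤ K := hK ⟨p, ⟨by simpa using h1, by simpa using h2⟩, rfl⟩
  obtain ⟨b1, b2⟩ := ap_sub_estimate h1 h2 hR1 hR2 (by linarith) hnm
  obtain ⟨c1, c2⟩ := back_fsol p R (apA m p - apA n p) (apB m p - apB n p)
  set A := apA m p - apA n p
  set B := apB m p - apB n p
  have hw := wkb_ne_zero p.1 R
  have d1 : fsol p A B R = wkb p.1 R * hq p (fsol p A B) R := by rw [hq]; field_simp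
  have d2 : fsol' p A B R = wkb p.1 R * (hqd p (fsol p A B) (fsol' p A B) R
      + wkbL p.1 R * hq p (fsol p A B) R) := by rw [hq, hqd]; field_simp; ring
  have hs : 0 < √((n : ℝ) + 1) := by positivity
  set s := √((n : ℝ) + 1)
  have e1 : ‖fsol p A B R‖ ≤ ‖wkb p.1 R‖ * (72 * ρ / s) := by rw [d1, norm_mul]; gcongr
  have e2 : ‖fsol' p A B R‖ ≤
      ‖wkb p.1 R‖ * ((12 * ρ + 432 * (M + 2) ^ 4) / s + ‖wkbL p.1 R‖ * (72 * ρ / s)) := by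
    rw [d2, norm_mul]
    gcongr
    refine (norm_add_le _ _).trans ?_
    rw [norm_mul]
    gcongr
  have hle : F p / s ≤ K / s := by gcongr
  have hFe : F p / s = (‖wkb p.1 R‖ * (72 * ρ / s)) *
    (‖dsol (qv p) 0 1 R‖ + ‖dsol (qv p) 1 0 R‖) +
    (‖wkb p.1 R‖ * ((12 * ρ + 432 * (M + 2) ^ 4) / s + ‖wkbL p.1 R‖ * (72 * ρ / s))) *
      (‖sol (qv p) 0 1 R‖ + ‖sol (qv p) 1 0 R‖) := by
    rw [hF]; field_simp
  have g1 : ‖fsol p A B R‖ * (‖dsol (qv p) 0 1 R‖ + ‖dsol (qv p) 1 0 R‖) +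
      ‖fsol' p A B R‖ * (‖sol (qv p) 0 1 R‖ + ‖sol (qv p) 1 0 R‖) ≤ K / s := by
    refine le_trans ?_ hle
    rw [hFe]
    gcongr
  constructor
  · rw [← c1, backA]
    refine (norm_sub_le _ _).trans (le_trans ?_ g1)
    rw [norm_mul, norm_mul]
    gcongr <;> linarith [norm_nonneg (dsol (qv p) 1 0 R), norm_nonneg (sol (qv p) 1 0 R)]
  · rw [← c2, backB]
    refine (norm_sub_le _ _).trans (le_trans ?_ g1)
    rw [norm_mul, norm_mul, add_comm, mul_comm (‖dsol (qv p) 1 0 R‖), mul_comm (‖sol (qv p) 1 0 R‖)]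
    gcongr <;> linarith [norm_nonneg (dsol (qv p) 0 1 R), norm_nonneg (sol (qv p) 0 1 R)]

/-- Separate holomorphy is preserved under limits that are uniform on bounded sets. -/
lemma SepHol.of_limit {f : ℕ → ℂ × ℂ → ℂ} {g : ℂ × ℂ → ℂ}
    (hc : ∀ n, Continuous (f n))
    (hd : ∀ n (p : ℂ → ℂ × ℂ), Differentiable ℂ p → Differentiable ℂ fun y => f n (p y))
    (h : ∀ M : ℝ, ∃ K N : ℝ, ∀ p : ℂ × ℂ, ‖p.1‖ ≤ M → ‖p.2‖ ≤ M → ∀ n : ℕ, N ≤ n →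
      ‖g p - f n p‖ ≤ K / √(n + 1)) :
    SepHol (fun x y => g (x, y)) ∧
    ∀ p : ℂ → ℂ × ℂ, Differentiable ℂ p → Differentiable ℂ fun y => g (p y) := by
  have key : TendstoLocallyUniformly f g atTop := by
    rw [Metric.tendstoLocallyUniformly_iff]
    intro ε hε p₀
    obtain ⟨K, N, hK⟩ := h (‖p₀‖ + 1)
    have hs : Metric.ball p₀ 1 ∈ 𝓝 p₀ := Metric.ball_mem_nhds _ one_pos
    have hlim : Tendsto (fun n : ℕ => K / √((n : ℝ) + 1)) atTop (𝓝 0) :=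
      Tendsto.const_div_atTop (Real.tendsto_sqrt_atTop.comp
        (tendsto_atTop_add_const_right _ _ tendsto_natCast_atTop_atTop)) _
    refine ⟨_, hs, ?_⟩
    filter_upwards [hlim.eventually_lt_const hε,
      tendsto_natCast_atTop_atTop.eventually_ge_atTop N] with n hn1 hn2 p hp
    have hp' : ‖p‖ ≤ ‖p₀‖ + 1 := by
      have : ‖p - p₀‖ < 1 := by simpa [dist_eq_norm] using hp
      have h3 := norm_add_le p₀ (p - p₀)
      rw [add_sub_cancel] at h3
      linarith
    rw [dist_eq_norm]
    exact (hK p ((norm_fst_le p).trans hp') ((norm_snd_le p).trans hp') n hn2).trans_lt hn1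
  have hgc : Continuous g := key.continuous (Eventually.of_forall hc).frequently
  have hgd : ∀ p : ℂ → ℂ × ℂ, Differentiable ℂ p → Differentiable ℂ fun y => g (p y) := by
    intro p hp
    rw [← differentiableOn_univ]
    have h1 : TendstoLocallyUniformly (fun n y => f n (p y)) (fun y => g (p y)) atTop :=
      key.comp p hp.continuous
    exact (tendstoLocallyUniformlyOn_univ.2 h1).differentiableOn
      (Eventually.of_forall fun n => (hd n p hp).differentiableOn) isOpen_univ
  exact ⟨⟨by exact hgc, fun y => hgd (fun x => (x, y)) (by fun_prop),
    fun x => hgd (fun y => (x, y)) (by fun_prop)⟩, hgd⟩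

/-- Value at zero of the subdominant solution. -/
noncomputable def Y0A (p : ℂ × ℂ) : ℂ := limUnder atTop fun n => apA n p

/-- Derivative at zero of the subdominant solution. -/
noncomputable def Y0B (p : ℂ × ℂ) : ℂ := limUnder atTop fun n => apB n p

lemma tendsto_of_sqrt_cauchy {u : ℕ → ℂ} {K N : ℝ}
    (h : ∀ n m : ℕ, N ≤ n → n ≤ m → ‖u m - u n‖ ≤ K / √(n + 1)) :
    Tendsto u atTop (𝓝 (limUnder atTop u)) ∧
      ∀ n : ℕ, N ≤ n → ‖limUnder atTop u - u n‖ ≤ K / √(n + 1) := by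
  have hc : CauchySeq u := by
    have hlim : Tendsto (fun n : ℕ => K / √((n : ℝ) + 1)) atTop (𝓝 0) :=
      Tendsto.const_div_atTop (Real.tendsto_sqrt_atTop.comp
        (tendsto_atTop_add_const_right _ _ tendsto_natCast_atTop_atTop)) _
    rw [Metric.cauchySeq_iff']
    intro ε hε
    obtain ⟨n, hn1, hn2⟩ := ((hlim.eventually_lt_const hε).and
      (tendsto_natCast_atTop_atTop.eventually_ge_atTop N)).exists
    exact ⟨n, fun m hm => by rw [dist_eq_norm]; exact (h n m hn2 hm).trans_lt hn1⟩
  have ht := tendsto_nhds_limUnder (cauchySeq_tendsto_of_complete hc)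
  exact ⟨ht, fun n hn => le_of_tendsto (ht.sub_const _).norm
    ((eventually_ge_atTop n).mono fun m hm => h n m hn hm)⟩

lemma Y0_limit (p : ℂ × ℂ) : Tendsto (fun n => apA n p) atTop (𝓝 (Y0A p)) ∧
    Tendsto (fun n => apB n p) atTop (𝓝 (Y0B p)) := by
  obtain ⟨K, N, h⟩ := ap_cauchy ‖p‖
  exact ⟨(tendsto_of_sqrt_cauchy fun n m hn hm =>
      (h p (norm_fst_le p) (norm_snd_le p) n m hn hm).1).1,
    (tendsto_of_sqrt_cauchy fun n m hn hm =>
      (h p (norm_fst_le p) (norm_snd_le p) n m hn hm).2).1⟩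

lemma sepHol_Y0A : SepHol (fun x y => Y0A (x, y)) ∧
    ∀ p : ℂ → ℂ × ℂ, Differentiable ℂ p → Differentiable ℂ fun y => Y0A (p y) :=
  SepHol.of_limit (fun n => (continuous_ap n).1) (fun n _ hp => (differentiable_ap n hp).1) fun M => by
    obtain ⟨K, N, h⟩ := ap_cauchy M
    exact ⟨K, N, fun p h1 h2 => (tendsto_of_sqrt_cauchy fun n m hn hm => (h p h1 h2 n m hn hm).1).2⟩

lemma sepHol_Y0B : SepHol (fun x y => Y0B (x, y)) ∧
    ∀ p : ℂ → ℂ × ℂ, Differentiable ℂ p → Differentiable ℂ fun y => Y0B (p y) :=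
  SepHol.of_limit (fun n => (continuous_ap n).2) (fun n _ hp => (differentiable_ap n hp).2) fun M => by
    obtain ⟨K, N, h⟩ := ap_cauchy M
    exact ⟨K, N, fun p h1 h2 => (tendsto_of_sqrt_cauchy fun n m hn hm => (h p h1 h2 n m hn hm).2).2⟩

/-- The solution subdominant on the positive real axis. -/
noncomputable def Y0 (p : ℂ × ℂ) (z : ℂ) : ℂ := fsol p (Y0A p) (Y0B p) z

/-- The derivative of `Y0`. -/
noncomputable def Y0' (p : ℂ × ℂ) (z : ℂ) : ℂ := fsol' p (Y0A p) (Y0B p) z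

lemma isSol_Y0 (p : ℂ × ℂ) : IsSol (pot p) (Y0 p) (Y0' p) := isSol_fsol _ _ _

lemma continuous_Y0A : Continuous Y0A := sepHol_Y0A.1.cont
lemma continuous_Y0B : Continuous Y0B := sepHol_Y0B.1.cont

lemma continuous_Y0 {X : Type*} [TopologicalSpace X] {p : X → ℂ × ℂ} {z : X → ℂ}
    (hp : Continuous p) (hz : Continuous z) :
    Continuous (fun x => Y0 (p x) (z x)) ∧ Continuous (fun x => Y0' (p x) (z x)) :=
  continuous_fsol_aux hp (continuous_Y0A.comp hp) (continuous_Y0B.comp hp) hz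

lemma differentiable_Y0 {p : ℂ → ℂ × ℂ} {z : ℂ → ℂ} (hp : Differentiable ℂ p)
    (hz : Differentiable ℂ z) :
    Differentiable ℂ (fun x => Y0 (p x) (z x)) ∧ Differentiable ℂ (fun x => Y0' (p x) (z x)) :=
  differentiable_fsol_aux hp (sepHol_Y0A.2 p hp) (sepHol_Y0B.2 p hp) hz

lemma Y0_tendsto (p : ℂ × ℂ) (z : ℂ) :
    Tendsto (fun n => hq p (fsol p (apA n p) (apB n p)) z) atTop (𝓝 (hq p (Y0 p) z)) ∧
    Tendsto (fun n => hqd p (fsol p (apA n p) (apB n p)) (fsol' p (apA n p) (apB n p)) z) atTop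
      (𝓝 (hqd p (Y0 p) (Y0' p) z)) := by
  obtain ⟨h1, h2⟩ := Y0_limit p
  have e1 : Tendsto (fun n => fsol p (apA n p) (apB n p) z) atTop (𝓝 (Y0 p z)) :=
    (h1.mul_const _).add (h2.mul_const _)
  have e2 : Tendsto (fun n => fsol' p (apA n p) (apB n p) z) atTop (𝓝 (Y0' p z)) :=
    (h1.mul_const _).add (h2.mul_const _)
  exact ⟨e1.div_const _, (e2.sub (e1.const_mul _)).div_const _⟩

lemma Y0_real_estimate {p : ℂ × ℂ} {M x : ℝ} (h1 : ‖p.1‖ ≤ M) (h2 : ‖p.2‖ ≤ M)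
    (hx1 : 1 ≤ x) (hx : 24 * (M + 2) ^ 2 ≤ √x) :
    ‖hq p (Y0 p) x - 1‖ ≤ 24 * (M + 2) ^ 2 / √x ∧
    ‖hqd p (Y0 p) (Y0' p) x‖ ≤ 12 * (M + 2) ^ 2 / √x ^ 3 := by
  obtain ⟨t1, t2⟩ := Y0_tendsto p x
  have hev : ∀ᶠ n : ℕ in atTop, x ≤ n + 1 :=
    (tendsto_atTop_add_const_right _ _ tendsto_natCast_atTop_atTop).eventually_ge_atTop x
  exact ⟨le_of_tendsto (t1.sub_const _).norm (hev.mono fun n hn => (ap_estimate h1 h2 hx1 hx hn).1),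
    le_of_tendsto t2.norm (hev.mono fun n hn => (ap_estimate h1 h2 hx1 hx hn).2)⟩

lemma Y0_upper_estimate {p : ℂ × ℂ} {M : ℝ} (h1 : ‖p.1‖ ≤ M) (h2 : ‖p.2‖ ≤ M) {z : ℂ}
    (hz1 : 0 ≤ z.re) (hz2 : 0 ≤ z.im) (hR : 2 ≤ ‖z‖) (hR' : 48 * (M + 2) ^ 2 ≤ √(‖z‖ / 2)) :
    ‖hq p (Y0 p) z - 1‖ ≤ 216 * (M + 2) ^ 2 / √(‖z‖ / 2) ∧
    ‖hqd p (Y0 p) (Y0' p) z‖ ≤ 48 * (M + 2) ^ 2 / √(‖z‖ / 2) ^ 3 := by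
  set ρ := (M + 2) ^ 2 with hρ
  have hρ0 : 0 ≤ ρ := by positivity
  set r := ‖z‖ with hr
  set σ := √(r / 2) with hσ
  have hσ1 : 1 ≤ σ := Real.one_le_sqrt.2 (by linarith)
  have hσ2 : σ ^ 2 = r / 2 := Real.sq_sqrt (by linarith)
  set x := z.re + z.im / √3 with hx
  have h33 : √3 ^ 2 = 3 := Real.sq_sqrt (by norm_num)
  have hxr : r / 2 ≤ x := by
    have hzsq : r ^ 2 = z.re ^ 2 + z.im ^ 2 := by
      rw [hr, ← Complex.normSq_eq_norm_sq, Complex.normSq_apply]; ring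
    have : (r / 2) ^ 2 ≤ x ^ 2 := by
      have h4 : x ^ 2 = z.re ^ 2 + 2 * (z.re * (z.im / √3)) + z.im ^ 2 / 3 := by
        rw [hx, add_sq, div_pow, h33]; ring
      have h5 : 0 ≤ z.re * (z.im / √3) := by positivity
      rw [h4]
      nlinarith [sq_nonneg z.re, sq_nonneg z.im]
    exact (abs_le_of_sq_le_sq' this (by positivity)).2
  have hsx : σ ≤ √x := Real.sqrt_le_sqrt hxr
  obtain ⟨a1, a2⟩ := Y0_real_estimate h1 h2 (x := x) (by linarith) (by linarith)
  have hσ0 : 0 < σ := by linarith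
  have b1 : ‖hq p (Y0 p) x - 1‖ ≤ 24 * ρ / σ := a1.trans (by gcongr)
  have b2 : ‖hqd p (Y0 p) (Y0' p) x‖ ≤ 12 * ρ / σ ^ 3 := a2.trans (by gcongr)
  have b3 : ‖hq p (Y0 p) x‖ ≤ 2 := by
    have h5 : 24 * ρ / σ ≤ 1 := by rw [div_le_one hσ0]; linarith
    have := norm_add_le (hq p (Y0 p) x - 1) 1
    rw [sub_add_cancel, norm_one] at this
    linarith
  obtain ⟨c1, c2⟩ := slant_estimate (isSol_Y0 p) h1 h2 hz1 hz2 hR hR' b3 b2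
  rw [← hr, ← hσ, ← hρ] at c1 c2
  have e1 : 2 * r * (12 * ρ / σ ^ 3) = 48 * ρ / σ := by
    rw [show r = 2 * σ ^ 2 by linarith]; field_simp; ring
  have e2 : 48 * ρ / σ ≤ 1 := by rw [div_le_one hσ0]; linarith
  rw [e1] at c1 c2
  constructor
  · have e3 : 48 * ρ * (2 + 48 * ρ / σ) / σ ≤ 48 * ρ * 3 / σ := by gcongr; linarith
    have e4 : ‖hq p (Y0 p) z - 1‖ ≤ ‖hq p (Y0 p) z - hq p (Y0 p) x‖ + ‖hq p (Y0 p) x - 1‖ :=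
      norm_sub_le_norm_sub_add_norm_sub _ _ _
    have e5 : 216 * ρ / σ = 48 * ρ / σ + 48 * ρ * 3 / σ + 24 * ρ / σ := by ring
    rw [e5]
    linarith
  · refine c1.trans ?_
    have e3 : 12 * ρ * (2 + 48 * ρ / σ) / σ ^ 3 ≤ 12 * ρ * 3 / σ ^ 3 := by gcongr; linarith
    have e5 : 48 * ρ / σ ^ 3 = 12 * ρ / σ ^ 3 + 12 * ρ * 3 / σ ^ 3 := by ring
    rw [e5]
    linarith

lemma pot_conj (p : ℂ × ℂ) (z : ℂ) : conj (pot p (conj z)) = pot (conj p.1, conj p.2) z := by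
  simp [pot]

lemma IsSol.conj {p : ℂ × ℂ} {w w' : ℂ → ℂ} (hw : IsSol (pot p) w w') :
    IsSol (pot (conj p.1, conj p.2)) (fun z => conj (w (conj z))) (fun z => conj (w' (conj z))) := by
  refine ⟨fun z => ?_, fun z => ?_⟩
  · have := (hw.d1 (conj z)).conj_conj
    simpa [Function.comp_def] using this
  · have := (hw.d2 (conj z)).conj_conj
    simpa [Function.comp_def, pot_conj] using this

lemma fsol_conj (p : ℂ × ℂ) (A B z : ℂ) :
    conj (fsol p A B (conj z)) = fsol (conj p.1, conj p.2) (conj A) (conj B) z ∧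
    conj (fsol' p A B (conj z)) = fsol' (conj p.1, conj p.2) (conj A) (conj B) z := by
  have h := (isSol_fsol p A B).conj.eq_fsol
  simp only [map_zero, fsol_zero, fsol'_zero] at h
  exact ⟨congrFun h.1 z, congrFun h.2 z⟩

lemma wkb_conj (a : ℂ) {z : ℂ} (hz : z ∈ slitPlane) :
    wkb (conj a) (conj z) = conj (wkb a z) ∧ wkbL (conj a) (conj z) = conj (wkbL a z) := by
  have h1 : log (conj z) = conj (log z) := log_conj z (slitPlane_arg_ne_pi hz)
  have h2 : rt (conj z) = conj (rt z) := by rw [rt, rt, h1, ← exp_conj]; simp [map_ofNat]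
  constructor
  · rw [wkb, wkb, h1, h2, ← exp_conj]; simp [map_ofNat]
  · rw [wkbL, wkbL, h2]; simp [map_ofNat]

lemma sol_qv_conj (p : ℂ × ℂ) (z : ℂ) :
    (sol (qv (conj p.1, conj p.2)) 1 0 (conj z) = conj (sol (qv p) 1 0 z) ∧
    dsol (qv (conj p.1, conj p.2)) 1 0 (conj z) = conj (dsol (qv p) 1 0 z)) ∧
    sol (qv (conj p.1, conj p.2)) 0 1 (conj z) = conj (sol (qv p) 0 1 z) ∧
    dsol (qv (conj p.1, conj p.2)) 0 1 (conj z) = conj (dsol (qv p) 0 1 z) := by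
  have h1 := fsol_conj p 1 0 (conj z)
  have h2 := fsol_conj p 0 1 (conj z)
  simp only [fsol, fsol', conj_conj, map_one, map_zero, zero_mul, one_mul, add_zero, zero_add] at h1 h2
  exact ⟨⟨h1.1.symm, h1.2.symm⟩, h2.1.symm, h2.2.symm⟩

lemma ap_conj (n : ℕ) (p : ℂ × ℂ) : apA n (conj p.1, conj p.2) = conj (apA n p) ∧
    apB n (conj p.1, conj p.2) = conj (apB n p) := by
  have hx : ((n + 1 : ℝ) : ℂ) ∈ slitPlane := ofReal_mem_slitPlane.2 (by positivity)
  obtain ⟨w1, w2⟩ := wkb_conj p.1 hx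
  obtain ⟨⟨h1, h2⟩, h3, h4⟩ := sol_qv_conj p ((n + 1 : ℝ) : ℂ)
  rw [conj_ofReal] at *
  constructor
  · simp only [apA, backA, map_sub, map_mul, w1, w2, h3, h4]
  · simp only [apB, backB, map_sub, map_mul, w1, w2, h1, h2]

lemma Y0A_conj (p : ℂ × ℂ) : Y0A (conj p.1, conj p.2) = conj (Y0A p) ∧
    Y0B (conj p.1, conj p.2) = conj (Y0B p) := by
  have h1 := Y0_limit p
  have h2 := Y0_limit (conj p.1, conj p.2)
  constructor
  · exact tendsto_nhds_unique h2.1 (((continuous_conj.tendsto _).comp h1.1).congr fun n =>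
      (ap_conj n p).1.symm)
  · exact tendsto_nhds_unique h2.2 (((continuous_conj.tendsto _).comp h1.2).congr fun n =>
      (ap_conj n p).2.symm)

lemma Y0_conj (p : ℂ × ℂ) (z : ℂ) : Y0 (conj p.1, conj p.2) (conj z) = conj (Y0 p z) ∧
    Y0' (conj p.1, conj p.2) (conj z) = conj (Y0' p z) := by
  have := fsol_conj p (Y0A p) (Y0B p) (conj z)
  simp only [conj_conj] at this
  rw [Y0, Y0', (Y0A_conj p).1, (Y0A_conj p).2]
  exact ⟨this.1.symm, this.2.symm⟩

/-- Asymptotics of the subdominant solution in the right half plane. -/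
theorem Y0_asymp (M : ℝ) : ∃ R K : ℝ, 1 ≤ R ∧ 0 ≤ K ∧ ∀ p : ℂ × ℂ, ‖p.1‖ ≤ M → ‖p.2‖ ≤ M →
    ∀ z : ℂ, 0 ≤ z.re → R ≤ ‖z‖ →
      ‖hq p (Y0 p) z - 1‖ ≤ K / √‖z‖ ∧ ‖hqd p (Y0 p) (Y0' p) z‖ ≤ K / √‖z‖ ^ 3 := by
  set ρ := (M + 2) ^ 2 with hρ
  have hρ0 : 0 ≤ ρ := by positivity
  refine ⟨2 * (48 * ρ) ^ 2 + 2, 432 * ρ, by nlinarith [sq_nonneg (48 * ρ)], by positivity, ?_⟩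
  have main : ∀ p : ℂ × ℂ, ‖p.1‖ ≤ M → ‖p.2‖ ≤ M → ∀ z : ℂ, 0 ≤ z.re → 0 ≤ z.im →
      2 * (48 * ρ) ^ 2 + 2 ≤ ‖z‖ →
      ‖hq p (Y0 p) z - 1‖ ≤ 432 * ρ / √‖z‖ ∧ ‖hqd p (Y0 p) (Y0' p) z‖ ≤ 432 * ρ / √‖z‖ ^ 3 := by
    intro p h1 h2 z hz1 hz2 hR
    have hpos : 0 < ‖z‖ := by linarith [sq_nonneg (48 * ρ)]
    have hs : 0 < √‖z‖ := Real.sqrt_pos.2 hpos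
    have hss : √‖z‖ ≤ 2 * √(‖z‖ / 2) := by
      rw [Real.sqrt_le_left (by positivity), mul_pow, Real.sq_sqrt (by positivity)]
      linarith
    have hs2 : 0 < √(‖z‖ / 2) := by positivity
    obtain ⟨a, b⟩ := Y0_upper_estimate h1 h2 hz1 hz2 (by linarith [sq_nonneg (48 * ρ)])
      (Real.le_sqrt_of_sq_le (by linarith))
    refine ⟨a.trans ?_, b.trans ?_⟩
    · rw [div_le_div_iff₀ hs2 hs]
      nlinarith
    · rw [div_le_div_iff₀ (by positivity) (by positivity)]
      have : √‖z‖ ^ 3 ≤ (2 * √(‖z‖ / 2)) ^ 3 := by gcongr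
      rw [mul_pow] at this
      nlinarith [pow_pos hs2 3]
  intro p h1 h2 z hz1 hR
  rcases le_total 0 z.im with h | h
  · exact main p h1 h2 z hz1 h hR
  · have hz : z ∈ slitPlane := mem_slitPlane_of_re hz1
      (norm_pos_iff.1 (by linarith [sq_nonneg (48 * ρ)]))
    have := main (conj p.1, conj p.2) (by simpa using h1) (by simpa using h2) (conj z) (by simpa)
      (by simpa using h) (by simpa using hR)
    simp only [hq, hqd, (Y0_conj p z).1, (Y0_conj p z).2, (wkb_conj p.1 hz).1, (wkb_conj p.1 hz).2,
      ← map_mul, ← map_sub, ← map_div₀, norm_conj] at this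
    rw [← norm_conj (_ - 1)]
    simpa [hq, hqd] using this

/-- The primitive fifth root of unity `e^{2πi/5}`. -/
noncomputable def om : ℂ := exp ((2 * Real.pi / 5 : ℝ) * I)

/-- `e^{-iπ/5}`. -/
noncomputable def om10 : ℂ := exp ((-(Real.pi / 5) : ℝ) * I)

/-- `e^{3πi/10}`. -/
noncomputable def ph : ℂ := exp ((3 * Real.pi / 10 : ℝ) * I)

lemma norm_om : ‖om‖ = 1 := norm_exp_ofReal_mul_I _
lemma norm_ph : ‖ph‖ = 1 := norm_exp_ofReal_mul_I _

lemma om_pow_five : om ^ 5 = 1 := by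
  rw [om, ← exp_nat_mul, ← exp_two_pi_mul_I]
  congr 1; push_cast; ring

lemma om10_pow_five : om10 ^ 5 = -1 := by
  rw [om10, ← exp_nat_mul, ← exp_neg_pi_mul_I]
  congr 1; push_cast; ring

lemma om_ne_zero : om ≠ 0 := exp_ne_zero _
lemma ph_ne_zero : ph ≠ 0 := exp_ne_zero _
lemma om10_ne_zero : om10 ≠ 0 := exp_ne_zero _

lemma om_pow_four : om ^ 4 = om10 ^ 2 := by
  have : om * om10 ^ 2 = 1 := by
    rw [om, om10, ← exp_nat_mul, ← exp_add, ← exp_zero]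
    congr 1; push_cast; ring
  have h5 := om_pow_five
  have h0 := om_ne_zero
  apply mul_left_cancel₀ h0
  rw [this, ← h5]; ring

lemma om_pow_three : om ^ 3 = om10 ^ 4 := by
  have h5 := om_pow_five
  have h4 := om_pow_four
  calc om ^ 3 = om ^ 5 * om ^ 3 := by rw [h5, one_mul]
    _ = (om ^ 4) ^ 2 := by ring
    _ = _ := by rw [h4]; ring

lemma conj_om : conj om = om ^ 4 := by
  have h5 := om_pow_five
  have : om * conj om = 1 := by
    rw [mul_conj, normSq_eq_norm_sq, norm_om]; simp
  apply mul_left_cancel₀ om_ne_zero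
  rw [this, ← h5]; ring

lemma conj_ph : conj ph = ph⁻¹ := by
  rw [← Complex.inv_eq_conj norm_ph]

/-- Action of the rotation on parameters. -/
noncomputable def rotp (j : ℕ) (p : ℂ × ℂ) : ℂ × ℂ := (om ^ (3 * j) * p.1, om ^ (2 * j) * p.2)

lemma rotp_rotp (j k : ℕ) (p : ℂ × ℂ) : rotp j (rotp k p) = rotp (j + k) p := by
  simp only [rotp, Prod.mk.injEq]; constructor <;> ring

lemma om_pow_five_mul (k : ℕ) : om ^ (5 * k) = 1 := by rw [pow_mul, om_pow_five, one_pow]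

lemma rotp_five (p : ℂ × ℂ) : rotp 5 p = p := by
  have h1 := om_pow_five_mul 3
  have h2 := om_pow_five_mul 2
  simp only [rotp] at *
  simp only [Nat.reduceMul] at *
  rw [h1, h2]; simp

lemma norm_rotp (j : ℕ) (p : ℂ × ℂ) : ‖(rotp j p).1‖ = ‖p.1‖ ∧ ‖(rotp j p).2‖ = ‖p.2‖ := by
  simp [rotp, norm_om]

/-- The rotated subdominant solutions. -/
noncomputable def Z (j : ℕ) (p : ℂ × ℂ) (z : ℂ) : ℂ := Y0 (rotp j p) (om ^ (4 * j) * z)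

/-- Derivatives of the rotated subdominant solutions. -/
noncomputable def Z' (j : ℕ) (p : ℂ × ℂ) (z : ℂ) : ℂ :=
  om ^ (4 * j) * Y0' (rotp j p) (om ^ (4 * j) * z)

lemma Z_zero (p : ℂ × ℂ) : Z 0 p = Y0 p ∧ Z' 0 p = Y0' p := by
  constructor <;> funext z <;> simp [Z, Z', rotp]

lemma Z_rot (j k : ℕ) (p : ℂ × ℂ) (z : ℂ) : Z j (rotp k p) (om ^ (4 * k) * z) = Z (j + k) p z ∧
    om ^ (4 * k) * Z' j (rotp k p) (om ^ (4 * k) * z) = Z' (j + k) p z := by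
  have : om ^ (4 * j) * (om ^ (4 * k) * z) = om ^ (4 * (j + k)) * z := by ring
  simp only [Z, Z', rotp_rotp, this]
  exact ⟨trivial, by ring⟩

lemma Z_add_five (j : ℕ) (p : ℂ × ℂ) : Z (j + 5) p = Z j p ∧ Z' (j + 5) p = Z' j p := by
  have h : om ^ (4 * 5) = 1 := om_pow_five_mul 4
  constructor <;> funext z
  · rw [← (Z_rot j 5 p z).1, rotp_five, h, one_mul]
  · rw [← (Z_rot j 5 p z).2, rotp_five, h, one_mul, one_mul]

lemma isSol_Z (j : ℕ) (p : ℂ × ℂ) : IsSol (pot p) (Z j p) (Z' j p) := by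
  set η := om ^ (4 * j) with hη
  have hd : ∀ z : ℂ, HasDerivAt (fun z => η * z) η z := fun z => by
    simpa using (hasDerivAt_id z).const_mul η
  refine ⟨fun z => ?_, fun z => ?_⟩
  · have := ((isSol_Y0 (rotp j p)).d1 (η * z)).comp z (hd z)
    rw [mul_comm] at this
    exact this
  · have := (((isSol_Y0 (rotp j p)).d2 (η * z)).comp z (hd z)).const_mul η
    refine this.congr_deriv ?_
    have h1 : η ^ 5 = 1 := by rw [hη, ← pow_mul]; rw [show 4 * j * 5 = 5 * (4 * j) by ring, om_pow_five_mul]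
    have h2 : η ^ 3 * om ^ (3 * j) = 1 := by
      rw [hη, ← pow_mul, ← pow_add, show 4 * j * 3 + 3 * j = 5 * (3 * j) by ring, om_pow_five_mul]
    have h3 : η ^ 2 * om ^ (2 * j) = 1 := by
      rw [hη, ← pow_mul, ← pow_add, show 4 * j * 2 + 2 * j = 5 * (2 * j) by ring, om_pow_five_mul]
    have : η ^ 2 * pot (rotp j p) (η * z) = pot p z := by
      simp only [pot, rotp]
      linear_combination z ^ 3 * h1 - p.1 * z * h2 + p.2 * h3
    rw [← this, Z]
    ring

lemma continuous_rotp (j : ℕ) : Continuous (rotp j) := by unfold rotp; fun_prop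

lemma differentiable_rotp (j : ℕ) : Differentiable ℂ (rotp j) := by unfold rotp; fun_prop

lemma continuous_Z (j : ℕ) {X : Type*} [TopologicalSpace X] {p : X → ℂ × ℂ} {z : X → ℂ}
    (hp : Continuous p) (hz : Continuous z) :
    Continuous (fun x => Z j (p x) (z x)) ∧ Continuous (fun x => Z' j (p x) (z x)) := by
  have := continuous_Y0 ((continuous_rotp j).comp hp) (hz.const_mul (om ^ (4 * j)))
  exact ⟨this.1, continuous_const.mul this.2⟩

lemma differentiable_Z (j : ℕ) {p : ℂ → ℂ × ℂ} {z : ℂ → ℂ} (hp : Differentiable ℂ p)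
    (hz : Differentiable ℂ z) :
    Differentiable ℂ (fun x => Z j (p x) (z x)) ∧ Differentiable ℂ (fun x => Z' j (p x) (z x)) := by
  have := differentiable_Y0 ((differentiable_rotp j).comp hp) (hz.const_mul (om ^ (4 * j)))
  exact ⟨this.1, this.2.const_mul _⟩

/-- Conjugation of parameters. -/
noncomputable def cj (p : ℂ × ℂ) : ℂ × ℂ := (conj p.1, conj p.2)

lemma Z_conj {j k : ℕ} (hjk : j + k = 5) (p : ℂ × ℂ) (z : ℂ) :
    Z j (cj p) (conj z) = conj (Z k p z) ∧ Z' j (cj p) (conj z) = conj (Z' k p z) := by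
  have e : ∀ m, om ^ (m * j) = conj (om ^ (m * k)) := fun m => by
    have h1 : om ^ (m * j) * om ^ (m * k) = 1 := by
      rw [← pow_add, ← mul_add, hjk, mul_comm, om_pow_five_mul]
    have h2 : conj (om ^ (m * k)) * om ^ (m * k) = 1 := by
      rw [mul_comm, mul_conj, normSq_eq_norm_sq, norm_pow, norm_om]; simp
    exact mul_right_cancel₀ (pow_ne_zero _ om_ne_zero) (h1.trans h2.symm)
  have hr : rotp j (cj p) = (conj (rotp k p).1, conj (rotp k p).2) := by
    simp only [rotp, cj, e, map_mul]
  have hz : om ^ (4 * j) * conj z = conj (om ^ (4 * k) * z) := by rw [e, map_mul]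
  obtain ⟨h1, h2⟩ := Y0_conj (rotp k p) (om ^ (4 * k) * z)
  rw [Z, Z', hr, hz, h1, h2, e, ← map_mul]
  exact ⟨rfl, rfl⟩

/-- The growing WKB approximation. -/
noncomputable def wkbp (a z : ℂ) : ℂ := exp (2 / 5 * rt z ^ 5 - a * rt z - 3 / 4 * log z)

/-- Logarithmic derivative of `wkbp`. -/
noncomputable def wkbpL (a z : ℂ) : ℂ := rt z ^ 3 - a / (2 * rt z) - 3 / (4 * rt z ^ 2)

lemma wkbp_ne_zero (a z : ℂ) : wkbp a z ≠ 0 := exp_ne_zero _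

lemma wkb_mul_wkbp {a z : ℂ} : wkb a z * wkbp a z * rt z ^ 3 = 1 := by
  have : rt z ^ 3 = exp (3 / 2 * log z) := by
    rw [rt, ← exp_nat_mul]; congr 1; push_cast; ring
  rw [this, wkb, wkbp, ← exp_add, ← exp_add, ← exp_zero]
  congr 1; ring

lemma log_rot {z : ℂ} (hz : z ≠ 0) (h : -(3 * Real.pi / 5) < arg z) :
    log (om ^ 4 * z) = log z - (2 * Real.pi / 5 : ℝ) * I := by
  have hpi := Real.pi_pos
  have h1 : om ^ 4 * z = exp (log z - (2 * Real.pi / 5 : ℝ) * I) := by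
    rw [exp_sub, exp_log hz, ← om, eq_div_iff om_ne_zero]
    linear_combination z * om_pow_five
  rw [h1, log_exp]
  · simp only [sub_im, log_im, I_im, im_ofReal_mul]
    linarith
  · simp only [sub_im, log_im, im_ofReal_mul, I_im]
    linarith [arg_le_pi z]

lemma rt_rot {z : ℂ} (hz : z ≠ 0) (h : -(3 * Real.pi / 5) < arg z) :
    rt (om ^ 4 * z) = om10 * rt z := by
  rw [rt, log_rot hz h, rt, om10, ← exp_add]
  congr 1; push_cast; ring

lemma wkb_rot (a : ℂ) {z : ℂ} (hz : z ≠ 0) (h : -(3 * Real.pi / 5) < arg z) :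
    wkb (om ^ 3 * a) (om ^ 4 * z) = ph * wkbp a z ∧
    om ^ 4 * wkbL (om ^ 3 * a) (om ^ 4 * z) = wkbpL a z := by
  have h5 := om10_pow_five
  have h0 := om10_ne_zero
  have hr := rt_ne_zero z
  constructor
  · rw [wkb, rt_rot hz h, log_rot hz h, ph, wkbp, ← exp_add]
    congr 1
    rw [om_pow_three]
    push_cast
    linear_combination (-(2 / 5) * rt z ^ 5 + a * rt z) * h5
  · rw [wkbL, rt_rot hz h, wkbpL, om_pow_three, om_pow_four]
    field_simp
    linear_combination (-8 * rt z ^ 5 + 4 * a * rt z) * h5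

/-- The solution `Y₁`, subdominant near `arg z = 2π/5`. -/
noncomputable def Y1 (p : ℂ × ℂ) (z : ℂ) : ℂ := ph⁻¹ * Z 1 p z

/-- Derivative of `Y1`. -/
noncomputable def Y1' (p : ℂ × ℂ) (z : ℂ) : ℂ := ph⁻¹ * Z' 1 p z

/-- The solution subdominant near `arg z = -2π/5`. -/
noncomputable def Ym (p : ℂ × ℂ) (z : ℂ) : ℂ := ph * Z 4 p z

/-- Derivative of `Ym`. -/
noncomputable def Ym' (p : ℂ × ℂ) (z : ℂ) : ℂ := ph * Z' 4 p z

lemma isSol_Y1 (p : ℂ × ℂ) : IsSol (pot p) (Y1 p) (Y1' p) := (isSol_Z 1 p).smul _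

lemma isSol_Ym (p : ℂ × ℂ) : IsSol (pot p) (Ym p) (Ym' p) := (isSol_Z 4 p).smul _

lemma Y1_conj (p : ℂ × ℂ) (z : ℂ) : Y1 (cj p) (conj z) = conj (Ym p z) ∧
    Y1' (cj p) (conj z) = conj (Ym' p z) := by
  obtain ⟨h1, h2⟩ := Z_conj (j := 1) (k := 4) rfl p z
  simp only [Y1, Y1', Ym, Ym', h1, h2, map_mul, conj_ph, and_self]

/-- Asymptotics of `Y1`. -/
theorem Y1_asymp (M : ℝ) : ∃ R K : ℝ, 1 ≤ R ∧ 0 ≤ K ∧ ∀ p : ℂ × ℂ, ‖p.1‖ ≤ M → ‖p.2‖ ≤ M →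
    ∀ z : ℂ, -(3 * Real.pi / 5) < arg z → 0 ≤ (om ^ 4 * z).re → R ≤ ‖z‖ →
      ‖Y1 p z / wkbp p.1 z - 1‖ ≤ K / √‖z‖ ∧
      ‖(Y1' p z - wkbpL p.1 z * Y1 p z) / wkbp p.1 z‖ ≤ K / √‖z‖ ^ 3 := by
  obtain ⟨R, K, hR, hK, h⟩ := Y0_asymp M
  refine ⟨R, K, hR, hK, fun p h1 h2 z ha hre hz => ?_⟩
  have hz0 : z ≠ 0 := norm_pos_iff.1 (by linarith)
  have hn : ‖om ^ 4 * z‖ = ‖z‖ := by simp [norm_om]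
  obtain ⟨a1, a2⟩ := h (rotp 1 p) (by rwa [(norm_rotp 1 p).1]) (by rwa [(norm_rotp 1 p).2])
    (om ^ 4 * z) hre (by rwa [hn])
  have hp1 : (rotp 1 p).1 = om ^ 3 * p.1 := by simp [rotp]
  obtain ⟨w1, w2⟩ := wkb_rot p.1 hz0 ha
  rw [hn, hq, hp1, w1] at a1
  rw [hn, hqd, hp1, w1] at a2
  have hph := ph_ne_zero
  have hwp := wkbp_ne_zero p.1 z
  constructor
  · have : Y1 p z / wkbp p.1 z = Y0 (rotp 1 p) (om ^ 4 * z) / (ph * wkbp p.1 z) := by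
      rw [Y1, Z, mul_one 4]
      generalize om ^ 4 * z = ζ
      field_simp
    rwa [this]
  · have : (Y1' p z - wkbpL p.1 z * Y1 p z) / wkbp p.1 z = om ^ 4 *
        ((Y0' (rotp 1 p) (om ^ 4 * z) - wkbL (om ^ 3 * p.1) (om ^ 4 * z) *
        Y0 (rotp 1 p) (om ^ 4 * z)) / (ph * wkbp p.1 z)) := by
      rw [← w2, Y1, Y1', Z, Z', mul_one 4]
      generalize om ^ 4 * z = ζ
      field_simp
    rw [this, norm_mul, norm_pow, norm_om, one_pow, one_mul]
    exact a2

lemma om_pow_four_eq : om ^ 4 = (Real.cos (2 * Real.pi / 5) : ℝ) - (Real.sin (2 * Real.pi / 5) : ℝ) * I := by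
  rw [← conj_om, om, exp_mul_I, ← ofReal_cos, ← ofReal_sin]
  simp only [map_add, map_mul, conj_ofReal, conj_I]
  ring

lemma cos_om_pos : 0 < Real.cos (2 * Real.pi / 5) :=
  Real.cos_pos_of_mem_Ioo ⟨by linarith [Real.pi_pos], by linarith [Real.pi_pos]⟩

lemma sin_om_pos : 0 < Real.sin (2 * Real.pi / 5) :=
  Real.sin_pos_of_pos_of_lt_pi (by linarith [Real.pi_pos]) (by linarith [Real.pi_pos])

lemma om_pow_four_mul_re (z : ℂ) : (om ^ 4 * z).re =
    Real.cos (2 * Real.pi / 5) * z.re + Real.sin (2 * Real.pi / 5) * z.im := by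
  rw [om_pow_four_eq]; simp [-ofReal_cos, -ofReal_sin, mul_re]

lemma tendsto_of_sqrt_bound {f : ℝ → ℂ} {l : ℂ} {R K : ℝ}
    (h : ∀ x, R ≤ x → ‖f x - l‖ ≤ K / √x) : Tendsto f atTop (𝓝 l) := by
  rw [tendsto_iff_norm_sub_tendsto_zero]
  refine squeeze_zero' (Eventually.of_forall fun _ => norm_nonneg _)
    ((eventually_ge_atTop R).mono h) ?_
  exact Real.tendsto_sqrt_atTop.const_div_atTop K

theorem wr_Y0_Y1 (p : ℂ × ℂ) (z : ℂ) : wr (Y0 p) (Y0' p) (Y1 p) (Y1' p) z = 2 := by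
  obtain ⟨R, K, hR, hK, h⟩ := Y0_asymp (max ‖p.1‖ ‖p.2‖)
  obtain ⟨S, L, hS, hL, h'⟩ := Y1_asymp (max ‖p.1‖ ‖p.2‖)
  replace h := h p (le_max_left _ _) (le_max_right _ _)
  replace h' := h' p (le_max_left _ _) (le_max_right _ _)
  have hcube : ∀ (x K : ℝ), 0 ≤ K → 1 ≤ x → K / √x ^ 3 ≤ K / √x := fun x K hK hx => by
    have h1 : 1 ≤ √x := Real.one_le_sqrt.2 hx
    have : √x ≤ √x ^ 3 := le_self_pow₀ h1 (by norm_num)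
    gcongr
  have hY0 : ∀ x : ℝ, R ≤ x → ‖hq p (Y0 p) x - 1‖ ≤ K / √x ∧ ‖hqd p (Y0 p) (Y0' p) x - 0‖ ≤ K / √x := by
    intro x hx
    have hn : ‖(x : ℂ)‖ = x := by rw [norm_real, Real.norm_of_nonneg (by linarith)]
    have := h x (by rw [ofReal_re]; linarith) (by rwa [hn])
    rw [hn] at this
    exact ⟨this.1, by rw [sub_zero]; exact this.2.trans (hcube x K hK (by linarith))⟩
  have hY1 : ∀ x : ℝ, S ≤ x → ‖Y1 p x / wkbp p.1 x - 1‖ ≤ L / √x ∧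
      ‖(Y1' p x - wkbpL p.1 x * Y1 p x) / wkbp p.1 x - 0‖ ≤ L / √x := by
    intro x hx
    have hn : ‖(x : ℂ)‖ = x := by rw [norm_real, Real.norm_of_nonneg (by linarith)]
    have := h' x (by rw [arg_ofReal_of_nonneg (by linarith)]; linarith [Real.pi_pos])
      (by rw [om_pow_four_mul_re]; simp only [ofReal_re, ofReal_im, mul_zero, add_zero]
          exact mul_nonneg cos_om_pos.le (by linarith)) (by rwa [hn])
    rw [hn] at this
    exact ⟨this.1, by rw [sub_zero]; exact this.2.trans (hcube x L hL (by linarith))⟩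
  have t1 := tendsto_of_sqrt_bound fun x hx => (hY0 x hx).1
  have t2 := tendsto_of_sqrt_bound fun x hx => (hY0 x hx).2
  have t3 := tendsto_of_sqrt_bound fun x hx => (hY1 x hx).1
  have t4 := tendsto_of_sqrt_bound fun x hx => (hY1 x hx).2
  have t5 : Tendsto (fun x : ℝ => (rt x)⁻¹) atTop (𝓝 0) := by
    refine tendsto_of_sqrt_bound (R := 1) (K := 1) fun x hx => ?_
    rw [sub_zero, norm_inv, norm_rt (by norm_cast; linarith), norm_real,
      Real.norm_of_nonneg (by linarith), one_div]
  have t6 := (((t1.mul t3).const_mul 2).sub (((t5.pow 4).const_mul p.1).mul (t1.mul t3))).add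
    ((t5.pow 3).mul ((t1.mul t4).sub (t2.mul t3)))
  have t7 : Tendsto (fun x : ℝ => wr (Y0 p) (Y0' p) (Y1 p) (Y1' p) x) atTop (𝓝 2) := by
    convert t6 using 1
    · funext x
      have e1 := wkb_mul_wkbp (a := p.1) (z := x)
      have hE := wkb_ne_zero p.1 x
      have hE' := wkbp_ne_zero p.1 x
      have hr := rt_ne_zero x
      have e2 : wkbpL p.1 x - wkbL p.1 x = 2 * rt x ^ 3 - p.1 / rt x := by
        rw [wkbpL, wkbL]; field_simp; ring
      have e3 : wkb p.1 x * wkbp p.1 x = (rt x)⁻¹ ^ 3 := by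
        rw [inv_pow]; exact eq_inv_of_mul_eq_one_left e1
      have d1 : Y0 p x = hq p (Y0 p) x * wkb p.1 x := by rw [hq]; field_simp
      have d2 : Y0' p x = wkbL p.1 x * Y0 p x + hqd p (Y0 p) (Y0' p) x * wkb p.1 x := by
        rw [hqd]; field_simp; ring
      set k := (Y1' p x - wkbpL p.1 x * Y1 p x) / wkbp p.1 x with hk
      have d4 : Y1' p x = wkbpL p.1 x * Y1 p x + k * wkbp p.1 x := by
        rw [hk]; field_simp; ring
      set h := Y1 p x / wkbp p.1 x with hh
      have d3 : Y1 p x = h * wkbp p.1 x := by rw [hh]; field_simp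
      rw [wr, d2, d4, d1, d3]
      generalize hq p (Y0 p) x = u
      generalize hqd p (Y0 p) (Y0' p) x = v
      have e4 : wkbpL p.1 x = wkbL p.1 x + (2 * rt x ^ 3 - p.1 / rt x) := by rw [← e2]; ring
      rw [e4]
      have : u * wkb p.1 x * ((wkbL p.1 x + (2 * rt x ^ 3 - p.1 / rt x)) * (h * wkbp p.1 x) + k * wkbp p.1 x) -
          (wkbL p.1 x * (u * wkb p.1 x) + v * wkb p.1 x) * (h * wkbp p.1 x) =
          (wkb p.1 x * wkbp p.1 x) * (u * h * (2 * rt x ^ 3 - p.1 / rt x) + (u * k - v * h)) := by ring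
      rw [this, e3]
      field_simp
    · norm_num
  have t8 : Tendsto (fun x : ℝ => wr (Y0 p) (Y0' p) (Y1 p) (Y1' p) x) atTop
      (𝓝 (wr (Y0 p) (Y0' p) (Y1 p) (Y1' p) z)) := by
    refine tendsto_const_nhds.congr fun x => ?_
    exact (isSol_Y0 p).wr_const (isSol_Y1 p) _ _
  exact tendsto_nhds_unique t8 t7

lemma cj_cj (p : ℂ × ℂ) : cj (cj p) = p := by simp [cj]

lemma Y0_cj (p : ℂ × ℂ) (z : ℂ) : Y0 (cj p) (conj z) = conj (Y0 p z) ∧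
    Y0' (cj p) (conj z) = conj (Y0' p z) := Y0_conj p z

lemma Ym_conj (p : ℂ × ℂ) (z : ℂ) : Ym (cj p) (conj z) = conj (Y1 p z) ∧
    Ym' (cj p) (conj z) = conj (Y1' p z) := by
  obtain ⟨h1, h2⟩ := Y1_conj (cj p) (conj z)
  rw [cj_cj, conj_conj] at h1 h2
  rw [h1, h2, conj_conj, conj_conj]; exact ⟨rfl, rfl⟩

theorem wr_Y0_Ym (p : ℂ × ℂ) (z : ℂ) : wr (Y0 p) (Y0' p) (Ym p) (Ym' p) z = 2 := by
  have := congrArg conj (wr_Y0_Y1 (cj p) (conj z))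
  obtain ⟨h1, h2⟩ := Y1_conj p z
  obtain ⟨h3, h4⟩ := Y0_cj p z
  simpa [wr, h1, h2, h3, h4, map_ofNat] using this

/-- The spectral determinant. -/
noncomputable def cc (p : ℂ × ℂ) : ℂ := I / 4 * wr (Ym p) (Ym' p) (Y1 p) (Y1' p) 0

lemma wr_Ym_Y1 (p : ℂ × ℂ) (z : ℂ) : wr (Ym p) (Ym' p) (Y1 p) (Y1' p) z = -4 * I * cc p := by
  rw [(isSol_Ym p).wr_const (isSol_Y1 p) z 0, cc]
  linear_combination wr (Ym p) (Ym' p) (Y1 p) (Y1' p) 0 * I_sq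

/-- Connection formula. -/
lemma Y1_sub_Ym (p : ℂ × ℂ) (z : ℂ) : Y1 p z - Ym p z = 2 * I * cc p * Y0 p z ∧
    Y1' p z - Ym' p z = 2 * I * cc p * Y0' p z := by
  have h1 := wr_Y0_Y1 p z
  have h2 := wr_Y0_Ym p z
  have h3 := wr_Ym_Y1 p z
  rw [wr] at h1 h2 h3
  constructor
  · linear_combination (Ym p z / 2) * h1 - (Y1 p z / 2) * h2 - (Y0 p z / 2) * h3
  · linear_combination (Ym' p z / 2) * h1 - (Y1' p z / 2) * h2 - (Y0' p z / 2) * h3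

lemma cc_conj (p : ℂ × ℂ) : cc (cj p) = conj (cc p) := by
  obtain ⟨h1, h2⟩ := Y1_conj p 0
  obtain ⟨h3, h4⟩ := Ym_conj p 0
  rw [map_zero] at h1 h2 h3 h4
  simp only [cc, wr, h1, h2, h3, h4, map_mul, map_sub, map_div₀, conj_I, map_ofNat]
  ring

lemma differentiable_Y1 {p : ℂ → ℂ × ℂ} {z : ℂ → ℂ} (hp : Differentiable ℂ p)
    (hz : Differentiable ℂ z) :
    Differentiable ℂ (fun x => Y1 (p x) (z x)) ∧ Differentiable ℂ (fun x => Y1' (p x) (z x)) :=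
  ⟨(differentiable_Z 1 hp hz).1.const_mul _, (differentiable_Z 1 hp hz).2.const_mul _⟩

lemma continuous_Y1 {X : Type*} [TopologicalSpace X] {p : X → ℂ × ℂ} {z : X → ℂ}
    (hp : Continuous p) (hz : Continuous z) :
    Continuous (fun x => Y1 (p x) (z x)) ∧ Continuous (fun x => Y1' (p x) (z x)) :=
  ⟨continuous_const.mul (continuous_Z 1 hp hz).1, continuous_const.mul (continuous_Z 1 hp hz).2⟩

lemma continuous_Ym {X : Type*} [TopologicalSpace X] {p : X → ℂ × ℂ} {z : X → ℂ}
    (hp : Continuous p) (hz : Continuous z) :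
    Continuous (fun x => Ym (p x) (z x)) ∧ Continuous (fun x => Ym' (p x) (z x)) :=
  ⟨continuous_const.mul (continuous_Z 4 hp hz).1, continuous_const.mul (continuous_Z 4 hp hz).2⟩

lemma differentiable_Ym {p : ℂ → ℂ × ℂ} {z : ℂ → ℂ} (hp : Differentiable ℂ p)
    (hz : Differentiable ℂ z) :
    Differentiable ℂ (fun x => Ym (p x) (z x)) ∧ Differentiable ℂ (fun x => Ym' (p x) (z x)) :=
  ⟨(differentiable_Z 4 hp hz).1.const_mul _, (differentiable_Z 4 hp hz).2.const_mul _⟩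

lemma continuous_cc : Continuous cc := by
  have h1 := continuous_Y1 (X := ℂ × ℂ) (p := id) (z := fun _ => 0) continuous_id continuous_const
  have h4 := continuous_Ym (X := ℂ × ℂ) (p := id) (z := fun _ => 0) continuous_id continuous_const
  exact continuous_const.mul ((h4.1.mul h1.2).sub (h4.2.mul h1.1))

lemma differentiable_cc {p : ℂ → ℂ × ℂ} (hp : Differentiable ℂ p) :
    Differentiable ℂ fun x => cc (p x) := by
  have h1 := differentiable_Y1 (z := fun _ => 0) hp (differentiable_const _)
  have h4 := differentiable_Ym (z := fun _ => 0) hp (differentiable_const _)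
  exact ((h4.1.mul h1.2).sub (h4.2.mul h1.1)).const_mul _

lemma arg_I_mul {y : ℝ} (hy : 0 < y) : arg (y * I) = Real.pi / 2 := by
  rw [arg_real_mul _ hy, arg_I]

lemma rt_pow_five_re {y : ℝ} (hy : 0 < y) : (rt (y * I) ^ 5).re = -(√y ^ 5 * (√2 / 2)) := by
  have h0 : (y : ℂ) * I ≠ 0 := by simp [hy.ne']
  have hn : ‖(y : ℂ) * I‖ = y := by simp [abs_of_pos hy]
  rw [rt_eq_polar h0, hn, arg_I_mul hy, mul_pow, ← exp_nat_mul,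
    show ((5 : ℕ) : ℂ) * ((Real.pi / 2 / 2 : ℝ) * I) = ((Real.pi / 4 + Real.pi : ℝ) : ℂ) * I by
      push_cast; ring, ← ofReal_pow, re_ofReal_mul, exp_ofReal_mul_I_re, Real.cos_add_pi,
    Real.cos_pi_div_four]
  ring

lemma norm_wkb_I (a : ℂ) : Tendsto (fun y : ℝ => ‖wkb a (y * I)‖) atTop atTop ∧
    Tendsto (fun y : ℝ => ‖wkbp a (y * I)‖) atTop (𝓝 0) := by
  have hg : Tendsto (fun s : ℝ => s * (1 / 5 * s ^ 4 - (‖a‖ + 2))) atTop atTop := by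
    refine tendsto_id.atTop_mul_atTop₀ ?_
    exact tendsto_atTop_add_const_right _ _ ((tendsto_pow_atTop (by norm_num)).const_mul_atTop (by norm_num))
  have hg' := hg.comp Real.tendsto_sqrt_atTop
  have h2 : 1 ≤ √2 := Real.one_le_sqrt.2 (by norm_num)
  have key : ∀ y : ℝ, 1 ≤ y → √y * (1 / 5 * √y ^ 4 - (‖a‖ + 2)) ≤
      (-(2 / 5) * rt (y * I) ^ 5 + a * rt (y * I) - 3 / 4 * log (y * I)).re ∧
      (2 / 5 * rt (y * I) ^ 5 - a * rt (y * I) - 3 / 4 * log (y * I)).re ≤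
      -(√y * (1 / 5 * √y ^ 4 - (‖a‖ + 2))) := by
    intro y hy
    have hy0 : 0 < y := by linarith
    have h0 : (y : ℂ) * I ≠ 0 := by simp [hy0.ne']
    have hn : ‖(y : ℂ) * I‖ = y := by simp [abs_of_pos hy0]
    have hs : 1 ≤ √y := Real.one_le_sqrt.2 hy
    have e1 := rt_pow_five_re hy0
    have e2 := abs_le.1 (abs_re_le_norm (a * rt (y * I)))
    rw [norm_mul, norm_rt h0, hn] at e2
    have e3 : (log (y * I)).re = Real.log y := by rw [log_re, hn]
    have e4 : Real.log y ≤ 2 * √y := by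
      have := Real.log_le_sub_one_of_pos (Real.sqrt_pos.2 hy0)
      rw [Real.log_sqrt hy0.le] at this
      linarith
    have e5 := Real.log_nonneg hy
    have e6 : √y ^ 5 ≤ √y ^ 5 * √2 := le_mul_of_one_le_right (by positivity) h2
    have c1 : (-(2 / 5) * rt (y * I) ^ 5).re = -(2 / 5) * (rt (y * I) ^ 5).re := by
      rw [show (-(2 / 5) : ℂ) = ((-(2 / 5) : ℝ) : ℂ) by push_cast; ring, re_ofReal_mul]
    have c2 : (2 / 5 * rt (y * I) ^ 5).re = (2 / 5) * (rt (y * I) ^ 5).re := by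
      rw [show (2 / 5 : ℂ) = ((2 / 5 : ℝ) : ℂ) by push_cast; ring, re_ofReal_mul]
    have c3 : (3 / 4 * log (y * I)).re = 3 / 4 * (log (y * I)).re := by
      rw [show (3 / 4 : ℂ) = ((3 / 4 : ℝ) : ℂ) by push_cast; ring, re_ofReal_mul]
    simp only [sub_re (_ + _), add_re, sub_re, c1, c2, c3, e1, e3]
    constructor <;> nlinarith
  constructor
  · refine tendsto_atTop_mono' _ ?_ (Real.tendsto_exp_atTop.comp hg')
    filter_upwards [eventually_ge_atTop 1] with y hy
    rw [wkb, norm_exp]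
    exact Real.exp_le_exp.2 (key y hy).1
  · refine squeeze_zero' (Eventually.of_forall fun _ => norm_nonneg _) ?_
      (Real.tendsto_exp_neg_atTop_nhds_zero.comp hg')
    filter_upwards [eventually_ge_atTop 1] with y hy
    rw [wkbp, norm_exp]
    exact Real.exp_le_exp.2 (key y hy).2

lemma Y1_tendsto_I (p : ℂ × ℂ) : Tendsto (fun y : ℝ => Y1 p (y * I)) atTop (𝓝 0) := by
  obtain ⟨R, K, hR, hK, h⟩ := Y1_asymp (max ‖p.1‖ ‖p.2‖)
  replace h := h p (le_max_left _ _) (le_max_right _ _)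
  have hb : ∀ᶠ y : ℝ in atTop, ‖Y1 p (y * I)‖ ≤ (1 + K) * ‖wkbp p.1 (y * I)‖ := by
    filter_upwards [eventually_ge_atTop R] with y hy
    have hy0 : 0 < y := by linarith
    have hn : ‖(y : ℂ) * I‖ = y := by simp [abs_of_pos hy0]
    have h1 := (h (y * I) (by rw [arg_I_mul hy0]; linarith [Real.pi_pos])
      (by rw [om_pow_four_mul_re]; simpa using mul_nonneg sin_om_pos.le hy0.le) (by rwa [hn])).1
    have h2 : K / √‖(y : ℂ) * I‖ ≤ K := by
      rw [hn]; exact div_le_self hK (Real.one_le_sqrt.2 (by linarith))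
    have h3 := norm_add_le (Y1 p (y * I) / wkbp p.1 (y * I) - 1) 1
    rw [sub_add_cancel, norm_one, norm_div] at h3
    rw [← div_le_iff₀ (norm_pos_iff.2 (wkbp_ne_zero _ _))]
    linarith
  refine squeeze_zero_norm' hb ?_
  simpa using (norm_wkb_I p.1).2.const_mul (1 + K)

lemma Y0_tendsto_I (p : ℂ × ℂ) : Tendsto (fun y : ℝ => ‖Y0 p (y * I)‖) atTop atTop := by
  obtain ⟨R, K, hR, hK, h⟩ := Y0_asymp (max ‖p.1‖ ‖p.2‖)
  replace h := h p (le_max_left _ _) (le_max_right _ _)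
  have hb : ∀ᶠ y : ℝ in atTop, 1 / 2 * ‖wkb p.1 (y * I)‖ ≤ ‖Y0 p (y * I)‖ := by
    have h4 : ∀ᶠ y : ℝ in atTop, K / √y < 1 / 2 :=
      (Real.tendsto_sqrt_atTop.const_div_atTop K).eventually (gt_mem_nhds (by norm_num))
    filter_upwards [eventually_ge_atTop R, h4] with y hy h4
    have hy0 : 0 < y := by linarith
    have hn : ‖(y : ℂ) * I‖ = y := by simp [abs_of_pos hy0]
    have h1 := (h (y * I) (by simp) (by rwa [hn])).1
    rw [hn] at h1
    have h3 := norm_sub_norm_le (1 : ℂ) (1 - Y0 p (y * I) / wkb p.1 (y * I))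
    rw [sub_sub_cancel, norm_one, norm_div, norm_sub_rev] at h3
    rw [hq] at h1
    rw [← le_div_iff₀ (norm_pos_iff.2 (wkb_ne_zero _ _))]
    linarith
  exact tendsto_atTop_mono' _ hb ((norm_wkb_I p.1).1.const_mul_atTop (by norm_num))

/-- Real parameters as complex parameters. -/
noncomputable def rp (p : ℝ × ℝ) : ℂ × ℂ := ((p.1 : ℂ), (p.2 : ℂ))

lemma cj_rp (p : ℝ × ℝ) : cj (rp p) = rp p := by simp [cj, rp]

lemma continuous_rp : Continuous rp := by unfold rp; fun_prop

/-- A solution decaying along the positive imaginary axis is a multiple of `Y1`. -/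
lemma eq_smul_Y1 {p : ℂ × ℂ} {w w' : ℂ → ℂ} (hw : IsSol (pot p) w w')
    (h : Tendsto (fun y : ℝ => w (y * I)) atTop (𝓝 0)) : ∃ β, ∀ z, w z = β * Y1 p z := by
  set α := wr w w' (Y1 p) (Y1' p) 0 / 2 with hα
  set β := wr (Y0 p) (Y0' p) w w' 0 / 2 with hβ
  have e : ∀ z, w z = α * Y0 p z + β * Y1 p z := fun z => by
    rw [hα, hβ, ← hw.wr_const (isSol_Y1 p) z, ← (isSol_Y0 p).wr_const hw z]
    have h1 := wr_Y0_Y1 p z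
    rw [wr] at *
    simp only [wr]
    linear_combination (-w z / 2) * h1
  have t : Tendsto (fun y : ℝ => α * Y0 p (y * I)) atTop (𝓝 0) := by
    have := h.sub ((Y1_tendsto_I p).const_mul β)
    rw [mul_zero, sub_zero] at this
    refine this.congr fun y => ?_
    rw [e]; ring
  have hα0 : α = 0 := by
    by_contra hne
    have t2 := t.norm
    simp only [norm_mul, norm_zero] at t2
    exact not_tendsto_nhds_of_tendsto_atTop
      ((Y0_tendsto_I p).const_mul_atTop (norm_pos_iff.2 hne)) _ t2
  exact ⟨β, fun z => by rw [e, hα0]; ring⟩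

lemma Y1_ne_zero (p : ℂ × ℂ) : Y1 p ≠ 0 := by
  intro h
  have h1 := wr_Y0_Y1 p 0
  have h2 : Y1' p 0 = 0 := by rw [← (isSol_Y1 p).deriv_eq, h]; simp
  rw [wr, h, h2] at h1
  simp at h1

lemma isSol_of_eigen {a lam : ℝ} {w : ℂ → ℂ} (h : PTCubicEigenfunction a lam w) :
    IsSol (pot (rp (a, lam))) w (deriv w) := by
  refine ⟨fun z => (h.2.1 z).hasDerivAt, fun z => ?_⟩
  have := ((h.2.1.contDiff (n := 2)).differentiable_deriv_two z).hasDerivAt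
  rwa [h.2.2.1 z] at this

lemma Y1_eigen {p : ℝ × ℝ} (hc : cc (rp p) = 0) : PTCubicEigenfunction p.1 p.2 (Y1 (rp p)) := by
  have hs := isSol_Y1 (rp p)
  refine ⟨Y1_ne_zero _, hs.differentiable, fun z => ?_, Y1_tendsto_I _, ?_⟩
  · rw [hs.deriv_eq, (hs.d2 z).deriv]; rfl
  · have e : ∀ z, Y1 (rp p) z = conj (Y1 (rp p) (conj z)) := fun z => by
      have h1 := (Y1_sub_Ym (rp p) z).1
      rw [hc, mul_zero, zero_mul, sub_eq_zero] at h1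
      have h2 := (Ym_conj (rp p) (conj z)).1
      rwa [cj_rp, conj_conj, ← h1] at h2
    have h2 := ((continuous_conj.tendsto _).comp (Y1_tendsto_I (rp p))).comp tendsto_neg_atBot_atTop
    rw [map_zero] at h2
    refine h2.congr fun y => ?_
    rw [e]
    simp

theorem mem_locus_iff (p : ℝ × ℝ) : p ∈ PTCubicLocus ↔ cc (rp p) = 0 := by
  constructor
  · rintro ⟨w, hw⟩
    have hs := isSol_of_eigen hw
    obtain ⟨β, hβ⟩ := eq_smul_Y1 hs hw.2.2.2.1
    have hs' := IsSol.conj hs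
    change IsSol (pot (cj (rp p))) _ _ at hs'
    rw [cj_rp] at hs'
    obtain ⟨γ, hγ⟩ := eq_smul_Y1 hs' (by
      have h2 := ((continuous_conj.tendsto _).comp hw.2.2.2.2).comp tendsto_neg_atTop_atBot
      rw [map_zero] at h2
      refine h2.congr fun y => ?_
      simp)
    have hβ0 : β ≠ 0 := by
      rintro rfl
      exact hw.1 (funext fun z => by rw [hβ]; simp)
    have h3 : ∀ z, w z = conj γ * Ym (rp p) z := fun z => by
      have h1 := hγ (conj z)
      have h2 := (Y1_conj (rp p) z).1
      rw [cj_rp] at h2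
      rw [conj_conj, h2] at h1
      have := congrArg conj h1
      simpa using this
    have h5 : ∀ z, β * Y1 (rp p) z = conj γ * Ym (rp p) z := fun z => by rw [← hβ, h3]
    have h6 : β * Y1' (rp p) 0 = conj γ * Ym' (rp p) 0 := by
      have e1 := ((isSol_Y1 (rp p)).d1 0).const_mul β
      have e2 := ((isSol_Ym (rp p)).d1 0).const_mul (conj γ)
      have e3 : (fun z => β * Y1 (rp p) z) = fun z => conj γ * Ym (rp p) z := funext h5
      rw [e3] at e1
      exact e1.unique e2
    have hγ0 : conj γ ≠ 0 := by
      intro h0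
      exact hw.1 (funext fun z => by rw [h3, h0]; simp)
    rw [cc, wr]
    have h50 := h5 0
    have : β * conj γ * (Ym (rp p) 0 * Y1' (rp p) 0 - Ym' (rp p) 0 * Y1 (rp p) 0) = 0 := by
      linear_combination conj γ * Ym (rp p) 0 * h6 - conj γ * Ym' (rp p) 0 * h50
    rw [(mul_eq_zero.1 this).resolve_left (mul_ne_zero hβ0 hγ0), mul_zero]
  · exact fun h => ⟨_, Y1_eigen h⟩

/-- Wronskian of `Z j` and `Z k`. -/
noncomputable def WZ (j k : ℕ) (p : ℂ × ℂ) : ℂ := wr (Z j p) (Z' j p) (Z k p) (Z' k p) 0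

lemma wr_Z (j k : ℕ) (p : ℂ × ℂ) (z : ℂ) :
    Z j p z * Z' k p z - Z' j p z * Z k p z = WZ j k p :=
  (isSol_Z j p).wr_const (isSol_Z k p) z 0

lemma Z_one (p : ℂ × ℂ) (z : ℂ) : Z 1 p z = ph * Y1 p z ∧ Z' 1 p z = ph * Y1' p z := by
  rw [Y1, Y1', mul_inv_cancel_left₀ ph_ne_zero, mul_inv_cancel_left₀ ph_ne_zero]
  exact ⟨rfl, rfl⟩

lemma WZ_succ (j : ℕ) (p : ℂ × ℂ) : WZ j (j + 1) p = om ^ (4 * j) * (2 * ph) := by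
  have h := wr_Y0_Y1 (rotp j p) 0
  obtain ⟨a1, a2⟩ := Z_rot 0 j p 0
  obtain ⟨b1, b2⟩ := Z_rot 1 j p 0
  obtain ⟨c1, c2⟩ := Z_one (rotp j p) 0
  obtain ⟨d1, d2⟩ := Z_zero (rotp j p)
  rw [mul_zero, d1, zero_add] at a1
  rw [mul_zero, d2, zero_add] at a2
  rw [mul_zero, c1, add_comm] at b1
  rw [mul_zero, c2, add_comm] at b2
  rw [WZ, wr, ← a1, ← a2, ← b1, ← b2]
  rw [wr] at h
  linear_combination ph * om ^ (4 * j) * h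

lemma WZ_plucker (i j k l : ℕ) (p : ℂ × ℂ) :
    WZ i j p * WZ k l p - WZ i k p * WZ j l p + WZ i l p * WZ j k p = 0 := by
  simp only [WZ, wr]; ring

lemma WZ_add_five (j k : ℕ) (p : ℂ × ℂ) : WZ (j + 5) k p = WZ j k p ∧ WZ j (k + 5) p = WZ j k p := by
  simp only [WZ, Z_add_five, and_self]

lemma WZ_antisymm (j k : ℕ) (p : ℂ × ℂ) : WZ k j p = - WZ j k p := by
  simp only [WZ, wr]; ring

/-- A line in parameter space. -/
def pline (p q : ℂ × ℂ) (ε : ℂ) : ℂ × ℂ := (p.1 + ε * q.1, p.2 + ε * q.2)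

lemma pline_zero (p q : ℂ × ℂ) : pline p q 0 = p := by simp [pline]

lemma differentiable_pline (p q : ℂ × ℂ) : Differentiable ℂ (pline p q) := by
  unfold pline; fun_prop

lemma rotp_pline (j : ℕ) (p q : ℂ × ℂ) (ε : ℂ) :
    rotp j (pline p q ε) = pline (rotp j p) (rotp j q) ε := by
  simp only [rotp, pline, Prod.mk.injEq]; constructor <;> ring

/-- Parameter derivative of `Z j`. -/
noncomputable def DZ (j : ℕ) (p q : ℂ × ℂ) (z : ℂ) : ℂ := deriv (fun ε => Z j (pline p q ε) z) 0

/-- Parameter derivative of `Z' j`. -/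
noncomputable def DZ' (j : ℕ) (p q : ℂ × ℂ) (z : ℂ) : ℂ := deriv (fun ε => Z' j (pline p q ε) z) 0

lemma hasDerivAt_eps (j : ℕ) (p q : ℂ × ℂ) (z : ℂ) :
    HasDerivAt (fun ε => Z j (pline p q ε) z) (DZ j p q z) 0 ∧
    HasDerivAt (fun ε => Z' j (pline p q ε) z) (DZ' j p q z) 0 := by
  have h := differentiable_Z j (differentiable_pline p q) (differentiable_const z)
  exact ⟨(h.1 0).hasDerivAt, (h.2 0).hasDerivAt⟩

lemma sepHol_Z (j : ℕ) (p q : ℂ × ℂ) : SepHol (fun ε z => Z j (pline p q ε) z) ∧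
    SepHol (fun ε z => Z' j (pline p q ε) z) := by
  have hc := continuous_Z j (X := ℂ × ℂ) (p := fun x => pline p q x.1) (z := fun x => x.2)
    ((differentiable_pline p q).continuous.comp continuous_fst) continuous_snd
  have h1 := fun z => differentiable_Z j (differentiable_pline p q) (differentiable_const z)
  exact ⟨⟨hc.1, fun z => (h1 z).1, fun ε => (isSol_Z j _).differentiable⟩,
    ⟨hc.2, fun z => (h1 z).2, fun ε => (isSol_Z j _).differentiable'⟩⟩

lemma hasDerivAt_pot_pline (p q : ℂ × ℂ) (z : ℂ) :
    HasDerivAt (fun ε => pot (pline p q ε) z) (q.2 - q.1 * z) 0 := by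
  have h1 : HasDerivAt (fun ε : ℂ => pot p z + ε * (q.2 - q.1 * z)) (1 * (q.2 - q.1 * z)) 0 :=
    ((hasDerivAt_id (0 : ℂ)).mul_const _).const_add _
  rw [one_mul] at h1
  convert h1 using 2 with ε
  simp only [pot, pline]; ring

lemma hasDerivAt_DZ (j : ℕ) (p q : ℂ × ℂ) (z : ℂ) :
    HasDerivAt (DZ j p q) (DZ' j p q z) z ∧
    HasDerivAt (DZ' j p q) (pot p z * DZ j p q z + (q.2 - q.1 * z) * Z j p z) z := by
  obtain ⟨s1, s2⟩ := sepHol_Z j p q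
  constructor
  · have h := (s1.deriv1.d2 0 z).hasDerivAt
    have e : deriv (fun y => deriv (fun x => Z j (pline p q x) y) 0) z = DZ' j p q z := by
      rw [s1.deriv_comm, DZ']
      congr 1; funext x
      exact ((isSol_Z j (pline p q x)).d1 z).deriv
    rw [e] at h
    exact h
  · have h := (s2.deriv1.d2 0 z).hasDerivAt
    have e : deriv (fun y => deriv (fun x => Z' j (pline p q x) y) 0) z =
        pot p z * DZ j p q z + (q.2 - q.1 * z) * Z j p z := by
      rw [s2.deriv_comm]
      have : (fun x => deriv (fun y => Z' j (pline p q x) y) z) =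
          fun x => pot (pline p q x) z * Z j (pline p q x) z := by
        funext x
        exact ((isSol_Z j (pline p q x)).d2 z).deriv
      rw [this]
      have := ((hasDerivAt_pot_pline p q z).mul (hasDerivAt_eps j p q z).1).deriv
      rw [pline_zero] at this
      refine this.trans ?_
      ring
    rw [e] at h
    exact h

/-- Parameter derivative of a Wronskian. -/
noncomputable def DW (j k : ℕ) (p q : ℂ × ℂ) : ℂ := deriv (fun ε => WZ j k (pline p q ε)) 0

lemma hasDerivAt_WZ (j k : ℕ) (p q : ℂ × ℂ) :
    HasDerivAt (fun ε => WZ j k (pline p q ε)) (DW j k p q) 0 := by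
  have h1 := hasDerivAt_eps j p q 0
  have h2 := hasDerivAt_eps k p q 0
  exact ((h1.1.mul h2.2).sub (h1.2.mul h2.1)).differentiableAt.hasDerivAt

lemma DW_eq (j k : ℕ) (p q : ℂ × ℂ) (z : ℂ) : DW j k p q =
    DZ j p q z * Z' k p z + Z j p z * DZ' k p q z - (DZ' j p q z * Z k p z + Z' j p z * DZ k p q z) := by
  have h1 := hasDerivAt_eps j p q z
  have h2 := hasDerivAt_eps k p q z
  have h := (h1.1.mul h2.2).sub (h1.2.mul h2.1)
  simp only [pline_zero] at h
  refine (hasDerivAt_WZ j k p q).unique (HasDerivAt.congr_of_eventuallyEq h ?_)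
  exact Eventually.of_forall fun ε => (wr_Z j k _ z).symm

lemma DW_succ (j : ℕ) (p q : ℂ × ℂ) : DW j (j + 1) p q = 0 := by
  simp only [DW, WZ_succ, deriv_const]

lemma DW_antisymm (j k : ℕ) (p q : ℂ × ℂ) : DW k j p q = - DW j k p q := by
  simp only [DW_eq _ _ p q 0]; ring

lemma DW_add_five (j k : ℕ) (p q : ℂ × ℂ) : DW j (k + 5) p q = DW j k p q := by
  simp only [DW, WZ_add_five]

lemma DW_plucker (i j k l : ℕ) (p q : ℂ × ℂ) :
    DW i j p q * WZ k l p + WZ i j p * DW k l p q - (DW i k p q * WZ j l p + WZ i k p * DW j l p q)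
      + (DW i l p q * WZ j k p + WZ i l p * DW j k p q) = 0 := by
  have h := (((hasDerivAt_WZ i j p q).mul (hasDerivAt_WZ k l p q)).sub
    ((hasDerivAt_WZ i k p q).mul (hasDerivAt_WZ j l p q))).add
    ((hasDerivAt_WZ i l p q).mul (hasDerivAt_WZ j k p q))
  simp only [pline_zero] at h
  refine (h.unique (HasDerivAt.congr_of_eventuallyEq (hasDerivAt_const _ (0 : ℂ)) ?_))
  exact Eventually.of_forall fun ε => WZ_plucker i j k l _

/-- The Wronskian-type combination of `Z j`, `Z (j+1)` and their parameter derivatives. -/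
noncomputable def XZ (j : ℕ) (p q : ℂ × ℂ) (z : ℂ) : ℂ :=
  Z (j + 1) p z * DZ j p q z - Z j p z * DZ (j + 1) p q z

lemma DZ_rot (i j : ℕ) (p q : ℂ × ℂ) (z : ℂ) :
    DZ (i + j) p q z = DZ i (rotp j p) (rotp j q) (om ^ (4 * j) * z) := by
  simp only [DZ, ← rotp_pline, (Z_rot _ _ _ _).1]

lemma XZ_rot (j : ℕ) (p q : ℂ × ℂ) (z : ℂ) :
    XZ j p q z = XZ 0 (rotp j p) (rotp j q) (om ^ (4 * j) * z) := by
  have h1 := DZ_rot 0 j p q z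
  have h2 := DZ_rot 1 j p q z
  rw [zero_add] at h1
  rw [add_comm] at h2
  simp only [XZ, h1, h2, zero_add, (Z_rot _ _ _ _).1, add_comm 1 j]

lemma wkb_add (a b z : ℂ) : wkb (a + b) z = wkb a z * exp (b * rt z) ∧
    wkbp (a + b) z = wkbp a z * exp (-(b * rt z)) := by
  rw [wkb, wkb, wkbp, wkbp, ← exp_add, ← exp_add]
  constructor <;> congr 1 <;> ring

lemma XZ_zero_bound (p q : ℂ × ℂ) : ∃ R C : ℝ, 1 ≤ R ∧ 0 ≤ C ∧ ∀ z : ℂ, 0 ≤ z.re →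
    0 ≤ (om ^ 4 * z).re → R ≤ ‖z‖ → ‖XZ 0 p q z‖ ≤ C / ‖z‖ := by
  set M := max (‖p.1‖ + ‖q.1‖) (‖p.2‖ + ‖q.2‖) with hM
  obtain ⟨R, K, hR, hK, h⟩ := Y0_asymp M
  obtain ⟨S, L, hS, hL, h'⟩ := Y1_asymp M
  set C := 2 * ((1 + K) * (1 + L) * Real.exp ‖q.1‖)
  refine ⟨max R S, C, le_max_of_le_left hR, by positivity, fun z hre hre' hz => ?_⟩
  have hzR : R ≤ ‖z‖ := (le_max_left _ _).trans hz
  have hzS : S ≤ ‖z‖ := (le_max_right _ _).trans hz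
  have hz1 : 1 ≤ ‖z‖ := hR.trans hzR
  have hz0 : z ≠ 0 := norm_pos_iff.1 (by linarith)
  have hs : 1 ≤ √‖z‖ := Real.one_le_sqrt.2 hz1
  have hs2 : √‖z‖ ^ 2 = ‖z‖ := Real.sq_sqrt (by linarith)
  have harg : -(3 * Real.pi / 5) < arg z := by
    have := abs_le.1 (abs_arg_le_pi_div_two_iff.2 hre)
    linarith [Real.pi_pos]
  have hM' : ∀ ε : ℂ, ‖ε‖ ≤ 1 → ‖(pline p q ε).1‖ ≤ M ∧ ‖(pline p q ε).2‖ ≤ M := by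
    intro ε hε
    simp only [pline]
    constructor
    · refine ((norm_add_le _ _).trans ?_).trans (le_max_left _ _)
      rw [norm_mul]
      linarith [mul_le_of_le_one_left (norm_nonneg q.1) hε]
    · refine ((norm_add_le _ _).trans ?_).trans (le_max_right _ _)
      rw [norm_mul]
      linarith [mul_le_of_le_one_left (norm_nonneg q.2) hε]
  have hb0 : ∀ ε : ℂ, ‖ε‖ ≤ 1 → ‖Z 0 (pline p q ε) z‖ ≤
      (1 + K) * (‖wkb p.1 z‖ * Real.exp (‖ε‖ * ‖q.1‖ * √‖z‖)) := by
    intro ε hε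
    obtain ⟨m1, m2⟩ := hM' ε hε
    have h1 := (h _ m1 m2 z hre hzR).1
    have h2 : K / √‖z‖ ≤ K := div_le_self hK hs
    have h3 := norm_add_le (hq (pline p q ε) (Y0 (pline p q ε)) z - 1) 1
    rw [sub_add_cancel, norm_one, hq, norm_div] at h3
    have h4 : ‖Y0 (pline p q ε) z‖ ≤ (1 + K) * ‖wkb (pline p q ε).1 z‖ := by
      rw [← div_le_iff₀ (norm_pos_iff.2 (wkb_ne_zero _ _))]
      rw [hq] at h1
      linarith
    rw [(Z_zero _).1]
    refine h4.trans ?_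
    rw [pline, (wkb_add _ _ _).1, norm_mul]
    gcongr
    refine (norm_exp_le_exp_norm _).trans ?_
    rw [norm_mul, norm_mul, norm_rt hz0]
  have hb1 : ∀ ε : ℂ, ‖ε‖ ≤ 1 → ‖Z 1 (pline p q ε) z‖ ≤
      (1 + L) * (‖wkbp p.1 z‖ * Real.exp (‖ε‖ * ‖q.1‖ * √‖z‖)) := by
    intro ε hε
    obtain ⟨m1, m2⟩ := hM' ε hε
    have h1 := (h' _ m1 m2 z harg hre' hzS).1
    have h2 : L / √‖z‖ ≤ L := div_le_self hL hs
    have h3 := norm_add_le (Y1 (pline p q ε) z / wkbp (pline p q ε).1 z - 1) 1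
    rw [sub_add_cancel, norm_one, norm_div] at h3
    have h4 : ‖Y1 (pline p q ε) z‖ ≤ (1 + L) * ‖wkbp (pline p q ε).1 z‖ := by
      rw [← div_le_iff₀ (norm_pos_iff.2 (wkbp_ne_zero _ _))]
      linarith
    rw [(Z_one _ _).1, norm_mul, norm_ph, one_mul]
    refine h4.trans ?_
    rw [pline, (wkb_add _ _ _).2, norm_mul]
    gcongr
    refine (norm_exp_le_exp_norm _).trans ?_
    rw [norm_neg, norm_mul, norm_mul, norm_rt hz0]
  have hE : ‖wkb p.1 z‖ * ‖wkbp p.1 z‖ = 1 / √‖z‖ ^ 3 := by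
    have := congrArg norm (wkb_mul_wkbp (a := p.1) (z := z))
    rw [norm_mul, norm_mul, norm_pow, norm_rt hz0, norm_one] at this
    rw [eq_div_iff (by positivity), this]
  set F : ℂ → ℂ := fun ε => Z 1 p z * Z 0 (pline p q ε) z - Z 0 p z * Z 1 (pline p q ε) z with hF
  have hd0 := differentiable_Z 0 (differentiable_pline p q) (differentiable_const z)
  have hd1 := differentiable_Z 1 (differentiable_pline p q) (differentiable_const z)
  have hFd : Differentiable ℂ F := (hd0.1.const_mul _).sub (hd1.1.const_mul _)
  have hX : deriv F 0 = XZ 0 p q z :=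
    (((hasDerivAt_eps 0 p q z).1.const_mul _).sub ((hasDerivAt_eps 1 p q z).1.const_mul _)).deriv
  have hr : 0 < 1 / √‖z‖ := by positivity
  have hbd : ∀ ε ∈ Metric.sphere (0 : ℂ) (1 / √‖z‖), ‖F ε‖ ≤ C / √‖z‖ ^ 3 := by
    intro ε hε
    rw [mem_sphere_zero_iff_norm] at hε
    have hε1 : ‖ε‖ ≤ 1 := by rw [hε, div_le_one (by positivity)]; exact hs
    have he : ‖ε‖ * ‖q.1‖ * √‖z‖ = ‖q.1‖ := by rw [hε]; field_simp
    have a0 := hb0 0 (by simp)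
    have a1 := hb1 0 (by simp)
    have b0 := hb0 ε hε1
    have b1 := hb1 ε hε1
    rw [he] at b0 b1
    rw [pline_zero, norm_zero, zero_mul, zero_mul, Real.exp_zero, mul_one] at a0 a1
    refine (norm_sub_le _ _).trans ?_
    rw [norm_mul, norm_mul]
    have c1 := mul_le_mul a1 b0 (norm_nonneg _) (by positivity)
    have c2 := mul_le_mul a0 b1 (norm_nonneg _) (by positivity)
    have e1 : (1 + L) * ‖wkbp p.1 z‖ * ((1 + K) * (‖wkb p.1 z‖ * Real.exp ‖q.1‖)) =
      (1 + K) * (1 + L) * Real.exp ‖q.1‖ * (‖wkb p.1 z‖ * ‖wkbp p.1 z‖) := by ring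
    have e2 : (1 + K) * ‖wkb p.1 z‖ * ((1 + L) * (‖wkbp p.1 z‖ * Real.exp ‖q.1‖)) =
      (1 + K) * (1 + L) * Real.exp ‖q.1‖ * (‖wkb p.1 z‖ * ‖wkbp p.1 z‖) := by ring
    rw [e1, hE] at c1
    rw [e2, hE] at c2
    have : C / √‖z‖ ^ 3 = 2 * ((1 + K) * (1 + L) * Real.exp ‖q.1‖ * (1 / √‖z‖ ^ 3)) := by
      simp only [C]; ring
    rw [this]; linarith
  have := norm_deriv_le_of_forall_mem_sphere_norm_le hr hFd.diffContOnCl hbd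
  rw [hX] at this
  refine this.trans (le_of_eq ?_)
  have : C / √‖z‖ ^ 3 / (1 / √‖z‖) = C / √‖z‖ ^ 2 := by field_simp
  rw [this, hs2]

lemma exists_rotation (z : ℂ) : ∃ j < 5, 0 ≤ (om ^ (4 * j) * z).re ∧
    0 ≤ (om ^ 4 * (om ^ (4 * j) * z)).re := by
  have hpi := Real.pi_pos
  obtain ⟨θ, h0, h1, hz⟩ : ∃ θ : ℝ, 0 ≤ θ ∧ θ < 2 * Real.pi ∧ z = ‖z‖ * exp (θ * I) := by
    rcases le_or_gt 0 (arg z) with h | h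
    · exact ⟨arg z, h, by linarith [arg_le_pi z], (norm_mul_exp_arg_mul_I z).symm⟩
    · refine ⟨arg z + 2 * Real.pi, by linarith [neg_pi_lt_arg z], by linarith, ?_⟩
      push_cast
      rw [add_mul, exp_add, exp_two_pi_mul_I, mul_one, norm_mul_exp_arg_mul_I]
  have ho : om ^ 4 = exp ((-(2 * Real.pi / 5) : ℝ) * I) := by
    have : om ^ 4 * om = 1 := by rw [← pow_succ, om_pow_five]
    rw [eq_div_of_mul_eq om_ne_zero this, om, one_div, ← exp_neg]
    congr 1; push_cast; ring
  have hre : ∀ j : ℕ, (om ^ (4 * j) * z).re = ‖z‖ * Real.cos (θ - j * (2 * Real.pi / 5)) := by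
    intro j
    have : om ^ (4 * j) * z = ‖z‖ * exp ((θ - j * (2 * Real.pi / 5) : ℝ) * I) := by
      conv_lhs => rw [hz, pow_mul, ho, ← exp_nat_mul, mul_left_comm, ← exp_add]
      congr 2; push_cast; ring
    rw [this, re_ofReal_mul, exp_ofReal_mul_I_re]
  set x := θ / (2 * Real.pi / 5) with hx
  have hx0 : 0 ≤ x := by positivity
  have f1 := Nat.floor_le hx0
  have f2 := Nat.lt_floor_add_one x
  have hθ : θ = x * (2 * Real.pi / 5) := by rw [hx]; field_simp
  refine ⟨⌊x⌋₊, ?_, ?_, ?_⟩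
  · rw [Nat.floor_lt hx0, hx, div_lt_iff₀ (by positivity)]
    push_cast; linarith
  · rw [hre]
    refine mul_nonneg (norm_nonneg _) (Real.cos_nonneg_of_mem_Icc ⟨?_, ?_⟩) <;> rw [hθ] <;> nlinarith
  · rw [← mul_assoc, ← pow_add, show 4 + 4 * ⌊x⌋₊ = 4 * (⌊x⌋₊ + 1) by ring, hre]
    refine mul_nonneg (norm_nonneg _) (Real.cos_nonneg_of_mem_Icc ⟨?_, ?_⟩) <;> rw [hθ] <;>
      push_cast <;> nlinarith

lemma XZ_eq {p q : ℂ × ℂ} (hW : ∀ j k, DW j k p q = 0) (j : ℕ) (z : ℂ) :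
    XZ j p q z = om ^ (4 * j) * XZ 0 p q z := by
  have hexp : ∀ i, WZ 0 1 p * Z i p z = WZ i 1 p * Z 0 p z + WZ 0 i p * Z 1 p z := fun i => by
    simp only [← wr_Z _ _ p z]; ring
  have hexpD : ∀ i, WZ 0 1 p * DZ i p q z = WZ i 1 p * DZ 0 p q z + WZ 0 i p * DZ 1 p q z := fun i => by
    have h1 := (hasDerivAt_WZ 0 1 p q).mul (hasDerivAt_eps i p q z).1
    have h2 := ((hasDerivAt_WZ i 1 p q).mul (hasDerivAt_eps 0 p q z).1).add
      ((hasDerivAt_WZ 0 i p q).mul (hasDerivAt_eps 1 p q z).1)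
    simp only [hW, pline_zero, zero_mul, zero_add] at h1 h2
    refine h1.unique (h2.congr_of_eventuallyEq (Eventually.of_forall fun ε => ?_))
    simp only [Pi.mul_apply, Pi.add_apply, ← wr_Z _ _ _ z]; ring
  have hne : WZ 0 1 p ≠ 0 := by
    have := WZ_succ 0 p
    rw [zero_add] at this
    rw [this]; simp [ph_ne_zero]
  have hp := WZ_plucker 0 1 j (j + 1) p
  have hs : WZ j (j + 1) p = om ^ (4 * j) * WZ 0 1 p := by
    have := WZ_succ 0 p
    rw [zero_add] at this
    rw [WZ_succ, this]; simp
  have a1 := hexp j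
  have a2 := hexp (j + 1)
  have b1 := hexpD j
  have b2 := hexpD (j + 1)
  have c1 := WZ_antisymm 1 j p
  have c2 := WZ_antisymm 1 (j + 1) p
  rw [c1] at a1 b1
  rw [c2] at a2 b2
  have hne2 : WZ 0 1 p * WZ 0 1 p ≠ 0 := mul_ne_zero hne hne
  apply mul_left_cancel₀ hne2
  calc WZ 0 1 p * WZ 0 1 p * XZ j p q z = (WZ 0 1 p * Z (j + 1) p z) * (WZ 0 1 p * DZ j p q z) -
        (WZ 0 1 p * Z j p z) * (WZ 0 1 p * DZ (j + 1) p q z) := by rw [XZ]; ring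
    _ = (WZ 0 1 p * WZ j (j + 1) p) * XZ 0 p q z := by
        rw [a1, a2, b1, b2, XZ, zero_add]
        linear_combination (-(Z 1 p z * DZ 0 p q z - Z 0 p z * DZ 1 p q z)) * hp
    _ = _ := by rw [hs]; ring

lemma XZ_zero_eq_zero {p q : ℂ × ℂ} (hW : ∀ j k, DW j k p q = 0) (z : ℂ) : XZ 0 p q z = 0 := by
  choose R C hR hC h using fun j => XZ_zero_bound (rotp j p) (rotp j q)
  have hd : Differentiable ℂ (XZ 0 p q) := fun z =>
    (((isSol_Z 1 p).differentiable z).mul (hasDerivAt_DZ 0 p q z).1.differentiableAt).sub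
    (((isSol_Z 0 p).differentiable z).mul (hasDerivAt_DZ 1 p q z).1.differentiableAt)
  set R' := ∑ j ∈ Finset.range 5, R j
  set C' := ∑ j ∈ Finset.range 5, C j
  have hb : ∀ z : ℂ, R' ≤ ‖z‖ → ‖XZ 0 p q z‖ ≤ C' / ‖z‖ := by
    intro z hz
    obtain ⟨j, hj, h1, h2⟩ := exists_rotation z
    have hn : ‖om ^ (4 * j) * z‖ = ‖z‖ := by simp [norm_om]
    have h3 : R j ≤ R' := Finset.single_le_sum (fun i _ => (zero_le_one.trans (hR i))) (Finset.mem_range.2 hj)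
    have h4 : C j ≤ C' := Finset.single_le_sum (fun i _ => hC i) (Finset.mem_range.2 hj)
    have h5 := h j _ h1 h2 (by rw [hn]; linarith)
    rw [← XZ_rot, XZ_eq hW, norm_mul, norm_pow, norm_om, one_pow, one_mul, hn] at h5
    exact h5.trans (by gcongr)
  have ht : Tendsto (XZ 0 p q) (cocompact ℂ) (𝓝 0) := by
    refine squeeze_zero_norm' ?_ ((tendsto_norm_cocompact_atTop (E := ℂ)).const_div_atTop C')
    filter_upwards [(tendsto_norm_cocompact_atTop (E := ℂ)).eventually_ge_atTop R'] with z hz using hb z hz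
  exact hd.apply_eq_of_tendsto_cocompact z ht

lemma eq_zero_of_DW {p q : ℂ × ℂ} (hW : ∀ j k, DW j k p q = 0) : q = 0 := by
  have hX := XZ_zero_eq_zero hW
  have hne : WZ 0 1 p ≠ 0 := by
    have := WZ_succ 0 p
    rw [zero_add] at this
    rw [this]; simp [ph_ne_zero]
  have hd : ∀ z, Z' 1 p z * DZ 0 p q z = Z' 0 p z * DZ 1 p q z := by
    intro z
    have h1 := (((isSol_Z 1 p).d1 z).mul (hasDerivAt_DZ 0 p q z).1).sub
      (((isSol_Z 0 p).d1 z).mul (hasDerivAt_DZ 1 p q z).1)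
    have h2 := h1.unique ((hasDerivAt_const z (0 : ℂ)).congr_of_eventuallyEq
      (Eventually.of_forall fun y => hX y))
    have h3 := DW_eq 0 1 p q z
    rw [hW] at h3
    linear_combination (1 / 2) * h2 - (1 / 2) * h3
  have hD : ∀ z, DZ 0 p q z = 0 ∧ DZ 1 p q z = 0 := by
    intro z
    have h1 := hd z
    have h2 := hX z
    rw [XZ, zero_add] at h2
    have h3 := wr_Z 0 1 p z
    constructor
    · apply mul_left_cancel₀ hne
      rw [← h3]; linear_combination Z 0 p z * h1 - Z' 0 p z * h2
    · apply mul_left_cancel₀ hne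
      rw [← h3]; linear_combination Z 1 p z * h1 - Z' 1 p z * h2
  have key : ∀ i, (∀ z, DZ i p q z = 0) → ∀ z, (q.2 - q.1 * z) * Z i p z = 0 := by
    intro i hi z
    have e0 : DZ i p q = fun _ => 0 := funext hi
    have e1 : DZ' i p q = fun _ => 0 := funext fun z => by
      have := (hasDerivAt_DZ i p q z).1
      rw [e0] at this
      exact this.unique (hasDerivAt_const _ _)
    have := (hasDerivAt_DZ i p q z).2
    rw [e1, e0, mul_zero, zero_add] at this
    exact this.unique (hasDerivAt_const _ _)
  have k0 := key 0 fun z => (hD z).1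
  have k1 := key 1 fun z => (hD z).2
  have hP : ∀ z, q.2 - q.1 * z = 0 := fun z => by
    apply mul_left_cancel₀ hne
    rw [← wr_Z 0 1 p z]
    linear_combination Z' 1 p z * k0 z - Z' 0 p z * k1 z
  have h0 := hP 0
  have h1 := hP 1
  rw [mul_zero, sub_zero] at h0
  rw [h0, mul_one, zero_sub, neg_eq_zero] at h1
  exact Prod.ext h1 h0

/-- The second coordinate near the spectral locus. -/
noncomputable def TT (p : ℂ × ℂ) : ℂ := (om * WZ 0 2 p + om ^ 4 * WZ 0 3 p) / 2

lemma cc_eq_WZ (p : ℂ × ℂ) : cc p = I / 4 * WZ 4 1 p := by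
  rw [cc, WZ, wr, wr, Ym, Ym', Y1, Y1']
  have := mul_inv_cancel₀ ph_ne_zero
  linear_combination I / 4 * (Z 4 p 0 * Z' 1 p 0 - Z' 4 p 0 * Z 1 p 0) * this

lemma eq_zero_of_antisymm {D : ℕ → ℕ → ℂ} (ha : ∀ j k, D k j = -D j k)
    (h5 : ∀ j k, D j (k + 5) = D j k) (h0 : ∀ j k, j < k → k < 5 → D j k = 0) (j k : ℕ) :
    D j k = 0 := by
  have hall : ∀ j < 5, ∀ k < 5, D j k = 0 := by
    intro j hj k hk
    rcases lt_trichotomy j k with h | h | h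
    · exact h0 j k h hk
    · subst h
      linear_combination (1 / 2) * ha j j
    · rw [ha k j, h0 k j h hj, neg_zero]
  have hk : ∀ j < 5, ∀ k, D j k = 0 := by
    intro j hj k
    induction k using Nat.strong_induction_on with
    | _ k ih =>
      rcases lt_or_ge k 5 with h | h
      · exact hall j hj k h
      · obtain ⟨m, rfl⟩ := Nat.exists_eq_add_of_le' h
        rw [h5]; exact ih m (by omega)
  induction j using Nat.strong_induction_on with
  | _ j ih =>
    rcases lt_or_ge j 5 with h | h
    · exact hk j h k
    · obtain ⟨m, rfl⟩ := Nat.exists_eq_add_of_le' h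
      rw [ha k, h5, ← ha]; exact ih m (by omega)

/-- Nondegeneracy of the pair `(cc, TT)` on the spectral locus. -/
theorem nondegenerate {p q : ℂ × ℂ} (hc : cc p = 0)
    (h1 : deriv (fun ε => cc (pline p q ε)) 0 = 0)
    (h2 : deriv (fun ε => TT (pline p q ε)) 0 = 0) : q = 0 := by
  have hph := ph_ne_zero
  have hom := om_ne_zero
  have h5 := om_pow_five
  have hc1 : ∀ x, cc x = I / 4 * - WZ 1 4 x := fun x => by rw [cc_eq_WZ, WZ_antisymm 1 4]
  have w14 : WZ 1 4 p = 0 := by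
    rw [hc1] at hc
    simpa using hc
  have d14 : DW 1 4 p q = 0 := by
    have := ((hasDerivAt_WZ 1 4 p q).neg.const_mul (I / 4)).deriv
    have e : (fun ε => cc (pline p q ε)) = fun ε => I / 4 * (-fun ε => WZ 1 4 (pline p q ε)) ε :=
      funext fun ε => hc1 _
    rw [e, this] at h1
    simpa using h1
  have hT : om * DW 0 2 p q + om ^ 4 * DW 0 3 p q = 0 := by
    have := ((((hasDerivAt_WZ 0 2 p q).const_mul om).add
      ((hasDerivAt_WZ 0 3 p q).const_mul (om ^ 4))).div_const 2).deriv
    have e : (fun ε => TT (pline p q ε)) = fun ε =>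
      ((fun ε => om * WZ 0 2 (pline p q ε)) + fun ε => om ^ 4 * WZ 0 3 (pline p q ε)) ε / 2 := rfl
    rw [e, this] at h2
    simpa using h2
  have s0 := WZ_succ 0 p
  have s1 := WZ_succ 1 p
  have s2 := WZ_succ 2 p
  have s3 := WZ_succ 3 p
  have s4 := WZ_succ 4 p
  have e4 := (WZ_add_five 4 0 p).2
  have e4' := DW_add_five 4 0 p q
  have t0 := DW_succ 0 p q
  have t1 := DW_succ 1 p q
  have t2 := DW_succ 2 p q
  have t3 := DW_succ 3 p q
  have t4 := DW_succ 4 p q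
  simp only [zero_add, Nat.reduceAdd, Nat.reduceMul, pow_zero, one_mul] at *
  rw [e4, WZ_antisymm 0 4] at s4
  rw [e4', DW_antisymm 0 4] at t4
  replace t4 := neg_eq_zero.1 t4
  have hs0 : WZ 0 1 p ≠ 0 := by rw [s0]; simp [hph]
  have d24 : DW 2 4 p q = 0 := by
    have := DW_plucker 0 1 2 4 p q
    simp only [t0, t1, t4, d14, w14, zero_mul, mul_zero, zero_add, add_zero, sub_zero] at this
    exact (mul_eq_zero.1 this).resolve_left hs0
  have d13 : DW 1 3 p q = 0 := by
    have := DW_plucker 0 1 3 4 p q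
    simp only [t0, t3, t4, d14, w14, zero_mul, mul_zero, zero_add, add_zero, sub_zero] at this
    refine (mul_eq_zero.1 this).resolve_left ?_
    intro h
    rw [h, neg_zero] at s4
    exact (mul_ne_zero (pow_ne_zero _ hom) (mul_ne_zero two_ne_zero hph)) s4.symm
  have w13 : WZ 1 3 p = 2 * ph * om := by
    have := WZ_plucker 0 1 3 4 p
    rw [w14, s0, s3, mul_zero, sub_zero] at this
    have h16 : om ^ 16 = om := by linear_combination (om ^ 11 + om ^ 6 + om) * h5
    have h12 : om ^ 12 = om ^ 2 := by linear_combination (om ^ 7 + om ^ 2) * h5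
    rw [h16] at s4
    rw [h12] at this
    have h4 : WZ 0 4 p = -(om * (2 * ph)) := by rw [← s4, neg_neg]
    rw [h4] at this
    apply mul_left_cancel₀ (mul_ne_zero hom (mul_ne_zero two_ne_zero hph))
    linear_combination -this
  have d02 : DW 0 2 p q = 0 ∧ DW 0 3 p q = 0 := by
    have := DW_plucker 0 1 2 3 p q
    simp only [t0, t1, t2, d13, w13, s1, zero_mul, mul_zero, add_zero] at this
    have h3 : DW 0 3 p q * om ^ 4 = DW 0 2 p q * om := by
      apply mul_left_cancel₀ (mul_ne_zero two_ne_zero hph)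
      linear_combination this
    have h4 : DW 0 2 p q = 0 := by
      have : 2 * om * DW 0 2 p q = 0 := by linear_combination hT - h3
      exact (mul_eq_zero.1 this).resolve_left (mul_ne_zero two_ne_zero hom)
    rw [h4, zero_mul] at h3
    exact ⟨h4, (mul_eq_zero.1 h3).resolve_right (pow_ne_zero _ hom)⟩
  refine eq_zero_of_DW (p := p) (eq_zero_of_antisymm (DW_antisymm · · p q) (DW_add_five · · p q) ?_)
  intro j k hjk hk
  have hj : j < 4 := by omega
  interval_cases k <;> interval_cases j <;>
    simp only [t0, t1, t2, t3, t4, d14, d24, d13, d02.1, d02.2]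

lemma continuous_WZ (j k : ℕ) : Continuous (WZ j k) := by
  have h1 := continuous_Z j (X := ℂ × ℂ) (p := id) (z := fun _ => 0) continuous_id continuous_const
  have h4 := continuous_Z k (X := ℂ × ℂ) (p := id) (z := fun _ => 0) continuous_id continuous_const
  exact (h1.1.mul h4.2).sub (h1.2.mul h4.1)

lemma differentiable_WZ (j k : ℕ) {p : ℂ → ℂ × ℂ} (hp : Differentiable ℂ p) :
    Differentiable ℂ fun x => WZ j k (p x) := by
  have h1 := differentiable_Z j (z := fun _ => 0) hp (differentiable_const _)
  have h4 := differentiable_Z k (z := fun _ => 0) hp (differentiable_const _)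
  exact (h1.1.mul h4.2).sub (h1.2.mul h4.1)

lemma continuous_TT : Continuous TT :=
  (((continuous_WZ 0 2).const_mul om).add ((continuous_WZ 0 3).const_mul (om ^ 4))).div_const 2

lemma differentiable_TT {p : ℂ → ℂ × ℂ} (hp : Differentiable ℂ p) :
    Differentiable ℂ fun x => TT (p x) :=
  (((differentiable_WZ 0 2 hp).const_mul om).add
    ((differentiable_WZ 0 3 hp).const_mul (om ^ 4))).div_const 2

lemma TT_conj (p : ℂ × ℂ) : TT (cj p) = conj (TT p) := by
  have h0 : Z 0 (cj p) 0 = conj (Z 0 p 0) ∧ Z' 0 (cj p) 0 = conj (Z' 0 p 0) := by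
    rw [(Z_zero _).1, (Z_zero _).2, (Z_zero _).1, (Z_zero _).2]
    simpa using Y0_cj p 0
  have h2 := Z_conj (show 2 + 3 = 5 by rfl) p 0
  have h3 := Z_conj (show 3 + 2 = 5 by rfl) p 0
  rw [map_zero] at h2 h3
  have hom : conj (om ^ 4) = om := by rw [← conj_om, conj_conj]
  simp only [TT, WZ, wr, h0.1, h0.2, h2.1, h2.2, h3.1, h3.2, map_div₀, map_add, map_mul, map_sub,
    hom, conj_om, map_ofNat]
  ring

lemma sepHol_cc : SepHol fun x y => cc (x, y) :=
  ⟨continuous_cc, fun _ => differentiable_cc (differentiable_id.prodMk (differentiable_const _)),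
    fun _ => differentiable_cc ((differentiable_const _).prodMk differentiable_id)⟩

lemma sepHol_TT : SepHol fun x y => TT (x, y) :=
  ⟨continuous_TT, fun _ => differentiable_TT (differentiable_id.prodMk (differentiable_const _)),
    fun _ => differentiable_TT ((differentiable_const _).prodMk differentiable_id)⟩

lemma SepHol.contDiff {f : ℂ → ℂ → ℂ} (h : SepHol f) :
    ContDiff ℂ 1 fun p : ℂ × ℂ => f p.1 p.2 := by
  rw [contDiff_one_iff_fderiv]
  refine ⟨fun u => (h.hasStrictFDerivAt u).hasFDerivAt.differentiableAt, ?_⟩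
  have e : fderiv ℂ (fun p : ℂ × ℂ => f p.1 p.2) = fun u =>
      (deriv (fun x => f x u.2) u.1) • ContinuousLinearMap.fst ℂ ℂ ℂ +
      (deriv (fun y => f u.1 y) u.2) • ContinuousLinearMap.snd ℂ ℂ ℂ := by
    funext u
    rw [(h.hasStrictFDerivAt u).hasFDerivAt.fderiv]
    ext <;> simp
  rw [e]
  exact (h.deriv1.cont.smul continuous_const).add (h.deriv2.cont.smul continuous_const)

/-- Pair of the spectral determinant and the uniformizing parameter. -/
noncomputable def ccTT (u : ℂ × ℂ) : ℂ × ℂ := (cc u, TT u)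

lemma contDiff_ccTT : ContDiff ℂ 1 ccTT := sepHol_cc.contDiff.prodMk sepHol_TT.contDiff

lemma hasDerivAt_pline (p q : ℂ × ℂ) (ε : ℂ) : HasDerivAt (pline p q) q ε := by
  have h1 : ∀ a b : ℂ, HasDerivAt (fun ε : ℂ => a + ε * b) b ε := fun a b => by
    simpa using ((hasDerivAt_id ε).mul_const b).const_add a
  exact (h1 _ _).prodMk (h1 _ _)

lemma fderiv_ccTT_injective {p : ℂ × ℂ} (hc : cc p = 0) :
    Function.Injective (fderiv ℂ ccTT p) := by
  rw [injective_iff_map_eq_zero]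
  intro q hq
  have hd := (contDiff_ccTT.differentiable one_ne_zero p).hasFDerivAt
  have hd' : HasFDerivAt ccTT (fderiv ℂ ccTT p) (pline p q 0) := by rwa [pline_zero]
  have h := hd'.comp_hasDerivAt (0 : ℂ) (hasDerivAt_pline p q 0)
  rw [hq] at h
  have h1 : HasDerivAt (fun ε => cc (pline p q ε)) 0 0 :=
    (ContinuousLinearMap.fst ℂ ℂ ℂ).hasFDerivAt.comp_hasDerivAt (0 : ℂ) h
  have h2 : HasDerivAt (fun ε => TT (pline p q ε)) 0 0 :=
    (ContinuousLinearMap.snd ℂ ℂ ℂ).hasFDerivAt.comp_hasDerivAt (0 : ℂ) h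
  exact nondegenerate hc h1.deriv h2.deriv

/-- The uniformizing parameter on the real parameter plane. -/
noncomputable def TR (p : ℝ × ℝ) : ℝ := (TT (rp p)).re

lemma ofReal_TR (p : ℝ × ℝ) : (TR p : ℂ) = TT (rp p) := by
  have := TT_conj (rp p)
  rw [cj_rp] at this
  exact conj_eq_iff_re.1 this.symm

lemma continuous_cj : Continuous cj :=
  (continuous_conj.comp continuous_fst).prodMk (continuous_conj.comp continuous_snd)

/-- Local analytic parametrization of the spectral locus by the parameter `TR`. -/
theorem locus_chart {p : ℝ × ℝ} (hp : cc (rp p) = 0) : ∃ σ : ℝ → ℝ × ℝ, σ (TR p) = p ∧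
    (∀ᶠ t in 𝓝 (TR p), AnalyticAt ℝ σ t ∧ cc (rp (σ t)) = 0 ∧ TR (σ t) = t) ∧
    ∀ᶠ p' in 𝓝 p, cc (rp p') = 0 → σ (TR p') = p' := by
  have hinj := fderiv_ccTT_injective hp
  set u := rp p with hu
  have hd := (contDiff_ccTT.differentiable one_ne_zero u).hasFDerivAt
  set L : (ℂ × ℂ) ≃L[ℂ] (ℂ × ℂ) :=
    (LinearEquiv.ofInjectiveEndo (fderiv ℂ ccTT u : (ℂ × ℂ) →ₗ[ℂ] (ℂ × ℂ))
      hinj).toContinuousLinearEquiv with hL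
  have hLd : HasFDerivAt ccTT (L : (ℂ × ℂ) →L[ℂ] (ℂ × ℂ)) u := by
    have e : (L : (ℂ × ℂ) →L[ℂ] (ℂ × ℂ)) = fderiv ℂ ccTT u :=
      ContinuousLinearMap.ext fun x => rfl
    rwa [e]
  have hcd : ContDiffAt ℂ 1 ccTT u := contDiff_ccTT.contDiffAt
  have hs := hcd.hasStrictFDerivAt' hLd one_ne_zero
  set g := hcd.localInverse hLd one_ne_zero with hg
  have hfu : ccTT u = (0, ((TR p : ℝ) : ℂ)) := by rw [ccTT, hp, ofReal_TR]
  have hgd : ContDiffAt ℂ 1 g (ccTT u) := hcd.to_localInverse hLd one_ne_zero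
  have hgl : ∀ᶠ x in 𝓝 u, g (ccTT x) = x := hs.eventually_left_inverse
  have hgr : ∀ᶠ y in 𝓝 (ccTT u), ccTT (g y) = y := hs.eventually_right_inverse
  have hgu : g (ccTT u) = u := hgl.self_of_nhds
  rw [hfu] at hgd hgr hgu
  have hιc : Continuous fun τ : ℂ => ((0 : ℂ), τ) := continuous_const.prodMk continuous_id
  have hρc : Continuous fun t : ℝ => ((0 : ℂ), (t : ℂ)) := hιc.comp continuous_ofReal
  have hd1 : ∀ᶠ τ in 𝓝 ((TR p : ℝ) : ℂ), DifferentiableAt ℂ (fun τ : ℂ => g (0, τ)) τ := by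
    have := (hgd.eventually (by simp)).mono fun y hy => hy.differentiableAt one_ne_zero
    refine (hιc.continuousAt.eventually this).mono fun τ hτ => ?_
    exact hτ.comp τ ((differentiableAt_const _).prodMk differentiableAt_id)
  have han : AnalyticAt ℂ (fun τ : ℂ => g (0, τ)) ((TR p : ℝ) : ℂ) :=
    Complex.analyticAt_iff_eventually_differentiableAt.2 hd1
  set σ : ℝ → ℝ × ℝ := fun t => ((g (0, (t : ℂ))).1.re, (g (0, (t : ℂ))).2.re) with hσ
  have hσan : AnalyticAt ℝ σ (TR p) := by
    have h1 : AnalyticAt ℝ (fun t : ℝ => g (0, (t : ℂ))) (TR p) :=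
      (han.restrictScalars (𝕜 := ℝ)).comp (Complex.ofRealCLM.analyticAt _)
    have h2 : AnalyticAt ℝ (fun x : ℂ × ℂ => (x.1.re, x.2.re)) (g (0, ((TR p : ℝ) : ℂ))) :=
      ((Complex.reCLM.comp (ContinuousLinearMap.fst ℝ ℂ ℂ)).prod
        (Complex.reCLM.comp (ContinuousLinearMap.snd ℝ ℂ ℂ))).analyticAt _
    exact AnalyticAt.comp (f := fun t : ℝ => g (0, (t : ℂ))) h2 h1
  have hgc : ContinuousAt (fun t : ℝ => g (0, (t : ℂ))) (TR p) :=
    ContinuousAt.comp (f := fun t : ℝ => ((0 : ℂ), (t : ℂ))) (g := g) hgd.continuousAt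
      hρc.continuousAt
  have hreal : ∀ᶠ t : ℝ in 𝓝 (TR p), g (0, (t : ℂ)) = rp (σ t) ∧
      ccTT (g (0, (t : ℂ))) = (0, (t : ℂ)) := by
    have hcu : cj (g (0, ((TR p : ℝ) : ℂ))) = u := by rw [hgu, hu, cj_rp]
    have h1 : ContinuousAt (fun t : ℝ => cj (g (0, (t : ℂ)))) (TR p) :=
      continuous_cj.continuousAt.comp hgc
    have h2 := h1.eventually (by simpa only [hcu] using hgl)
    have h3 := (hρc.continuousAt (x := TR p)).eventually hgr
    filter_upwards [h2, h3] with t ht2 ht3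
    refine ⟨?_, ht3⟩
    have e : ccTT (cj (g (0, (t : ℂ)))) = (0, (t : ℂ)) := by
      rw [ccTT, Prod.mk.injEq] at ht3
      rw [ccTT, cc_conj, TT_conj, ht3.1, ht3.2]
      simp
    rw [e] at ht2
    have h5 := congrArg Prod.fst ht2
    have h6 := congrArg Prod.snd ht2
    simp only [cj] at h5 h6
    ext1
    · exact (conj_eq_iff_re.1 h5.symm).symm
    · exact (conj_eq_iff_re.1 h6.symm).symm
  refine ⟨σ, ?_, ?_, ?_⟩
  · simp only [hσ, hgu, hu, rp, ofReal_re]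
  · filter_upwards [hreal, hσan.eventually_analyticAt] with t ⟨h1, h2⟩ h3
    rw [h1, ccTT, Prod.mk.injEq] at h2
    exact ⟨h3, h2.1, by rw [TR, h2.2, ofReal_re]⟩
  · have := (continuous_rp.continuousAt (x := p)).eventually hgl
    filter_upwards [this] with p' hp' hc
    rw [ccTT, hc, ← ofReal_TR] at hp'
    simp only [hσ, hp', rp, ofReal_re]

/-- The filter at infinity in a narrow cone around the positive axis. -/
noncomputable def cone : Filter ℂ := comap norm atTop ⊓ 𝓟 {z | |arg z| ≤ 2 * Real.pi / 15}

lemma tendsto_norm_cone : Tendsto (fun z : ℂ => √‖z‖) cone atTop :=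
  Real.tendsto_sqrt_atTop.comp (tendsto_comap.mono_left inf_le_left)

lemma norm_wkb_le (a : ℂ) {z : ℂ} (hz : 1 ≤ ‖z‖) (ha : |arg z| ≤ 2 * Real.pi / 15) :
    ‖wkb a z‖ ≤ Real.exp (-(√‖z‖ * (1 / 5 * √‖z‖ ^ 4 - ‖a‖))) := by
  have h0 : z ≠ 0 := norm_pos_iff.1 (by linarith)
  have hs : 1 ≤ √‖z‖ := Real.one_le_sqrt.2 hz
  rw [wkb, norm_exp]
  refine Real.exp_le_exp.2 ?_
  have e1 : 1 / 2 * √‖z‖ ^ 5 ≤ (rt z ^ 5).re := by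
    rw [rt_eq_polar h0, mul_pow, ← exp_nat_mul,
      show ((5 : ℕ) : ℂ) * ((arg z / 2 : ℝ) * I) = ((5 / 2 * arg z : ℝ) : ℂ) * I by
        push_cast; ring, ← ofReal_pow, re_ofReal_mul, exp_ofReal_mul_I_re, mul_comm]
    gcongr
    rw [← Real.cos_abs, ← Real.cos_pi_div_three]
    apply Real.cos_le_cos_of_nonneg_of_le_pi (abs_nonneg _) (by linarith [Real.pi_pos])
    rw [abs_mul, abs_of_pos (by norm_num : (0:ℝ) < 5 / 2)]
    linarith
  have e2 := abs_le.1 (abs_re_le_norm (a * rt z))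
  rw [norm_mul, norm_rt h0] at e2
  have e3 : (log z).re = Real.log ‖z‖ := log_re z
  have e5 := Real.log_nonneg hz
  have c1 : (-(2 / 5) * rt z ^ 5).re = -(2 / 5) * (rt z ^ 5).re := by
    rw [show (-(2 / 5) : ℂ) = ((-(2 / 5) : ℝ) : ℂ) by push_cast; ring, re_ofReal_mul]
  have c3 : (3 / 4 * log z).re = 3 / 4 * (log z).re := by
    rw [show (3 / 4 : ℂ) = ((3 / 4 : ℝ) : ℂ) by push_cast; ring, re_ofReal_mul]
  simp only [sub_re, add_re, c1, c3, e3]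
  nlinarith

lemma wkb_decay (a : ℂ) (k : ℕ) : Tendsto (fun z => √‖z‖ ^ k * ‖wkb a z‖) cone (𝓝 0) := by
  have h1 : Tendsto (fun z : ℂ => √‖z‖ ^ k * Real.exp (-√‖z‖)) cone (𝓝 0) :=
    (Real.tendsto_pow_mul_exp_neg_atTop_nhds_zero k).comp tendsto_norm_cone
  refine squeeze_zero' (Eventually.of_forall fun _ => by positivity) ?_ h1
  have h2 : ∀ᶠ z : ℂ in cone, |arg z| ≤ 2 * Real.pi / 15 := by
    apply Eventually.filter_mono inf_le_right
    exact mem_principal_self _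
  filter_upwards [h2, tendsto_norm_cone.eventually_ge_atTop (5 * (1 + ‖a‖))] with z h2 h3
  have hp := norm_nonneg a
  have hs : 1 ≤ √‖z‖ := by linarith
  refine mul_le_mul_of_nonneg_left ((norm_wkb_le a (Real.one_le_sqrt.1 hs) h2).trans
    (Real.exp_le_exp.2 (neg_le_neg ?_))) (by positivity)
  have h4 : √‖z‖ ≤ √‖z‖ ^ 4 := le_self_pow₀ hs (by norm_num)
  nlinarith

lemma norm_wkbL_le (a : ℂ) {z : ℂ} (hz : 1 ≤ ‖z‖) : ‖wkbL a z‖ ≤ (2 + ‖a‖) * √‖z‖ ^ 3 := by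
  have h0 : z ≠ 0 := norm_pos_iff.1 (by linarith)
  have hs : 1 ≤ √‖z‖ := Real.one_le_sqrt.2 hz
  have h3 : 1 ≤ √‖z‖ ^ 3 := one_le_pow₀ hs
  have e1 : ‖a / (2 * rt z)‖ ≤ ‖a‖ := by
    rw [norm_div, norm_mul, norm_rt h0]
    refine div_le_self (norm_nonneg _) ?_
    simp; linarith
  have e2 : ‖3 / (4 * rt z ^ 2)‖ ≤ 1 := by
    rw [rt_sq h0, norm_div, norm_mul]
    simp only [norm_ofNat]
    rw [div_le_one (by linarith)]
    linarith
  have := norm_sub_le (-rt z ^ 3 + a / (2 * rt z)) (3 / (4 * rt z ^ 2))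
  have h4 := norm_add_le (-rt z ^ 3) (a / (2 * rt z))
  rw [norm_neg, norm_pow, norm_rt h0] at h4
  rw [wkbL]
  nlinarith [norm_nonneg a]

lemma Y0_decay (p : ℂ × ℂ) : Tendsto (Y0 p) cone (𝓝 0) ∧ Tendsto (Y0' p) cone (𝓝 0) := by
  obtain ⟨R, K, hR, hK, h⟩ := Y0_asymp (max ‖p.1‖ ‖p.2‖)
  replace h := h p (le_max_left _ _) (le_max_right _ _)
  have h2 : ∀ᶠ z : ℂ in cone, |arg z| ≤ 2 * Real.pi / 15 := by
    apply Eventually.filter_mono inf_le_right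
    exact mem_principal_self _
  have hn : ∀ᶠ z : ℂ in cone, R ≤ ‖z‖ := by
    apply Eventually.filter_mono inf_le_left
    exact tendsto_comap.eventually_ge_atTop R
  have hb : ∀ᶠ z in cone, ‖Y0 p z‖ ≤ (1 + K) * (√‖z‖ ^ 0 * ‖wkb p.1 z‖) ∧
      ‖Y0' p z‖ ≤ ((2 + ‖p.1‖) * (1 + K) + K) * (√‖z‖ ^ 3 * ‖wkb p.1 z‖) := by
    filter_upwards [h2, hn] with z ha hz
    have h1 : 1 ≤ ‖z‖ := hR.trans hz
    have hs : 1 ≤ √‖z‖ := Real.one_le_sqrt.2 h1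
    have hs3 : 1 ≤ √‖z‖ ^ 3 := one_le_pow₀ hs
    have hre : 0 ≤ z.re := by
      rw [← abs_arg_le_pi_div_two_iff]; linarith [Real.pi_pos]
    obtain ⟨a1, a2⟩ := h z hre hz
    have hw : 0 < ‖wkb p.1 z‖ := norm_pos_iff.2 (wkb_ne_zero _ _)
    have b1 : K / √‖z‖ ≤ K := div_le_self hK hs
    have b2 : K / √‖z‖ ^ 3 ≤ K := div_le_self hK hs3
    have h3 := norm_add_le (hq p (Y0 p) z - 1) 1
    rw [sub_add_cancel, norm_one, hq, norm_div] at h3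
    have c1 : ‖Y0 p z‖ ≤ (1 + K) * ‖wkb p.1 z‖ := by
      rw [← div_le_iff₀ hw]; rw [hq] at a1; linarith
    rw [hqd, norm_div, div_le_iff₀ hw] at a2
    refine ⟨by simpa using c1, ?_⟩
    have c2 := norm_add_le (Y0' p z - wkbL p.1 z * Y0 p z) (wkbL p.1 z * Y0 p z)
    rw [sub_add_cancel, norm_mul] at c2
    have c3 : ‖wkbL p.1 z‖ * ‖Y0 p z‖ ≤ ((2 + ‖p.1‖) * √‖z‖ ^ 3) * ((1 + K) * ‖wkb p.1 z‖) :=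
      mul_le_mul (norm_wkbL_le _ h1) c1 (norm_nonneg _) (by positivity)
    have c4 : K / √‖z‖ ^ 3 * ‖wkb p.1 z‖ ≤ K * (√‖z‖ ^ 3 * ‖wkb p.1 z‖) := by
      have : ‖wkb p.1 z‖ ≤ √‖z‖ ^ 3 * ‖wkb p.1 z‖ := le_mul_of_one_le_left hw.le hs3
      gcongr
    linarith
  constructor
  · exact squeeze_zero_norm' (hb.mono fun z h => h.1) (by
      simpa using (wkb_decay p.1 0).const_mul (1 + K))
  · exact squeeze_zero_norm' (hb.mono fun z h => h.2) (by
      simpa using (wkb_decay p.1 3).const_mul ((2 + ‖p.1‖) * (1 + K) + K))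

lemma tendsto_ray_cone (z₀ : ℂ) {e : ℂ} (he : e ∈ slitPlane) (ha : |arg e| < 2 * Real.pi / 15) :
    Tendsto (fun s : ℝ => z₀ + s * e) atTop cone := by
  have he0 := slitPlane_ne_zero he
  refine tendsto_inf.2 ⟨tendsto_comap_iff.2 ?_, tendsto_principal.2 ?_⟩
  · have h1 : Tendsto (fun s : ℝ => s * ‖e‖ - ‖z₀‖) atTop atTop :=
      tendsto_atTop_add_const_right _ _ (tendsto_id.atTop_mul_const (norm_pos_iff.2 he0))
    refine tendsto_atTop_mono' _ ?_ h1
    filter_upwards [eventually_ge_atTop 0] with s hs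
    have := norm_sub_le (z₀ + s * e) z₀
    rw [add_sub_cancel_left, norm_mul, norm_real, Real.norm_of_nonneg hs] at this
    simp only [Function.comp_apply]; linarith
  · have h1 : Tendsto (fun s : ℝ => (s : ℂ)⁻¹ * z₀ + e) atTop (𝓝 e) := by
      have h2 : Tendsto (fun s : ℝ => (s : ℂ)⁻¹) atTop (𝓝 0) := by
        have := (continuous_ofReal.tendsto 0).comp tendsto_inv_atTop_zero
        simpa [Function.comp_def] using this
      simpa using (h2.mul_const z₀).add_const e
    have h2 := ((continuousAt_arg he).tendsto.comp h1).abs.eventually (gt_mem_nhds ha)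
    filter_upwards [h2, eventually_gt_atTop 0] with s h3 hs
    have : z₀ + s * e = (s : ℝ) * ((s : ℂ)⁻¹ * z₀ + e) := by
      have : (s : ℂ) ≠ 0 := by exact_mod_cast hs.ne'
      field_simp
    change |arg (z₀ + s * e)| ≤ _
    rw [this, arg_real_mul _ hs]
    exact h3.le

lemma om_pow_four_mul_I : om ^ 4 * I = exp ((Real.pi / 10 : ℝ) * I) := by
  rw [om_pow_four_eq, exp_mul_I, ← ofReal_cos, ← ofReal_sin,
    show Real.pi / 10 = Real.pi / 2 - 2 * Real.pi / 5 by ring, Real.cos_pi_div_two_sub,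
    Real.sin_pi_div_two_sub]
  linear_combination -((Real.sin (2 * Real.pi / 5) : ℝ) : ℂ) * I_sq

lemma tendsto_vert_cone (x : ℂ) :
    Tendsto (fun s : ℝ => om ^ 4 * (x + s * I)) atTop cone := by
  have hpi := Real.pi_pos
  have ha : arg (om ^ 4 * I) = Real.pi / 10 := by
    rw [om_pow_four_mul_I, arg_exp_mul_I, toIocMod_eq_self]
    constructor <;> linarith
  have h := tendsto_ray_cone (om ^ 4 * x) (e := om ^ 4 * I) (by
    rw [mem_slitPlane_iff_arg, ha]
    exact ⟨by linarith, mul_ne_zero (pow_ne_zero _ om_ne_zero) I_ne_zero⟩)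
    (by rw [ha, abs_of_pos (by linarith)]; linarith)
  refine h.congr fun s => by ring

lemma Y1_eq_Y0 (p : ℂ × ℂ) (z : ℂ) : Y1 p z = ph⁻¹ * Y0 (rotp 1 p) (om ^ 4 * z) ∧
    Y1' p z = ph⁻¹ * (om ^ 4 * Y0' (rotp 1 p) (om ^ 4 * z)) := ⟨rfl, rfl⟩

lemma Y1_vert (p : ℂ × ℂ) (x : ℂ) : Tendsto (fun s : ℝ => Y1 p (x + s * I)) atTop (𝓝 0) ∧
    Tendsto (fun s : ℝ => Y1' p (x + s * I)) atTop (𝓝 0) := by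
  obtain ⟨h1, h2⟩ := Y0_decay (rotp 1 p)
  have hv := tendsto_vert_cone x
  constructor
  · simpa only [Function.comp_def, mul_zero, (Y1_eq_Y0 p _).1] using (h1.comp hv).const_mul ph⁻¹
  · simpa only [Function.comp_def, mul_zero, (Y1_eq_Y0 p _).2] using
      ((h2.comp hv).const_mul (om ^ 4)).const_mul ph⁻¹

lemma Y0_horiz (p : ℂ × ℂ) (x : ℂ) : Tendsto (fun s : ℝ => Y0 p (x + s)) atTop (𝓝 0) ∧
    Tendsto (fun s : ℝ => Y0' p (x + s)) atTop (𝓝 0) := by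
  obtain ⟨h1, h2⟩ := Y0_decay p
  have hv := tendsto_ray_cone x (e := 1) (by simp) (by simp [Real.pi_pos])
  simp only [mul_one] at hv
  exact ⟨h1.comp hv, h2.comp hv⟩

/-- The flux `w' * conj w`. -/
noncomputable def fl (w w' : ℂ → ℂ) (z : ℂ) : ℂ := w' z * conj (w z)

lemma hasDerivAt_line {w w' : ℂ → ℂ} (h : ∀ z, HasDerivAt w (w' z) z) (z₀ e : ℂ) (t : ℝ) :
    HasDerivAt (fun t : ℝ => w (z₀ + t * e)) (w' (z₀ + t * e) * e) t := by
  have h1 : HasDerivAt (fun t : ℝ => z₀ + t * e) (1 * e) t :=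
    ((hasDerivAt_id t).ofReal_comp.mul_const e).const_add z₀
  rw [one_mul] at h1
  exact (h _).comp t h1

lemma hasDerivAt_fl {Q w w' : ℂ → ℂ} (hw : IsSol Q w w') (z₀ e : ℂ) (t : ℝ) :
    HasDerivAt (fun t : ℝ => fl w w' (z₀ + t * e))
      (e * Q (z₀ + t * e) * normSq (w (z₀ + t * e)) + conj e * normSq (w' (z₀ + t * e))) t := by
  have h1 := hasDerivAt_line hw.d1 z₀ e t
  have h2 := hasDerivAt_line hw.d2 z₀ e t
  refine (h2.mul h1.star).congr_deriv ?_
  simp only [star_def, map_mul, ← mul_conj]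
  ring

lemma isSol_pot_eq_zero {p : ℂ × ℂ} {w w' : ℂ → ℂ} (hw : IsSol (pot p) w w') {z₀ : ℂ}
    (h0 : w z₀ = 0) (h1 : w' z₀ = 0) : w = 0 := by
  have : IsSol (cubic (qv p)) w w' := by rw [cubic_qv]; exact hw
  exact funext fun z => this.eq_zero h0 h1 z

lemma eq_zero_of_line {f : ℂ → ℂ} (hf : Differentiable ℂ f) {z₀ e : ℂ} (he : e ≠ 0) {t₀ t₁ : ℝ}
    (ht : t₀ < t₁) (h : ∀ t ∈ Set.Ioo t₀ t₁, f (z₀ + t * e) = 0) : f = 0 := by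
  have han : AnalyticOnNhd ℂ f Set.univ := fun z _ => hf.analyticAt z
  set m := (t₀ + t₁) / 2 with hm
  have hacc : ∃ᶠ z in 𝓝[≠] (z₀ + m * e), f z = 0 := by
    have hc : Tendsto (fun t : ℝ => z₀ + t * e) (𝓝[≠] m) (𝓝[≠] (z₀ + m * e)) := by
      apply tendsto_nhdsWithin_of_tendsto_nhds_of_eventually_within
      · exact (by fun_prop : Continuous fun t : ℝ => z₀ + t * e).continuousAt.mono_left inf_le_left
      · filter_upwards [self_mem_nhdsWithin] with t ht1
        simpa [he] using ht1
    refine hc.frequently (Eventually.frequently ?_)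
    apply Eventually.filter_mono inf_le_left
    filter_upwards [Ioo_mem_nhds (a := t₀) (b := t₁) (x := m) (by linarith) (by linarith)] with t ht
    exact h t ht
  funext z
  exact han.eqOn_zero_of_preconnected_of_frequently_eq_zero isPreconnected_univ (Set.mem_univ _)
    hacc (Set.mem_univ z)

lemma isSol_pot_eq_zero' {p : ℂ × ℂ} {w w' : ℂ → ℂ} (hw : IsSol (pot p) w w') (h : w' = 0) :
    w = 0 := by
  have hc : ∀ z, w z = w 0 := fun z =>
    is_const_of_deriv_eq_zero hw.differentiable (fun z => by rw [hw.deriv_eq, h]; rfl) z 0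
  have hq : ∀ z, pot p z * w 0 = 0 := fun z => by
    have h1 := (hw.d2 z).deriv
    rw [h, hc z] at h1
    rw [← h1]
    exact deriv_const z (0 : ℂ)
  have h0 : w 0 = 0 := by
    have e0 := hq 0
    have e1 := hq 1
    have e2 := hq 2
    simp only [pot] at e0 e1 e2
    have : 6 * w 0 = 0 := by linear_combination e2 - 2 * e1 + e0
    simpa using this
  exact funext fun z => (hc z).trans h0

lemma flux_lt {p : ℂ × ℂ} {w w' : ℂ → ℂ} (hw : IsSol (pot p) w w') (hne : w ≠ 0) (z₀ e α : ℂ)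
    (he : e ≠ 0) {t₀ t₁ : ℝ} (ht : t₀ < t₁)
    (h1 : ∀ t ∈ Set.Ioo t₀ t₁, 0 ≤ (α * e * pot p (z₀ + (t : ℝ) * e)).re) (h2 : 0 ≤ (α * conj e).re)
    (h3 : (∀ t ∈ Set.Ioo t₀ t₁, 0 < (α * e * pot p (z₀ + (t : ℝ) * e)).re) ∨ 0 < (α * conj e).re) :
    (α * fl w w' (z₀ + t₀ * e)).re < (α * fl w w' (z₀ + t₁ * e)).re := by
  by_contra! hcon
  set g : ℝ → ℝ := fun t => (α * fl w w' (z₀ + t * e)).re with hg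
  set D : ℝ → ℝ := fun t => (α * e * pot p (z₀ + t * e)).re * normSq (w (z₀ + t * e)) +
    (α * conj e).re * normSq (w' (z₀ + t * e)) with hD
  have hd : ∀ t, HasDerivAt g (D t) t := fun t => by
    have h := ((hasDerivAt_fl hw z₀ e t).const_mul α)
    have h' := (Complex.reCLM.hasFDerivAt (x := α * fl w w' (z₀ + t * e))).comp_hasDerivAt t h
    refine h'.congr_deriv ?_
    simp only [reCLM_apply, hD]
    rw [mul_add, ← mul_assoc, ← mul_assoc, ← mul_assoc, add_re, re_mul_ofReal, re_mul_ofReal]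
  have hD0 : ∀ t ∈ Set.Ioo t₀ t₁, 0 ≤ D t := fun t ht =>
    add_nonneg (mul_nonneg (h1 t ht) (normSq_nonneg _)) (mul_nonneg h2 (normSq_nonneg _))
  have hcont : Continuous g := continuous_iff_continuousAt.2 fun t => (hd t).continuousAt
  have hmono : MonotoneOn g (Set.Icc t₀ t₁) := by
    refine monotoneOn_of_hasDerivWithinAt_nonneg (convex_Icc _ _) hcont.continuousOn
      (fun t ht => (hd t).hasDerivWithinAt) (fun t ht => ?_)
    rw [interior_Icc] at ht
    exact hD0 t ht
  have hconst : ∀ t ∈ Set.Icc t₀ t₁, g t = g t₀ := fun t ht' =>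
    le_antisymm ((hmono ht' (Set.right_mem_Icc.2 ht.le) ht'.2).trans hcon)
      (hmono (Set.left_mem_Icc.2 ht.le) ht' ht'.1)
  have hDz : ∀ t ∈ Set.Ioo t₀ t₁, D t = 0 := fun t ht' => by
    have : HasDerivAt g 0 t := by
      refine (hasDerivAt_const t (g t₀)).congr_of_eventuallyEq ?_
      filter_upwards [Ioo_mem_nhds ht'.1 ht'.2] with s hs
      exact hconst s (Set.Ioo_subset_Icc_self hs)
    exact (hd t).unique this
  rcases h3 with h3 | h3
  · refine hne (eq_zero_of_line (z₀ := z₀) hw.differentiable he ht fun t ht' => ?_)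
    have := hDz t ht'
    simp only [hD] at this
    have h5 := (add_eq_zero_iff_of_nonneg (mul_nonneg (h1 t ht') (normSq_nonneg _))
      (mul_nonneg h2 (normSq_nonneg _))).1 this
    exact normSq_eq_zero.1 ((mul_eq_zero.1 h5.1).resolve_left (h3 t ht').ne')
  · refine hne (isSol_pot_eq_zero' hw (eq_zero_of_line (z₀ := z₀) hw.differentiable' he ht fun t ht' => ?_))
    have := hDz t ht'
    simp only [hD] at this
    have h5 := (add_eq_zero_iff_of_nonneg (mul_nonneg (h1 t ht') (normSq_nonneg _))
      (mul_nonneg h2 (normSq_nonneg _))).1 this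
    exact normSq_eq_zero.1 ((mul_eq_zero.1 h5.2).resolve_left h3.ne')

lemma flux_neg {p : ℂ × ℂ} {w w' : ℂ → ℂ} (hw : IsSol (pot p) w w') (hne : w ≠ 0) (z₀ e α : ℂ)
    (he : e ≠ 0) {t₀ : ℝ}
    (h1 : ∀ t > t₀, 0 ≤ (α * e * pot p (z₀ + (t : ℝ) * e)).re) (h2 : 0 ≤ (α * conj e).re)
    (h3 : (∀ t > t₀, 0 < (α * e * pot p (z₀ + (t : ℝ) * e)).re) ∨ 0 < (α * conj e).re)
    (hl : Tendsto (fun t : ℝ => w (z₀ + t * e)) atTop (𝓝 0))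
    (hl' : Tendsto (fun t : ℝ => w' (z₀ + t * e)) atTop (𝓝 0)) :
    (α * fl w w' (z₀ + t₀ * e)).re < 0 := by
  have hlt : ∀ s t : ℝ, t₀ ≤ s → s < t →
      (α * fl w w' (z₀ + s * e)).re < (α * fl w w' (z₀ + t * e)).re := fun s t h0 hst =>
    flux_lt hw hne z₀ e α he hst (fun t ht => h1 t (h0.trans_lt ht.1)) h2
      (h3.imp_left fun h t ht => h t (h0.trans_lt ht.1))
  have hlim : Tendsto (fun t : ℝ => (α * fl w w' (z₀ + t * e)).re) atTop (𝓝 0) := by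
    have h5 := (hl'.mul ((continuous_conj.tendsto _).comp hl)).const_mul α
    simpa [fl, Function.comp_def] using (continuous_re.tendsto _).comp h5
  have h6 : (α * fl w w' (z₀ + (t₀ + 1 : ℝ) * e)).re ≤ 0 := by
    refine ge_of_tendsto hlim ?_
    filter_upwards [eventually_gt_atTop (t₀ + 1)] with t ht
    exact (hlt _ t (by linarith) ht).le
  exact (hlt t₀ (t₀ + 1) le_rfl (by linarith)).trans_le h6

lemma pot_rp_re_im (a l x y : ℝ) : pot (rp (a, l)) (x + y * I) =
    ((x ^ 3 - 3 * x * y ^ 2 - a * x + l : ℝ) : ℂ) + (y * (3 * x ^ 2 - y ^ 2 - a) : ℝ) * I := by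
  simp only [pot, rp]
  push_cast
  linear_combination (3 * x * y ^ 2 + y ^ 3 * I : ℂ) * I_sq

lemma fl_eq_zero {w w' : ℂ → ℂ} {z : ℂ} (h : w z = 0) : fl w w' z = 0 := by simp [fl, h]

lemma Y1_conj_rp (p : ℝ × ℝ) (z : ℂ) : Y1 (rp p) (conj z) = conj (Ym (rp p) z) ∧
    Y1' (rp p) (conj z) = conj (Ym' (rp p) z) := by
  have := Y1_conj (rp p) z
  rwa [cj_rp] at this

lemma ofReal_cc_rp (p : ℝ × ℝ) : (((cc (rp p)).re : ℝ) : ℂ) = cc (rp p) := by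
  have := cc_conj (rp p)
  rw [cj_rp] at this
  exact conj_eq_iff_re.1 this.symm

/-- Flux through the real axis. -/
lemma fl_Y1_real (p : ℝ × ℝ) (x : ℝ) : (fl (Y1 (rp p)) (Y1' (rp p)) x).im = -2 * (cc (rp p)).re := by
  have h := wr_Ym_Y1 (rp p) x
  have h1 := (Y1_conj_rp p x).1
  have h2 := (Y1_conj_rp p x).2
  rw [conj_ofReal] at h1 h2
  have h1' : Ym (rp p) x = conj (Y1 (rp p) x) := by rw [h1, conj_conj]
  have h2' : Ym' (rp p) x = conj (Y1' (rp p) x) := by rw [h2, conj_conj]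
  rw [wr, h1', h2', ← ofReal_cc_rp] at h
  have h3 := congrArg im h
  simp [mul_im] at h3
  simp only [fl, mul_im, conj_re, conj_im]
  linarith

/-- Vertical flux of `Y1` on the critical line. -/
lemma fl_Y1_crit (m l s : ℝ) (hs : 0 ≤ s) :
    (fl (Y1 (rp (3 * m ^ 2, l))) (Y1' (rp (3 * m ^ 2, l))) (m + s * I)).re < 0 := by
  have h := flux_neg (isSol_Y1 (rp (3 * m ^ 2, l))) (Y1_ne_zero _) m I 1 I_ne_zero (t₀ := s)
  simp only [one_mul, pot_rp_re_im] at h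
  have e : ∀ t : ℝ, s < t → 0 < (I * (((m ^ 3 - 3 * m * t ^ 2 - 3 * m ^ 2 * m + l : ℝ) : ℂ) +
      (t * (3 * m ^ 2 - t ^ 2 - 3 * m ^ 2) : ℝ) * I)).re := fun t ht => by
    have : 0 < t ^ 3 := pow_pos (hs.trans_lt ht) 3
    rw [I_mul_re, add_im, ofReal_im, im_ofReal_mul, I_im]
    linarith
  exact h (fun t ht => (e t ht).le) (by simp) (Or.inl e) (Y1_vert _ _).1 (Y1_vert _ _).2

lemma Y1_crit_ne_zero (m l s : ℝ) (hs : 0 ≤ s) : Y1 (rp (3 * m ^ 2, l)) (m + s * I) ≠ 0 := fun h => by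
  have := fl_Y1_crit m l s hs
  rw [fl_eq_zero h] at this
  simp at this

/-- The spectral determinant is negative below the critical value. -/
lemma cc_neg {m E : ℝ} (hm : 0 ≤ m) (hE : E ≤ 0) : (cc (rp (3 * m ^ 2, 2 * m ^ 3 + E))).re < 0 := by
  set l := 2 * m ^ 3 + E with hl
  have h := flux_neg (isSol_Y1 (rp (3 * m ^ 2, l))) (Y1_ne_zero _) m I I I_ne_zero (t₀ := 0)
  simp only [pot_rp_re_im, I_mul_I] at h
  have h' := h (fun t ht => by
    rw [neg_one_mul, neg_re, add_re, re_ofReal_mul, I_re, ofReal_re]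
    have : 0 ≤ m * t ^ 2 := by positivity
    nlinarith) (by simp) (Or.inr (by simp)) (Y1_vert _ _).1 (Y1_vert _ _).2
  rw [ofReal_zero, zero_mul, add_zero, I_mul_re, fl_Y1_real] at h'
  linarith

/-- Zeros in the upper half-plane lie inside a hyperbola. -/
lemma Y1_zero_hyperbola {a l x y : ℝ} (hy : 0 < y) (hz : Y1 (rp (a, l)) (x + y * I) = 0) :
    y ^ 2 < 3 * x ^ 2 - a := by
  by_contra! hcon
  have h := flux_neg (isSol_Y1 (rp (a, l))) (Y1_ne_zero _) x I 1 I_ne_zero (t₀ := y)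
  simp only [one_mul, pot_rp_re_im] at h
  have e : ∀ t : ℝ, y < t → 0 < (I * (((x ^ 3 - 3 * x * t ^ 2 - a * x + l : ℝ) : ℂ) +
      (t * (3 * x ^ 2 - t ^ 2 - a) : ℝ) * I)).re := fun t ht => by
    rw [I_mul_re, add_im, ofReal_im, im_ofReal_mul, I_im]
    have : 0 < t * (t ^ 2 + a - 3 * x ^ 2) := mul_pos (by linarith) (by nlinarith)
    linarith
  have hneg := h (fun t ht => (e t ht).le) (by simp) (Or.inl e) (Y1_vert _ _).1 (Y1_vert _ _).2
  rw [fl_eq_zero hz] at hneg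
  simp at hneg

/-- No zeros in the closed left half-plane off the real axis, case `0 ≤ a`, `0 < l`. -/
lemma Y1_zero_re_pos {a l x y : ℝ} (ha : 0 ≤ a) (hl : 0 < l) (hc : cc (rp (a, l)) = 0) (hy : 0 < y)
    (hz : Y1 (rp (a, l)) (x + y * I) = 0) : 0 < x := by
  by_contra! hx
  have hne := Y1_ne_zero (rp (a, l))
  have hs := isSol_Y1 (rp (a, l))
  by_cases hP : x ^ 3 - 3 * x * y ^ 2 - a * x + l ≤ 0
  · have h := flux_lt hs hne x I I I_ne_zero hy
    simp only [pot_rp_re_im, I_mul_I] at h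
    have h' := h (fun t ht => by
      rw [neg_one_mul, neg_re, add_re, re_ofReal_mul, I_re, ofReal_re]
      have h1 : t ^ 2 ≤ y ^ 2 := by nlinarith [ht.1, ht.2]
      nlinarith) (by simp) (Or.inr (by simp))
    rw [fl_eq_zero hz, ofReal_zero, zero_mul, add_zero, I_mul_re, fl_Y1_real, hc] at h'
    simp at h'
  · push Not at hP
    have hA : (fl (Y1 (rp (a, l))) (Y1' (rp (a, l))) (0 + y * I)).re < 0 := by
      have h := flux_neg hs hne (0 : ℝ) I 1 I_ne_zero (t₀ := y)
      simp only [one_mul, pot_rp_re_im] at h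
      have e : ∀ t : ℝ, y < t → 0 < (I * (((0 ^ 3 - 3 * 0 * t ^ 2 - a * 0 + l : ℝ) : ℂ) +
          (t * (3 * 0 ^ 2 - t ^ 2 - a) : ℝ) * I)).re := fun t ht => by
        rw [I_mul_re, add_im, ofReal_im, im_ofReal_mul, I_im]
        have : 0 < t * (t ^ 2 + a) := mul_pos (by linarith) (by nlinarith)
        linarith
      have h' := h (fun t ht => (e t ht).le) (by simp) (Or.inl e) (Y1_vert _ _).1 (Y1_vert _ _).2
      simpa using h'
    have hle : (fl (Y1 (rp (a, l))) (Y1' (rp (a, l))) (x + y * I)).re ≤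
        (fl (Y1 (rp (a, l))) (Y1' (rp (a, l))) (0 + y * I)).re := by
      rcases hx.lt_or_eq with hx | hx
      · have h := flux_lt hs hne (y * I) 1 1 one_ne_zero hx
        simp only [one_mul, mul_one, add_comm (y * I : ℂ), pot_rp_re_im, map_one, one_re] at h
        have h' := h (fun t ht => by
          rw [add_re, re_ofReal_mul, I_re, ofReal_re]
          have h1 : 0 < t - x := by linarith [ht.1]
          have h2 : 0 < -t := by linarith [ht.2]
          have e1 : -x * (t ^ 3 - 3 * t * y ^ 2 - a * t + l) =
            -t * (x ^ 3 - 3 * x * y ^ 2 - a * x + l) + (t - x) * l + (-x) * (-t) * (t - x) * (-(t + x)) := by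
            ring
          have e2 : 0 < -x * (t ^ 3 - 3 * t * y ^ 2 - a * t + l) := by
            rw [e1]
            have := mul_pos h2 hP
            have := mul_pos h1 hl
            have : 0 < (-x) * (-t) * (t - x) * (-(t + x)) :=
              mul_pos (mul_pos (mul_pos (by linarith) h2) h1) (by linarith)
            linarith
          exact (add_pos_of_pos_of_nonneg (pos_of_mul_pos_right e2 (by linarith)) (by simp)).le)
          (by norm_num) (Or.inr (by norm_num))
        simpa using h'.le
      · simp [hx]
    rw [fl_eq_zero hz] at hle
    simp only [zero_re] at hle
    linarith

/-- Vertical exclusion of zeros on the spectral locus. -/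
lemma Y1_ne_zero_of_re_pot {a l x y : ℝ} (hc : cc (rp (a, l)) = 0) (hy : 0 < y)
    (hP : ∀ t ∈ Set.Ioo 0 y, x ^ 3 - 3 * x * t ^ 2 - a * x + l ≤ 0) :
    Y1 (rp (a, l)) (x + y * I) ≠ 0 := fun hz => by
  have h := flux_lt (isSol_Y1 (rp (a, l))) (Y1_ne_zero _) x I I I_ne_zero hy
  simp only [pot_rp_re_im, I_mul_I] at h
  have h' := h (fun t ht => by
    rw [neg_one_mul, neg_re, add_re, re_ofReal_mul, I_re, ofReal_re]
    have := hP t ht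
    linarith) (by simp) (Or.inr (by simp))
  rw [fl_eq_zero hz, ofReal_zero, zero_mul, add_zero, I_mul_re, fl_Y1_real, hc] at h'
  simp at h'

lemma wkb_ofReal (a : ℝ) {x : ℝ} (hx : 0 < x) : ∃ r : ℝ, 0 < r ∧ wkb a x = r :=
  ⟨Real.exp (-(2 / 5) * √x ^ 5 + a * √x - 3 / 4 * Real.log x), Real.exp_pos _, by
    rw [wkb, rt_ofReal hx, ← ofReal_log hx.le]; push_cast; rfl⟩

lemma wkbp_ofReal (a : ℝ) {x : ℝ} (hx : 0 < x) : ∃ r : ℝ, 0 < r ∧ wkbp a x = r :=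
  ⟨Real.exp (2 / 5 * √x ^ 5 - a * √x - 3 / 4 * Real.log x), Real.exp_pos _, by
    rw [wkbp, rt_ofReal hx, ← ofReal_log hx.le]; push_cast; rfl⟩

lemma re_pos_of_div {z : ℂ} {r : ℝ} (hr : 0 < r) (h : ‖z / r - 1‖ < 1) : 0 < z.re := by
  have h1 := (abs_re_le_norm (z / r - 1)).trans_lt h
  rw [sub_re, one_re, div_ofReal_re, abs_lt] at h1
  have h2 : 0 < z.re / r := by linarith [h1.1]
  exact (div_pos_iff_of_pos_right hr).1 h2

lemma div_sqrt_eventually_lt (K : ℝ) : ∀ᶠ x : ℝ in atTop, K / √x < 1 :=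
  (tendsto_const_nhds.div_atTop Real.tendsto_sqrt_atTop).eventually (gt_mem_nhds one_pos)

lemma Y0_re_pos_eventually (p : ℝ × ℝ) : ∀ᶠ x : ℝ in atTop, 0 < (Y0 (rp p) x).re := by
  obtain ⟨R, K, hR, hK, h⟩ := Y0_asymp (max ‖(rp p).1‖ ‖(rp p).2‖)
  filter_upwards [eventually_ge_atTop R, div_sqrt_eventually_lt K] with x hx hKx
  have hx0 : 0 < x := by linarith
  have hn : ‖(x : ℂ)‖ = x := by simp [abs_of_pos hx0]
  have h1 := (h (rp p) (le_max_left _ _) (le_max_right _ _) x hx0.le (by rwa [hn])).1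
  obtain ⟨r, hr, hw⟩ := wkb_ofReal p.1 hx0
  rw [hq, show (rp p).1 = (p.1 : ℂ) from rfl, hw, hn] at h1
  exact re_pos_of_div hr (h1.trans_lt hKx)

lemma Y1_re_pos_eventually (p : ℝ × ℝ) : ∀ᶠ x : ℝ in atTop, 0 < (Y1 (rp p) x).re := by
  obtain ⟨R, K, hR, hK, h⟩ := Y1_asymp (max ‖(rp p).1‖ ‖(rp p).2‖)
  filter_upwards [eventually_ge_atTop R, div_sqrt_eventually_lt K] with x hx hKx
  have hx0 : 0 < x := by linarith
  have hn : ‖(x : ℂ)‖ = x := by simp [abs_of_pos hx0]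
  have h1 := (h (rp p) (le_max_left _ _) (le_max_right _ _) x
    (by rw [arg_ofReal_of_nonneg hx0.le]; linarith [Real.pi_pos])
    (by rw [om_pow_four_mul_re]; simpa using mul_nonneg cos_om_pos.le hx0.le) (by rwa [hn])).1
  obtain ⟨r, hr, hw⟩ := wkbp_ofReal p.1 hx0
  rw [show (rp p).1 = (p.1 : ℂ) from rfl, hw, hn] at h1
  exact re_pos_of_div hr (h1.trans_lt hKx)

lemma Y0_real_im (p : ℝ × ℝ) (x : ℝ) : (Y0 (rp p) x).im = 0 := by
  have := (Y0_cj (rp p) x).1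
  rw [cj_rp, conj_ofReal] at this
  exact conj_eq_iff_im.1 this.symm

lemma continuous_re_line {w w' Q : ℂ → ℂ} (hw : IsSol Q w w') :
    Continuous fun x : ℝ => (w x).re :=
  continuous_re.comp (hw.differentiable.continuous.comp continuous_ofReal)

lemma pos_of_ne_zero_of_eventually {g : ℝ → ℝ} (hg : Continuous g) {x₀ : ℝ}
    (hne : ∀ x, x₀ ≤ x → g x ≠ 0) (hpos : ∀ᶠ x in atTop, 0 < g x) : 0 < g x₀ := by
  obtain ⟨X, h1, h2⟩ := (hpos.and (eventually_ge_atTop x₀)).exists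
  by_contra! h
  obtain ⟨c, hc, hc0⟩ := intermediate_value_Icc h2 hg.continuousOn ⟨h, h1.le⟩
  exact hne c hc.1 hc0

lemma pot_real (a l x : ℝ) : pot (rp (a, l)) x = ((x ^ 3 - a * x + l : ℝ) : ℂ) := by
  simp [pot, rp]

lemma pot_crit (m E u : ℝ) :
    pot (rp (3 * m ^ 2, 2 * m ^ 3 + E)) ((m + u : ℝ) : ℂ) = ((u ^ 3 + 3 * m * u ^ 2 + E : ℝ) : ℂ) := by
  rw [pot_real]; congr 1; ring

lemma pot_crit_nonneg {m E x t : ℝ} (hm : 0 ≤ m) (hE : 0 ≤ E) (hx : m ≤ x) (ht : 0 ≤ t) :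
    0 ≤ (1 * 1 * pot (rp (3 * m ^ 2, 2 * m ^ 3 + E)) ((x : ℂ) + (t : ℝ) * 1)).re := by
  have := pot_crit m E (x + t - m)
  rw [show ((m + (x + t - m) : ℝ) : ℂ) = (x : ℂ) + (t : ℝ) * 1 by push_cast; ring] at this
  rw [this, one_mul, one_mul, ofReal_re]
  have : 0 ≤ x + t - m := by linarith
  positivity

lemma Y0_ne_zero (p : ℂ × ℂ) : Y0 p ≠ 0 := fun h => by
  have h1 := wr_Y0_Y1 p 0
  have h2 : Y0' p 0 = 0 := by
    rw [← (isSol_Y0 p).deriv_eq, h]; exact deriv_const (0 : ℂ) (0 : ℂ)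
  rw [wr, h, h2] at h1
  simp at h1

/-- The subdominant solution is positive to the right of the critical point. -/
lemma Y0_pos {m E : ℝ} (hm : 0 ≤ m) (hE : 0 ≤ E) :
    0 < (Y0 (rp (3 * m ^ 2, 2 * m ^ 3 + E)) m).re := by
  refine pos_of_ne_zero_of_eventually (continuous_re_line (isSol_Y0 _)) (fun x hx h0 => ?_)
    (Y0_re_pos_eventually _)
  have h1 := flux_neg (isSol_Y0 (rp (3 * m ^ 2, 2 * m ^ 3 + E))) (Y0_ne_zero _) x 1 1 one_ne_zero
    (t₀ := 0) (fun t ht => pot_crit_nonneg hm hE hx ht.le) (by simp) (Or.inr (by simp))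
    (by simpa using (Y0_horiz _ _).1) (by simpa using (Y0_horiz _ _).2)
  rw [fl_eq_zero] at h1
  · simp at h1
  · simpa using Complex.ext h0 (Y0_real_im _ x)

lemma Y1_real_im (p : ℝ × ℝ) (x : ℝ) :
    (Y1 (rp p) x).im = (cc (rp p)).re * (Y0 (rp p) x).re := by
  have h1 := (Y1_sub_Ym (rp p) x).1
  have h2 := (Y1_conj_rp p x).1
  rw [conj_ofReal] at h2
  rw [show Ym (rp p) x = conj (Y1 (rp p) x) by rw [h2, conj_conj], ← ofReal_cc_rp] at h1
  have h3 := congrArg im h1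
  simp [mul_im, Y0_real_im] at h3
  linarith

lemma Y1_real_ne_zero {p : ℝ × ℝ} (hc : (cc (rp p)).re ≠ 0) (x : ℝ) : Y1 (rp p) x ≠ 0 := fun h => by
  have := fl_Y1_real p x
  rw [fl_eq_zero h, zero_im] at this
  exact hc (by linarith)

lemma Y1_zero_unique {m E x y : ℝ} (hm : 0 ≤ m) (hE : 0 ≤ E) (hx : m ≤ x)
    (h1 : Y1 (rp (3 * m ^ 2, 2 * m ^ 3 + E)) x = 0) (h2 : Y1 (rp (3 * m ^ 2, 2 * m ^ 3 + E)) y = 0) :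
    y ≤ x := by
  by_contra! hxy
  have h := flux_lt (isSol_Y1 (rp (3 * m ^ 2, 2 * m ^ 3 + E))) (Y1_ne_zero _) x 1 1 one_ne_zero
    (t₀ := 0) (t₁ := y - x) (by linarith) (fun t ht => pot_crit_nonneg hm hE hx ht.1.le)
    (by simp) (Or.inr (by simp))
  rw [fl_eq_zero (by simpa using h1), fl_eq_zero (by simpa using h2)] at h
  simp at h

section eigen
variable {m E : ℝ}

lemma Y1_real_im_zero {p : ℝ × ℝ} (hc : cc (rp p) = 0) (x : ℝ) : (Y1 (rp p) x).im = 0 := by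
  rw [Y1_real_im, hc]; simp

lemma Y1'_ne_zero_of_zero {p : ℂ × ℂ} {z : ℂ} (h : Y1 p z = 0) : Y1' p z ≠ 0 := fun hd =>
  Y1_ne_zero p (isSol_pot_eq_zero (isSol_Y1 p) h hd)

/-- If the eigenfunction is positive at the critical point it has no zero to its right. -/
lemma Y1_no_real_zero (hm : 0 ≤ m) (hE : 0 ≤ E) (hc : cc (rp (3 * m ^ 2, 2 * m ^ 3 + E)) = 0)
    (h0 : 0 < (Y1 (rp (3 * m ^ 2, 2 * m ^ 3 + E)) m).re) {x : ℝ} (hx : m ≤ x) :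
    Y1 (rp (3 * m ^ 2, 2 * m ^ 3 + E)) x ≠ 0 := fun hz => by
  set p := rp (3 * m ^ 2, 2 * m ^ 3 + E) with hp
  have hcont : Continuous fun x : ℝ => (Y1 p x).re := continuous_re_line (isSol_Y1 p)
  have hmx : m < x := hx.lt_of_ne fun h => by rw [h, hz] at h0; simp at h0
  have hnz : ∀ y : ℝ, m ≤ y → y ≠ x → (Y1 p y).re ≠ 0 := fun y hy hyx h => by
    have hy0 : Y1 p y = 0 := Complex.ext h (Y1_real_im_zero hc y)
    exact hyx (le_antisymm (Y1_zero_unique hm hE hx hz hy0) (Y1_zero_unique hm hE hy hy0 hz))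
  have hloc : IsLocalMin (fun x : ℝ => (Y1 p x).re) x := by
    filter_upwards [lt_mem_nhds hmx] with y hy
    simp only [hz, zero_re]
    by_contra! hneg
    rcases lt_trichotomy y x with h | h | h
    · obtain ⟨c, hc, hc0⟩ := intermediate_value_Icc' hy.le hcont.continuousOn ⟨hneg.le, h0.le⟩
      exact hnz c hc.1 (by linarith [hc.2]) hc0
    · rw [h, hz] at hneg; simp at hneg
    · exact lt_asymm hneg (pos_of_ne_zero_of_eventually hcont
        (fun c hc => hnz c (hy.le.trans hc) (by linarith)) (Y1_re_pos_eventually _))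
  have hd : HasDerivAt (fun x : ℝ => Y1 p x) (Y1' p x) x := by
    simpa using hasDerivAt_line (isSol_Y1 p).d1 0 1 x
  have hre := (reCLM.hasFDerivAt (x := Y1 p x)).comp_hasDerivAt x hd
  have him := (imCLM.hasFDerivAt (x := Y1 p x)).comp_hasDerivAt x hd
  have e1 : (Y1' p x).re = 0 := hloc.hasDerivAt_eq_zero hre
  have e2 : (Y1' p x).im = 0 := by
    have : HasDerivAt (imCLM ∘ fun x : ℝ => Y1 p x) 0 x := by
      rw [show (imCLM ∘ fun x : ℝ => Y1 p x) = fun _ => (0 : ℝ) from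
        funext fun x => Y1_real_im_zero hc x]
      exact hasDerivAt_const x 0
    exact him.unique this
  exact Y1'_ne_zero_of_zero hz (Complex.ext e1 e2)

/-- If the eigenfunction is negative at the critical point it has a zero to its right. -/
lemma Y1_real_zero (hc : cc (rp (3 * m ^ 2, 2 * m ^ 3 + E)) = 0)
    (h0 : (Y1 (rp (3 * m ^ 2, 2 * m ^ 3 + E)) m).re < 0) :
    ∃ x : ℝ, m < x ∧ Y1 (rp (3 * m ^ 2, 2 * m ^ 3 + E)) x = 0 := by
  set p := rp (3 * m ^ 2, 2 * m ^ 3 + E) with hp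
  by_contra! h
  have := pos_of_ne_zero_of_eventually (continuous_re_line (isSol_Y1 p)) (x₀ := m) (fun x hx h1 => ?_)
    (Y1_re_pos_eventually _)
  · exact lt_asymm h0 this
  · rcases hx.eq_or_lt with hx | hx
    · rw [← hx] at h1; exact h0.ne h1
    · exact h x hx (Complex.ext h1 (Y1_real_im_zero hc x))
end eigen

section base
variable {m : ℝ}

lemma pot_base (m : ℝ) (u : ℂ) : pot (rp (3 * m ^ 2, 2 * m ^ 3 + 0)) (m + u) = u ^ 3 + 3 * m * u ^ 2 := by
  simp only [pot, rp]; push_cast; ring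

/-- The direction `exp (iπ/3)`. -/
noncomputable def e60 : ℂ := exp ((Real.pi / 3 : ℝ) * I)

lemma e60_eq : e60 = ((1 / 2 : ℝ) : ℂ) + (√3 / 2 : ℝ) * I := by
  rw [e60, exp_mul_I, ← ofReal_cos, ← ofReal_sin, Real.cos_pi_div_three, Real.sin_pi_div_three]

lemma Y1_ray60 (p : ℂ × ℂ) (z : ℂ) : Tendsto (fun s : ℝ => Y1 p (z + s * e60)) atTop (𝓝 0) ∧
    Tendsto (fun s : ℝ => Y1' p (z + s * e60)) atTop (𝓝 0) := by
  obtain ⟨h1, h2⟩ := Y0_decay (rotp 1 p)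
  have harg : arg (om ^ 4 * e60) = -(Real.pi / 15) := by
    have : om ^ 4 * e60 = exp ((-(Real.pi / 15) : ℝ) * I) := by
      rw [om, ← exp_nat_mul, e60, ← exp_add, exp_eq_exp_iff_exists_int]
      exact ⟨1, by push_cast; ring⟩
    rw [this, arg_exp_mul_I, toIocMod_eq_self]
    constructor <;> linarith [Real.pi_pos]
  have hv := tendsto_ray_cone (om ^ 4 * z) (e := om ^ 4 * e60)
    (by
      rw [mem_slitPlane_iff_arg, harg]
      exact ⟨by linarith [Real.pi_pos], mul_ne_zero (pow_ne_zero _ om_ne_zero) (exp_ne_zero _)⟩)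
    (by rw [harg, abs_neg, abs_of_pos (by linarith [Real.pi_pos])]; linarith [Real.pi_pos])
  have hv' : Tendsto (fun s : ℝ => om ^ 4 * (z + s * e60)) atTop cone := by
    refine hv.congr fun s => ?_
    ring
  constructor
  · simp only [fun s : ℝ => (Y1_eq_Y0 p (z + s * e60)).1]
    simpa using (h1.comp hv').const_mul ph⁻¹
  · simp only [fun s : ℝ => (Y1_eq_Y0 p (z + s * e60)).2]
    simpa using ((h2.comp hv').const_mul (om ^ 4)).const_mul ph⁻¹

lemma ray60_flux (hm : 0 ≤ m) {x y : ℝ} (h0 : 0 ≤ x) (h1 : x ≤ √3 * y) (h2 : y ≤ √3 * x) :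
    √3 * (fl (Y1 (rp (3 * m ^ 2, 2 * m ^ 3 + 0))) (Y1' (rp (3 * m ^ 2, 2 * m ^ 3 + 0)))
        (m + (x + y * I))).re +
      (fl (Y1 (rp (3 * m ^ 2, 2 * m ^ 3 + 0))) (Y1' (rp (3 * m ^ 2, 2 * m ^ 3 + 0)))
        (m + (x + y * I))).im > 0 := by
  set p := rp (3 * m ^ 2, 2 * m ^ 3 + 0) with hp
  have h3 : √3 ^ 2 = 3 := Real.sq_sqrt (by norm_num)
  have h30 : 0 < √3 := by positivity
  have key := flux_neg (isSol_Y1 p) (Y1_ne_zero _) (m + (x + y * I)) e60 (-√3 + I)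
    (exp_ne_zero _) (t₀ := 0)
  have hpos : ∀ t : ℝ, 0 < t → 0 < ((-√3 + I) * e60 * pot p (m + (x + y * I) + t * e60)).re := by
    intro t ht
    rw [add_assoc, hp, pot_base]
    set X := x + t / 2 with hX
    set Y := y + t * √3 / 2 with hY
    have hu : (x : ℂ) + y * I + t * e60 = X + Y * I := by
      rw [e60_eq, hX, hY]; push_cast; ring
    have hX0 : 0 < X := by linarith
    have hXY : X < √3 * Y := by rw [hX, hY]; nlinarith
    have hYX : Y ≤ √3 * X := by rw [hX, hY]; nlinarith
    have hY0 : 0 < Y := pos_of_mul_pos_right (hX0.trans hXY) h30.le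
    rw [hu, e60_eq]
    clear_value X Y
    have e : ((-√3 + I) * (((1 / 2 : ℝ) : ℂ) + (√3 / 2 : ℝ) * I) *
        ((X + Y * I) ^ 3 + 3 * m * (X + Y * I) ^ 2)).re =
        (3 * X ^ 2 * Y - Y ^ 3 - √3 * (X ^ 3 - 3 * X * Y ^ 2)) +
        3 * m * (2 * X * Y - √3 * (X ^ 2 - Y ^ 2)) := by
      simp [pow_succ, mul_re, mul_im, -mul_eq_mul_left_iff]
      linear_combination (3 * X ^ 2 * Y - Y ^ 3 + 3 * m * 2 * X * Y) / 2 * h3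
    rw [e]
    have a1 : 2 * X * Y - √3 * (X ^ 2 - Y ^ 2) = (√3 * Y - X) * (Y + √3 * X) := by
      linear_combination (-(X * Y)) * h3
    have a2 : 3 * X ^ 2 * Y - Y ^ 3 - √3 * (X ^ 3 - 3 * X * Y ^ 2) =
        (√3 * X - Y) * Y ^ 2 + (√3 * Y - X) * √3 * X ^ 2 + 2 * √3 * X * Y ^ 2 := by
      linear_combination (-(X ^ 2 * Y)) * h3
    have b1 := mul_pos (sub_pos.2 hXY) (show 0 < Y + √3 * X by positivity)
    have b2 : 0 ≤ (√3 * X - Y) * Y ^ 2 := mul_nonneg (by linarith) (by positivity)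
    have b3 : 0 ≤ (√3 * Y - X) * √3 * X ^ 2 :=
      mul_nonneg (mul_nonneg (by linarith) h30.le) (by positivity)
    have b4 : 0 < 2 * √3 * X * Y ^ 2 := by positivity
    rw [a1, a2]
    have b5 : 0 ≤ 3 * m * ((√3 * Y - X) * (Y + √3 * X)) := mul_nonneg (by linarith) b1.le
    linarith
  have hk := key (fun t ht => (hpos t ht).le) (by
    rw [e60_eq, map_add, map_mul, conj_ofReal, conj_ofReal, conj_I]
    simp only [mul_re, add_re, add_im, neg_re, neg_im, ofReal_re, ofReal_im, I_re, I_im, mul_im]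
    linarith) (Or.inl hpos) (Y1_ray60 _ _).1 (Y1_ray60 _ _).2
  simp [mul_re] at hk
  linarith

/-- At the bottom of the energy range there are no zeros in the quarter plane. -/
lemma Y1_base (hm : 0 ≤ m) {x y : ℝ} (hx : 0 < x) (hy : 0 < y) :
    Y1 (rp (3 * m ^ 2, 2 * m ^ 3 + 0)) (m + (x + y * I)) ≠ 0 := fun hz => by
  have h3 : √3 ^ 2 = 3 := Real.sq_sqrt (by norm_num)
  have h30 : 0 < √3 := by positivity
  by_cases hA : √3 * x < y
  · have h := flux_neg (isSol_Y1 (rp (3 * m ^ 2, 2 * m ^ 3 + 0))) (Y1_ne_zero _) (m + x) I I I_ne_zero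
      (t₀ := y) (fun t ht => ?_) (by simp) (Or.inr (by simp)) (Y1_vert _ _).1 (Y1_vert _ _).2
    · rw [add_assoc, fl_eq_zero hz] at h
      simp at h
    · rw [add_assoc, pot_base, I_mul_I, neg_one_mul, neg_re]
      have e : (((x : ℂ) + t * I) ^ 3 + 3 * m * (x + t * I) ^ 2).re =
          x * (x ^ 2 - 3 * t ^ 2) + 3 * m * (x ^ 2 - t ^ 2) := by
        simp [pow_succ, mul_re, mul_im, -mul_eq_mul_left_iff]
        ring
      rw [e]
      have h1 := mul_self_lt_mul_self (by positivity) (hA.trans ht)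
      have h2 : 0 ≤ x * (3 * t ^ 2 - x ^ 2) := mul_nonneg hx.le (by nlinarith)
      have h4 : 0 ≤ 3 * m * (t ^ 2 - x ^ 2) := mul_nonneg (by positivity) (by nlinarith)
      linarith
  by_cases hB : x ≤ √3 * y
  · have := ray60_flux hm hx.le hB (not_lt.1 hA)
    rw [fl_eq_zero hz] at this
    simp at this
  push Not at hA hB
  set p := rp (3 * m ^ 2, 2 * m ^ 3 + 0) with hp
  have h00 := ray60_flux hm le_rfl (y := 0) (by simp) (by simp)
  have h01 := fl_Y1_crit m (2 * m ^ 3 + 0) 0 le_rfl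
  rw [← hp] at h00 h01
  simp only [ofReal_zero, zero_mul, add_zero] at h00 h01
  set g := fl (Y1 p) (Y1' p) m with hg
  set u : ℂ := x + y * I with hu
  have hu0 : u ≠ 0 := fun h => by
    have := congrArg re h
    simp [hu] at this
    exact hx.ne' this
  have key := flux_lt (isSol_Y1 p) (Y1_ne_zero _) m u (-I * u) hu0 (t₀ := 0) (t₁ := 1) one_pos
  have hpos : ∀ t ∈ Set.Ioo (0 : ℝ) 1, 0 < (-I * u * u * pot p (m + t * u)).re := by
    intro t ht
    rw [hp, pot_base]
    have e : (-I * u * u * ((t * u) ^ 3 + 3 * m * (t * u) ^ 2)).re =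
        t ^ 3 * (y * (5 * x ^ 2 * (x ^ 2 - 2 * y ^ 2) + y ^ 4)) +
          3 * m * t ^ 2 * (4 * x * y * (x ^ 2 - y ^ 2)) := by
      rw [hu]
      simp [pow_succ, mul_re, mul_im, -mul_eq_mul_left_iff]
      ring
    rw [e]
    have hq : 3 * y ^ 2 < x ^ 2 := by
      have := mul_self_lt_mul_self (by positivity) hB
      nlinarith
    have c1 : 0 < x ^ 2 - 2 * y ^ 2 := by nlinarith
    have c2 : 0 < x ^ 2 - y ^ 2 := by nlinarith
    have ht0 := ht.1
    positivity
  have hk := key (fun t ht => (hpos t ht).le) (by rw [mul_assoc, mul_conj]; simp) (Or.inl hpos)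
  rw [ofReal_one, one_mul, fl_eq_zero hz, ofReal_zero, zero_mul, add_zero, ← hg, hu] at hk
  simp [mul_re, mul_im] at hk
  nlinarith
end base

section localconst
variable {X : Type*} [TopologicalSpace X] {f f' : X → ℂ → ℂ}

/-- A simple zero persists uniquely in every small ball. -/
lemma simple_zero_persists (hd : ∀ x z, HasDerivAt (f x) (f' x z) z)
    (hc : Continuous fun q : X × ℂ => f q.1 q.2) (hc' : Continuous fun q : X × ℂ => f' q.1 q.2)
    {x₀ : X} {z₀ : ℂ} (h0 : f x₀ z₀ = 0) (h1 : f' x₀ z₀ ≠ 0) :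
    ∃ ε > 0, ∀ r, 0 < r → r ≤ ε → ∀ᶠ x in 𝓝 x₀,
      ∃ z ∈ Metric.ball z₀ r, f x z = 0 ∧ ∀ w ∈ Metric.ball z₀ r, f x w = 0 → w = z := by
  set d := f' x₀ z₀ with hdd
  have hd0 : 0 < ‖d‖ := norm_pos_iff.2 h1
  have hnear : ∀ᶠ q : X × ℂ in 𝓝 x₀ ×ˢ 𝓝 z₀, ‖f' q.1 q.2 - d‖ ≤ ‖d‖ / 2 := by
    rw [← nhds_prod_eq]
    have : ContinuousAt (fun q : X × ℂ => ‖f' q.1 q.2 - d‖) (x₀, z₀) :=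
      (hc'.sub continuous_const).norm.continuousAt
    refine this.eventually (ge_mem_nhds ?_)
    simpa [hdd] using h1
  obtain ⟨pa, ha, pb, hb, hab⟩ := eventually_prod_iff.1 hnear
  obtain ⟨ε, hε, hball⟩ := Metric.eventually_nhds_iff_ball.1 hb
  refine ⟨ε / 2, by positivity, fun r hr hrε => ?_⟩
  have hsmall : ∀ᶠ x in 𝓝 x₀, ‖f x z₀‖ < ‖d‖ * r / 8 := by
    have : ContinuousAt (fun x => ‖f x z₀‖) x₀ :=
      (hc.comp (Continuous.prodMk_left z₀)).norm.continuousAt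
    refine this.eventually (gt_mem_nhds ?_)
    simp only [h0, norm_zero]; positivity
  filter_upwards [ha, hsmall] with x hx hs
  have hlin : ∀ z ∈ Metric.ball z₀ ε, ∀ w ∈ Metric.ball z₀ ε,
      ‖d‖ / 2 * ‖w - z‖ ≤ ‖f x w - f x z‖ := by
    intro z hz w hw
    have h := Convex.norm_image_sub_le_of_norm_hasDerivWithin_le (s := Metric.ball z₀ ε)
      (f := fun z => f x z - d * z) (f' := fun z => f' x z - d) (C := ‖d‖ / 2)
      (fun z _ => ((hd x z).sub ((hasDerivAt_id z).const_mul d |>.congr_deriv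
        (mul_one d))).hasDerivWithinAt)
      (fun z hz => hab hx (hball z hz)) (convex_ball _ _) hz hw
    have e : d * (w - z) = (f x w - f x z) - ((f x w - d * w) - (f x z - d * z)) := by ring
    have h2 := norm_sub_le (f x w - f x z) ((f x w - d * w) - (f x z - d * z))
    rw [← e, norm_mul] at h2
    linarith
  have hz₀ : z₀ ∈ Metric.ball z₀ ε := Metric.mem_ball_self hε
  have hinj : ∀ z ∈ Metric.ball z₀ ε, ∀ w ∈ Metric.ball z₀ ε, f x w = f x z → w = z := by
    intro z hz w hw h
    have := hlin z hz w hw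
    rw [h, sub_self, norm_zero] at this
    have h3 : ‖w - z‖ ≤ 0 := by
      by_contra! h4
      have : 0 < ‖d‖ / 2 * ‖w - z‖ := by positivity
      linarith
    exact sub_eq_zero.1 (norm_le_zero_iff.1 h3)
  have hsub : Metric.ball z₀ r ⊆ Metric.ball z₀ ε := Metric.ball_subset_ball (by linarith)
  have himg := DiffContOnCl.ball_subset_image_closedBall (f := f x) (z₀ := z₀) (r := r / 2)
    (ε := ‖d‖ * r / 4)
    (Differentiable.diffContOnCl fun z => (hd x z).differentiableAt) (by positivity)
    (fun z hz => by
      have hz' : ‖z - z₀‖ = r / 2 := by rw [← dist_eq_norm]; exact hz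
      have := hlin z₀ hz₀ z (by rw [Metric.mem_ball, dist_eq_norm, hz']; linarith)
      rw [hz'] at this
      linarith)
    (by
      apply Eventually.frequently (f := 𝓝[≠] z₀) _ |>.filter_mono inf_le_left
      have : Metric.ball z₀ ε ∈ 𝓝[≠] z₀ := nhdsWithin_le_nhds (Metric.ball_mem_nhds _ hε)
      filter_upwards [this, self_mem_nhdsWithin] with z hz hne h
      exact hne (hinj z₀ hz₀ z hz h))
  have h0mem : (0 : ℂ) ∈ Metric.ball (f x z₀) (‖d‖ * r / 4 / 2) := by
    rw [Metric.mem_ball, dist_comm, dist_zero_right]; linarith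
  obtain ⟨z, hz, hz0⟩ := himg h0mem
  have hzr : z ∈ Metric.ball z₀ r := Metric.closedBall_subset_ball (by linarith) hz
  exact ⟨z, hzr, hz0, fun w hw hw0 => hinj z (hsub hzr) w (hsub hw) (hw0.trans hz0.symm)⟩

lemma finite_zeros {g : ℂ → ℂ} (hg : Differentiable ℂ g) {K : Set ℂ} (hK : IsCompact K)
    (hs : ∀ z ∈ K, g z = 0 → deriv g z ≠ 0) : {z | z ∈ K ∧ g z = 0}.Finite := by
  have hcl : IsCompact {z | z ∈ K ∧ g z = 0} :=
    hK.inter_right (isClosed_eq hg.continuous continuous_const)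
  refine hcl.finite ?_
  rw [isDiscrete_iff_nhdsNE]
  intro z hz
  have := (hg z).hasDerivAt.eventually_ne (c := 0) (hs z hz.1 hz.2)
  rw [← disjoint_iff, disjoint_principal_right]
  filter_upwards [this] with w hw h
  exact hw h.2

/-- The number of zeros in an open set is locally constant as long as no zero can
enter through the boundary or from infinity. -/
lemma zeros_ncard_eventually_eq (hd : ∀ x z, HasDerivAt (f x) (f' x z) z)
    (hc : Continuous fun q : X × ℂ => f q.1 q.2) (hc' : Continuous fun q : X × ℂ => f' q.1 q.2)
    {x₀ : X} {l : Filter X} (hl : l ≤ 𝓝 x₀) {U : Set ℂ} (hU : IsOpen U) {R : ℝ}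
    (hR : ∀ᶠ x in l, ∀ z ∈ U, f x z = 0 → ‖z‖ ≤ R)
    (hR0 : ∀ z ∈ U, f x₀ z = 0 → ‖z‖ ≤ R)
    (hb : ∀ z ∉ U, ∀ᶠ q : X × ℂ in l ×ˢ 𝓝 z, q.2 ∈ U → f q.1 q.2 ≠ 0)
    (hs : ∀ z, f x₀ z = 0 → f' x₀ z ≠ 0) :
    {z | z ∈ U ∧ f x₀ z = 0}.Finite ∧ ∀ᶠ x in l, {z | z ∈ U ∧ f x z = 0}.Finite ∧
      {z | z ∈ U ∧ f x z = 0}.ncard = {z | z ∈ U ∧ f x₀ z = 0}.ncard := by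
  set S := {z | z ∈ U ∧ f x₀ z = 0} with hS
  have hfin : S.Finite := by
    refine (finite_zeros (g := f x₀) (fun z => (hd x₀ z).differentiableAt)
      (isCompact_closedBall (0 : ℂ) R) (fun z _ h => by
        rw [(hd x₀ z).deriv]; exact hs z h)).subset fun z hz => ?_
    exact ⟨by simpa using hR0 z hz.1 hz.2, hz.2⟩
  refine ⟨hfin, ?_⟩
  obtain ⟨V, hV, hVd⟩ := hfin.t2_separation
  have hball : ∀ z ∈ S, ∃ r > 0, Metric.ball z r ⊆ V z ∩ U ∧ ∀ᶠ x in 𝓝 x₀,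
      ∃ w ∈ Metric.ball z r, f x w = 0 ∧ ∀ w' ∈ Metric.ball z r, f x w' = 0 → w' = w := by
    intro z hz
    obtain ⟨ε, hε, h⟩ := simple_zero_persists hd hc hc' hz.2 (hs z hz.2)
    obtain ⟨δ, hδ, h'⟩ := Metric.isOpen_iff.1 ((hV z).2.inter hU) z ⟨(hV z).1, hz.1⟩
    exact ⟨min ε δ, lt_min hε hδ, (Metric.ball_subset_ball (min_le_right _ _)).trans h',
      h _ (lt_min hε hδ) (min_le_left _ _)⟩
  choose! r hr hrV hrx using hball
  have hall : ∀ᶠ x in l, ∀ z ∈ S, ∃ w ∈ Metric.ball z (r z), f x w = 0 ∧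
      ∀ w' ∈ Metric.ball z (r z), f x w' = 0 → w' = w :=
    hl ((eventually_all_finite hfin).2 hrx)
  set K := Metric.closedBall (0 : ℂ) R \ ⋃ z ∈ S, Metric.ball z (r z) with hK
  have hKc : IsCompact K := (isCompact_closedBall _ _).diff
    (isOpen_biUnion fun z _ => Metric.isOpen_ball)
  have hno : ∀ᶠ x in l, ∀ z ∈ K, z ∈ U → f x z ≠ 0 := by
    have := hKc.mem_prod_nhdsSet_of_forall (l := l)
      (s := {q : X × ℂ | q.2 ∈ U → f q.1 q.2 ≠ 0}) (fun z hz => by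
        by_cases hzU : z ∈ U
        · have hne : f x₀ z ≠ 0 := fun h =>
            hz.2 (Set.mem_biUnion (show z ∈ S from ⟨hzU, h⟩) (Metric.mem_ball_self (hr z ⟨hzU, h⟩)))
          have h1 : ∀ᶠ q : X × ℂ in 𝓝 (x₀, z), f q.1 q.2 ≠ 0 :=
            hc.continuousAt.eventually_ne hne
          rw [nhds_prod_eq] at h1
          have h2 := h1.filter_mono (prod_mono hl (le_refl (𝓝 z)))
          exact h2.mono fun q hq _ => hq
        · exact hb z hzU)
    obtain ⟨pa, ha, pb, hb, hab⟩ := eventually_prod_iff.1 this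
    filter_upwards [ha] with x hx z hz
    exact hab hx (hb.self_of_nhdsSet z hz)
  filter_upwards [hall, hno, hR] with x h1 h2 h3
  choose! g hg hg0 hgu using h1
  have hbij : Set.BijOn g S {z | z ∈ U ∧ f x z = 0} := by
    refine ⟨fun z hz => ⟨(hrV z hz (hg z hz)).2, hg0 z hz⟩, fun z hz w hw h => ?_, fun w hw => ?_⟩
    · by_contra hne
      have hdis := hVd hz hw hne
      exact Set.disjoint_left.1 hdis (hrV z hz (hg z hz)).1 (h ▸ (hrV w hw (hg w hw)).1)
    · have hwK : w ∉ K := fun h => h2 w h hw.1 hw.2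
      have : w ∈ ⋃ z ∈ S, Metric.ball z (r z) := by
        by_contra h
        exact hwK ⟨by simpa using h3 w hw.1 hw.2, h⟩
      obtain ⟨z, hz, hwz⟩ := Set.mem_iUnion₂.1 this
      exact ⟨z, hz, (hgu z hz w hwz hw.2).symm⟩
  exact ⟨hbij.image_eq ▸ hfin.image g, hbij.ncard_eq.symm⟩

end localconst

lemma two_mul_cos_le_sin : 2 * Real.cos (2 * Real.pi / 5) ≤ Real.sin (2 * Real.pi / 5) := by
  have e : 2 * Real.pi / 5 = Real.pi / 2 - Real.pi / 10 := by ring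
  rw [e, Real.cos_pi_div_two_sub, Real.sin_pi_div_two_sub]
  have h1 := Real.sin_le (x := Real.pi / 10) (by positivity)
  have h2 := Real.one_sub_sq_div_two_le_cos (x := Real.pi / 10)
  have h3 := Real.pi_lt_d2
  have h4 := Real.pi_pos
  nlinarith

/-- `Y1` has no large zeros in its sector. -/
lemma Y1_large (M : ℝ) : ∃ R : ℝ, 1 ≤ R ∧ ∀ p : ℂ × ℂ, ‖p.1‖ ≤ M → ‖p.2‖ ≤ M → ∀ z : ℂ,
    0 ≤ z.im → 0 ≤ (om ^ 4 * z).re → Y1 p z = 0 → ‖z‖ ≤ R := by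
  obtain ⟨R, K, hR, hK, h⟩ := Y1_asymp M
  obtain ⟨X, hX⟩ := eventually_atTop.1 (div_sqrt_eventually_lt K)
  refine ⟨max R X, le_max_of_le_left hR, fun p h1 h2 z hz1 hz2 h0 => ?_⟩
  by_contra! hlt
  have h3 := (h p h1 h2 z (by have := arg_nonneg_iff.2 hz1; linarith [Real.pi_pos]) hz2
    ((le_max_left _ _).trans hlt.le)).1
  rw [h0, zero_div, zero_sub, norm_neg, norm_one] at h3
  exact absurd (hX _ ((le_max_right _ _).trans hlt.le)) (not_lt.2 h3)

lemma norm_rp_le (p : ℝ × ℝ) : ‖(rp p).1‖ ≤ ‖p‖ ∧ ‖(rp p).2‖ ≤ ‖p‖ := by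
  simp only [rp, norm_real]
  exact ⟨norm_fst_le p, norm_snd_le p⟩

/-- On the spectral locus the zeros in the upper half-plane are locally uniformly bounded. -/
lemma locus_zeros_bounded (M : ℝ) : ∃ R : ℝ, ∀ p : ℝ × ℝ, ‖p‖ ≤ M → cc (rp p) = 0 → ∀ z : ℂ,
    0 < z.im → Y1 (rp p) z = 0 → ‖z‖ ≤ R := by
  obtain ⟨R, hR1, hR⟩ := Y1_large M
  refine ⟨max R (8 * (|M| + 1)), fun p hp hc z hz h0 => ?_⟩
  by_cases hre : 0 ≤ (om ^ 4 * z).re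
  · exact le_max_of_le_left (hR _ ((norm_rp_le p).1.trans hp) ((norm_rp_le p).2.trans hp) z hz.le hre h0)
  refine le_max_of_le_right ?_
  by_contra! hlt
  obtain ⟨a, l⟩ := p
  obtain ⟨x, y⟩ := z
  rw [om_pow_four_mul_re] at hre
  push Not at hre
  simp only at hz hre
  have hx : x < 0 := by
    by_contra! hx
    have := mul_nonneg cos_om_pos.le hx
    have := mul_pos sin_om_pos hz
    linarith
  have hy : y < -x / 2 := by
    have h1 := two_mul_cos_le_sin
    have h2 : Real.sin (2 * Real.pi / 5) * (2 * y) < Real.sin (2 * Real.pi / 5) * (-x) := by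
      have := mul_le_mul_of_nonneg_right h1 (show 0 ≤ -x by linarith)
      linarith
    have := lt_of_mul_lt_mul_left h2 sin_om_pos.le
    linarith
  have hn : ‖(⟨x, y⟩ : ℂ)‖ ≤ 2 * (-x) := by
    have := norm_le_abs_re_add_abs_im (⟨x, y⟩ : ℂ)
    simp only [abs_of_neg hx, abs_of_pos hz] at this
    linarith
  have hx4 : 4 * (|M| + 1) < -x := by linarith
  have ha : |a| ≤ |M| := (norm_fst_le (a, l)).trans (hp.trans (le_abs_self M))
  have hl : |l| ≤ |M| := (norm_snd_le (a, l)).trans (hp.trans (le_abs_self M))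
  have hM := abs_nonneg M
  refine Y1_ne_zero_of_re_pot (x := x) hc hz (fun t ht => ?_) (by
    rwa [show (x : ℂ) + y * I = ⟨x, y⟩ from by apply Complex.ext <;> simp])
  have ht2 : t ^ 2 ≤ x ^ 2 / 4 := by nlinarith [ht.1, ht.2]
  have ha' := abs_le.1 ha
  have hl' := abs_le.1 hl
  set s := -x with hs
  have hxs : x = -s := by rw [hs]; ring
  rw [hxs] at ht2 ⊢
  have e1 : s * t ^ 2 ≤ s * ((-s) ^ 2 / 4) := mul_le_mul_of_nonneg_left ht2 (by linarith)
  have e2 : a * s ≤ |M| * s := mul_le_mul_of_nonneg_right ha'.2 (by linarith)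
  have e3 : |M| * s + |M| ≤ s ^ 3 / 4 := by
    have : |M| + 1 ≤ s / 4 := by linarith
    have h5 : 4 ≤ s := by linarith
    nlinarith
  nlinarith

/-- Zeros in the upper half-plane. -/
def upZ (p : ℝ × ℝ) : Set ℂ := {z | z ∈ {z : ℂ | 0 < z.im} ∧ Y1 (rp p) z = 0}

lemma hasDerivAt_Y1 (p : ℂ × ℂ) (z : ℂ) : HasDerivAt (Y1 p) (Y1' p z) z := (isSol_Y1 p).d1 z

lemma Y1_conj_locus {p : ℝ × ℝ} (hc : cc (rp p) = 0) (z : ℂ) :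
    Y1 (rp p) (conj z) = conj (Y1 (rp p) z) := by
  have h1 := (Y1_sub_Ym (rp p) z).1
  rw [hc, mul_zero, zero_mul, sub_eq_zero] at h1
  rw [h1, (Y1_conj_rp p z).1]

lemma upZ_locally_const {p₀ : ℝ × ℝ} (h0 : cc (rp p₀) = 0) :
    (upZ p₀).Finite ∧ ∀ᶠ p in 𝓝[{p | cc (rp p) = 0}] p₀, (upZ p).Finite ∧
      (upZ p).ncard = (upZ p₀).ncard := by
  obtain ⟨R, hR⟩ := locus_zeros_bounded (‖p₀‖ + 1)
  have hcont := continuous_Y1 (X := (ℝ × ℝ) × ℂ) (p := fun q => rp q.1) (z := fun q => q.2)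
    (continuous_rp.comp continuous_fst) continuous_snd
  refine zeros_ncard_eventually_eq (f := fun p => Y1 (rp p)) (f' := fun p => Y1' (rp p))
    (fun p z => hasDerivAt_Y1 _ z) hcont.1 hcont.2 inf_le_left
    (isOpen_lt continuous_const continuous_im) (R := R) ?_
    (fun z hz h => hR p₀ (by linarith) h0 z hz h) (fun z hz => ?_)
    (fun z h => Y1'_ne_zero_of_zero h)
  · have h1 : ∀ᶠ p : ℝ × ℝ in 𝓝 p₀, ‖p‖ ≤ ‖p₀‖ + 1 :=
      continuous_norm.continuousAt.eventually (ge_mem_nhds (by linarith))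
    filter_upwards [nhdsWithin_le_nhds h1, self_mem_nhdsWithin] with p h1 h2 z hz h
    exact hR p h1 h2 z hz h
  · by_cases hz0 : Y1 (rp p₀) z = 0
    · rcases (not_lt.1 hz : z.im ≤ 0).lt_or_eq with him | him
      · have h1 : ∀ᶠ w : ℂ in 𝓝 z, w.im < 0 := continuous_im.continuousAt.eventually (gt_mem_nhds him)
        exact (h1.prod_inr _).mono fun q hq (h : 0 < q.2.im) => absurd h (not_lt.2 hq.le)
      · obtain ⟨ε, hε, h⟩ := simple_zero_persists (f := fun p => Y1 (rp p))
          (f' := fun p => Y1' (rp p)) (fun p z => hasDerivAt_Y1 _ z) hcont.1 hcont.2 hz0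
          (Y1'_ne_zero_of_zero hz0)
        have hz : conj z = z := conj_eq_iff_im.2 him
        have h2 : ∀ᶠ w : ℂ in 𝓝 z, w ∈ Metric.ball z ε := Metric.ball_mem_nhds _ hε
        have h3 : ∀ᶠ p in 𝓝[{p | cc (rp p) = 0}] p₀, cc (rp p) = 0 := self_mem_nhdsWithin
        have h6 : ∀ᶠ p in 𝓝[{p | cc (rp p) = 0}] p₀, ∃ w ∈ Metric.ball z ε, Y1 (rp p) w = 0 ∧
            ∀ w' ∈ Metric.ball z ε, Y1 (rp p) w' = 0 → w' = w :=
          nhdsWithin_le_nhds (h ε hε le_rfl)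
        filter_upwards [(h6.and h3).prod_mk h2]
          with q ⟨⟨⟨w, hw, hw0, hu⟩, hcc⟩, hq⟩ (h4 : 0 < q.2.im) h5
        have e1 := hu q.2 hq h5
        have e2 := hu (conj q.2) (by
          rw [Metric.mem_ball, dist_eq_norm] at hq ⊢
          rwa [← hz, ← map_sub, norm_conj]) (by
          rw [Y1_conj_locus hcc, h5, map_zero])
        have := conj_eq_iff_im.1 (e2.trans e1.symm)
        linarith
    · have h1 : ∀ᶠ q : (ℝ × ℝ) × ℂ in 𝓝 (p₀, z), Y1 (rp q.1) q.2 ≠ 0 :=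
        hcont.1.continuousAt.eventually_ne hz0
      rw [nhds_prod_eq] at h1
      exact (h1.filter_mono (prod_mono inf_le_left le_rfl)).mono fun q hq _ => hq

lemma nonreal_zeros_card {p : ℝ × ℝ} (hc : cc (rp p) = 0) :
    {z | Y1 (rp p) z = 0 ∧ z.im ≠ 0}.Finite ∧
      {z | Y1 (rp p) z = 0 ∧ z.im ≠ 0}.ncard = 2 * (upZ p).ncard := by
  have hf := (upZ_locally_const hc).1
  have e : {z | Y1 (rp p) z = 0 ∧ z.im ≠ 0} = upZ p ∪ conj '' upZ p := by
    ext z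
    constructor
    · rintro ⟨h1, h2⟩
      rcases h2.lt_or_gt with h | h
      · refine Or.inr ⟨conj z, ⟨by simpa using h, by rw [Y1_conj_locus hc, h1, map_zero]⟩, conj_conj z⟩
      · exact Or.inl ⟨h, h1⟩
    · rintro (⟨h1, h2⟩ | ⟨w, ⟨h1, h2⟩, rfl⟩)
      · exact ⟨h2, h1.ne'⟩
      · refine ⟨by rw [Y1_conj_locus hc, h2, map_zero], ?_⟩
        have : 0 < w.im := h1
        simpa using this.ne'
  have hinj : Function.Injective (conj : ℂ → ℂ) := (starRingEnd ℂ).injective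
  rw [e]
  refine ⟨hf.union (hf.image _), ?_⟩
  rw [Set.ncard_union_eq _ hf (hf.image _), Set.ncard_image_of_injective _ hinj]
  · ring
  · rw [Set.disjoint_left]
    rintro z ⟨h1, -⟩ ⟨w, ⟨h2, -⟩, rfl⟩
    have h1' : 0 < (conj w).im := h1
    have h2' : 0 < w.im := h2
    rw [conj_im] at h1'
    linarith

/-- The point of the parameter plane with critical point `m` and critical value `E`. -/
def cp (m E : ℝ) : ℝ × ℝ := (3 * m ^ 2, 2 * m ^ 3 + E)

lemma continuous_cp : Continuous fun q : ℝ × ℝ => cp q.1 q.2 := by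
  unfold cp; fun_prop

/-- The quadrant to the upper right of `m`. -/
def quadrant (m : ℝ) : Set ℂ := {z | m < z.re ∧ 0 < z.im}

lemma isOpen_quadrant (m : ℝ) : IsOpen (quadrant m) :=
  (isOpen_lt continuous_const continuous_re).inter (isOpen_lt continuous_const continuous_im)

/-- Zeros in the quadrant to the upper right of the critical point. -/
def quadZ (m E : ℝ) : Set ℂ := {z | z ∈ quadrant m ∧ Y1 (rp (cp m E)) z = 0}

lemma quad_zero_bounded (m E₀ : ℝ) (hm : 0 ≤ m) : ∃ R : ℝ, ∀ᶠ E in 𝓝 E₀, ∀ z ∈ quadrant m,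
    Y1 (rp (cp m E)) z = 0 → ‖z‖ ≤ R := by
  obtain ⟨R, -, hR⟩ := Y1_large (‖cp m E₀‖ + 1)
  refine ⟨R, ?_⟩
  have hc : Continuous fun E => ‖cp m E‖ :=
    (continuous_cp.comp (Continuous.prodMk_right m)).norm
  have h1 : ∀ᶠ E in 𝓝 E₀, ‖cp m E‖ ≤ ‖cp m E₀‖ + 1 :=
    hc.continuousAt.eventually (ge_mem_nhds (by linarith))
  filter_upwards [h1] with E h1 z hz h0
  have h2 := norm_rp_le (cp m E)
  refine hR _ (h2.1.trans h1) (h2.2.trans h1) z hz.2.le ?_ h0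
  rw [om_pow_four_mul_re]
  exact add_nonneg (mul_nonneg cos_om_pos.le (hm.trans hz.1.le)) (mul_nonneg sin_om_pos.le hz.2.le)

lemma eventually_not_quadrant {m : ℝ} {z : ℂ} (h : z.re < m ∨ z.im < 0) :
    ∀ᶠ w in 𝓝 z, w ∉ quadrant m := by
  rcases h with h | h
  · have := continuous_re.continuousAt.eventually (gt_mem_nhds h)
    filter_upwards [this] with w hw hq
    exact absurd hq.1 (not_lt.2 hw.le)
  · have := continuous_im.continuousAt.eventually (gt_mem_nhds h)
    filter_upwards [this] with w hw hq
    exact absurd hq.2 (not_lt.2 hw.le)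

lemma continuous_Y1_cp (m : ℝ) :
    (Continuous fun q : ℝ × ℂ => Y1 (rp (cp m q.1)) q.2) ∧
      Continuous fun q : ℝ × ℂ => Y1' (rp (cp m q.1)) q.2 :=
  continuous_Y1 (X := ℝ × ℂ) (p := fun q => rp (cp m q.1)) (z := fun q => q.2)
    (continuous_rp.comp (continuous_cp.comp (continuous_const.prodMk continuous_fst))) continuous_snd

lemma quad_cases {m E : ℝ} {z : ℂ} (hz : z ∉ quadrant m) (h0 : Y1 (rp (cp m E)) z = 0) :
    (z.re < m ∨ z.im < 0) ∨ ∃ x : ℝ, m < x ∧ z = x := by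
  by_cases h : z.re < m ∨ z.im < 0
  · exact Or.inl h
  push Not at h
  rcases h.1.eq_or_lt with h1 | h1
  · refine absurd h0 ?_
    have := Y1_crit_ne_zero m (2 * m ^ 3 + E) z.im h.2
    have e : (m : ℂ) + z.im * I = z := by rw [h1, re_add_im]
    rwa [e] at this
  · rcases h.2.eq_or_lt with h2 | h2
    · exact Or.inr ⟨z.re, h1, Complex.ext (by simp) (by simp [← h2])⟩
    · exact absurd ⟨h1, h2⟩ hz

lemma quadZ_locally_const {m E₀ : ℝ} (hm : 0 ≤ m)
    (hne : ∀ x : ℝ, m < x → Y1 (rp (cp m E₀)) x ≠ 0) :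
    (quadZ m E₀).Finite ∧
      ∀ᶠ E in 𝓝 E₀, (quadZ m E).Finite ∧ (quadZ m E).ncard = (quadZ m E₀).ncard := by
  obtain ⟨R, hR⟩ := quad_zero_bounded m E₀ hm
  have hcont := continuous_Y1_cp m
  refine zeros_ncard_eventually_eq (f := fun E => Y1 (rp (cp m E))) (f' := fun E => Y1' (rp (cp m E)))
    (fun _ z => hasDerivAt_Y1 _ z) hcont.1 hcont.2 le_rfl (isOpen_quadrant m) (R := R) hR
    hR.self_of_nhds (fun z hz => ?_) (fun z h => Y1'_ne_zero_of_zero h)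
  by_cases h0 : Y1 (rp (cp m E₀)) z = 0
  · rcases quad_cases hz h0 with h | ⟨x, hx, rfl⟩
    · exact ((eventually_not_quadrant h).prod_inr _).mono fun q hq h => absurd h hq
    · exact absurd h0 (hne x hx)
  · have h1 : ∀ᶠ q : ℝ × ℂ in 𝓝 (E₀, z), Y1 (rp (cp m q.1)) q.2 ≠ 0 :=
      hcont.1.continuousAt.eventually_ne h0
    rw [nhds_prod_eq] at h1
    exact h1.mono fun q hq _ => hq

/-- Sign of the imaginary part of a zero near a real zero. -/
lemma zero_im_sign {m E₀ x₀ : ℝ} (h0 : Y1 (rp (cp m E₀)) x₀ = 0) :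
    ∃ r > 0, ∀ᶠ E in 𝓝 E₀, ∀ z ∈ Metric.ball (x₀ : ℂ) r, Y1 (rp (cp m E)) z = 0 →
      ((cc (rp (cp m E))).re < 0 → 0 < z.im) ∧ (0 < (cc (rp (cp m E))).re → z.im < 0) := by
  have hcont := continuous_Y1_cp m
  have hpot : Continuous fun q : ℝ × ℂ => (pot (rp (cp m q.1)) q.2).re := by
    unfold pot rp cp; fun_prop
  have hg : Continuous fun q : ℝ × ℂ => normSq (Y1' (rp (cp m q.1)) q.2) -
      (pot (rp (cp m q.1)) q.2).re * normSq (Y1 (rp (cp m q.1)) q.2) :=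
    (continuous_normSq.comp hcont.2).sub (hpot.mul (continuous_normSq.comp hcont.1))
  have hev : ∀ᶠ q : ℝ × ℂ in 𝓝 (E₀, (x₀ : ℂ)), 0 < normSq (Y1' (rp (cp m q.1)) q.2) -
      (pot (rp (cp m q.1)) q.2).re * normSq (Y1 (rp (cp m q.1)) q.2) := by
    refine hg.continuousAt.eventually (lt_mem_nhds ?_)
    simp only [h0, map_zero, mul_zero, sub_zero]
    exact normSq_pos.2 (Y1'_ne_zero_of_zero h0)
  rw [nhds_prod_eq] at hev
  obtain ⟨pa, ha, pb, hb, hab⟩ := eventually_prod_iff.1 hev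
  obtain ⟨r, hr, hball⟩ := Metric.eventually_nhds_iff_ball.1 hb
  refine ⟨r, hr, ha.mono fun E hE z hz hz0 => ?_⟩
  set p := cp m E with hp
  set F : ℝ → ℝ := fun t => (fl (Y1 (rp p)) (Y1' (rp p)) (z.re + t * I)).im with hF
  have hd : ∀ t : ℝ, HasDerivAt F ((pot (rp p) (z.re + t * I)).re * normSq (Y1 (rp p) (z.re + t * I)) -
      normSq (Y1' (rp p) (z.re + t * I))) t := fun t => by
    have h := (Complex.imCLM.hasFDerivAt (x := fl (Y1 (rp p)) (Y1' (rp p)) (z.re + t * I))).comp_hasDerivAt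
      t (hasDerivAt_fl (isSol_Y1 (rp p)) z.re I t)
    refine h.congr_deriv ?_
    simp only [imCLM_apply, conj_I, add_im, im_mul_ofReal, I_mul_im, neg_im, I_im]
    ring
  have hcF : Continuous F := continuous_iff_continuousAt.2 fun t => (hd t).continuousAt
  have hF0 : F 0 = -2 * (cc (rp p)).re := by
    simp only [hF, ofReal_zero, zero_mul, add_zero]
    exact fl_Y1_real p z.re
  have hFe : F z.im = 0 := by
    simp only [hF, re_add_im, fl_eq_zero hz0, zero_im]
  have hmem : ∀ t : ℝ, |t| ≤ |z.im| → (z.re + t * I : ℂ) ∈ Metric.ball (x₀ : ℂ) r := fun t ht => by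
    rw [Metric.mem_ball, dist_eq_norm] at hz ⊢
    refine lt_of_le_of_lt ?_ hz
    rw [← sq_le_sq₀ (norm_nonneg _) (norm_nonneg _), ← normSq_eq_norm_sq, ← normSq_eq_norm_sq,
      normSq_apply, normSq_apply]
    have := sq_le_sq.2 ht
    simp
    nlinarith
  have hneg : ∀ t : ℝ, |t| ≤ |z.im| → deriv F t < 0 := fun t ht => by
    rw [(hd t).deriv]
    have := hab hE (hball _ (hmem t ht))
    linarith
  constructor
  · intro hc
    by_contra! hle
    rcases hle.lt_or_eq with hlt | heq
    · have := strictAntiOn_of_deriv_neg (convex_Icc z.im 0) hcF.continuousOn (fun t ht => hneg t (by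
        rw [interior_Icc] at ht
        rw [abs_of_neg ht.2, abs_of_neg hlt]; linarith [ht.1]))
        ⟨le_rfl, hle⟩ ⟨hle, le_rfl⟩ hlt
      linarith
    · rw [heq] at hFe; linarith
  · intro hc
    by_contra! hle
    rcases hle.lt_or_eq with hlt | heq
    · have := strictAntiOn_of_deriv_neg (convex_Icc 0 z.im) hcF.continuousOn (fun t ht => hneg t (by
        rw [interior_Icc] at ht
        rw [abs_of_pos ht.1, abs_of_pos hlt]; linarith [ht.2]))
        ⟨le_rfl, hle⟩ ⟨hle, le_rfl⟩ hlt
      linarith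
    · rw [← heq] at hFe; linarith

/-- Jump of the number of zeros when a zero crosses the real axis. -/
lemma quadZ_jump {m E₀ : ℝ} (hm : 0 ≤ m) (hE : 0 ≤ E₀) (hc : cc (rp (cp m E₀)) = 0)
    (hneg : (Y1 (rp (cp m E₀)) m).re < 0) :
    (quadZ m E₀).Finite ∧ ∀ᶠ E in 𝓝 E₀,
      ((cc (rp (cp m E))).re < 0 → (quadZ m E).Finite ∧ (quadZ m E).ncard = (quadZ m E₀).ncard + 1) ∧
      (0 < (cc (rp (cp m E))).re → (quadZ m E).Finite ∧ (quadZ m E).ncard = (quadZ m E₀).ncard) := by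
  obtain ⟨x₀, hx₀, h0⟩ := Y1_real_zero hc hneg
  obtain ⟨R, hR⟩ := quad_zero_bounded m E₀ hm
  have hcont := continuous_Y1_cp m
  obtain ⟨ε, hε, hpers⟩ := simple_zero_persists (f := fun E => Y1 (rp (cp m E)))
    (f' := fun E => Y1' (rp (cp m E))) (fun _ z => hasDerivAt_Y1 _ z) hcont.1 hcont.2 h0
    (Y1'_ne_zero_of_zero h0)
  obtain ⟨r₁, hr₁, hsign⟩ := zero_im_sign h0
  obtain ⟨r, hr0, hr⟩ : ∃ r : ℝ, 0 < r ∧ r < ε ∧ r < r₁ ∧ r < x₀ - m := by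
    obtain ⟨r, h1, h2⟩ := exists_between (lt_min hε (lt_min hr₁ (sub_pos.2 hx₀)))
    exact ⟨r, h1, lt_of_lt_of_le h2 (min_le_left _ _),
      lt_of_lt_of_le h2 ((min_le_right _ _).trans (min_le_left _ _)),
      lt_of_lt_of_le h2 ((min_le_right _ _).trans (min_le_right _ _))⟩
  have huniq : ∀ z ∈ Metric.ball (x₀ : ℂ) ε, Y1 (rp (cp m E₀)) z = 0 → z = x₀ := by
    obtain ⟨z, hz, hz0, hu⟩ := (hpers ε hε le_rfl).self_of_nhds
    intro w hw hw0
    rw [hu w hw hw0, hu x₀ (Metric.mem_ball_self hε) h0]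
  set U' := quadrant m ∪ Metric.ball (x₀ : ℂ) r with hU'
  have key := zeros_ncard_eventually_eq (f := fun E => Y1 (rp (cp m E)))
    (f' := fun E => Y1' (rp (cp m E))) (fun _ z => hasDerivAt_Y1 _ z) hcont.1 hcont.2
    (x₀ := E₀) le_rfl ((isOpen_quadrant m).union Metric.isOpen_ball) (U := U')
    (R := max R (‖(x₀ : ℂ)‖ + r)) ?_ ?_ ?_ (fun z h => Y1'_ne_zero_of_zero h)
  rotate_left
  · filter_upwards [hR] with E h z hz hz0
    rcases hz with hz | hz
    · exact le_max_of_le_left (h z hz hz0)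
    · refine le_max_of_le_right ?_
      have := norm_lt_of_mem_ball hz
      linarith
  · intro z hz hz0
    rcases hz with hz | hz
    · exact le_max_of_le_left (hR.self_of_nhds z hz hz0)
    · refine le_max_of_le_right ?_
      have := norm_lt_of_mem_ball hz
      linarith
  · intro z hz
    by_cases hz0 : Y1 (rp (cp m E₀)) z = 0
    · have hxm : (x₀ : ℂ) ∈ U' := Or.inr (Metric.mem_ball_self hr0)
      have h1 : ∀ᶠ w in 𝓝 z, w ∉ Metric.ball (x₀ : ℂ) r := by
        have h2 : z ∉ Metric.closedBall (x₀ : ℂ) r := fun h => hz (by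
          rwa [huniq z (Metric.closedBall_subset_ball hr.1 h) hz0])
        filter_upwards [Metric.isClosed_closedBall.isOpen_compl.mem_nhds h2] with w hw h
        exact hw (Metric.ball_subset_closedBall h)
      rcases quad_cases (fun h => hz (Or.inl h)) hz0 with h | ⟨x, hx, rfl⟩
      · refine (((eventually_not_quadrant h).and h1).prod_inr _).mono fun q hq h => ?_
        exact absurd h (not_or.2 hq)
      · have e1 := Y1_zero_unique hm hE hx.le hz0 h0
        have e2 := Y1_zero_unique hm hE hx₀.le h0 hz0
        rw [le_antisymm e2 e1] at hz
        exact absurd hxm hz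
    · have h1 : ∀ᶠ q : ℝ × ℂ in 𝓝 (E₀, z), Y1 (rp (cp m q.1)) q.2 ≠ 0 :=
        hcont.1.continuousAt.eventually_ne hz0
      rw [nhds_prod_eq] at h1
      exact h1.mono fun q hq _ => hq
  have hsub : ∀ E, quadZ m E ⊆ {z | z ∈ U' ∧ Y1 (rp (cp m E)) z = 0} := fun E z hz =>
    ⟨Or.inl hz.1, hz.2⟩
  have hfin0 : (quadZ m E₀).Finite := key.1.subset (hsub E₀)
  have hcard0 : {z | z ∈ U' ∧ Y1 (rp (cp m E₀)) z = 0}.ncard = (quadZ m E₀).ncard + 1 := by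
    have e : {z | z ∈ U' ∧ Y1 (rp (cp m E₀)) z = 0} = insert (x₀ : ℂ) (quadZ m E₀) := by
      ext z
      constructor
      · rintro ⟨h1 | h1, h2⟩
        · exact Or.inr ⟨h1, h2⟩
        · exact Or.inl (huniq z (Metric.ball_subset_ball hr.1.le h1) h2)
      · rintro (rfl | h)
        · exact ⟨Or.inr (Metric.mem_ball_self hr0), h0⟩
        · exact hsub E₀ h
    rw [e, Set.ncard_insert_of_notMem (fun h => by have := h.1.2; simp at this) hfin0]
  refine ⟨hfin0, ?_⟩
  filter_upwards [key.2, hpers r hr0 hr.1.le, hsign] with E ⟨hf, hn⟩ ⟨z, hz, hz0, hu⟩ hs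
  have hzs := hs z (Metric.ball_subset_ball hr.2.1.le hz) hz0
  refine ⟨fun hcE => ?_, fun hcE => ?_⟩
  · have hzi := hzs.1 hcE
    have hzq : z ∈ quadrant m := ⟨by
      rw [Metric.mem_ball, dist_eq_norm] at hz
      have := (abs_re_le_norm _).trans_lt hz
      rw [sub_re, ofReal_re, abs_lt] at this
      linarith [this.1, hr.2.2], hzi⟩
    have e : quadZ m E = {z | z ∈ U' ∧ Y1 (rp (cp m E)) z = 0} := by
      refine (hsub E).antisymm ?_
      rintro w ⟨h1 | h1, h2⟩
      · exact ⟨h1, h2⟩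
      · rw [hu w h1 h2]; exact ⟨hzq, hz0⟩
    rw [e]
    exact ⟨hf, hn.trans hcard0⟩
  · have hzi := hzs.2 hcE
    have hfE := hf.subset (hsub E)
    have e : {z | z ∈ U' ∧ Y1 (rp (cp m E)) z = 0} = insert z (quadZ m E) := by
      ext w
      constructor
      · rintro ⟨h1 | h1, h2⟩
        · exact Or.inr ⟨h1, h2⟩
        · exact Or.inl (hu w h1 h2)
      · rintro (rfl | h)
        · exact ⟨Or.inr hz, hz0⟩
        · exact hsub E h
    refine ⟨hfE, ?_⟩
    change {z | z ∈ U' ∧ Y1 (rp (cp m E)) z = 0}.ncard = {z | z ∈ U' ∧ Y1 (rp (cp m E₀)) z = 0}.ncard at hn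
    rw [e, Set.ncard_insert_of_notMem (fun h => by have := h.1.2; linarith) hfE, hcard0] at hn
    omega

lemma quadZ_base {m : ℝ} (hm : 0 ≤ m) : quadZ m 0 = ∅ := by
  rw [Set.eq_empty_iff_forall_notMem]
  rintro z ⟨⟨h1, h2⟩, h3⟩
  refine Y1_base hm (sub_pos.2 h1) h2 ?_
  rw [show (m : ℂ) + ((z.re - m : ℝ) + z.im * I) = z by
    push_cast; linear_combination re_add_im z]
  exact h3

/-- On the locus all zeros in the upper half-plane lie in the quadrant. -/
lemma upZ_eq_quadZ {m E : ℝ} (hm : 0 ≤ m) (hc : cc (rp (cp m E)) = 0) :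
    upZ (cp m E) = quadZ m E := by
  have hE : 0 < E := by
    by_contra! h
    have := cc_neg hm h
    change (cc (rp (cp m E))).re < 0 at this
    rw [hc, zero_re] at this
    exact lt_irrefl _ this
  ext z
  refine ⟨fun ⟨h1, h2⟩ => ⟨⟨?_, h1⟩, h2⟩, fun ⟨h1, h2⟩ => ⟨h1.2, h2⟩⟩
  have h2' : Y1 (rp (3 * m ^ 2, 2 * m ^ 3 + E)) (z.re + z.im * I) = 0 := by rw [re_add_im]; exact h2
  have e1 := Y1_zero_hyperbola h1 h2'
  have e2 := Y1_zero_re_pos (by positivity) (by positivity) hc h1 h2'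
  have h1' : 0 < z.im ^ 2 := pow_pos h1 2
  nlinarith

lemma sepHol_Y1 (a : ℂ) : SepHol fun l z => Y1 (a, l) z :=
  ⟨(continuous_Y1 (X := ℂ × ℂ) (p := fun q => (a, q.1)) (z := fun q => q.2)
      (continuous_const.prodMk continuous_fst) continuous_snd).1,
    fun z => (differentiable_Y1 (p := fun l => (a, l)) (z := fun _ => z)
      ((differentiable_const _).prodMk differentiable_id) (differentiable_const _)).1,
    fun l => (isSol_Y1 (a, l)).differentiable⟩

lemma sepHol_Y1' (a : ℂ) : SepHol fun l z => Y1' (a, l) z :=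
  ⟨(continuous_Y1 (X := ℂ × ℂ) (p := fun q => (a, q.1)) (z := fun q => q.2)
      (continuous_const.prodMk continuous_fst) continuous_snd).2,
    fun z => (differentiable_Y1 (p := fun l => (a, l)) (z := fun _ => z)
      ((differentiable_const _).prodMk differentiable_id) (differentiable_const _)).2,
    fun l => (isSol_Y1 (a, l)).differentiable'⟩

/-- Derivative of `Y1` in the spectral parameter. -/
noncomputable def Y1l (a l z : ℂ) : ℂ := deriv (fun l => Y1 (a, l) z) l

/-- Derivative of `Y1'` in the spectral parameter. -/
noncomputable def Y1l' (a l z : ℂ) : ℂ := deriv (fun l => Y1' (a, l) z) l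

lemma hasDerivAt_Y1l (a l z : ℂ) : HasDerivAt (fun z => Y1l a l z) (Y1l' a l z) z := by
  have h := ((sepHol_Y1 a).deriv1.d2 l z).hasDerivAt
  rw [(sepHol_Y1 a).deriv_comm] at h
  simpa only [Y1l, Y1l', ((isSol_Y1 _).d1 _).deriv] using h

lemma hasDerivAt_Y1l' (a l z : ℂ) :
    HasDerivAt (fun z => Y1l' a l z) (pot (a, l) z * Y1l a l z + Y1 (a, l) z) z := by
  have h := ((sepHol_Y1' a).deriv1.d2 l z).hasDerivAt
  rw [(sepHol_Y1' a).deriv_comm] at h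
  have e : (fun l => deriv (fun z => Y1' (a, l) z) z) = fun l => pot (a, l) z * Y1 (a, l) z :=
    funext fun l => ((isSol_Y1 (a, l)).d2 z).deriv
  simp only [e] at h
  refine h.congr_deriv ?_
  have h1 : HasDerivAt (fun l : ℂ => pot (a, l) z) 1 l := by
    simpa [pot] using (hasDerivAt_id l).const_add (z ^ 3 - a * z)
  have h2 := h1.mul ((sepHol_Y1 a).d1 z l).hasDerivAt
  rw [show (fun l => pot (a, l) z * Y1 (a, l) z) =
    (fun l => pot (a, l) z) * fun l => Y1 (a, l) z from rfl, h2.deriv, Y1l]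
  ring

/-- Cauchy estimates for the derivatives in the spectral parameter. -/
lemma Y1l_asymp (a l : ℂ) : ∃ R K : ℝ, 1 ≤ R ∧ ∀ z : ℂ, 0 ≤ z.re → 0 ≤ z.im → R ≤ ‖z‖ →
    ‖Y1l a l z / wkbp a z‖ ≤ K / √‖z‖ ∧
    ‖(Y1l' a l z - wkbpL a z * Y1l a l z) / wkbp a z‖ ≤ K / √‖z‖ ^ 3 := by
  obtain ⟨R, K, hR, hK, h⟩ := Y1_asymp (max ‖a‖ (‖l‖ + 1))
  refine ⟨R, K, hR, fun z h1 h2 h3 => ?_⟩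
  have hb : ∀ l' ∈ Metric.sphere l 1, _ := fun l' hl' => h (a, l') (le_max_left _ _)
    (le_max_of_le_right (by
      have e := norm_sub_norm_le l' l
      rw [mem_sphere_iff_norm] at hl'
      change ‖l'‖ ≤ _
      linarith)) z (by have := arg_nonneg_iff.2 h2; linarith [Real.pi_pos])
    (by rw [om_pow_four_mul_re]
        exact add_nonneg (mul_nonneg cos_om_pos.le h1) (mul_nonneg sin_om_pos.le h2)) h3
  have d1 : HasDerivAt (fun l => Y1 (a, l) z) (Y1l a l z) l := ((sepHol_Y1 a).d1 z l).hasDerivAt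
  have d2 : HasDerivAt (fun l => Y1' (a, l) z) (Y1l' a l z) l := ((sepHol_Y1' a).d1 z l).hasDerivAt
  have D1 : Differentiable ℂ fun l => Y1 (a, l) z / wkbp a z - 1 :=
    (((sepHol_Y1 a).d1 z).div_const _).sub_const _
  have D2 : Differentiable ℂ fun l => (Y1' (a, l) z - wkbpL a z * Y1 (a, l) z) / wkbp a z :=
    (((sepHol_Y1' a).d1 z).sub (((sepHol_Y1 a).d1 z).const_mul _)).div_const _
  constructor
  · have := norm_deriv_le_of_forall_mem_sphere_norm_le one_pos D1.diffContOnCl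
      (fun l' hl' => (hb l' hl').1)
    rwa [((d1.div_const _).sub_const _).deriv, div_one] at this
  · have := norm_deriv_le_of_forall_mem_sphere_norm_le one_pos D2.diffContOnCl
      (fun l' hl' => (hb l' hl').2)
    have e : HasDerivAt (fun l => (Y1' (a, l) z - wkbpL a z * Y1 (a, l) z) / wkbp a z) _ l :=
      (d2.sub (d1.const_mul _)).div_const _
    rwa [e.deriv, div_one] at this


lemma tendsto_norm_vert (x : ℂ) : Tendsto (fun s : ℝ => √‖x + s * I‖) atTop atTop := by
  refine Real.tendsto_sqrt_atTop.comp ?_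
  have h1 : Tendsto (fun s : ℝ => s - ‖x‖) atTop atTop :=
    tendsto_atTop_add_const_right _ _ tendsto_id
  refine tendsto_atTop_mono' _ ?_ h1
  filter_upwards [eventually_ge_atTop 0] with s hs
  have := norm_sub_le (x + s * I) x
  rw [add_sub_cancel_left, norm_mul, norm_real, Real.norm_of_nonneg hs, norm_I] at this
  linarith

lemma tendsto_zero_vert {x : ℂ} {g : ℂ → ℂ} {R K : ℝ} {k : ℕ} (hk : k ≠ 0)
    (h : ∀ s : ℝ, 0 ≤ s → R ≤ ‖x + s * I‖ → ‖g (x + s * I)‖ ≤ K / √‖x + s * I‖ ^ k) :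
    Tendsto (fun s : ℝ => g (x + s * I)) atTop (𝓝 0) := by
  have ht := tendsto_norm_vert x
  refine squeeze_zero_norm' ?_
    ((tendsto_const_nhds (x := K)).div_atTop ((tendsto_pow_atTop hk).comp ht))
  filter_upwards [eventually_ge_atTop 0, ht.eventually_ge_atTop (√R)] with s hs hs'
  exact h s hs ((Real.sqrt_le_sqrt_iff (norm_nonneg _)).1 hs')

/-- Limits along a vertical line used for the monotonicity of the phase. -/
lemma wr_Y1l_vert (a l : ℂ) {x : ℝ} (hx : 0 ≤ x) :
    Tendsto (fun s : ℝ => Y1l a l (x + s * I) * Y0' (a, l) (x + s * I) -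
      Y1l' a l (x + s * I) * Y0 (a, l) (x + s * I)) atTop (𝓝 0) ∧
    Tendsto (fun s : ℝ => Y1l a l (x + s * I) * Y1' (a, l) (x + s * I) -
      Y1l' a l (x + s * I) * Y1 (a, l) (x + s * I)) atTop (𝓝 0) := by
  obtain ⟨R₁, K₁, hR₁, h₁⟩ := Y1l_asymp a l
  obtain ⟨R₂, K₂, hR₂, -, h₂⟩ := Y1_asymp (max ‖a‖ ‖l‖)
  obtain ⟨R₃, K₃, hR₃, -, h₃⟩ := Y0_asymp (max ‖a‖ ‖l‖)
  replace h₂ := h₂ (a, l) (le_max_left _ _) (le_max_right _ _)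
  replace h₃ := h₃ (a, l) (le_max_left _ _) (le_max_right _ _)
  have hre : ∀ s : ℝ, ((x : ℂ) + s * I).re = x := fun s => by simp
  have him : ∀ s : ℝ, ((x : ℂ) + s * I).im = s := fun s => by simp
  have hom : ∀ s : ℝ, 0 ≤ s → 0 ≤ (om ^ 4 * ((x : ℂ) + s * I)).re := fun s hs => by
    rw [om_pow_four_mul_re, hre, him]
    exact add_nonneg (mul_nonneg cos_om_pos.le hx) (mul_nonneg sin_om_pos.le hs)
  have harg : ∀ s : ℝ, 0 ≤ s → -(3 * Real.pi / 5) < arg ((x : ℂ) + s * I) := fun s hs => by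
    have := arg_nonneg_iff.2 ((him s).symm ▸ hs : 0 ≤ ((x : ℂ) + s * I).im)
    linarith [Real.pi_pos]
  have hA := tendsto_zero_vert (x := x) (g := fun z => Y1l a l z / wkbp a z) (R := R₁) (K := K₁)
    one_ne_zero (fun s hs h => by
      rw [pow_one]; exact (h₁ _ (by rwa [hre]) (by rwa [him]) h).1)
  have hB := tendsto_zero_vert (x := x) (g := fun z => (Y1l' a l z - wkbpL a z * Y1l a l z) / wkbp a z)
    (R := R₁) (K := K₁) three_ne_zero (fun s hs h => (h₁ _ (by rwa [hre]) (by rwa [him]) h).2)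
  have hα := tendsto_zero_vert (x := x) (g := fun z => Y1 (a, l) z / wkbp a z - 1) (R := R₂) (K := K₂)
    one_ne_zero (fun s hs h => by rw [pow_one]; exact (h₂ _ (harg s hs) (hom s hs) h).1)
  have hβ := tendsto_zero_vert (x := x)
    (g := fun z => (Y1' (a, l) z - wkbpL a z * Y1 (a, l) z) / wkbp a z) (R := R₂) (K := K₂)
    three_ne_zero (fun s hs h => (h₂ _ (harg s hs) (hom s hs) h).2)
  have hγ := tendsto_zero_vert (x := x) (g := fun z => hq (a, l) (Y0 (a, l)) z - 1) (R := R₃) (K := K₃)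
    one_ne_zero (fun s hs h => by rw [pow_one]; exact (h₃ _ (by rwa [hre]) h).1)
  have hδ := tendsto_zero_vert (x := x) (g := fun z => hqd (a, l) (Y0 (a, l)) (Y0' (a, l)) z)
    (R := R₃) (K := K₃) three_ne_zero (fun s hs h => (h₃ _ (by rwa [hre]) h).2)
  have hr := tendsto_zero_vert (x := x) (g := fun z => (rt z)⁻¹) (R := 1) (K := 1)
    one_ne_zero (fun s hs h => by
      rw [norm_inv, norm_rt (norm_pos_iff.1 (one_pos.trans_le h)), pow_one, one_div])
  have hα' := hα.add_const 1
  have hγ' := hγ.add_const 1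
  simp only [sub_add_cancel, zero_add] at hα' hγ'
  have hw : Tendsto (fun s : ℝ => wkbp a (x + s * I)) atTop (𝓝 0) := by
    have h := (Y1_vert (a, l) x).1.div hα' one_ne_zero
    rw [zero_div] at h
    refine h.congr' ?_
    filter_upwards [hα'.eventually_ne one_ne_zero] with s hs
    have h0 : Y1 (a, l) (x + s * I) ≠ 0 := fun h => hs (by rw [h, zero_div])
    simp only [Pi.div_apply]
    rw [div_div_cancel₀ h0]
  constructor
  · have h := ((hr.pow 3).mul ((hA.mul hδ).sub (hB.mul hγ'))).add
      ((hA.mul hγ').mul (((hr.pow 4).const_mul a).sub_const 2))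
    simp only [zero_mul, mul_zero, sub_zero, add_zero] at h
    refine h.congr fun s => ?_
    have e := wkb_mul_wkbp (a := a) (z := x + s * I)
    have e1 := wkb_ne_zero a (x + s * I)
    have e2 := wkbp_ne_zero a (x + s * I)
    have e3 := rt_ne_zero (x + s * I)
    simp only [hq, hqd, wkbL, wkbpL]
    generalize wkb a (x + s * I) = u at *
    generalize wkbp a (x + s * I) = v at *
    generalize rt (x + s * I) = r at *
    have e4 : v = 1 / (u * r ^ 3) := by field_simp; linear_combination e
    subst e4
    field_simp
    ring
  · have h := (hw.pow 2).mul ((hA.mul hβ).sub (hB.mul hα'))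
    simp only [zero_mul, mul_zero, sub_zero] at h
    refine h.congr fun s => ?_
    have e2 := wkbp_ne_zero a (x + s * I)
    field_simp
    ring

/-- The phase of `Y1` at the critical point increases with the spectral parameter. -/
lemma phase_mono {m : ℝ} (hm : 0 ≤ m) (l : ℝ) :
    0 < (Y1l (3 * m ^ 2 : ℝ) l m / Y1 (rp (3 * m ^ 2, l)) m).im := by
  set a : ℂ := ((3 * m ^ 2 : ℝ) : ℂ) with ha
  have hrp : rp (3 * m ^ 2, l) = (a, (l : ℂ)) := rfl
  set p : ℂ × ℂ := (a, (l : ℂ)) with hp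
  have hY := isSol_Y1 p
  have hu0 : Y1 p m ≠ 0 := by
    have := Y1_crit_ne_zero m l 0 le_rfl
    rwa [hrp, ofReal_zero, zero_mul, add_zero] at this
  rw [hrp]
  obtain ⟨α, β, h0, h1⟩ : ∃ α β : ℂ, α * Y1 p m + β * Y0 p m = 0 ∧ α * Y1' p m + β * Y0' p m = 1 := by
    refine ⟨Y0 p m / 2, Y1 p m / -2, by ring, ?_⟩
    have := wr_Y0_Y1 p m
    simp only [wr] at this
    linear_combination (1 / 2 : ℂ) * this
  have hφ := hY.lin (isSol_Y0 p) α β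
  set φ : ℂ → ℂ := fun z => α * Y1 p z + β * Y0 p z with hφd
  set φ' : ℂ → ℂ := fun z => α * Y1' p z + β * Y0' p z with hφd'
  have hφ0 : φ m = 0 := h0
  have hφ1 : φ' m = 1 := h1
  have hφne : φ ≠ 0 := fun h => by
    have e : φ' m = 0 := by rw [← hφ.deriv_eq, h]; exact deriv_const (m : ℂ) (0 : ℂ)
    rw [hφ1] at e; exact one_ne_zero e
  have hwr : ∀ z, Y1 p z * φ' z - Y1' p z * φ z = Y1 p m := fun z => by
    have := hY.wr_const hφ z m
    simp only [wr] at this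
    rw [this, hφ0, hφ1]; ring
  set K : ℝ → ℂ := fun s =>
    (Y1l a l (m + s * I) * φ' (m + s * I) - Y1l' a l (m + s * I) * φ (m + s * I)) / Y1 p m with hK
  have hKd : ∀ s : ℝ, HasDerivAt K (-I * (Y1 p (m + s * I) * φ (m + s * I) / Y1 p m)) s := fun s => by
    have e : ∀ z, HasDerivAt (fun z => (Y1l a l z * φ' z - Y1l' a l z * φ z) / Y1 p m)
        (-(Y1 p z * φ z / Y1 p m)) z := fun z => by
      refine ((((hasDerivAt_Y1l a l z).mul (hφ.d2 z)).sub
        ((hasDerivAt_Y1l' a l z).mul (hφ.d1 z))).div_const (Y1 p m)).congr_deriv ?_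
      ring
    refine (hasDerivAt_line e m I s).congr_deriv ?_
    ring
  have hlim : Tendsto K atTop (𝓝 0) := by
    obtain ⟨h2, h3⟩ := wr_Y1l_vert a l hm
    have h4 := ((h3.const_mul α).add (h2.const_mul β)).div_const (Y1 p m)
    simp only [mul_zero, add_zero, zero_div] at h4
    refine h4.congr fun s => ?_
    simp only [hK, hφd, hφd']
    ring
  have hpos : ∀ s : ℝ, 0 < s → 0 < (Y1 p (m + s * I) * φ (m + s * I) / Y1 p m).re := fun s hs => by
    have e1 := fl_Y1_crit m l s hs.le
    rw [hrp] at e1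
    have e2 : 0 < (fl φ φ' (m + s * I)).re := by
      have h := flux_lt hφ hφne m I 1 I_ne_zero hs
      have hP : ∀ t ∈ Set.Ioo 0 s, 0 < (1 * I * pot p (m + (t : ℝ) * I)).re := fun t ht => by
        rw [← hrp, pot_rp_re_im, one_mul, I_mul_re, add_im, ofReal_im, im_ofReal_mul, I_im]
        have := pow_pos ht.1 3
        nlinarith
      have h := h (fun t ht => (hP t ht).le) (by simp) (Or.inl hP)
      rw [ofReal_zero, zero_mul, add_zero, one_mul, one_mul, fl_eq_zero hφ0, zero_re] at h
      exact h
    set z : ℂ := m + s * I with hz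
    have hu : Y1 p z ≠ 0 := fun h => by rw [fl_eq_zero h] at e1; simp at e1
    have hf : φ z ≠ 0 := fun h => by rw [fl_eq_zero h] at e2; simp at e2
    have f1 : (Y1' p z / Y1 p z).re < 0 := by
      have : Y1' p z / Y1 p z = fl (Y1 p) (Y1' p) z / (normSq (Y1 p z) : ℝ) := by
        rw [fl, ← mul_conj]; field_simp [(map_ne_zero _).2 hu]
      rw [this, div_ofReal_re]
      exact div_neg_of_neg_of_pos e1 (normSq_pos.2 hu)
    have f2 : 0 < (φ' z / φ z).re := by
      have : φ' z / φ z = fl φ φ' z / (normSq (φ z) : ℝ) := by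
        rw [fl, ← mul_conj]; field_simp [(map_ne_zero _).2 hf]
      rw [this, div_ofReal_re]
      exact div_pos e2 (normSq_pos.2 hf)
    have f3 : (Y1 p z * φ z / Y1 p m)⁻¹ = φ' z / φ z - Y1' p z / Y1 p z := by
      rw [inv_div, ← hwr z]; field_simp
    have f4 : 0 < ((Y1 p z * φ z / Y1 p m)⁻¹).re := by rw [f3, sub_re]; linarith
    rw [inv_re] at f4
    exact (div_pos_iff_of_pos_right (normSq_pos.2 (div_ne_zero (mul_ne_zero hu hf) hu0))).1 f4
  have hd : ∀ s : ℝ, HasDerivAt (fun s => (K s).im) (-(Y1 p (m + s * I) * φ (m + s * I) / Y1 p m).re) s :=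
    fun s => by
    refine ((Complex.imCLM.hasFDerivAt (x := K s)).comp_hasDerivAt s (hKd s)).congr_deriv ?_
    simp only [imCLM_apply, neg_mul, neg_im, I_mul_im]
  have hanti : StrictAntiOn (fun s => (K s).im) (Set.Ici 0) := by
    refine strictAntiOn_of_deriv_neg (convex_Ici 0)
      (fun s _ => (hd s).continuousAt.continuousWithinAt) fun s hs => ?_
    rw [interior_Ici] at hs
    rw [(hd s).deriv]
    linarith [hpos s hs]
  have hlim' : Tendsto (fun s => (K s).im) atTop (𝓝 0) := by
    simpa [Function.comp_def] using (continuous_im.tendsto _).comp hlim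
  have hge : 0 ≤ (K 1).im := by
    refine le_of_tendsto hlim' ?_
    filter_upwards [eventually_ge_atTop 1] with s hs
    exact hanti.antitoneOn (by simp) (by simp; linarith) hs
  have hlt : (K 1).im < (K 0).im := hanti (by simp) (by simp) one_pos
  have hK0 : K 0 = Y1l a l m / Y1 p m := by
    simp only [hK, ofReal_zero, zero_mul, add_zero]
    rw [hφ0, hφ1]; ring
  rw [← hK0]
  linarith

/-- Value of `Y1` at the critical point `√x`. -/
noncomputable def critVal (x E : ℝ) : ℂ := Y1 (rp (cp (√x) E)) (√x : ℝ)

/-- Logarithmic derivative of `critVal` in the second variable. -/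
noncomputable def critLog (x E : ℝ) : ℂ :=
  Y1l (3 * √x ^ 2 : ℝ) (2 * √x ^ 3 + E : ℝ) (√x : ℝ) / critVal x E

lemma critVal_ne_zero (x E : ℝ) : critVal x E ≠ 0 := by
  have := Y1_crit_ne_zero (√x) (2 * √x ^ 3 + E) 0 le_rfl
  rwa [ofReal_zero, zero_mul, add_zero] at this

lemma continuous_critVal : Continuous fun q : ℝ × ℝ => critVal q.1 q.2 :=
  (continuous_Y1 (X := ℝ × ℝ) (p := fun q => rp (cp (√q.1) q.2)) (z := fun q => (√q.1 : ℝ))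
    (continuous_rp.comp (continuous_cp.comp
      ((Real.continuous_sqrt.comp continuous_fst).prodMk continuous_snd)))
    (continuous_ofReal.comp (Real.continuous_sqrt.comp continuous_fst))).1

lemma continuous_Y1l_real : Continuous fun q : ℂ × ℝ => Y1l ((3 * q.2 ^ 2 : ℝ) : ℂ) q.1 (q.2 : ℂ) := by
  have hd : ∀ m : ℝ, Differentiable ℂ fun l : ℂ => Y1 (((3 * m ^ 2 : ℝ) : ℂ), l) (m : ℂ) :=
    fun m => (sepHol_Y1 ((3 * m ^ 2 : ℝ) : ℂ)).d1 (m : ℂ)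
  have hc : Continuous fun q : ℂ × ℝ => Y1 (((3 * q.2 ^ 2 : ℝ) : ℂ), q.1) (q.2 : ℂ) :=
    (continuous_Y1 (X := ℂ × ℝ) (p := fun q => (((3 * q.2 ^ 2 : ℝ) : ℂ), q.1))
      (z := fun q => (q.2 : ℂ)) (by fun_prop) (by fun_prop)).1
  exact continuous_deriv_param (X := ℝ)
    (f := fun l m => Y1 (((3 * m ^ 2 : ℝ) : ℂ), l) (m : ℂ)) hc hd

lemma continuous_critLog : Continuous fun q : ℝ × ℝ => critLog q.1 q.2 := by
  have h2 : Continuous fun q : ℝ × ℝ => (((2 * √q.1 ^ 3 + q.2 : ℝ) : ℂ), √q.1) := by fun_prop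
  have h3 := Continuous.comp (f := fun q : ℝ × ℝ => (((2 * √q.1 ^ 3 + q.2 : ℝ) : ℂ), √q.1))
    (g := fun q : ℂ × ℝ => Y1l ((3 * q.2 ^ 2 : ℝ) : ℂ) q.1 (q.2 : ℂ)) continuous_Y1l_real h2
  have h4 := Continuous.div (f := (fun q : ℂ × ℝ => Y1l ((3 * q.2 ^ 2 : ℝ) : ℂ) q.1 (q.2 : ℂ)) ∘
      fun q : ℝ × ℝ => (((2 * √q.1 ^ 3 + q.2 : ℝ) : ℂ), √q.1))
    (g := fun q : ℝ × ℝ => critVal q.1 q.2) h3 continuous_critVal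
    fun q => critVal_ne_zero q.1 q.2
  simp only [critLog]
  exact h4

lemma hasDerivAt_critVal (x E : ℝ) :
    HasDerivAt (critVal x) (critLog x E * critVal x E) E := by
  have h := ((sepHol_Y1 (3 * √x ^ 2 : ℝ)).d1 (√x : ℝ) (2 * √x ^ 3 + E : ℝ)).hasDerivAt
  have h1 : HasDerivAt (fun E : ℝ => ((2 * √x ^ 3 + E : ℝ) : ℂ)) 1 E := by
    simpa using ((hasDerivAt_id E).const_add (2 * √x ^ 3)).ofReal_comp
  rw [critLog, div_mul_cancel₀ _ (critVal_ne_zero x E), ← mul_one (Y1l _ _ _)]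
  exact HasDerivAt.comp (h₂ := fun l : ℂ => Y1 (((3 * √x ^ 2 : ℝ) : ℂ), l) ((√x : ℝ) : ℂ))
    (h := fun E : ℝ => ((2 * √x ^ 3 + E : ℝ) : ℂ)) E h h1

/-- A continuous phase of `critVal`. -/
noncomputable def phase (x E : ℝ) : ℝ := arg (critVal x 0) + (∫ t in (0 : ℝ)..E, critLog x t).im

lemma critVal_im (x E : ℝ) :
    (critVal x E).im = (cc (rp (cp (√x) E))).re * (Y0 (rp (cp (√x) E)) (√x : ℝ)).re :=
  Y1_real_im _ _

lemma critVal_zero_im_neg (x : ℝ) : (critVal x 0).im < 0 := by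
  rw [critVal_im]
  exact mul_neg_of_neg_of_pos (cc_neg (Real.sqrt_nonneg x) le_rfl) (Y0_pos (Real.sqrt_nonneg x) le_rfl)

lemma continuous_phase : Continuous fun q : ℝ × ℝ => phase q.1 q.2 := by
  refine Continuous.add ?_ (continuous_im.comp ?_)
  · refine continuous_iff_continuousAt.2 fun q => ?_
    refine (continuousAt_arg (x := critVal q.1 0) (Or.inr (critVal_zero_im_neg _).ne)).comp
      (f := fun q : ℝ × ℝ => critVal q.1 0) ?_
    exact (continuous_critVal.comp (continuous_fst.prodMk continuous_const)).continuousAt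
  · refine intervalIntegral.continuous_parametric_intervalIntegral_of_continuous
      (f := fun (q : ℝ × ℝ) t => critLog q.1 t) ?_ continuous_snd
    exact continuous_critLog.comp ((continuous_fst.comp continuous_fst).prodMk continuous_snd)

lemma hasDerivAt_critLog_integral (x E : ℝ) :
    HasDerivAt (fun E => ∫ t in (0 : ℝ)..E, critLog x t) (critLog x E) E :=
  (continuous_critLog.comp (Continuous.prodMk_right x)).integral_hasStrictDerivAt 0 E |>.hasDerivAt

lemma phase_strictMono (x : ℝ) : StrictMono (phase x) := by
  have hd : ∀ E, HasDerivAt (phase x) (critLog x E).im E := fun E =>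
    ((Complex.imCLM.hasFDerivAt (x := ∫ t in (0 : ℝ)..E, critLog x t)).comp_hasDerivAt E
      (hasDerivAt_critLog_integral x E)).const_add _
  refine strictMono_of_deriv_pos fun E => ?_
  rw [(hd E).deriv]
  exact phase_mono (Real.sqrt_nonneg x) _

lemma critVal_polar (x E : ℝ) : ∃ r : ℝ, 0 < r ∧ critVal x E = r * exp (phase x E * I) := by
  set G : ℝ → ℂ := fun E => ∫ t in (0 : ℝ)..E, critLog x t with hG
  have hc : ∀ E, critVal x E * exp (-G E) = critVal x 0 := fun E => by
    have hd : ∀ E, HasDerivAt (fun E => critVal x E * exp (-G E)) 0 E := fun E => by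
      refine ((hasDerivAt_critVal x E).mul (hasDerivAt_critLog_integral x E).neg.cexp).congr_deriv ?_
      ring
    have := is_const_of_deriv_eq_zero (fun E => (hd E).differentiableAt) (fun E => (hd E).deriv) E 0
    simpa [hG] using this
  refine ⟨‖critVal x 0‖ * Real.exp (G E).re,
    mul_pos (norm_pos_iff.2 (critVal_ne_zero _ _)) (Real.exp_pos _), ?_⟩
  have h1 : critVal x E = critVal x 0 * exp (G E) := by
    rw [← hc E, mul_assoc, ← exp_add, neg_add_cancel, exp_zero, mul_one]
  rw [h1]
  conv_lhs => rw [← norm_mul_exp_arg_mul_I (critVal x 0)]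
  rw [phase, mul_assoc, ← exp_add]
  push_cast
  rw [mul_assoc, ← exp_add]
  congr 2
  change _ = ((G E).re : ℂ) + (_ + ((G E).im : ℂ)) * I
  linear_combination -(re_add_im (G E))

lemma phase_zero (x : ℝ) : -Real.pi < phase x 0 ∧ phase x 0 < 0 := by
  rw [phase, intervalIntegral.integral_same, zero_im, add_zero]
  exact ⟨neg_pi_lt_arg _, arg_neg_iff.2 (critVal_zero_im_neg x)⟩

lemma critVal_re_im (x E : ℝ) : ∃ r : ℝ, 0 < r ∧ (critVal x E).re = r * Real.cos (phase x E) ∧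
    (critVal x E).im = r * Real.sin (phase x E) := by
  obtain ⟨r, hr, h⟩ := critVal_polar x E
  refine ⟨r, hr, ?_, ?_⟩
  · rw [h, re_ofReal_mul, exp_ofReal_mul_I_re]
  · rw [h, im_ofReal_mul, exp_ofReal_mul_I_im]

/-- Sign of the spectral determinant in terms of the phase. -/
lemma cc_sign (x : ℝ) {E : ℝ} (hE : 0 ≤ E) : ∃ r : ℝ, 0 < r ∧
    (cc (rp (cp (√x) E))).re = r * Real.sin (phase x E) := by
  obtain ⟨r, hr, -, h⟩ := critVal_re_im x E
  rw [critVal_im] at h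
  have hY := Y0_pos (Real.sqrt_nonneg x) hE
  change 0 < (Y0 (rp (cp (√x) E)) (√x : ℝ)).re at hY
  exact ⟨r / (Y0 (rp (cp (√x) E)) (√x : ℝ)).re, div_pos hr hY, by
    rw [div_mul_eq_mul_div, ← h, mul_div_cancel_right₀ _ hY.ne']⟩

lemma cc_eq_zero_iff_re (p : ℝ × ℝ) : cc (rp p) = 0 ↔ (cc (rp p)).re = 0 := by
  constructor
  · intro h; rw [h, zero_re]
  · intro h; rw [← ofReal_cc_rp, h, ofReal_zero]

lemma cc_eq_zero_iff_phase {x E : ℝ} : cc (rp (cp (√x) E)) = 0 ↔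
    0 ≤ E ∧ ∃ k : ℕ, phase x E = k * Real.pi := by
  rw [cc_eq_zero_iff_re]
  by_cases hE : 0 ≤ E
  · obtain ⟨r, hr, h⟩ := cc_sign x hE
    rw [h, mul_eq_zero, or_iff_right hr.ne', Real.sin_eq_zero_iff]
    refine ⟨fun ⟨n, hn⟩ => ⟨hE, n.toNat, ?_⟩, fun ⟨_, k, hk⟩ => ⟨k, by rw [hk]; simp⟩⟩
    have h1 := (phase_strictMono x).monotone hE
    have h2 := (phase_zero x).1
    have h3 : (-1 : ℤ) < n := by
      have : (-1 : ℝ) < n := by nlinarith [Real.pi_pos]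
      exact_mod_cast this
    rw [← hn, ← Int.cast_natCast, Int.toNat_of_nonneg (by omega)]
  · constructor
    · intro h
      have := cc_neg (Real.sqrt_nonneg x) (not_le.1 hE).le
      exact absurd h this.ne
    · exact fun h => absurd h.1 hE

/-- The number of zeros predicted by the phase. -/
noncomputable def phaseCount (φ : ℝ) : ℕ := ⌈(φ / Real.pi - 1) / 2⌉₊

lemma phaseCount_eq_iff {φ : ℝ} {j : ℕ} (h1 : (2 * j - 1) * Real.pi < φ) (h2 : φ ≤ (2 * j + 1) * Real.pi) :
    phaseCount φ = j := by
  have hpi := Real.pi_pos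
  have h3 : φ / Real.pi ≤ 2 * j + 1 := (div_le_iff₀ hpi).2 h2
  have h4 : 2 * j - 1 < φ / Real.pi := (lt_div_iff₀ hpi).2 h1
  refine le_antisymm (Nat.ceil_le.2 (by linarith)) ?_
  rcases j with _ | j
  · exact Nat.zero_le _
  · refine Nat.succ_le_of_lt (Nat.lt_ceil.2 ?_)
    push_cast at h4
    linarith

lemma critVal_def (x E : ℝ) : critVal x E = Y1 (rp (cp (√x) E)) (√x : ℝ) := rfl

lemma continuous_phase_right (x : ℝ) : Continuous (phase x) :=
  Continuous.comp (g := fun q : ℝ × ℝ => phase q.1 q.2) (f := fun E : ℝ => (x, E)) continuous_phase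
    (Continuous.prodMk_right x)

lemma phaseCount_bounds {φ : ℝ} (hφ : -Real.pi < φ) :
    (2 * (phaseCount φ : ℝ) - 1) * Real.pi < φ ∧ φ ≤ (2 * (phaseCount φ : ℝ) + 1) * Real.pi := by
  have hpi := Real.pi_pos
  constructor
  · rcases hn : phaseCount φ with _ | n
    · simpa using hφ
    · have h := Nat.lt_ceil.1 (show n < ⌈(φ / Real.pi - 1) / 2⌉₊ by
        rw [phaseCount] at hn; omega)
      push_cast
      rw [← lt_div_iff₀ hpi]; linarith
  · rw [← div_le_iff₀ hpi]
    have := Nat.le_ceil ((φ / Real.pi - 1) / 2)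
    rw [phaseCount]; linarith

lemma Y1_ne_zero_of_phase {x E : ℝ} (hE : 0 ≤ E) {j : ℕ} (hj1 : (2 * j - 1) * Real.pi < phase x E)
    (hlt : phase x E < (2 * j + 1) * Real.pi) (y : ℝ) (hy : √x < y) :
    Y1 (rp (cp (√x) E)) y ≠ 0 := by
  have hpi := Real.pi_pos
  by_cases hc : cc (rp (cp (√x) E)) = 0
  · refine Y1_no_real_zero (Real.sqrt_nonneg x) hE hc ?_ hy.le
    suffices hs : 0 < (critVal x E).re from hs
    obtain ⟨r, hr, h, -⟩ := critVal_re_im x E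
    obtain ⟨-, k, hk⟩ := cc_eq_zero_iff_phase.1 hc
    have h1 : 2 * (j : ℤ) - 1 < k := by
      have : (2 * (j : ℝ) - 1) < k := lt_of_mul_lt_mul_right (hj1.trans_eq hk) hpi.le
      exact_mod_cast this
    have h2 : (k : ℤ) < 2 * j + 1 := by
      have : (k : ℝ) < 2 * j + 1 := lt_of_mul_lt_mul_right (hk.symm.trans_lt hlt) hpi.le
      exact_mod_cast this
    have h3 : k = 2 * j := by omega
    rw [h, hk, h3]
    have : Real.cos ((2 * j : ℕ) * Real.pi) = 1 := by
      rw [show ((2 * j : ℕ) : ℝ) * Real.pi = (j : ℝ) * (2 * Real.pi) by push_cast; ring]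
      exact Real.cos_nat_mul_two_pi j
    rw [this, mul_one]; exact hr
  · exact Y1_real_ne_zero (fun h => hc ((cc_eq_zero_iff_re _).2 h)) y

lemma quadZ_ncard_jump {x E₀ : ℝ} (hE₀ : 0 ≤ E₀) {j : ℕ}
    (heq : phase x E₀ = (2 * j + 1) * Real.pi) :
    (quadZ (√x) E₀).Finite ∧ ∀ᶠ E in 𝓝 E₀,
      ((quadZ (√x) E).ncard : ℤ) - phaseCount (phase x E) =
        (quadZ (√x) E₀).ncard - phaseCount (phase x E₀) := by
  have hm := Real.sqrt_nonneg x
  have hpi := Real.pi_pos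
  have hcp := continuous_phase_right x
  have hk0 : phaseCount (phase x E₀) = j := phaseCount_eq_iff (by linarith) heq.le
  have hc : cc (rp (cp (√x) E₀)) = 0 :=
    cc_eq_zero_iff_phase.2 ⟨hE₀, 2 * j + 1, by rw [heq]; push_cast; ring⟩
  have hneg : (Y1 (rp (cp (√x) E₀)) (√x : ℝ)).re < 0 := by
    rw [← critVal_def]
    obtain ⟨r, hr, h, -⟩ := critVal_re_im x E₀
    rw [h, heq, show (2 * (j : ℝ) + 1) * Real.pi = (j : ℝ) * (2 * Real.pi) + Real.pi by ring,
      Real.cos_add_pi, Real.cos_nat_mul_two_pi]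
    linarith
  have hE₀' : 0 < E₀ := hE₀.lt_of_ne fun h => by
    have h2 := (phase_zero x).2
    rw [h, heq] at h2
    have : 0 < (2 * (j : ℝ) + 1) * Real.pi := by positivity
    linarith
  obtain ⟨hf, hev⟩ := quadZ_jump hm hE₀ hc hneg
  refine ⟨hf, ?_⟩
  have hl : 2 * j * Real.pi < phase x E₀ := by rw [heq]; linarith
  have hu : phase x E₀ < (2 * j + 2) * Real.pi := by rw [heq]; linarith
  filter_upwards [hev, hcp.continuousAt.eventually (lt_mem_nhds hl),
    hcp.continuousAt.eventually (gt_mem_nhds hu), lt_mem_nhds hE₀'] with E h1 h2 h3 h4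
  obtain ⟨r, hr, hs⟩ := cc_sign x h4.le
  have hsin : Real.sin (phase x E) = Real.sin (phase x E - j * (2 * Real.pi)) :=
    (Real.sin_sub_nat_mul_two_pi _ _).symm
  rcases lt_trichotomy E E₀ with h | h | h
  · have h5 := phase_strictMono x h
    rw [heq] at h5
    have : 0 < Real.sin (phase x E) := by
      rw [hsin]; exact Real.sin_pos_of_pos_of_lt_pi (by linarith) (by linarith)
    rw [(h1.2 (by rw [hs]; positivity)).2, hk0, phaseCount_eq_iff (by linarith) h5.le]
  · rw [h]
  · have h5 := phase_strictMono x h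
    rw [heq] at h5
    have : Real.sin (phase x E) < 0 := by
      rw [hsin, ← Real.sin_sub_two_pi]
      exact Real.sin_neg_of_neg_of_neg_pi_lt (by linarith) (by linarith)
    rw [(h1.1 (by rw [hs]; exact mul_neg_of_pos_of_neg hr this)).2, hk0,
      phaseCount_eq_iff (j := j + 1) (by push_cast; linarith) (by push_cast; linarith)]
    push_cast; ring

lemma quadZ_ncard_aux (x : ℝ) {E₀ : ℝ} (hE₀ : 0 ≤ E₀) :
    (quadZ (√x) E₀).Finite ∧ ∀ᶠ E in 𝓝 E₀,
      ((quadZ (√x) E).ncard : ℤ) - phaseCount (phase x E) =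
        (quadZ (√x) E₀).ncard - phaseCount (phase x E₀) := by
  have hcp := continuous_phase_right x
  have hφ : -Real.pi < phase x E₀ :=
    (phase_zero x).1.trans_le ((phase_strictMono x).monotone hE₀)
  obtain ⟨hj1, hj2⟩ := phaseCount_bounds hφ
  rcases hj2.lt_or_eq with hlt | heq
  · obtain ⟨hf, hev⟩ := quadZ_locally_const (Real.sqrt_nonneg x) (Y1_ne_zero_of_phase hE₀ hj1 hlt)
    refine ⟨hf, ?_⟩
    filter_upwards [hev, hcp.continuousAt.eventually (lt_mem_nhds hj1),
      hcp.continuousAt.eventually (gt_mem_nhds hlt)] with E h1 h2 h3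
    rw [h1.2, phaseCount_eq_iff h2 h3.le]
  · exact quadZ_ncard_jump hE₀ heq

/-- The number of zeros in the quadrant is determined by the phase. -/
theorem quadZ_ncard (x : ℝ) {E : ℝ} (hE : 0 ≤ E) :
    (quadZ (√x) E).Finite ∧ (quadZ (√x) E).ncard = phaseCount (phase x E) := by
  refine ⟨(quadZ_ncard_aux x hE).1, ?_⟩
  have hcont : ContinuousOn (fun E => ((quadZ (√x) E).ncard : ℤ) - phaseCount (phase x E))
      (Set.Ici 0) := fun E₀ hE₀ =>
    (tendsto_nhds_of_eventually_eq (quadZ_ncard_aux x hE₀).2).mono_left inf_le_left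
  have h := isPreconnected_Ici.constant hcont (Set.mem_Ici.2 hE) (Set.mem_Ici.2 le_rfl)
  have h0 : phaseCount (phase x 0) = 0 :=
    phaseCount_eq_iff (j := 0) (by simpa using (phase_zero x).1) (by
      have := (phase_zero x).2
      have := Real.pi_pos
      push_cast; linarith)
  simp only [quadZ_base (Real.sqrt_nonneg x), h0, Set.ncard_empty] at h
  omega

lemma IsSol.affine {Q w w' : ℂ → ℂ} (h : IsSol Q w w') (c κ : ℂ) :
    IsSol (fun t => κ ^ 2 * Q (c + κ * t)) (fun t => w (c + κ * t)) (fun t => κ * w' (c + κ * t)) := by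
  have hl : ∀ t : ℂ, HasDerivAt (fun t => c + κ * t) κ t := fun t => by
    simpa using ((hasDerivAt_id t).const_mul κ).const_add c
  refine ⟨fun t => ?_, fun t => ?_⟩
  · exact (HasDerivAt.comp (h₂ := w) t (h.d1 (c + κ * t)) (hl t)).congr_deriv (by ring)
  · exact ((HasDerivAt.comp (h₂ := w') t (h.d2 (c + κ * t)) (hl t)).const_mul κ).congr_deriv (by ring)

lemma IsSol.eq_sol {q : Fin 4 → ℂ} {w w' : ℂ → ℂ} (hw : IsSol (cubic q) w w') :
    w = sol q (w 0) (w' 0) := by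
  funext z
  rw [hw.eq_fund 0 z, (isSol_sol q (w 0) (w' 0)).eq_fund 0 z]
  simp only [sol_zero, dsol_zero]

lemma sol_smul (q : Fin 4 → ℂ) (c A B z : ℂ) : sol q (c * A) (c * B) z = c * sol q A B z := by
  rw [(isSol_sol q (c * A) (c * B)).eq_fund 0 z, (isSol_sol q A B).eq_fund 0 z]
  simp only [sol_zero, dsol_zero]
  ring

section persist
variable {X : Type*} [TopologicalSpace X] {f f' : X → ℂ → ℂ}

/-- Finitely many simple zeros persist under perturbation. -/
lemma finset_zeros_persist (hd : ∀ x z, HasDerivAt (f x) (f' x z) z)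
    (hc : Continuous fun q : X × ℂ => f q.1 q.2) (hc' : Continuous fun q : X × ℂ => f' q.1 q.2)
    {x₀ : X} {T : Finset ℂ} {r : ℝ} (h0 : ∀ z ∈ T, ‖z‖ < r ∧ f x₀ z = 0 ∧ f' x₀ z ≠ 0) :
    ∀ᶠ x in 𝓝 x₀, ∃ T' : Finset ℂ, T'.card = T.card ∧ ∀ z ∈ T', ‖z‖ < r ∧ f x z = 0 := by
  obtain ⟨U, hU, hdisj⟩ := T.finite_toSet.t2_separation
  have h : ∀ z ∈ T, ∀ᶠ x in 𝓝 x₀, ∃ w, w ∈ U z ∧ ‖w‖ < r ∧ f x w = 0 := fun z hz => by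
    obtain ⟨ε, hε, h⟩ := simple_zero_persists hd hc hc' (h0 z hz).2.1 (h0 z hz).2.2
    obtain ⟨δ, hδ, hb⟩ := Metric.isOpen_iff.1 ((hU z).2.inter (Metric.isOpen_ball (x := 0) (ε := r)))
      z ⟨(hU z).1, by simpa using (h0 z hz).1⟩
    filter_upwards [h (min ε δ) (lt_min hε hδ) (min_le_left _ _)] with x hx
    obtain ⟨w, hw, hw0, -⟩ := hx
    have := hb (Metric.ball_subset_ball (min_le_right _ _) hw)
    exact ⟨w, this.1, by simpa using this.2, hw0⟩
  filter_upwards [(eventually_all_finset T).2 h] with x hx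
  choose! g hg using hx
  refine ⟨T.image g, Finset.card_image_of_injOn fun a ha b hb hab => ?_, ?_⟩
  · by_contra hne
    exact Set.disjoint_left.1 (hdisj ha hb hne) (hg a ha).1 (hab ▸ (hg b hb).1)
  · intro z hz
    obtain ⟨a, ha, rfl⟩ := Finset.mem_image.1 hz
    exact (hg a ha).2

end persist

lemma continuous_sol_left (A B : ℂ) : Continuous (fun q : (Fin 4 → ℂ) × ℂ => sol q.1 A B q.2) ∧
    Continuous (fun q : (Fin 4 → ℂ) × ℂ => dsol q.1 A B q.2) :=
  continuous_sol_aux continuous_fst continuous_const continuous_const continuous_snd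

lemma sol_free_zero : ∃ ε > 0, ∀ q : Fin 4 → ℂ, ‖q‖ < ε → ∃ z : ℂ, ‖z‖ < 2 ∧ sol q 1 1 z = 0 := by
  have h1 : IsSol (cubic 0) (fun z => 1 + z) (fun _ => 1) :=
    ⟨fun z => by simpa using (hasDerivAt_id z).const_add 1, fun z => by
      simpa [cubic] using hasDerivAt_const z (1 : ℂ)⟩
  have h2 : sol 0 1 1 = fun z => 1 + z := by simpa using h1.eq_sol.symm
  have h3 : dsol 0 1 1 = fun _ => 1 := by
    rw [← (isSol_sol 0 1 1).deriv_eq, h2]; exact h1.deriv_eq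
  have h := finset_zeros_persist (f := fun q => sol q 1 1) (f' := fun q => dsol q 1 1)
    (fun q => hasDerivAt_sol q 1 1) (continuous_sol_left 1 1).1 (continuous_sol_left 1 1).2
    (x₀ := 0) (T := {-1}) (r := 2) (by
      intro z hz
      rw [Finset.mem_singleton] at hz
      rw [hz, h2, h3]; simp)
  obtain ⟨ε, hε, h⟩ := Metric.eventually_nhds_iff.1 h
  refine ⟨ε, hε, fun q hq => ?_⟩
  obtain ⟨T, hT, hz⟩ := h (y := q) (by simpa using hq)
  obtain ⟨z, rfl⟩ := Finset.card_eq_one.1 (hT.trans (Finset.card_singleton _))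
  exact ⟨z, hz z (Finset.mem_singleton_self z)⟩

/-- Coefficients of the Airy equation. -/
def airyq : Fin 4 → ℂ := ![0, 1, 0, 0]

lemma cubic_airyq (z : ℂ) : cubic airyq z = z := by simp [cubic, airyq]

/-- Away from zeros, the logarithmic derivative of an Airy solution grows at most like a square
root. -/
lemma airy_riccati_bound : ∃ V : ℝ, 1 ≤ V ∧ ∀ w w' : ℂ → ℂ, IsSol (cubic airyq) w w' → ∀ s : ℂ,
    1 ≤ ‖s‖ → (∀ z, ‖z - s‖ < 2 → w z ≠ 0) → ‖w' s / w s‖ ^ 2 ≤ V * ‖s‖ := by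
  obtain ⟨ε, hε, h⟩ := sol_free_zero
  refine ⟨1 / ε + 1, by have := one_div_pos.2 hε; linarith, fun w w' hw s hs hne => ?_⟩
  by_contra! hv
  set v := w' s / w s with hvd
  have hV : 1 / ε < ‖v‖ ^ 2 / ‖s‖ := by
    rw [lt_div_iff₀ (by linarith)]; nlinarith
  have hεp := one_div_pos.2 hε
  have hv1 : 1 ≤ ‖v‖ := by nlinarith [norm_nonneg v]
  have hv0 : v ≠ 0 := norm_pos_iff.1 (by linarith)
  have hws : w s ≠ 0 := hne s (by simp)
  have hw's : w' s = v * w s := by rw [hvd, div_mul_cancel₀ _ hws]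
  have hsv : ‖s‖ / ‖v‖ ^ 2 < ε := by
    rw [div_lt_iff₀ (by positivity)]
    rw [lt_div_iff₀ (by linarith), div_mul_eq_mul_div, div_lt_iff₀ hε] at hV
    linarith
  have hv3 : 1 / ‖v‖ ^ 3 < ε := by
    refine lt_of_le_of_lt ?_ hsv
    rw [div_le_div_iff₀ (by positivity) (by positivity)]
    have : ‖v‖ ^ 2 ≤ ‖v‖ ^ 3 := pow_le_pow_right₀ hv1 (by norm_num)
    have h3 : 0 ≤ ‖v‖ ^ 3 := by positivity
    nlinarith
  have hU := (hw.affine s v⁻¹).smul (w s)⁻¹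
  have hQ : (fun t => v⁻¹ ^ 2 * cubic airyq (s + v⁻¹ * t)) = cubic ![s / v ^ 2, 1 / v ^ 3, 0, 0] := by
    funext t
    rw [cubic_airyq]
    simp only [cubic, Matrix.cons_val]
    field_simp
    ring
  rw [hQ] at hU
  have hU' := hU.eq_sol
  simp only [mul_zero, add_zero, hw's, inv_mul_cancel₀ hws, ← mul_assoc, inv_mul_cancel₀ hv0] at hU'
  rw [mul_one, inv_mul_cancel₀ hws] at hU'
  obtain ⟨z, hz, hz0⟩ := h ![s / v ^ 2, 1 / v ^ 3, 0, 0] (by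
    rw [pi_norm_lt_iff hε]
    intro i
    fin_cases i
    · simpa using hsv
    · simpa using hv3
    · simpa using hε
    · simpa using hε)
  rw [← hU'] at hz0
  have h0 : w (s + v⁻¹ * z) = 0 := by
    simpa [hws] using hz0
  refine hne _ ?_ h0
  rw [add_sub_cancel_left, norm_mul, norm_inv]
  calc ‖v‖⁻¹ * ‖z‖ ≤ 1 * ‖z‖ := by
        have := inv_le_one_of_one_le₀ hv1
        gcongr
    _ < 2 := by linarith

/-- Every nontrivial solution of the Airy equation has infinitely many zeros. -/
lemma airy_zeros_infinite {w w' : ℂ → ℂ} (hw : IsSol (cubic airyq) w w') :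
    {z | w z = 0}.Infinite := by
  intro hfin
  obtain ⟨R, hR1, hR⟩ : ∃ R : ℝ, 0 < R ∧ ∀ z, w z = 0 → ‖z‖ < R := by
    obtain ⟨R, hR⟩ := hfin.isBounded.exists_norm_le
    exact ⟨|R| + 1, by positivity, fun z hz => (hR z hz).trans_lt (by linarith [le_abs_self R])⟩
  obtain ⟨V, hV1, hV⟩ := airy_riccati_bound
  set v : ℂ → ℂ := fun s => w' s / w s with hvd
  have hne : ∀ s, R ≤ ‖s‖ → w s ≠ 0 := fun s hs h => absurd (hR s h) (not_lt.2 hs)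
  have hb : ∀ s, R + 2 ≤ ‖s‖ → ‖v s‖ ^ 2 ≤ V * ‖s‖ := fun s hs =>
    hV w w' hw s (by linarith) fun z hz => hne z (by
      have := norm_sub_norm_le s z
      rw [norm_sub_rev] at this
      linarith)
  have hvder : ∀ s, R ≤ ‖s‖ → HasDerivAt v (s - v s ^ 2) s := fun s hs => by
    refine ((hw.d2 s).div (hw.d1 s) (hne s hs)).congr_deriv ?_
    have := hne s hs
    rw [cubic_airyq]
    simp only [hvd]
    field_simp
  set ρ : ℝ := R + V + 4 with hρ
  have hclose : ∀ s : ℂ, ‖s‖ = ρ → ‖s - v s ^ 2‖ < ρ := fun s hs => by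
    have hz : ∀ z ∈ Metric.closedBall s 1, R + 2 ≤ ‖z‖ ∧ ‖z‖ ≤ ρ + 1 := fun z hz => by
      rw [mem_closedBall_iff_norm] at hz
      have h1 := norm_sub_norm_le s z
      have h2 := norm_sub_norm_le z s
      rw [norm_sub_rev] at h1
      constructor <;> linarith
    have hd : DiffContOnCl ℂ v (Metric.ball s 1) :=
      DifferentiableOn.diffContOnCl fun z hz' => by
        rw [closure_ball _ one_ne_zero] at hz'
        exact (hvder z (by linarith [(hz z hz').1])).differentiableAt.differentiableWithinAt
    have h := norm_deriv_le_of_forall_mem_sphere_norm_le (C := √(V * (ρ + 1))) one_pos hd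
      fun z hz' => by
        obtain ⟨h1, h2⟩ := hz z (Metric.sphere_subset_closedBall hz')
        refine Real.le_sqrt_of_sq_le ((hb z h1).trans ?_)
        gcongr
    rw [(hvder s (by linarith)).deriv, div_one] at h
    refine h.trans_lt ((Real.sqrt_lt' (by linarith)).2 ?_)
    nlinarith
  set h : ℝ → ℂ := fun θ => v (ρ * exp (θ * I)) * exp (-(θ / 2 * I)) with hh
  have hnorm : ∀ θ : ℝ, ‖(ρ : ℂ) * exp (θ * I)‖ = ρ := fun θ => by
    rw [norm_mul, norm_exp_ofReal_mul_I, mul_one, norm_real, Real.norm_of_nonneg (by linarith)]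
  have hcont : Continuous h := by
    refine Continuous.mul (continuous_iff_continuousAt.2 fun θ => ?_) (by fun_prop)
    refine ContinuousAt.comp (f := fun θ : ℝ => (ρ : ℂ) * exp (θ * I)) (g := v)
      (hvder _ ?_).continuousAt (by fun_prop)
    rw [hnorm]; linarith
  have hre : ∀ θ, (h θ).re ≠ 0 := fun θ h0 => by
    have h1 := hclose _ (hnorm θ)
    have h2 : ‖(ρ : ℂ) - h θ ^ 2‖ < ρ := by
      have e : (ρ : ℂ) - h θ ^ 2 =
          (ρ * exp (θ * I) - v (ρ * exp (θ * I)) ^ 2) * exp ((-θ : ℝ) * I) := by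
        have e1 : exp (θ * I) * exp ((-θ : ℝ) * I) = 1 := by
          rw [← exp_add, ← exp_zero]; congr 1; push_cast; ring
        have e2 : exp (-(θ / 2 * I)) ^ 2 = exp ((-θ : ℝ) * I) := by
          rw [← exp_nat_mul]; congr 1; push_cast; ring
        simp only [hh]
        rw [mul_pow, e2]
        linear_combination -(ρ : ℂ) * e1
      rw [e, norm_mul, norm_exp_ofReal_mul_I, mul_one]
      exact h1
    have h3 := (abs_re_le_norm _).trans_lt h2
    rw [sub_re, ofReal_re, sq, mul_re, h0] at h3
    have h4 := (abs_lt.1 h3).2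
    nlinarith [sq_nonneg (h θ).im]
  have hper : h (2 * Real.pi) = -h 0 := by
    simp only [hh]
    push_cast
    rw [exp_two_pi_mul_I, zero_mul, exp_zero, zero_div, zero_mul, neg_zero, exp_zero,
      show -(2 * (Real.pi : ℂ) / 2 * I) = -(Real.pi * I) by ring, exp_neg, exp_pi_mul_I]
    norm_num
  have hcr : Continuous fun θ => (h θ).re := continuous_re.comp hcont
  have h0 : (0 : ℝ) ∈ Set.range fun θ => (h θ).re := by
    rcases lt_or_gt_of_ne (hre 0) with hl | hl
    · exact mem_range_of_exists_le_of_exists_ge hcr ⟨0, hl.le⟩ ⟨2 * Real.pi, by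
        simp only [hper, neg_re]; linarith⟩
    · exact mem_range_of_exists_le_of_exists_ge hcr ⟨2 * Real.pi, by
        simp only [hper, neg_re]; linarith⟩ ⟨0, hl.le⟩
  obtain ⟨θ, hθ⟩ := h0
  exact hre θ hθ

/-- Perturbations of the Airy equation: nontrivial solutions have many zeros in a fixed disc. -/
lemma near_airy_zeros (N : ℕ) : ∃ r : ℝ, 0 < r ∧ ∀ᶠ q in 𝓝 airyq, ∀ A B : ℂ, (A, B) ≠ 0 →
    ∃ T : Finset ℂ, T.card = N ∧ ∀ z ∈ T, ‖z‖ < r ∧ sol q A B z = 0 := by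
  have key : ∃ r : ℝ, ∀ᶠ q in 𝓝 airyq, ∀ C ∈ Metric.sphere (0 : ℂ × ℂ) 1,
      ∃ T : Finset ℂ, T.card = N ∧ ∀ z ∈ T, ‖z‖ < r ∧ sol q C.1 C.2 z = 0 := by
    refine (isCompact_sphere (0 : ℂ × ℂ) 1).induction_on
      (p := fun S => ∃ r : ℝ, ∀ᶠ q in 𝓝 airyq, ∀ C ∈ S,
        ∃ T : Finset ℂ, T.card = N ∧ ∀ z ∈ T, ‖z‖ < r ∧ sol q C.1 C.2 z = 0) ?_ ?_ ?_ ?_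
    · exact ⟨0, .of_forall fun q C hC => absurd hC (Set.notMem_empty C)⟩
    · rintro s t hst ⟨r, hr⟩
      exact ⟨r, hr.mono fun q hq C hC => hq C (hst hC)⟩
    · rintro s t ⟨r, hr⟩ ⟨r', hr'⟩
      refine ⟨max r r', ?_⟩
      filter_upwards [hr, hr'] with q hq hq' C hC
      rcases hC with hC | hC
      · obtain ⟨T, hT, h⟩ := hq C hC
        exact ⟨T, hT, fun z hz => ⟨(h z hz).1.trans_le (le_max_left _ _), (h z hz).2⟩⟩
      · obtain ⟨T, hT, h⟩ := hq' C hC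
        exact ⟨T, hT, fun z hz => ⟨(h z hz).1.trans_le (le_max_right _ _), (h z hz).2⟩⟩
    · intro C hC
      have hC0 : C ≠ 0 := fun h => by simp [h] at hC
      obtain ⟨T, hTs, hTc⟩ := (airy_zeros_infinite (isSol_sol airyq C.1 C.2)).exists_subset_card_eq N
      obtain ⟨r, hr⟩ := T.finite_toSet.isBounded.exists_norm_le
      have hsol := continuous_sol_aux (X := ((Fin 4 → ℂ) × (ℂ × ℂ)) × ℂ) (q := fun x => x.1.1)
        (A := fun x => x.1.2.1) (B := fun x => x.1.2.2) (z := fun x => x.2)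
        (by fun_prop) (by fun_prop) (by fun_prop) (by fun_prop)
      have h := finset_zeros_persist (X := (Fin 4 → ℂ) × (ℂ × ℂ)) (f := fun x => sol x.1 x.2.1 x.2.2)
        (f' := fun x => dsol x.1 x.2.1 x.2.2) (fun x => hasDerivAt_sol _ _ _) hsol.1 hsol.2
        (x₀ := (airyq, C)) (T := T) (r := r + 1) fun z hz =>
          ⟨(hr z hz).trans_lt (by linarith), hTs hz, fun h => by
            have h1 := (isSol_sol airyq C.1 C.2).eq_zero (hTs hz) h
            have h2 : sol airyq C.1 C.2 = fun _ => 0 := funext h1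
            have h3 : dsol airyq C.1 C.2 0 = 0 := by
              rw [← (isSol_sol airyq C.1 C.2).deriv_eq, h2]; simp
            have h4 := h1 0
            rw [sol_zero] at h4
            rw [dsol_zero] at h3
            exact hC0 (Prod.ext h4 h3)⟩
      rw [nhds_prod_eq] at h
      obtain ⟨pa, ha, pb, hb, hab⟩ := eventually_prod_iff.1 h
      refine ⟨{C | pb C}, mem_nhdsWithin_of_mem_nhds hb, r + 1, ?_⟩
      filter_upwards [ha] with q hq C hC
      obtain ⟨T', h1, h2⟩ := hab hq hC
      exact ⟨T', h1.trans hTc, h2⟩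
  obtain ⟨r, hr⟩ := key
  refine ⟨|r| + 1, by positivity, hr.mono fun q hq A B hAB => ?_⟩
  have hn : 0 < ‖(A, B)‖ := norm_pos_iff.2 hAB
  have hn' : ((‖(A, B)‖ : ℝ) : ℂ) ≠ 0 := ofReal_ne_zero.2 hn.ne'
  obtain ⟨T, hT, h⟩ := hq (((‖(A, B)‖ : ℝ) : ℂ)⁻¹ • (A, B)) (by
    rw [mem_sphere_zero_iff_norm, norm_smul, norm_inv, norm_real, norm_norm, inv_mul_cancel₀ hn.ne'])
  refine ⟨T, hT, fun z hz => ⟨(h z hz).1.trans (by linarith [le_abs_self r]), ?_⟩⟩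
  have h2 := (h z hz).2
  simp only [Prod.smul_mk, smul_eq_mul] at h2
  rw [sol_smul] at h2
  exact (mul_eq_zero.1 h2).resolve_left (inv_ne_zero hn')

/-- Many zeros near a simple turning point that is far from the other two. -/
lemma turning_point_zeros (N : ℕ) : ∃ Y : ℝ, 1 < Y ∧ ∀ x y : ℝ, Y ≤ y → x ^ 2 ≤ 3 * y ^ 2 →
    ∀ w w' : ℂ → ℂ, IsSol (pot (rp (3 * x ^ 2 - y ^ 2, 2 * x * (x ^ 2 + y ^ 2)))) w w' → w ≠ 0 →
    ∃ T : Finset ℂ, T.card = N ∧ ∀ z ∈ T, ‖z - (x + y * I)‖ < 1 ∧ w z = 0 := by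
  obtain ⟨r, hr, hev⟩ := near_airy_zeros N
  obtain ⟨δ, hδ, h⟩ := Metric.eventually_nhds_iff.1 hev
  set k₀ : ℝ := min (1 / 2) (min (δ / 7) (1 / (r + 1))) with hk₀
  have hk0 : 0 < k₀ := lt_min (by norm_num) (lt_min (by positivity) (by positivity))
  have hk1 : k₀ ≤ 1 / 2 := min_le_left _ _
  have hk2 : k₀ ≤ δ / 7 := (min_le_right _ _).trans (min_le_left _ _)
  have hk3 : k₀ ≤ 1 / (r + 1) := (min_le_right _ _).trans (min_le_right _ _)
  have hY1 : 1 < 1 / k₀ ^ 2 := by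
    rw [lt_div_iff₀ (by positivity)]; nlinarith
  refine ⟨1 / k₀ ^ 2, hY1, fun x y hy hxy w w' hw hw0 => ?_⟩
  have hy1 : 1 < y := hY1.trans_le hy
  set c : ℂ := x + y * I with hc
  have hcre : c.re = x := by simp [hc]
  have hcim : c.im = y := by simp [hc]
  set D : ℂ := (-2 * y ^ 2 : ℝ) + (6 * x * y : ℝ) * I with hD
  have hDn : 2 * y ^ 2 ≤ ‖D‖ := by
    refine le_trans ?_ (abs_re_le_norm D)
    rw [show D.re = -2 * y ^ 2 by simp [hD, sq], neg_mul, abs_neg, abs_of_nonneg (by positivity)]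
  have hD0 : D ≠ 0 := norm_pos_iff.1 (lt_of_lt_of_le (by positivity) hDn)
  have hcn : ‖c‖ ≤ 2 * y := by
    refine abs_le_of_sq_le_sq' ?_ (by linarith) |>.2
    rw [← normSq_eq_norm_sq, normSq_apply, hcre, hcim]
    nlinarith
  obtain ⟨κ, hκ⟩ := IsAlgClosed.exists_pow_nat_eq D⁻¹ (n := 3) (by norm_num)
  have hκD : κ ^ 3 * D = 1 := by rw [hκ, inv_mul_cancel₀ hD0]
  have hκ0 : κ ≠ 0 := fun h => by simp [h] at hκD
  set k := ‖κ‖ with hk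
  have hkn : 0 ≤ k := norm_nonneg _
  have hk3y : k ^ 3 * (2 * y ^ 2) ≤ 1 := by
    have : k ^ 3 * ‖D‖ = 1 := by rw [hk, ← norm_pow, ← norm_mul, hκD, norm_one]
    have h3 : 0 ≤ k ^ 3 := by positivity
    nlinarith
  have hkk : k ≤ k₀ := by
    by_contra! hlt
    have h1 : k₀ ^ 3 < k ^ 3 := by gcongr
    have h2 : 1 ≤ y * k₀ ^ 2 := by rwa [div_le_iff₀ (by positivity)] at hy
    have h4 : k₀ ^ 3 * (2 * y ^ 2) < 1 := lt_of_lt_of_le (by gcongr) hk3y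
    nlinarith [pow_pos hk0 3, pow_pos hk0 2]
  have hyk : y * k ^ 4 ≤ k := by
    refine abs_le_of_sq_le_sq' ?_ hkn |>.2
    have h5 : k ^ 3 ≤ 1 := pow_le_one₀ hkn (by linarith)
    have h6 : k ^ 3 * y ^ 2 ≤ 1 := by nlinarith
    calc (y * k ^ 4) ^ 2 = (k ^ 3 * y ^ 2) * (k ^ 3) * k ^ 2 := by ring
      _ ≤ 1 * 1 * k ^ 2 := by gcongr
      _ = k ^ 2 := by ring
  have hk5 : k ^ 5 ≤ k := by
    calc k ^ 5 ≤ k ^ 1 := pow_le_pow_of_le_one hkn (by linarith) (by norm_num)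
      _ = k := pow_one k
  have hU := hw.affine c κ
  have hQ : (fun t => κ ^ 2 * pot (rp (3 * x ^ 2 - y ^ 2, 2 * x * (x ^ 2 + y ^ 2))) (c + κ * t)) =
      cubic ![0, 1, 3 * c * κ ^ 4, κ ^ 5] := by
    funext t
    have e : D = 3 * c ^ 2 - (3 * x ^ 2 - y ^ 2) := by
      rw [hD, hc]; push_cast; linear_combination -3 * (y : ℂ) ^ 2 * I_sq
    have e2 : c ^ 3 - (3 * x ^ 2 - y ^ 2) * c + 2 * x * (x ^ 2 + y ^ 2) = 0 := by
      rw [hc]; linear_combination (3 * x * (y : ℂ) ^ 2 + y ^ 3 * I) * I_sq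
    simp only [pot, rp, cubic, Matrix.cons_val]
    push_cast
    rw [e] at hκD
    linear_combination κ ^ 2 * e2 + t * hκD
  rw [hQ] at hU
  have hU' := hU.eq_sol
  simp only [mul_zero, add_zero] at hU'
  have hmem : dist ![0, 1, 3 * c * κ ^ 4, κ ^ 5] airyq < δ := by
    rw [dist_eq_norm, pi_norm_lt_iff hδ]
    intro i
    fin_cases i
    · simpa [airyq] using hδ
    · simpa [airyq] using hδ
    · suffices 3 * ‖c‖ * k ^ 4 < δ by simpa [airyq, hk] using this
      have h4 : 0 ≤ k ^ 4 := by positivity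
      nlinarith
    · suffices k ^ 5 < δ by simpa [airyq, hk] using this
      linarith
  have hne : (w c, κ * w' c) ≠ 0 := fun h0 => by
    rw [Prod.mk_eq_zero, mul_eq_zero, or_iff_right hκ0] at h0
    exact hw0 (isSol_pot_eq_zero hw h0.1 h0.2)
  obtain ⟨T, hT, hz⟩ := h hmem _ _ hne
  refine ⟨T.image fun t => c + κ * t, ?_, fun z hz' => ?_⟩
  · rw [Finset.card_image_of_injective _ fun s t hst => mul_left_cancel₀ hκ0 (add_left_cancel hst), hT]
  · obtain ⟨t, ht, rfl⟩ := Finset.mem_image.1 hz'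
    obtain ⟨h1, h2⟩ := hz t ht
    refine ⟨?_, by rw [← hU'] at h2; exact h2⟩
    rw [add_sub_cancel_left, norm_mul]
    have h6 : k₀ * (r + 1) ≤ 1 := by rwa [le_div_iff₀ (by linarith)] at hk3
    have h7 : k * ‖t‖ ≤ k₀ * r := mul_le_mul hkk h1.le (norm_nonneg t) hk0.le
    linarith

lemma lt_of_norm_sub_lt_one {z : ℂ} {x y : ℝ} (h : ‖z - (x + y * I)‖ < 1) : x - 1 < z.re ∧ y - 1 < z.im := by
  have h1 := (abs_re_le_norm _).trans_lt h
  have h2 := (abs_im_le_norm _).trans_lt h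
  simp only [sub_re, add_re, ofReal_re, mul_re, I_re, mul_zero, ofReal_im, I_im, mul_one, sub_self,
    add_zero, sub_im, add_im, mul_im, zero_add] at h1 h2
  exact ⟨by linarith [(abs_lt.1 h1).1], by linarith [(abs_lt.1 h2).1]⟩

lemma phase_unbounded (x : ℝ) (N : ℕ) : ∃ E : ℝ, 0 ≤ E ∧ N * Real.pi < phase x E := by
  obtain ⟨Y, hY, h⟩ := turning_point_zeros (N + 1)
  set m := √x with hm
  have hm0 : 0 ≤ m := Real.sqrt_nonneg x
  set ξ : ℝ := Y + 2 * m + 2 with hξ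
  set y : ℝ := √(3 * ξ ^ 2 - 3 * m ^ 2) with hy
  have hξm : 2 * m ≤ ξ := by linarith
  have hY2 : Y ^ 2 ≤ 3 * ξ ^ 2 - 3 * m ^ 2 := by nlinarith
  have hy2 : y ^ 2 = 3 * ξ ^ 2 - 3 * m ^ 2 := Real.sq_sqrt ((sq_nonneg Y).trans hY2)
  have hYy : Y ≤ y := Real.le_sqrt_of_sq_le hY2
  have hE : 0 ≤ 2 * ξ * (ξ ^ 2 + y ^ 2) - 2 * m ^ 3 := by
    have h3 : m ^ 3 ≤ ξ ^ 3 := pow_le_pow_left₀ hm0 (by linarith) 3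
    have h4 : 0 ≤ ξ * y ^ 2 := mul_nonneg (by linarith) (sq_nonneg y)
    nlinarith [pow_nonneg hm0 3]
  refine ⟨2 * ξ * (ξ ^ 2 + y ^ 2) - 2 * m ^ 3, hE, ?_⟩
  have hp : cp m (2 * ξ * (ξ ^ 2 + y ^ 2) - 2 * m ^ 3) =
      (3 * ξ ^ 2 - y ^ 2, 2 * ξ * (ξ ^ 2 + y ^ 2)) := by
    rw [cp, hy2]; congr 1 <;> ring
  obtain ⟨T, hT, hz⟩ := h ξ y hYy (by nlinarith) _ _ (isSol_Y1 _) (Y1_ne_zero _)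
  obtain ⟨hf, hn⟩ := quadZ_ncard x hE
  have hsub : (T : Set ℂ) ⊆ quadZ m (2 * ξ * (ξ ^ 2 + y ^ 2) - 2 * m ^ 3) := fun z hzT => by
    obtain ⟨h1, h2⟩ := hz z hzT
    obtain ⟨h3, h4⟩ := lt_of_norm_sub_lt_one h1
    refine ⟨⟨by linarith, by linarith⟩, ?_⟩
    rw [hp]; exact h2
  have hcard := Set.ncard_le_ncard hsub hf
  rw [Set.ncard_coe_finset, hT, hn] at hcard
  have hb := (phaseCount_bounds ((phase_zero x).1.trans_le ((phase_strictMono x).monotone hE))).1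
  have hc' : (N : ℝ) + 1 ≤ phaseCount (phase x (2 * ξ * (ξ ^ 2 + y ^ 2) - 2 * m ^ 3)) := by
    exact_mod_cast hcard
  have := Nat.cast_nonneg (α := ℝ) N
  refine lt_of_le_of_lt ?_ hb
  have := Real.pi_pos
  gcongr
  linarith

lemma exists_phase_eq (x : ℝ) (k : ℕ) : ∃ E : ℝ, phase x E = k * Real.pi := by
  obtain ⟨E, hE, h⟩ := phase_unbounded x k
  have h0 : phase x 0 ≤ k * Real.pi := (phase_zero x).2.le.trans (by positivity)
  obtain ⟨F, -, hF⟩ := intermediate_value_Icc hE (continuous_phase_right x).continuousOn ⟨h0, h.le⟩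
  exact ⟨F, hF⟩

/-- The energy at which the phase reaches `k * π`. -/
noncomputable def lev (k : ℕ) (x : ℝ) : ℝ := (exists_phase_eq x k).choose

lemma phase_lev (k : ℕ) (x : ℝ) : phase x (lev k x) = k * Real.pi := (exists_phase_eq x k).choose_spec

lemma phase_eq_iff {k : ℕ} {x E : ℝ} : phase x E = k * Real.pi ↔ E = lev k x := by
  rw [← phase_lev]; exact (phase_strictMono x).injective.eq_iff

lemma lev_pos (k : ℕ) (x : ℝ) : 0 < lev k x := by
  rw [← (phase_strictMono x).lt_iff_lt, phase_lev]
  exact (phase_zero x).2.trans_le (by positivity)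

lemma lev_lt {j k : ℕ} (h : j < k) (x : ℝ) : lev j x < lev k x := by
  rw [← (phase_strictMono x).lt_iff_lt, phase_lev, phase_lev]
  have := Real.pi_pos
  gcongr

lemma continuous_lev (k : ℕ) : Continuous (lev k) := by
  refine continuous_iff_continuousAt.2 fun x => ?_
  have hc : ∀ E, Continuous fun x => phase x E := fun E =>
    Continuous.comp (g := fun q : ℝ × ℝ => phase q.1 q.2) (f := fun x : ℝ => (x, E)) continuous_phase
      (Continuous.prodMk_left E)
  refine tendsto_order.2 ⟨fun E hE => ?_, fun E hE => ?_⟩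
  · have := (phase_strictMono x) hE
    rw [phase_lev] at this
    filter_upwards [(hc E).continuousAt.eventually (gt_mem_nhds this)] with y hy
    rwa [← (phase_strictMono y).lt_iff_lt, phase_lev]
  · have := (phase_strictMono x) hE
    rw [phase_lev] at this
    filter_upwards [(hc E).continuousAt.eventually (lt_mem_nhds this)] with y hy
    rwa [← (phase_strictMono y).lt_iff_lt, phase_lev]

/-- The `k`-th eigenvalue, as a function of `a ≥ 0`. -/
noncomputable def br (k : ℕ) (a : ℝ) : ℝ := 2 * √(a / 3) ^ 3 + lev k (a / 3)

lemma continuous_br (k : ℕ) : Continuous (br k) :=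
  (continuous_const.mul ((Real.continuous_sqrt.comp (continuous_id.div_const 3)).pow 3)).add
    ((continuous_lev k).comp (continuous_id.div_const 3))

lemma br_lt {j k : ℕ} (h : j < k) (a : ℝ) : br j a < br k a := by
  have := lev_lt h (a / 3)
  rw [br, br]; linarith

lemma eq_cp {a : ℝ} (ha : 0 ≤ a) (l : ℝ) : (a, l) = cp √(a / 3) (l - 2 * √(a / 3) ^ 3) := by
  rw [cp, Real.sq_sqrt (by positivity)]
  congr 1 <;> ring

lemma cc_eq_zero_iff_br {a : ℝ} (ha : 0 ≤ a) (l : ℝ) : cc (rp (a, l)) = 0 ↔ ∃ k, l = br k a := by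
  rw [eq_cp ha, cc_eq_zero_iff_phase]
  constructor
  · rintro ⟨-, k, hk⟩
    exact ⟨k, by rw [br, ← phase_eq_iff.1 hk]; ring⟩
  · rintro ⟨k, rfl⟩
    have : br k a - 2 * √(a / 3) ^ 3 = lev k (a / 3) := by rw [br]; ring
    rw [this]
    exact ⟨(lev_pos _ _).le, k, phase_lev k _⟩

lemma cc_br {a : ℝ} (ha : 0 ≤ a) (k : ℕ) : cc (rp (a, br k a)) = 0 := (cc_eq_zero_iff_br ha _).2 ⟨k, rfl⟩

lemma upZ_br {a : ℝ} (ha : 0 ≤ a) (k : ℕ) : (upZ (a, br k a)).ncard = k / 2 := by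
  have hc := cc_br ha k
  have hl : br k a - 2 * √(a / 3) ^ 3 = lev k (a / 3) := by rw [br]; ring
  rw [eq_cp ha, hl] at hc ⊢
  rw [upZ_eq_quadZ (Real.sqrt_nonneg _) hc, (quadZ_ncard _ (lev_pos k _).le).2, phase_lev]
  have hpi := Real.pi_pos
  obtain ⟨n, h | h⟩ := Nat.even_or_odd' k
  · rw [phaseCount_eq_iff (j := n), h]
    · omega
    · rw [h]; push_cast; nlinarith
    · rw [h]; push_cast; nlinarith
  · rw [phaseCount_eq_iff (j := n), h]
    · omega
    · rw [h]; push_cast; nlinarith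
    · rw [h]; push_cast; nlinarith

/-- On the left half plane, points of the locus with few zeros are bounded. -/
lemma locus_left_bounded (n : ℕ) : ∃ M : ℝ, ∀ p : ℝ × ℝ, cc (rp p) = 0 → p.1 ≤ 0 →
    (upZ p).ncard ≤ n → ‖p‖ ≤ M := by
  obtain ⟨Y, hY, h⟩ := turning_point_zeros (n + 1)
  refine ⟨Y ^ 2 + 2 * Y * (Y ^ 2 + Y ^ 2), fun ⟨a, l⟩ hc ha hn => ?_⟩
  change a ≤ 0 at ha
  obtain ⟨x, hx⟩ : ∃ x : ℝ, 2 * x * (4 * x ^ 2 - a) = l := by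
    have hcont : Continuous fun x : ℝ => 2 * x * (4 * x ^ 2 - a) := by fun_prop
    refine mem_range_of_exists_le_of_exists_ge hcont ⟨-(|l| + 1), ?_⟩ ⟨|l| + 1, ?_⟩
    · have := neg_abs_le l
      nlinarith [abs_nonneg l, pow_nonneg (abs_nonneg l) 3]
    · have := le_abs_self l
      nlinarith [abs_nonneg l, pow_nonneg (abs_nonneg l) 3]
  set y : ℝ := √(3 * x ^ 2 - a) with hy
  have hy2 : y ^ 2 = 3 * x ^ 2 - a := Real.sq_sqrt (by nlinarith)
  have hp : (a, l) = (3 * x ^ 2 - y ^ 2, 2 * x * (x ^ 2 + y ^ 2)) := by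
    rw [hy2, ← hx]; congr 1 <;> ring
  have hyY : y < Y := by
    by_contra! hYy
    obtain ⟨T, hT, hz⟩ := h x y hYy (by nlinarith) _ _ (isSol_Y1 _) (Y1_ne_zero _)
    have hsub : (T : Set ℂ) ⊆ upZ (a, l) := fun z hzT => by
      obtain ⟨h1, h2⟩ := hz z hzT
      obtain ⟨h3, h4⟩ := lt_of_norm_sub_lt_one h1
      refine ⟨show 0 < z.im by linarith, ?_⟩
      rw [hp]; exact h2
    have hcard := Set.ncard_le_ncard hsub (upZ_locally_const hc).1
    rw [Set.ncard_coe_finset, hT] at hcard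
    omega
  have hy0 : 0 ≤ y := Real.sqrt_nonneg _
  have hyy : y ^ 2 ≤ Y ^ 2 := pow_le_pow_left₀ hy0 hyY.le 2
  have hxY : |x| ≤ Y := abs_le_of_sq_le_sq (by nlinarith) (by linarith)
  have hxx : x ^ 2 ≤ Y ^ 2 := sq_le_sq' (by linarith [(abs_le.1 hxY).1]) (abs_le.1 hxY).2
  rw [Prod.norm_def, max_le_iff, Real.norm_eq_abs, Real.norm_eq_abs]
  constructor
  · rw [abs_of_nonpos ha]
    have : 0 ≤ Y * (Y ^ 2 + Y ^ 2) := by positivity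
    nlinarith
  · rw [← hx, abs_mul, abs_mul, abs_two, show 4 * x ^ 2 - a = x ^ 2 + y ^ 2 by rw [hy2]; ring,
      abs_of_nonneg (show 0 ≤ x ^ 2 + y ^ 2 by positivity)]
    calc 2 * |x| * (x ^ 2 + y ^ 2) ≤ 2 * Y * (Y ^ 2 + Y ^ 2) := by gcongr
      _ ≤ _ := by nlinarith

lemma sturm_not_pos {f f' Q : ℝ → ℝ} {X : ℝ} (h1 : ∀ x, HasDerivAt f (f' x) x)
    (h2 : ∀ x, HasDerivAt f' (Q x * f x) x) (hQ : ∀ x ≤ X, Q x ≤ -1) {c : ℝ} (hc : c + Real.pi ≤ X) :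
    ¬ ∀ x ∈ Set.Icc c (c + Real.pi), 0 < f x := by
  intro hpos
  have hpi := Real.pi_pos
  set W : ℝ → ℝ := fun x => f' x * Real.sin (x - c) - f x * Real.cos (x - c) with hW
  have hd : ∀ x, HasDerivAt W ((Q x + 1) * f x * Real.sin (x - c)) x := fun x => by
    have hs : HasDerivAt (fun x => x - c) 1 x := (hasDerivAt_id x).sub_const c
    refine (((h2 x).mul hs.sin).sub ((h1 x).mul hs.cos)).congr_deriv ?_
    ring
  have hanti : AntitoneOn W (Set.Icc c (c + Real.pi)) := by
    refine antitoneOn_of_deriv_nonpos (convex_Icc _ _)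
      (fun x _ => (hd x).continuousAt.continuousWithinAt)
      (fun x _ => (hd x).differentiableAt.differentiableWithinAt) fun x hx => ?_
    rw [interior_Icc] at hx
    rw [(hd x).deriv]
    refine mul_nonpos_of_nonpos_of_nonneg (mul_nonpos_of_nonpos_of_nonneg ?_ ?_) ?_
    · linarith [hQ x (hx.2.le.trans hc)]
    · exact (hpos x ⟨hx.1.le, hx.2.le⟩).le
    · exact Real.sin_nonneg_of_nonneg_of_le_pi (by linarith [hx.1]) (by linarith [hx.2])
  have h := hanti (Set.left_mem_Icc.2 (by linarith)) (Set.right_mem_Icc.2 (by linarith))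
    (by linarith)
  have ha := hpos c (Set.left_mem_Icc.2 (by linarith))
  have hb := hpos _ (Set.right_mem_Icc.2 (show c ≤ c + Real.pi by linarith))
  simp only [hW, add_sub_cancel_left, sub_self, Real.sin_pi, Real.cos_pi, Real.sin_zero,
    Real.cos_zero] at h
  linarith

/-- Sturm comparison with the sine function. -/
lemma sturm_zero {f f' Q : ℝ → ℝ} {X : ℝ} (h1 : ∀ x, HasDerivAt f (f' x) x)
    (h2 : ∀ x, HasDerivAt f' (Q x * f x) x) (hQ : ∀ x ≤ X, Q x ≤ -1) {c : ℝ} (hc : c + Real.pi ≤ X) :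
    ∃ x, x ≤ c + Real.pi ∧ f x = 0 := by
  have hcf : Continuous f := continuous_iff_continuousAt.2 fun x => (h1 x).continuousAt
  have hp := sturm_not_pos h1 h2 hQ hc
  have hn := sturm_not_pos (f := fun x => -f x) (f' := fun x => -f' x) (Q := Q) (fun x => (h1 x).neg)
    (fun x => ((h2 x).neg).congr_deriv (by ring)) hQ hc
  push Not at hp hn
  obtain ⟨x, hx, hx'⟩ := hp
  obtain ⟨y, hy, hy'⟩ := hn
  obtain ⟨z, hz, hz'⟩ := isPreconnected_Icc.intermediate_value hx hy hcf.continuousOn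
    (⟨hx', by linarith⟩ : (0 : ℝ) ∈ Set.Icc (f x) (f y))
  exact ⟨z, hz.2, hz'⟩

lemma Y1_real_zeros_infinite {p : ℝ × ℝ} (hc : cc (rp p) = 0) :
    {x : ℝ | Y1 (rp p) x = 0}.Infinite := by
  obtain ⟨X, hX⟩ : ∃ X : ℝ, ∀ x ≤ X, x ^ 3 - p.1 * x + p.2 ≤ -1 := by
    refine ⟨-(|p.1| + |p.2| + 2), fun x hx => ?_⟩
    have h2 := le_abs_self p.2
    have h3 : x ^ 3 ≤ (|p.1| + |p.2| + 2) * x := by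
      have : |p.1| + |p.2| + 2 ≤ x ^ 2 := by nlinarith [abs_nonneg p.1, abs_nonneg p.2]
      nlinarith [abs_nonneg p.1, abs_nonneg p.2]
    have h4 : -(p.1 * x) ≤ -(|p.1| * x) := by
      nlinarith [le_abs_self p.1, abs_nonneg p.1, abs_nonneg p.2]
    have h5 : (|p.2| + 2) * x ≤ (|p.2| + 2) * (-2) :=
      mul_le_mul_of_nonneg_left (by linarith [abs_nonneg p.1, abs_nonneg p.2]) (by positivity)
    linarith [abs_nonneg p.2]
  have hd1 : ∀ x : ℝ, HasDerivAt (fun x : ℝ => (Y1 (rp p) x).re) (Y1' (rp p) x).re x := fun x =>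
    ((isSol_Y1 (rp p)).d1 x).real_of_complex
  have hd2 : ∀ x : ℝ, HasDerivAt (fun x : ℝ => (Y1' (rp p) x).re)
      ((x ^ 3 - p.1 * x + p.2) * (Y1 (rp p) x).re) x := fun x =>
    ((isSol_Y1 (rp p)).d2 x).real_of_complex.congr_deriv (by
      have : pot (rp p) x = ((x ^ 3 - p.1 * x + p.2 : ℝ) : ℂ) := by
        simp [pot, rp]
      rw [this, re_ofReal_mul])
  intro hfin
  obtain ⟨b, hb⟩ := hfin.bddBelow
  obtain ⟨x, hx, hx0⟩ := sturm_zero hd1 hd2 hX (c := min X b - Real.pi - 1)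
    (by linarith [min_le_left X b])
  have := hb (show x ∈ {x : ℝ | Y1 (rp p) x = 0} from
    Complex.ext hx0 (Y1_real_im_zero hc x))
  linarith [min_le_right X b]

lemma Y1_real_zeros_bddAbove (p : ℝ × ℝ) : ∃ x₀ : ℝ, ∀ x : ℝ, Y1 (rp p) x = 0 → x < x₀ := by
  obtain ⟨x₀, h⟩ := eventually_atTop.1 (Y1_re_pos_eventually p)
  refine ⟨x₀, fun x hx => ?_⟩
  by_contra! hlt
  have := h x hlt
  rw [hx] at this
  simp at this

/-- A closed subset of the plane that is locally the image of an analytic section of `T`. -/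
structure IsCurve (Γ : Set (ℝ × ℝ)) (T : ℝ × ℝ → ℝ) : Prop where
  closed : IsClosed Γ
  diff : Differentiable ℝ T
  chart : ∀ p ∈ Γ, ∃ σ : ℝ → ℝ × ℝ, σ (T p) = p ∧
    (∀ᶠ t in 𝓝 (T p), AnalyticAt ℝ σ t ∧ σ t ∈ Γ ∧ T (σ t) = t) ∧
    ∀ᶠ r in 𝓝 p, r ∈ Γ → σ (T r) = r

/-- `σ` is an analytic section of `T` over the open interval `J` with values in `Γ`. -/
def IsSec (Γ : Set (ℝ × ℝ)) (T : ℝ × ℝ → ℝ) (σ : ℝ → ℝ × ℝ) (J : Set ℝ) : Prop :=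
  IsOpen J ∧ J.OrdConnected ∧ ∀ s ∈ J, AnalyticAt ℝ σ s ∧ σ s ∈ Γ ∧ T (σ s) = s

/-- Two points lie on a common analytic section. -/
def Conn (Γ : Set (ℝ × ℝ)) (T : ℝ × ℝ → ℝ) (q p : ℝ × ℝ) : Prop :=
  ∃ σ J, IsSec Γ T σ J ∧ T q ∈ J ∧ T p ∈ J ∧ σ (T q) = q ∧ σ (T p) = p

section
variable {Γ : Set (ℝ × ℝ)} {T : ℝ × ℝ → ℝ}

lemma Conn.symm {q p : ℝ × ℝ} (h : Conn Γ T q p) : Conn Γ T p q := by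
  obtain ⟨σ, J, h1, h2, h3, h4, h5⟩ := h
  exact ⟨σ, J, h1, h3, h2, h5, h4⟩

lemma Conn.mem {q p : ℝ × ℝ} (h : Conn Γ T q p) : p ∈ Γ := by
  obtain ⟨σ, J, h1, h2, h3, h4, h5⟩ := h
  rw [← h5]
  exact (h1.2.2 _ h3).2.1

lemma IsCurve.eventually_conn (hΓ : IsCurve Γ T) {p : ℝ × ℝ} (hp : p ∈ Γ) :
    ∀ᶠ p' in 𝓝 p, p' ∈ Γ → Conn Γ T p p' := by
  obtain ⟨σ, h1, h2, h3⟩ := hΓ.chart p hp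
  obtain ⟨ε, hε, h4⟩ := Metric.eventually_nhds_iff_ball.1 h2
  have h5 : ∀ᶠ p' in 𝓝 p, T p' ∈ Metric.ball (T p) ε :=
    hΓ.diff.continuous.continuousAt (Metric.ball_mem_nhds _ hε)
  filter_upwards [h3, h5] with p' h6 h7 h8
  refine ⟨σ, Metric.ball (T p) ε, ⟨Metric.isOpen_ball, ?_, h4⟩, Metric.mem_ball_self hε, h7, h1, h6 h8⟩
  rw [Real.ball_eq_Ioo]
  exact Set.ordConnected_Ioo

lemma IsCurve.isSec_unique (hΓ : IsCurve Γ T) {σ τ : ℝ → ℝ × ℝ} {J J' : Set ℝ} (h : IsSec Γ T σ J)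
    (h' : IsSec Γ T τ J') {t : ℝ} (ht : t ∈ J ∩ J') (e : σ t = τ t) :
    ∀ s ∈ J ∩ J', σ s = τ s := by
  have hpre : IsPreconnected (J ∩ J') := (h.2.1.inter h'.2.1).isPreconnected
  have hcl : ∀ s ∈ J ∩ J', ContinuousAt σ s ∧ ContinuousAt τ s := fun s hs =>
    ⟨(h.2.2 s hs.1).1.continuousAt, (h'.2.2 s hs.2).1.continuousAt⟩
  have hop : IsOpen (J ∩ J') := h.1.inter h'.1
  have hsub : J ∩ J' ⊆ {s | ∀ᶠ r in 𝓝 s, σ r = τ r} := by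
    refine hpre.subset_of_closure_inter_subset isOpen_setOfPred_eventually_nhds ?_ ?_
    · refine ⟨t, ht, ?_⟩
      obtain ⟨ρ, -, -, h3⟩ := hΓ.chart (σ t) (h.2.2 t ht.1).2.1
      have a1 := (hcl t ht).1.eventually h3
      have a2 := (hcl t ht).2.eventually (e ▸ h3)
      filter_upwards [a1, a2, hop.mem_nhds ht] with s b1 b2 b3
      rw [← b1 (h.2.2 s b3.1).2.1, ← b2 (h'.2.2 s b3.2).2.1, (h.2.2 s b3.1).2.2,
        (h'.2.2 s b3.2).2.2]
    · rintro s ⟨h1, h2⟩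
      have e' : σ s = τ s := by
        have hf : ∃ᶠ r in 𝓝 s, σ r = τ r := by
          rw [mem_closure_iff_frequently] at h1
          exact h1.mono fun r hr => hr.self_of_nhds
        by_contra hne
        have hev : ∀ᶠ r in 𝓝 s, σ r ≠ τ r := ((hcl s h2).1.ne_iff_eventually_ne (hcl s h2).2).1 hne
        exact hf hev
      obtain ⟨ρ, -, -, h3⟩ := hΓ.chart (σ s) (h.2.2 s h2.1).2.1
      have a1 := (hcl s h2).1.eventually h3
      have a2 := (hcl s h2).2.eventually (e' ▸ h3)
      show ∀ᶠ r in 𝓝 s, σ r = τ r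
      filter_upwards [a1, a2, hop.mem_nhds h2] with r b1 b2 b3
      rw [← b1 (h.2.2 r b3.1).2.1, ← b2 (h'.2.2 r b3.2).2.1, (h.2.2 r b3.1).2.2,
        (h'.2.2 r b3.2).2.2]
  exact fun s hs => (hsub hs).self_of_nhds

lemma IsCurve.conn_trans (hΓ : IsCurve Γ T) {q p r : ℝ × ℝ} (h : Conn Γ T q p)
    (h' : Conn Γ T p r) : Conn Γ T q r := by
  classical
  obtain ⟨σ, J, h1, h2, h3, h4, h5⟩ := h
  obtain ⟨τ, J', k1, k2, k3, k4, k5⟩ := h'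
  have hu := hΓ.isSec_unique h1 k1 ⟨h3, k2⟩ (h5.trans k4.symm)
  set ρ : ℝ → ℝ × ℝ := fun s => if s ∈ J then σ s else τ s with hρ
  have e1 : ∀ s ∈ J, ρ s = σ s := fun s hs => if_pos hs
  have e2 : ∀ s ∈ J', ρ s = τ s := fun s hs => by
    by_cases hJ : s ∈ J
    · rw [e1 s hJ, hu s ⟨hJ, hs⟩]
    · exact if_neg hJ
  refine ⟨ρ, J ∪ J', ⟨h1.1.union k1.1, ?_, ?_⟩, .inl h2, .inr k3, ?_, ?_⟩
  · exact Set.OrdConnected.mk fun x hx y hy => by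
      have := (h1.2.1.isPreconnected).union (T p) h3 k2 k1.2.1.isPreconnected
      exact this.ordConnected.out hx hy
  · rintro s (hs | hs)
    · rw [e1 s hs]
      refine ⟨(h1.2.2 s hs).1.congr ?_, (h1.2.2 s hs).2⟩
      filter_upwards [h1.1.mem_nhds hs] with x hx using (e1 x hx).symm
    · rw [e2 s hs]
      refine ⟨(k1.2.2 s hs).1.congr ?_, (k1.2.2 s hs).2⟩
      filter_upwards [k1.1.mem_nhds hs] with x hx using (e2 x hx).symm
  · rw [e1 _ h2, h4]
  · rw [e2 _ k3, k5]

lemma IsCurve.conn_inj (hΓ : IsCurve Γ T) {q p r : ℝ × ℝ} (h : Conn Γ T q p)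
    (h' : Conn Γ T q r) (e : T p = T r) : p = r := by
  obtain ⟨σ, J, h1, h2, h3, h4, h5⟩ := hΓ.conn_trans h.symm h'
  rw [← h4, ← h5, e]

lemma IsCurve.isClosed_conn (hΓ : IsCurve Γ T) (q : ℝ × ℝ) : IsClosed {p | Conn Γ T q p} := by
  refine isClosed_of_closure_subset fun p hp => ?_
  have hpΓ : p ∈ Γ := closure_minimal (fun x hx => Conn.mem hx) hΓ.closed hp
  obtain ⟨x, h1, h2⟩ := ((mem_closure_iff_frequently.1 hp).and_eventually
    (hΓ.eventually_conn hpΓ)).exists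
  exact hΓ.conn_trans h1 (h2 h1.mem).symm

lemma IsCurve.maximal (hΓ : IsCurve Γ T) {q : ℝ × ℝ} (hq : q ∈ Γ) :
    ∃ g U, IsSec Γ T g U ∧ T q ∈ U ∧ g (T q) = q ∧ ∀ p, Conn Γ T q p ↔ ∃ s ∈ U, g s = p := by
  classical
  have hqq : Conn Γ T q q := (hΓ.eventually_conn hq).self_of_nhds hq
  set U : Set ℝ := {t | ∃ p, Conn Γ T q p ∧ T p = t} with hU
  have hg : ∀ t, ∃ p, t ∈ U → Conn Γ T q p ∧ T p = t := fun t => by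
    by_cases h : t ∈ U
    · obtain ⟨p, hp⟩ := h
      exact ⟨p, fun _ => hp⟩
    · exact ⟨q, fun h' => (h h').elim⟩
  choose g hg using hg
  have hgp : ∀ p, Conn Γ T q p → g (T p) = p := fun p hp =>
    hΓ.conn_inj (hg (T p) ⟨p, hp, rfl⟩).1 hp (hg (T p) ⟨p, hp, rfl⟩).2
  have hloc : ∀ t ∈ U, ∃ σ J, IsSec Γ T σ J ∧ t ∈ J ∧ T q ∈ J ∧ J ⊆ U ∧ ∀ s ∈ J, g s = σ s := by
    rintro t ⟨p, hp, rfl⟩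
    obtain ⟨σ, J, h1, h2, h3, h4, h5⟩ := hp
    have hc : ∀ s ∈ J, Conn Γ T q (σ s) := fun s hs => by
      refine ⟨σ, J, h1, h2, ?_, h4, ?_⟩ <;> rw [(h1.2.2 s hs).2.2]
      exact hs
    refine ⟨σ, J, h1, h3, h2, fun s hs => ⟨σ s, hc s hs, (h1.2.2 s hs).2.2⟩, fun s hs => ?_⟩
    have := hgp _ (hc s hs)
    rwa [(h1.2.2 s hs).2.2] at this
  refine ⟨g, U, ⟨?_, ?_, ?_⟩, ⟨q, hqq, rfl⟩, hgp q hqq, fun p => ⟨fun h => ⟨T p, ⟨p, h, rfl⟩, hgp p h⟩, ?_⟩⟩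
  · refine isOpen_iff_mem_nhds.2 fun t ht => ?_
    obtain ⟨σ, J, h1, h2, -, h3, -⟩ := hloc t ht
    exact mem_of_superset (h1.1.mem_nhds h2) h3
  · refine Set.OrdConnected.mk fun x hx y hy z hz => ?_
    rcases le_total z (T q) with h | h
    · obtain ⟨σ, J, h1, h2, h4, h3, -⟩ := hloc x hx
      exact h3 (h1.2.1.out h2 h4 ⟨hz.1, h⟩)
    · obtain ⟨σ, J, h1, h2, h4, h3, -⟩ := hloc y hy
      exact h3 (h1.2.1.out h4 h2 ⟨h, hz.2⟩)
  · intro s hs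
    obtain ⟨σ, J, h1, h2, h4, h3, h5⟩ := hloc s hs
    refine ⟨(h1.2.2 s h2).1.congr ?_, (hg s hs).1.mem, (hg s hs).2⟩
    filter_upwards [h1.1.mem_nhds h2] with x hx using (h5 x hx).symm
  · rintro ⟨s, hs, rfl⟩
    exact (hg s hs).1

/-- A plane curve lying over two graphs `b₀ < b₁` in the right half plane and bounded in the
left half plane is connected. -/
lemma IsCurve.conn_base (hΓ : IsCurve Γ T) {b0 b1 : ℝ → ℝ} (hb0 : Continuous b0)
    (hb1 : Continuous b1) (hR : ∀ a l, 0 ≤ a → ((a, l) ∈ Γ ↔ l = b0 a ∨ l = b1 a)) {M : ℝ}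
    (hL : ∀ p ∈ Γ, p.1 ≤ 0 → ‖p‖ ≤ M) {q : ℝ × ℝ} (hq : q ∈ Γ) : Conn Γ T q (0, b0 0) := by
  have hf : Continuous fun x : ℝ => (|x|, b0 |x|) := by fun_prop
  have hfΓ : ∀ x : ℝ, (|x|, b0 |x|) ∈ Γ := fun x => (hR _ _ (abs_nonneg x)).2 (.inl rfl)
  have hclopen : IsClopen {x : ℝ | Conn Γ T q (|x|, b0 |x|)} := by
    refine ⟨(hΓ.isClosed_conn q).preimage hf, isOpen_iff_mem_nhds.2 fun x hx => ?_⟩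
    have h1 := hf.continuousAt.eventually (hΓ.eventually_conn (hfΓ x))
    filter_upwards [h1] with y hy using hΓ.conn_trans hx (hy (hfΓ y))
  rcases isClopen_iff.1 hclopen with h0 | h0
  swap
  · have : (0 : ℝ) ∈ {x : ℝ | Conn Γ T q (|x|, b0 |x|)} := h0 ▸ Set.mem_univ _
    simpa using this
  exfalso
  have hno : ∀ a l, 0 ≤ a → Conn Γ T q (a, l) → l = b1 a := fun a l ha h => by
    rcases (hR a l ha).1 h.mem with rfl | h'
    · have : a ∈ {x : ℝ | Conn Γ T q (|x|, b0 |x|)} := by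
        show Conn Γ T q (|a|, b0 |a|)
        rwa [abs_of_nonneg ha]
      rw [h0] at this
      exact this.elim
    · exact h'
  obtain ⟨g, U, hs, hqU, hgq, hC⟩ := hΓ.maximal hq
  have hgC : ∀ s ∈ U, Conn Γ T q (g s) := fun s h => (hC _).2 ⟨s, h, rfl⟩
  have huc : ContinuousOn (fun s => (g s).1) U := fun s h =>
    (continuous_fst.continuousAt.comp (hs.2.2 s h).1.continuousAt).continuousWithinAt
  have hinj : ∀ s ∈ U, ∀ t ∈ U, 0 ≤ (g s).1 → (g s).1 = (g t).1 → s = t := by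
    intro s h1 t h2 h3 h4
    have e1 := hno (g s).1 (g s).2 h3 (hgC s h1)
    have e2 := hno (g t).1 (g t).2 (h4 ▸ h3) (hgC t h2)
    have e : g s = g t := Prod.ext h4 (by rw [e1, e2, h4])
    rw [← (hs.2.2 s h1).2.2, ← (hs.2.2 t h2).2.2, e]
  obtain ⟨v, hv0, hv1⟩ : ∃ v : ℝ, 0 ≤ v ∧ q.1 < v :=
    ⟨max q.1 0 + 1, by positivity, by linarith [le_max_left q.1 0]⟩
  have hcomp : IsCompact (Γ ∩ {p | p.1 ≤ v}) := by
    have h1 : IsCompact ((fun a => (a, b0 a)) '' Set.Icc 0 v ∪ (fun a => (a, b1 a)) '' Set.Icc 0 v ∪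
        Metric.closedBall 0 M) :=
      ((isCompact_Icc.image (by fun_prop)).union (isCompact_Icc.image (by fun_prop))).union
        (isCompact_closedBall 0 M)
    refine h1.of_isClosed_subset (hΓ.closed.inter (isClosed_le continuous_fst continuous_const)) ?_
    rintro ⟨a, l⟩ ⟨h2, h3⟩
    rcases le_total a 0 with h | h
    · exact .inr (by simpa using hL _ h2 h)
    · rcases (hR a l h).1 h2 with rfl | rfl
      · exact .inl (.inl ⟨a, ⟨h, h3⟩, rfl⟩)
      · exact .inl (.inr ⟨a, ⟨h, h3⟩, rfl⟩)
  have hS : IsCompact (T '' ({p | Conn Γ T q p} ∩ (Γ ∩ {p | p.1 ≤ v}))) :=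
    (hcomp.inter_left (hΓ.isClosed_conn q)).image hΓ.diff.continuous
  set S := T '' ({p | Conn Γ T q p} ∩ (Γ ∩ {p | p.1 ≤ v})) with hSdef
  have hqS : T q ∈ S := ⟨q, ⟨by simpa [hgq] using hgC _ hqU, hq, hv1.le⟩, rfl⟩
  have hSU : S ⊆ U := by
    rintro _ ⟨p, ⟨h1, -⟩, rfl⟩
    obtain ⟨s, h2, rfl⟩ := (hC p).1 h1
    rwa [(hs.2.2 s h2).2.2]
  have hout : ∀ s ∈ U, s ∉ S → v < (g s).1 := fun s h1 h2 => by
    by_contra hcon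
    exact h2 ⟨g s, ⟨hgC s h1, (hgC s h1).mem, not_lt.1 hcon⟩, (hs.2.2 s h1).2.2⟩
  have hc := hSU (hS.sInf_mem ⟨_, hqS⟩)
  have hd := hSU (hS.sSup_mem ⟨_, hqS⟩)
  obtain ⟨s, hsc, hsU⟩ : ∃ s, s < sInf S ∧ s ∈ U := by
    obtain ⟨s, h1, h2⟩ := exists_Ioc_subset_of_mem_nhds (hs.1.mem_nhds hc) (exists_lt _)
    obtain ⟨x, h3, h4⟩ := exists_between h1
    exact ⟨x, h4, h2 ⟨h3, h4.le⟩⟩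
  obtain ⟨s', hsd, hsU'⟩ : ∃ s, sSup S < s ∧ s ∈ U := by
    obtain ⟨s, h1, h2⟩ := exists_Ico_subset_of_mem_nhds (hs.1.mem_nhds hd) (exists_gt _)
    obtain ⟨x, h3, h4⟩ := exists_between h1
    exact ⟨x, h3, h2 ⟨h3.le, h4⟩⟩
  have hv : v < (g s).1 := hout s hsU fun h => hsc.not_ge (csInf_le hS.bddBelow h)
  have hv' : v < (g s').1 := hout s' hsU' fun h => hsd.not_ge (le_csSup hS.bddAbove h)
  have hl : s ≤ T q := hsc.le.trans (csInf_le hS.bddBelow hqS)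
  have hr : T q ≤ s' := (le_csSup hS.bddAbove hqS).trans hsd.le
  have hv1' : (g (T q)).1 < v := by rwa [hgq]
  obtain ⟨t, ht, ht'⟩ := intermediate_value_Icc' hl (huc.mono (hs.2.1.out hsU hqU))
    ⟨hv1'.le, hv.le⟩
  obtain ⟨r, hr, hr'⟩ := intermediate_value_Icc hr (huc.mono (hs.2.1.out hqU hsU'))
    ⟨hv1'.le, hv'.le⟩
  simp only at ht' hr'
  have := hinj t (hs.2.1.out hsU hqU ht) r (hs.2.1.out hqU hsU' hr) (by rw [ht']; exact hv0)
    (ht'.trans hr'.symm)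
  have h1 : t = T q := le_antisymm ht.2 (this ▸ hr.1)
  rw [h1] at ht'
  exact hv1'.ne ht'

end

/-- Every nonempty open interval is analytically diffeomorphic to the line. -/
lemma exists_analytic_param {U : Set ℝ} (ho : IsOpen U) (hc : U.OrdConnected) (hne : U.Nonempty) :
    ∃ φ : ℝ → ℝ, StrictMono φ ∧ (∀ x, AnalyticAt ℝ φ x) ∧ (∀ x, deriv φ x ≠ 0) ∧
      Set.range φ = U := by
  have hpre := hc.isPreconnected
  have hmem : ∀ x ∈ U, (∃ y ∈ U, y < x) ∧ ∃ y ∈ U, x < y := fun x hx => by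
    obtain ⟨s, h1, h2⟩ := exists_Ioc_subset_of_mem_nhds (ho.mem_nhds hx) (exists_lt _)
    obtain ⟨y, h3, h4⟩ := exists_between h1
    obtain ⟨s', k1, k2⟩ := exists_Ico_subset_of_mem_nhds (ho.mem_nhds hx) (exists_gt _)
    obtain ⟨y', k3, k4⟩ := exists_between k1
    exact ⟨⟨y, h2 ⟨h3, h4.le⟩, h4⟩, y', k2 ⟨k3.le, k4⟩, k3⟩
  obtain ⟨x0, hx0⟩ := hne
  by_cases hb : BddBelow U <;> by_cases ha : BddAbove U
  · set a := sInf U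
    set b := sSup U
    have hab : a < b := by
      obtain ⟨y, h1, h2⟩ := (hmem x0 hx0).2
      exact (csInf_le hb hx0).trans_lt (h2.trans_le (le_csSup ha h1))
    have hU : U = Set.Ioo a b := by
      refine Set.Subset.antisymm (fun x hx => ?_) fun x hx => ?_
      · obtain ⟨⟨y, h1, h2⟩, y', h3, h4⟩ := hmem x hx
        exact ⟨(csInf_le hb h1).trans_lt h2, h4.trans_le (le_csSup ha h3)⟩
      · obtain ⟨y, h1, h2⟩ := exists_lt_of_csInf_lt ⟨x0, hx0⟩ hx.1
        obtain ⟨y', h3, h4⟩ := exists_lt_of_lt_csSup ⟨x0, hx0⟩ hx.2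
        exact hc.out h1 h3 ⟨h2.le, h4.le⟩
    have hba : 0 < b - a := sub_pos.2 hab
    refine ⟨fun x => a + (b - a) * Real.sigmoid x, fun x y h => ?_, fun x => ?_, fun x => ?_, ?_⟩
    · have := mul_lt_mul_of_pos_left (Real.sigmoid_strictMono h) hba
      simpa using this
    · exact analyticAt_const.add (analyticAt_const.mul analyticAt_sigmoid)
    · have e : HasDerivAt (fun x => a + (b - a) * Real.sigmoid x) _ x :=
        ((Real.hasDerivAt_sigmoid x).const_mul (b - a)).const_add a
      rw [e.deriv]
      have h1 := Real.sigmoid_pos x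
      have h2 := sub_pos.2 (Real.sigmoid_lt_one x)
      positivity
    · rw [hU]
      ext y
      constructor
      · rintro ⟨x, rfl⟩
        have h1 := Real.sigmoid_pos x
        have h2 := Real.sigmoid_lt_one x
        constructor <;> simp only <;> nlinarith
      · rintro ⟨h1, h2⟩
        have : (y - a) / (b - a) ∈ Set.range Real.sigmoid := by
          rw [Real.range_sigmoid]
          exact ⟨div_pos (by linarith) hba, (div_lt_one hba).2 (by linarith)⟩
        obtain ⟨x, hx⟩ := this
        exact ⟨x, by simp only [hx]; field_simp; ring⟩
  · set a := sInf U
    have hU : U = Set.Ioi a := by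
      refine Set.Subset.antisymm (fun x hx => ?_) fun x hx => ?_
      · obtain ⟨⟨y, h1, h2⟩, -⟩ := hmem x hx
        exact (csInf_le hb h1).trans_lt h2
      · obtain ⟨y, h1, h2⟩ := exists_lt_of_csInf_lt ⟨x0, hx0⟩ hx
        obtain ⟨y', h3, h4⟩ := not_bddAbove_iff.1 ha x
        exact hc.out h1 h3 ⟨h2.le, h4.le⟩
    refine ⟨fun x => a + Real.exp x, fun x y h => ?_, fun x => ?_, fun x => ?_, ?_⟩
    · simpa using h
    · exact analyticAt_const.add (analyticAt_rexp)
    · have e : HasDerivAt (fun x => a + Real.exp x) _ x := (Real.hasDerivAt_exp x).const_add a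
      rw [e.deriv]
      positivity
    · rw [hU]
      ext y
      constructor
      · rintro ⟨x, rfl⟩
        have := Real.exp_pos x
        show a < a + Real.exp x
        linarith
      · intro h
        exact ⟨Real.log (y - a), by simp only [Real.exp_log (sub_pos.2 h)]; ring⟩
  · set b := sSup U
    have hU : U = Set.Iio b := by
      refine Set.Subset.antisymm (fun x hx => ?_) fun x hx => ?_
      · obtain ⟨-, y', h3, h4⟩ := hmem x hx
        exact h4.trans_le (le_csSup ha h3)
      · obtain ⟨y', h3, h4⟩ := exists_lt_of_lt_csSup ⟨x0, hx0⟩ hx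
        obtain ⟨y, h1, h2⟩ := not_bddBelow_iff.1 hb x
        exact hc.out h1 h3 ⟨h2.le, h4.le⟩
    refine ⟨fun x => b - Real.exp (-x), fun x y h => ?_, fun x => ?_, fun x => ?_, ?_⟩
    · simpa using h
    · exact analyticAt_const.sub (analyticAt_id.neg.rexp)
    · have e : HasDerivAt (fun x => b - Real.exp (-x)) _ x := (hasDerivAt_neg x).exp.const_sub b
      rw [e.deriv]
      have := Real.exp_pos (-x)
      simp
    · rw [hU]
      ext y
      constructor
      · rintro ⟨x, rfl⟩
        have := Real.exp_pos (-x)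
        show b - Real.exp (-x) < b
        linarith
      · intro h
        exact ⟨-Real.log (b - y), by simp only [neg_neg, Real.exp_log (sub_pos.2 h)]; ring⟩
  · have hU : U = Set.univ := by
      refine Set.eq_univ_of_forall fun x => ?_
      obtain ⟨y', h3, h4⟩ := not_bddAbove_iff.1 ha x
      obtain ⟨y, h1, h2⟩ := not_bddBelow_iff.1 hb x
      exact hc.out h1 h3 ⟨h2.le, h4.le⟩
    exact ⟨id, strictMono_id, fun x => analyticAt_id, fun x => by simp, by simp [hU]⟩

lemma IsCurve.exists_param {Γ : Set (ℝ × ℝ)} {T : ℝ × ℝ → ℝ} (hΓ : IsCurve Γ T) {q : ℝ × ℝ}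
    (hq : q ∈ Γ) (hconn : ∀ p ∈ Γ, Conn Γ T q p) :
    ∃ γ : ℝ → ℝ × ℝ, Function.Injective γ ∧ IsProperMap γ ∧ AnalyticOn ℝ γ Set.univ ∧
      (∀ x : ℝ, deriv γ x ≠ 0) ∧ Γ = Set.range γ := by
  obtain ⟨g, U, hs, hqU, -, hC⟩ := hΓ.maximal hq
  obtain ⟨φ, h1, h2, h3, h4⟩ := exists_analytic_param hs.1 hs.2.1 ⟨_, hqU⟩
  have hφU : ∀ x, φ x ∈ U := fun x => h4 ▸ Set.mem_range_self x
  have hT : ∀ x, T (g (φ x)) = φ x := fun x => (hs.2.2 _ (hφU x)).2.2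
  have han : ∀ x, AnalyticAt ℝ (fun x => g (φ x)) x := fun x =>
    AnalyticAt.comp (g := g) (f := φ) (hs.2.2 _ (hφU x)).1 (h2 x)
  have hcont : Continuous fun x => g (φ x) := continuous_iff_continuousAt.2 fun x => (han x).continuousAt
  have hgT : ∀ p ∈ Γ, T p ∈ U ∧ g (T p) = p := fun p hp => by
    obtain ⟨s, k1, rfl⟩ := (hC p).1 (hconn p hp)
    rw [(hs.2.2 s k1).2.2]
    exact ⟨k1, rfl⟩
  refine ⟨fun x => g (φ x), fun x y e => ?_, ?_, fun x _ => (han x).analyticWithinAt, fun x e => ?_, ?_⟩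
  · exact h1.injective (by rw [← hT x, ← hT y]; exact congrArg T e)
  · refine isProperMap_iff_isCompact_preimage.2 ⟨hcont, fun K hK => ?_⟩
    have hemb := h1.isEmbedding_of_ordConnected (by rw [h4]; exact hs.2.1)
    have hcomp : IsCompact (T '' (Γ ∩ K)) := (hK.inter_left hΓ.closed).image hΓ.diff.continuous
    have hsub : T '' (Γ ∩ K) ⊆ Set.range φ := by
      rintro _ ⟨p, ⟨k1, -⟩, rfl⟩
      rw [h4]
      exact (hgT p k1).1
    have := (hemb.isInducing.isCompact_preimage_iff hsub).2 hcomp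
    convert this using 1
    ext x
    constructor
    · intro hx
      exact ⟨g (φ x), ⟨(hs.2.2 _ (hφU x)).2.1, hx⟩, hT x⟩
    · rintro ⟨p, ⟨k1, k2⟩, k3⟩
      show g (φ x) ∈ K
      rwa [← k3, (hgT p k1).2]
  · have d1 : HasDerivAt (fun x => g (φ x)) 0 x := e ▸ (han x).differentiableAt.hasDerivAt
    have d2 := (hΓ.diff (g (φ x))).hasFDerivAt.comp_hasDerivAt x d1
    rw [map_zero] at d2
    have e2 : T ∘ (fun x => g (φ x)) = φ := funext hT
    rw [e2] at d2
    exact h3 x d2.deriv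
  · ext p
    constructor
    · intro hp
      obtain ⟨x, hx⟩ : T p ∈ Set.range φ := h4 ▸ (hgT p hp).1
      exact ⟨x, by show g (φ x) = p; rw [hx, (hgT p hp).2]⟩
    · rintro ⟨x, rfl⟩
      exact (hs.2.2 _ (hφU x)).2.1

/-- The part of the real spectral locus whose eigenfunctions have `2 n` nonreal zeros. -/
def branch (n : ℕ) : Set (ℝ × ℝ) := {p | cc (rp p) = 0 ∧ (upZ p).ncard = n}

lemma isCurve_branch (n : ℕ) : IsCurve (branch n) TR where
  closed := by
    refine isClosed_of_closure_subset fun p hp => ?_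
    have hcl : IsClosed {p | cc (rp p) = 0} :=
      isClosed_eq (continuous_cc.comp continuous_rp) continuous_const
    have hc : cc (rp p) = 0 := closure_minimal (fun x hx => hx.1) hcl hp
    obtain ⟨x, h1, h2⟩ := ((mem_closure_iff_frequently.1 hp).and_eventually
      (eventually_nhdsWithin_iff.1 (upZ_locally_const hc).2)).exists
    exact ⟨hc, ((h2 h1.1).2).symm.trans h1.2⟩
  diff := by
    have h1 : Differentiable ℝ fun u : ℂ × ℂ => TT (u.1, u.2) :=
      (sepHol_TT.contDiff.differentiable one_ne_zero).restrictScalars ℝ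
    have h2 : Differentiable ℝ rp :=
      (ofRealCLM.differentiable.comp differentiable_fst).prodMk
        (ofRealCLM.differentiable.comp differentiable_snd)
    exact reCLM.differentiable.comp (h1.comp h2)
  chart := by
    rintro p ⟨hc, hn⟩
    obtain ⟨σ, h1, h2, h3⟩ := locus_chart hc
    refine ⟨σ, h1, ?_, h3.mono fun p' h h' => h h'.1⟩
    have hσ : ContinuousAt σ (TR p) := h2.self_of_nhds.1.continuousAt
    have h4 : ∀ᶠ p' in 𝓝 (σ (TR p)), p' ∈ {p | cc (rp p) = 0} →
        (upZ p').Finite ∧ (upZ p').ncard = (upZ p).ncard := by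
      rw [h1]
      exact eventually_nhdsWithin_iff.1 (upZ_locally_const hc).2
    have h5 : ∀ᶠ t in 𝓝 (TR p), σ t ∈ {p | cc (rp p) = 0} →
        (upZ (σ t)).Finite ∧ (upZ (σ t)).ncard = (upZ p).ncard := hσ.eventually h4
    filter_upwards [h2, h5] with t k1 k2
    exact ⟨k1.1, ⟨k1.2.1, (k2 k1.2.1).2.trans hn⟩, k1.2.2⟩

lemma mem_branch_iff {n : ℕ} {a : ℝ} (ha : 0 ≤ a) (l : ℝ) :
    (a, l) ∈ branch n ↔ l = br (2 * n) a ∨ l = br (2 * n + 1) a := by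
  constructor
  · rintro ⟨h1, h2⟩
    obtain ⟨k, rfl⟩ := (cc_eq_zero_iff_br ha l).1 h1
    rw [upZ_br ha k] at h2
    obtain rfl | rfl : k = 2 * n ∨ k = 2 * n + 1 := by omega
    · exact .inl rfl
    · exact .inr rfl
  · rintro (rfl | rfl)
    · exact ⟨cc_br ha _, by rw [upZ_br ha]; omega⟩
    · exact ⟨cc_br ha _, by rw [upZ_br ha]; omega⟩

lemma branch_param (n : ℕ) : ∃ γ : ℝ → ℝ × ℝ, Function.Injective γ ∧ IsProperMap γ ∧
    AnalyticOn ℝ γ Set.univ ∧ (∀ x : ℝ, deriv γ x ≠ 0) ∧ branch n = Set.range γ := by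
  have hΓ := isCurve_branch n
  obtain ⟨M, hM⟩ := locus_left_bounded n
  have hb : ∀ q ∈ branch n, Conn (branch n) TR q (0, br (2 * n) 0) := fun q hq =>
    hΓ.conn_base (continuous_br (2 * n)) (continuous_br (2 * n + 1))
      (fun a l ha => mem_branch_iff ha l) (fun p hp h => hM p hp.1 h hp.2.le) hq
  exact hΓ.exists_param ((mem_branch_iff le_rfl _).2 (.inl rfl)) fun p hp => (hb p hp).symm

/-- The part of a branch over `a ≥ 0` is the disjoint union of two graphs. -/
noncomputable def branchHomeomorph (n : ℕ) :
    {p : ℝ × ℝ // p ∈ branch n ∧ 0 ≤ p.1} ≃ₜ {a : ℝ // 0 ≤ a} × Bool := by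
  classical
  have hlt := br_lt (Nat.lt_succ_self (2 * n))
  refine
    { toFun := fun p => (⟨p.1.1, p.2.2⟩, decide (p.1.2 = br (2 * n) p.1.1))
      invFun := fun x => ⟨(x.1.1, if x.2 then br (2 * n) x.1.1 else br (2 * n + 1) x.1.1),
        (mem_branch_iff x.1.2 _).2 (by split_ifs <;> simp), x.1.2⟩
      left_inv := ?_
      right_inv := ?_
      continuous_toFun := ?_
      continuous_invFun := ?_ }
  · rintro ⟨⟨a, l⟩, h, ha⟩
    change 0 ≤ a at ha
    rcases (mem_branch_iff ha l).1 h with rfl | rfl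
    · simp
    · simp [(hlt a).ne']
  · rintro ⟨⟨a, ha⟩, b⟩
    cases b
    · simp [(hlt a).ne']
    · simp
  · refine Continuous.prodMk (by fun_prop) ((continuous_bool_rng true).2 ?_)
    have hc : ∀ k, IsClosed {p : {p : ℝ × ℝ // p ∈ branch n ∧ 0 ≤ p.1} | p.1.2 = br k p.1.1} :=
      fun k => isClosed_eq (by fun_prop) ((continuous_br k).comp (by fun_prop))
    have e : (fun p : {p : ℝ × ℝ // p ∈ branch n ∧ 0 ≤ p.1} =>
        decide (p.1.2 = br (2 * n) p.1.1)) ⁻¹' {true} = {p | p.1.2 = br (2 * n) p.1.1} := by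
      ext p; simp
    rw [e]
    refine ⟨hc _, isClosed_compl_iff.1 ?_⟩
    convert hc (2 * n + 1) using 1
    ext ⟨⟨a, l⟩, h, ha⟩
    change 0 ≤ a at ha
    rcases (mem_branch_iff ha l).1 h with rfl | rfl
    · simp [(hlt a).ne]
    · simp [(hlt a).ne']
  · refine Continuous.subtype_mk (Continuous.prodMk (by fun_prop) ?_) _
    refine continuous_prod_of_discrete_right.2 fun b => ?_
    cases b
    · simpa [Function.comp_def] using (continuous_br _).comp continuous_subtype_val
    · simpa [Function.comp_def] using (continuous_br _).comp continuous_subtype_val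

lemma branch_covering (n : ℕ) :
    IsCoveringMap (fun p : {p : ℝ × ℝ // p ∈ branch n ∧ 0 ≤ p.1} =>
      (⟨p.1.1, p.2.2⟩ : {a : ℝ // 0 ≤ a})) := by
  have h : IsCoveringMap (Prod.fst : {a : ℝ // 0 ≤ a} × Bool → {a : ℝ // 0 ≤ a}) := fun x =>
    IsEvenlyCovered.to_isEvenlyCovered_preimage (I := Bool)
      ⟨inferInstance, Set.univ, Set.mem_univ _, isOpen_univ, isOpen_univ.preimage continuous_fst,
        (Homeomorph.Set.univ _).trans ((Homeomorph.Set.univ _).symm.prodCongr (.refl _)),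
        fun _ => rfl⟩
  exact h.comp_homeomorph (branchHomeomorph n)

end PTCubic

open PTCubic in
/-- Structure of the real spectral locus of the PT-symmetric cubic: it is the disjoint
union of properly embedded analytic curves `Γ_n`, the eigenfunctions on `Γ_n` have exactly
`2n` non-real zeros and infinitely many real zeros lying on a ray `(−∞, x₀)`; over `a ≥ 0`
each `Γ_n` is a 2-to-1 covering of `[0,∞)`, and the curves are ordered: `Γ_{n+1}` lies
above `Γ_n` for `a ≥ 0`. -/
theorem pt_cubic_real_spectral_locus :
    ∃ Γ : ℕ → Set (ℝ × ℝ),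
      -- (1) each Γ_n is a proper analytic embedding of the real line
      (∀ n : ℕ, ∃ γ : ℝ → ℝ × ℝ,
        Function.Injective γ ∧ IsProperMap γ ∧ AnalyticOn ℝ γ Set.univ ∧
        (∀ x : ℝ, deriv γ x ≠ 0) ∧ Γ n = Set.range γ) ∧
      -- (2) eigenfunctions on Γ_n have exactly 2n non-real zeros, infinitely many real
      -- zeros, all real zeros lying in a ray (−∞, x₀)
      (∀ n : ℕ, ∀ p ∈ Γ n, ∃ w : ℂ → ℂ, PTCubicEigenfunction p.1 p.2 w ∧
        {z : ℂ | w z = 0 ∧ z.im ≠ 0}.Finite ∧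
        {z : ℂ | w z = 0 ∧ z.im ≠ 0}.ncard = 2 * n ∧
        {x : ℝ | w (x : ℂ) = 0}.Infinite ∧
        ∃ x₀ : ℝ, ∀ x : ℝ, w (x : ℂ) = 0 → x < x₀) ∧
      -- (3) the Γ_n are pairwise disjoint and their union is the real spectral locus
      Pairwise (Function.onFun Disjoint Γ) ∧
      (⋃ n : ℕ, Γ n) = PTCubicLocus ∧
      -- (4) over a ≥ 0, the projection (a,λ) ↦ a is a 2-to-1 covering of [0,∞)
      (∀ n : ℕ,
        IsCoveringMap (fun p : {p : ℝ × ℝ // p ∈ Γ n ∧ 0 ≤ p.1} =>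
          (⟨p.1.1, p.2.2⟩ : {a : ℝ // 0 ≤ a})) ∧
        Function.Surjective (fun p : {p : ℝ × ℝ // p ∈ Γ n ∧ 0 ≤ p.1} =>
          (⟨p.1.1, p.2.2⟩ : {a : ℝ // 0 ≤ a})) ∧
        ∀ a : ℝ, 0 ≤ a → {lam : ℝ | (a, lam) ∈ Γ n}.ncard = 2) ∧
      -- (5) ordering of the curves over a ≥ 0
      (∀ n : ℕ, ∀ a lam lam' : ℝ, 0 ≤ a →
        (a, lam) ∈ Γ n → (a, lam') ∈ Γ (n + 1) → lam < lam') := by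
  refine ⟨branch, branch_param, ?_, ?_, ?_, fun n => ⟨branch_covering n, ?_, ?_⟩, ?_⟩
  · rintro n p ⟨hc, hn⟩
    obtain ⟨h1, h2⟩ := nonreal_zeros_card hc
    exact ⟨Y1 (rp p), Y1_eigen hc, h1, by rw [h2, hn], Y1_real_zeros_infinite hc,
      Y1_real_zeros_bddAbove p⟩
  · intro m n hmn
    exact Set.disjoint_left.2 fun p h1 h2 => hmn (h1.2.symm.trans h2.2)
  · ext p
    rw [Set.mem_iUnion, mem_locus_iff]
    exact ⟨fun ⟨n, h⟩ => h.1, fun h => ⟨_, h, rfl⟩⟩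
  · rintro ⟨a, ha⟩
    exact ⟨⟨(a, br (2 * n) a), (mem_branch_iff ha _).2 (.inl rfl), ha⟩, rfl⟩
  · intro a ha
    have e : {lam : ℝ | (a, lam) ∈ branch n} = {br (2 * n) a, br (2 * n + 1) a} :=
      Set.ext fun l => mem_branch_iff ha l
    rw [e, Set.ncard_pair (br_lt (Nat.lt_succ_self _) a).ne]
  · intro n a l l' ha h h'
    rcases (mem_branch_iff ha l).1 h with rfl | rfl <;>
      rcases (mem_branch_iff ha l').1 h' with rfl | rfl <;> exact br_lt (by omega) a
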